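/- (Even-order case of Theorem 3.2.) Fix integers n ≥ 2, m ≥ 1, N ≥ 1, let p ∈ (1,∞) and let s ≥ 1 be an integer with 2s ≤ N+1. Then there exists a constant c > 0 such that for every φ ∈ C_c^∞(ℝ^(n+m)) and every word α ∈ {1,…,n+m}^(2s) one has ‖Y^α φ‖_p ≤ c · ‖H_N^s φ‖_p, where H_N^s denotes the s-fold composition of the Gru\v{s}in operator H_N. -/

import Mathlib

open MeasureTheory
open scoped ENNReal NNReal

/-- Points of `ℝ^(n+m)`, written `(x, y)` with `x ∈ ℝⁿ`, `y ∈ ℝᵐ`. -/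
abbrev Pt (n m : ℕ) := (Fin n → ℝ) × (Fin m → ℝ)

/-- The partial derivative operator `∂_{x_j}`. -/
noncomputable def Dx (n m : ℕ) (j : Fin n) (f : Pt n m → ℝ) : Pt n m → ℝ :=
  fun z => fderiv ℝ f z (Pi.single j 1, 0)

/-- The partial derivative operator `∂_{y_k}`. -/
noncomputable def Dy (n m : ℕ) (k : Fin m) (f : Pt n m → ℝ) : Pt n m → ℝ :=
  fun z => fderiv ℝ f z (0, Pi.single k 1)

/-- Index set for the family `𝒳`: either `j ∈ {1,…,n}` (giving `X_j = ∂_{x_j}`) or a pair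
of a multi-index `ν ∈ ℕⁿ` with `|ν| = N` and `k ∈ {1,…,m}` (giving
`X_{ν,k} = (N!/ν!)^(1/2) x^ν ∂_{y_k}`). -/
def XIdx (n m N : ℕ) := Fin n ⊕ ({ν : Fin n → ℕ // ∑ i, ν i = N} × Fin m)

/-- The family `𝒳` of first-order operators `X_j = ∂_{x_j}` and
`X_{ν,k} = (N!/ν!)^(1/2) x^ν ∂_{y_k}` for `|ν| = N`. -/
noncomputable def Xop (n m N : ℕ) : XIdx n m N → (Pt n m → ℝ) → (Pt n m → ℝ)
  | Sum.inl j => Dx n m j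
  | Sum.inr (ν, k) => fun f z =>
      Real.sqrt ((Nat.factorial N : ℝ) / ∏ i, (Nat.factorial (ν.1 i) : ℝ)) *
        (∏ i, z.1 i ^ ν.1 i) * Dy n m k f z

/-- Composition `Z_1 ∘ Z_2 ∘ ⋯ ∘ Z_s` of a word of operators. -/
def compOps {n m : ℕ} (l : List ((Pt n m → ℝ) → (Pt n m → ℝ))) :
    (Pt n m → ℝ) → (Pt n m → ℝ) :=
  l.foldr (· ∘ ·) id

/-- `X^α` for a word `α` of elements of `𝒳`. -/
noncomputable def Xw {n m N M : ℕ} (α : Fin M → XIdx n m N) :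
    (Pt n m → ℝ) → (Pt n m → ℝ) :=
  compOps (List.ofFn fun i => Xop n m N (α i))

/-- The Gru\v{s}in operator `H_N = −Δ_x − |x|^(2N) Δ_y`. -/
noncomputable def grusin (n m N : ℕ) (f : Pt n m → ℝ) : Pt n m → ℝ :=
  fun z => -(∑ j, Dx n m j (Dx n m j f) z) -
    (∑ i, z.1 i ^ 2) ^ N * ∑ k, Dy n m k (Dy n m k f) z

/-- The operators `Y_j = ∂_{x_j}` for `j ≤ n` and `Y_{n+l} = |x|^N ∂_{y_l}` for `l ≤ m`. -/
noncomputable def Yop (n m N : ℕ) : (Fin n ⊕ Fin m) → (Pt n m → ℝ) → (Pt n m → ℝ)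
  | Sum.inl j => Dx n m j
  | Sum.inr l => fun f z => Real.sqrt (∑ i, z.1 i ^ 2) ^ N * Dy n m l f z

/-- `Y^α` for a word `α ∈ {1,…,n+m}^M`. -/
noncomputable def Yw {n m N M : ℕ} (α : Fin M → (Fin n ⊕ Fin m)) :
    (Pt n m → ℝ) → (Pt n m → ℝ) :=
  compOps (List.ofFn fun i => Yop n m N (α i))

set_option linter.unusedSectionVars false

section TestFunctions

open Topology Filter

variable {V : Type*} [NormedAddCommGroup V] [NormedSpace ℝ V]

/-- Smooth compactly supported real functions. -/
def IsTest (f : V → ℝ) : Prop := ContDiff ℝ (⊤ : ℕ∞) f ∧ HasCompactSupport f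

/-- Directional derivative with constant direction. -/
noncomputable def dirD (v : V) (f : V → ℝ) : V → ℝ := fun x => fderiv ℝ f x v

theorem ContDiff.dirD {f : V → ℝ} (hf : ContDiff ℝ (⊤ : ℕ∞) f) (v : V) :
    ContDiff ℝ (⊤ : ℕ∞) (dirD v f) :=
  (hf.fderiv_right (m := (⊤ : ℕ∞)) (by simp)).clm_apply contDiff_const

theorem IsTest.dirD {f : V → ℝ} (hf : IsTest f) (v : V) : IsTest (dirD v f) :=
  ⟨hf.1.dirD v, (hf.2.fderiv_apply (𝕜 := ℝ) v)⟩

theorem IsTest.continuous {f : V → ℝ} (hf : IsTest f) : Continuous f := hf.1.continuous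

theorem IsTest.differentiable {f : V → ℝ} (hf : IsTest f) : Differentiable ℝ f :=
  hf.1.differentiable (by simp)

theorem IsTest.add {f g : V → ℝ} (hf : IsTest f) (hg : IsTest g) :
    IsTest (fun x => f x + g x) := ⟨hf.1.add hg.1, hf.2.add hg.2⟩

theorem IsTest.mul_left {f g : V → ℝ} (hf : ContDiff ℝ (⊤ : ℕ∞) f) (hg : IsTest g) :
    IsTest (fun x => f x * g x) := ⟨hf.mul hg.1, hg.2.mul_left⟩

theorem IsTest.const_mul {g : V → ℝ} (c : ℝ) (hg : IsTest g) :
    IsTest (fun x => c * g x) := IsTest.mul_left contDiff_const hg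

theorem IsTest.neg {g : V → ℝ} (hg : IsTest g) : IsTest (fun x => -g x) := by
  simpa using hg.const_mul (-1)

theorem IsTest.sub {f g : V → ℝ} (hf : IsTest f) (hg : IsTest g) :
    IsTest (fun x => f x - g x) := by
  simpa [sub_eq_add_neg] using hf.add hg.neg

theorem IsTest.zero : IsTest (fun _ : V => (0 : ℝ)) := ⟨contDiff_const, HasCompactSupport.zero⟩

theorem IsTest.sum {ι : Type*} (s : Finset ι) {f : ι → V → ℝ} (hf : ∀ i ∈ s, IsTest (f i)) :
    IsTest (fun x => ∑ i ∈ s, f i x) := by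
  classical
  induction s using Finset.induction_on with
  | empty => simpa using IsTest.zero
  | insert a s ha ih =>
    simp only [Finset.sum_insert ha]
    exact (hf a (by simp)).add (ih fun i hi => hf i (by simp [hi]))

theorem IsTest.comp_add_const {f : V → ℝ} (hf : IsTest f) (v : V) :
    IsTest (fun x => f (x + v)) :=
  ⟨hf.1.comp (contDiff_id.add contDiff_const),
    hf.2.comp_homeomorph (Homeomorph.addRight v)⟩

theorem IsTest.exists_bound {f : V → ℝ} (hf : IsTest f) : ∃ C, 0 ≤ C ∧ ∀ x, |f x| ≤ C := by
  obtain ⟨C, hC⟩ := hf.2.exists_bound_of_continuous hf.continuous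
  exact ⟨max C 0, le_max_right _ _, fun x => (hC x).trans (le_max_left _ _)⟩

theorem dirD_add {f g : V → ℝ} (v : V) (hf : Differentiable ℝ f) (hg : Differentiable ℝ g) :
    dirD v (fun x => f x + g x) = fun x => dirD v f x + dirD v g x := by
  funext x
  simp only [dirD]
  rw [fderiv_fun_add (hf x) (hg x)]; rfl

theorem dirD_sub {f g : V → ℝ} (v : V) (hf : Differentiable ℝ f) (hg : Differentiable ℝ g) :
    dirD v (fun x => f x - g x) = fun x => dirD v f x - dirD v g x := by
  funext x
  simp only [dirD]
  rw [fderiv_fun_sub (hf x) (hg x)]; rfl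

theorem dirD_mul {f g : V → ℝ} (v : V) (hf : Differentiable ℝ f) (hg : Differentiable ℝ g) :
    dirD v (fun x => f x * g x) = fun x => dirD v f x * g x + f x * dirD v g x := by
  funext x
  simp only [dirD]
  rw [fderiv_fun_mul (hf x) (hg x)]
  simp; ring

theorem dirD_neg {f : V → ℝ} (v : V) :
    dirD v (fun x => -f x) = fun x => -dirD v f x := by
  funext x
  simp only [dirD]
  rw [fderiv_fun_neg]; rfl

theorem dirD_const (v : V) (c : ℝ) : dirD v (fun _ : V => c) = fun _ => 0 := by
  funext x
  simp [dirD]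

theorem dirD_const_mul {f : V → ℝ} (v : V) (c : ℝ) (hf : Differentiable ℝ f) :
    dirD v (fun x => c * f x) = fun x => c * dirD v f x := by
  rw [dirD_mul v (differentiable_const c) hf, dirD_const]; simp

theorem dirD_sum {ι : Type*} (s : Finset ι) {f : ι → V → ℝ} (v : V)
    (hf : ∀ i ∈ s, Differentiable ℝ (f i)) :
    dirD v (fun x => ∑ i ∈ s, f i x) = fun x => ∑ i ∈ s, dirD v (f i) x := by
  funext x
  simp only [dirD]
  rw [fderiv_fun_sum fun i hi => hf i hi x]
  simp

theorem dirD_comp_add_const {f : V → ℝ} (v w : V) :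
    dirD v (fun x => f (x + w)) = fun x => dirD v f (x + w) := by
  funext x
  simp only [dirD]
  rw [fderiv_comp_add_right]

theorem dirD_smul_dir {f : V → ℝ} (c : ℝ) (v : V) :
    dirD (c • v) f = fun x => c * dirD v f x := by
  funext x; simp [dirD]

theorem dirD_comm {f : V → ℝ} (hf : ContDiff ℝ (⊤ : ℕ∞) f) (v w : V) :
    dirD v (dirD w f) = dirD w (dirD v f) := by
  funext x
  have h2 : Differentiable ℝ (fderiv ℝ f) :=
    (hf.fderiv_right (m := (⊤ : ℕ∞)) (by simp)).differentiable (by simp)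
  have key : ∀ a b : V, dirD a (dirD b f) x = fderiv ℝ (fderiv ℝ f) x a b := by
    intro a b
    change fderiv ℝ (fun y => fderiv ℝ f y b) x a = _
    rw [fderiv_clm_apply (h2 x) (differentiableAt_const b)]
    simp
  rw [key, key]
  have := (hf.contDiffAt (x := x)).isSymmSndFDerivAt (by
    simpa using ENat.LEInfty.out)
  exact this v w

theorem hasDerivAt_line {f : V → ℝ} {x v : V} {t : ℝ} (hf : DifferentiableAt ℝ f (x + t • v)) :
    HasDerivAt (fun s : ℝ => f (x + s • v)) (dirD v f (x + t • v)) t := by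
  have h1 : HasDerivAt (fun s : ℝ => x + s • v) v t := by
    simpa using ((hasDerivAt_id t).smul_const v).const_add x
  exact hf.hasFDerivAt.comp_hasDerivAt t h1

variable [MeasurableSpace V] [BorelSpace V]

theorem IsTest.integrable {f : V → ℝ} (hf : IsTest f) (μ : Measure V)
    [IsFiniteMeasureOnCompacts μ] : Integrable f μ :=
  hf.continuous.integrable_of_hasCompactSupport hf.2

end TestFunctions

section Averages

open Topology Filter

variable {V : Type*} [NormedAddCommGroup V] [NormedSpace ℝ V]
variable {W : Type*} [TopologicalSpace W] [MeasurableSpace W] [OpensMeasurableSpace W]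

/-- Superposition of translates of `f`. -/
noncomputable def avg (ν : Measure W) (ψ : W → ℝ) (A : W → V) (f : V → ℝ) : V → ℝ :=
  fun x => ∫ w, ψ w * f (x + A w) ∂ν

variable {ν : Measure W} {ψ : W → ℝ} {A : W → V}

theorem integrable_avg_integrand (hψ : Integrable ψ ν) (hA : Continuous A) {f : V → ℝ}
    (hf : Continuous f) {C : ℝ} (hC : ∀ x, |f x| ≤ C) (x : V) :
    Integrable (fun w => ψ w * f (x + A w)) ν :=
  hψ.mul_bdd (c := C) (by fun_prop : Continuous fun w => f (x + A w)).aestronglyMeasurable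
    (Eventually.of_forall fun w => hC _)

theorem abs_avg_le (hψ : Integrable ψ ν) {f : V → ℝ}
    {C : ℝ} (hC : ∀ x, |f x| ≤ C) (x : V) :
    |avg ν ψ A f x| ≤ (∫ w, |ψ w| ∂ν) * C := by
  rw [← integral_mul_const, ← Real.norm_eq_abs]
  unfold avg
  refine norm_integral_le_of_norm_le (hψ.abs.mul_const C) (Eventually.of_forall fun w => ?_)
  rw [norm_mul]
  exact mul_le_mul_of_nonneg_left (hC _) (abs_nonneg _)

theorem continuous_avg {P : Type*} [TopologicalSpace P] [FirstCountableTopology P]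
    [FirstCountableTopology V]
    (hψ : Integrable ψ ν) {A : P → W → V} (hA : Continuous (Function.uncurry A)) {f : V → ℝ}
    (hf : Continuous f) {C : ℝ} (hC : ∀ x, |f x| ≤ C) :
    Continuous fun q : P × V => avg ν ψ (A q.1) f q.2 := by
  refine continuous_of_dominated (bound := fun w => |ψ w| * C) ?_ ?_ (hψ.abs.mul_const C) ?_
  · intro q
    exact hψ.1.mul (by fun_prop : Continuous fun w => f (q.2 + A q.1 w)).aestronglyMeasurable
  · intro q
    refine Eventually.of_forall fun w => ?_
    rw [norm_mul]
    exact mul_le_mul_of_nonneg_left (hC _) (abs_nonneg _)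
  · refine Eventually.of_forall fun w => ?_
    have : Continuous fun q : P × V => A q.1 w :=
      hA.comp (by fun_prop : Continuous fun q : P × V => (q.1, w))
    fun_prop

theorem hasFDerivAt_avg [FiniteDimensional ℝ V] (hψ : Integrable ψ ν) (hA : Continuous A)
    {f : V → ℝ} (hf : IsTest f) (x : V) :
    HasFDerivAt (avg ν ψ A f) (∫ w, ψ w • fderiv ℝ f (x + A w) ∂ν) x := by
  obtain ⟨C, -, hC⟩ := hf.exists_bound
  have hc' : Continuous (fderiv ℝ f) := hf.1.continuous_fderiv (by simp)
  obtain ⟨C', hC'⟩ := (hf.2.fderiv (𝕜 := ℝ)).exists_bound_of_continuous hc'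
  refine hasFDerivAt_integral_of_dominated_of_fderiv_le (s := Set.univ)
    (F := fun x w => ψ w * f (x + A w))
    (F' := fun x w => ψ w • fderiv ℝ f (x + A w)) (bound := fun w => |ψ w| * C')
    Filter.univ_mem ?_ ?_ ?_ ?_ (hψ.abs.mul_const C') ?_
  · exact Eventually.of_forall fun x => (integrable_avg_integrand hψ hA hf.continuous hC x).1
  · exact integrable_avg_integrand hψ hA hf.continuous hC x
  · exact hψ.1.smul (by fun_prop : Continuous fun w => fderiv ℝ f (x + A w)).aestronglyMeasurable
  · refine Eventually.of_forall fun w x _ => ?_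
    rw [norm_smul]
    exact mul_le_mul_of_nonneg_left (hC' _) (abs_nonneg _)
  · refine Eventually.of_forall fun w x _ => ?_
    have h := (hf.differentiable (x + A w)).hasFDerivAt.comp x ((hasFDerivAt_id x).add_const (A w))
    exact h.const_mul (ψ w)

theorem dirD_avg [FiniteDimensional ℝ V] (hψ : Integrable ψ ν) (hA : Continuous A)
    {f : V → ℝ} (hf : IsTest f) (v : V) :
    dirD v (avg ν ψ A f) = avg ν ψ A (dirD v f) := by
  funext x
  have hc' : Continuous (fderiv ℝ f) := hf.1.continuous_fderiv (by simp)
  obtain ⟨C', hC'⟩ := (hf.2.fderiv (𝕜 := ℝ)).exists_bound_of_continuous hc'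
  rw [dirD, (hasFDerivAt_avg hψ hA hf x).fderiv, ContinuousLinearMap.integral_apply]
  · rfl
  · exact hψ.smul_bdd C' (by fun_prop : Continuous fun w => fderiv ℝ f (x + A w)).aestronglyMeasurable
      (Eventually.of_forall fun w => hC' _)

theorem contDiff_avg [FiniteDimensional ℝ V] (hψ : Integrable ψ ν) (hA : Continuous A)
    {f : V → ℝ} (hf : IsTest f) : ContDiff ℝ (⊤ : ℕ∞) (avg ν ψ A f) := by
  rw [contDiff_infty]
  intro k
  induction k generalizing f with
  | zero =>
    refine contDiff_zero.2 (continuous_iff_continuousAt.2 fun x =>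
      (hasFDerivAt_avg hψ hA hf x).continuousAt)
  | succ k ih =>
    rw [Nat.cast_succ, contDiff_succ_iff_fderiv_apply]
    refine ⟨fun x => (hasFDerivAt_avg hψ hA hf x).differentiableAt, by simp, fun v => ?_⟩
    have := ih (hf.dirD v)
    rwa [← dirD_avg hψ hA hf v] at this

theorem hasCompactSupport_avg (hA : Continuous A) (hψ : HasCompactSupport ψ)
    {f : V → ℝ} (hf : HasCompactSupport f) : HasCompactSupport (avg ν ψ A f) := by
  refine HasCompactSupport.intro (K := (fun q : V × W => q.1 - A q.2) '' (tsupport f ×ˢ tsupport ψ))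
    ((hf.prod hψ).image (by fun_prop)) ?_
  intro x hx
  refine integral_eq_zero_of_ae (Eventually.of_forall fun w => ?_)
  by_contra h
  have h1 : ψ w ≠ 0 := left_ne_zero_of_mul h
  have h2 : f (x + A w) ≠ 0 := right_ne_zero_of_mul h
  exact hx ⟨(x + A w, w), ⟨subset_tsupport _ h2, subset_tsupport _ h1⟩, by simp⟩

theorem avg_add (hψ : Integrable ψ ν) (hA : Continuous A) {f g : V → ℝ}
    (hf : IsTest f) (hg : IsTest g) :
    avg ν ψ A (fun x => f x + g x) = fun x => avg ν ψ A f x + avg ν ψ A g x := by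
  obtain ⟨C, -, hC⟩ := hf.exists_bound
  obtain ⟨C', -, hC'⟩ := hg.exists_bound
  funext x
  simp only [avg, mul_add]
  exact integral_add (integrable_avg_integrand hψ hA hf.continuous hC x)
    (integrable_avg_integrand hψ hA hg.continuous hC' x)

theorem avg_const_mul (c : ℝ) (f : V → ℝ) :
    avg ν ψ A (fun x => c * f x) = fun x => c * avg ν ψ A f x := by
  funext x
  simp only [avg]
  rw [← integral_const_mul]
  congr 1; funext w; ring

theorem avg_sum {ι : Type*} (hψ : Integrable ψ ν) (hA : Continuous A) (s : Finset ι)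
    {f : ι → V → ℝ} (hf : ∀ i ∈ s, IsTest (f i)) :
    avg ν ψ A (fun x => ∑ i ∈ s, f i x) = fun x => ∑ i ∈ s, avg ν ψ A (f i) x := by
  funext x
  simp only [avg, Finset.mul_sum]
  refine integral_finsetSum _ fun i hi => ?_
  obtain ⟨C, -, hC⟩ := (hf i hi).exists_bound
  exact integrable_avg_integrand hψ hA (hf i hi).continuous hC x

variable [MeasurableSpace V] [BorelSpace V]

theorem lintegral_mul_rpow_le {α : Type*} [MeasurableSpace α] {ν : Measure α} {p : ℝ} (hp : 1 ≤ p)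
    {a b : α → ℝ≥0∞} (ha : AEMeasurable a ν) (hb : AEMeasurable b ν) :
    (∫⁻ w, a w * b w ∂ν) ^ p ≤ (∫⁻ w, a w ∂ν) ^ (p - 1) * ∫⁻ w, a w * b w ^ p ∂ν := by
  have hp0 : 0 < p := by linarith
  have h := ENNReal.lintegral_mul_norm_pow_le (p := 1 - p⁻¹) (q := p⁻¹) ha (ha.mul (hb.pow_const p))
    (by simpa using inv_le_one_of_one_le₀ hp) (by positivity) (by ring)
  have e : ∀ w, a w ^ (1 - p⁻¹) * (a w * b w ^ p) ^ p⁻¹ = a w * b w := by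
    intro w
    rw [ENNReal.mul_rpow_of_nonneg _ _ (by positivity : 0 ≤ p⁻¹), ← ENNReal.rpow_mul,
      mul_inv_cancel₀ hp0.ne', ENNReal.rpow_one, ← mul_assoc, ← ENNReal.rpow_add_of_nonneg]
    · simp
    · simpa using inv_le_one_of_one_le₀ hp
    · positivity
  simp only [Pi.mul_apply, e] at h
  calc _ ≤ _ := ENNReal.rpow_le_rpow h hp0.le
    _ = _ := by
      rw [ENNReal.mul_rpow_of_nonneg _ _ hp0.le, ← ENNReal.rpow_mul, ← ENNReal.rpow_mul,
        inv_mul_cancel₀ hp0.ne', ENNReal.rpow_one, sub_mul, inv_mul_cancel₀ hp0.ne', one_mul]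

/-- Minkowski's inequality for superpositions of translates. -/
theorem lintegral_avg_rpow_le [FiniteDimensional ℝ V] [SigmaFinite ν]
    (μ : Measure V) [μ.IsAddHaarMeasure]
    {p : ℝ} (hp : 1 ≤ p) (hψ : AEMeasurable ψ ν) (hA : Continuous A)
    {f : V → ℝ} (hf : Continuous f) :
    ∫⁻ x, ‖avg ν ψ A f x‖ₑ ^ p ∂μ ≤ (∫⁻ w, ‖ψ w‖ₑ ∂ν) ^ p * ∫⁻ x, ‖f x‖ₑ ^ p ∂μ := by
  have hp0 : 0 < p := by linarith
  have hm : ∀ x, AEMeasurable (fun w => ‖f (x + A w)‖ₑ) ν := fun x =>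
    (by fun_prop : Continuous fun w => f (x + A w)).measurable.enorm.aemeasurable
  have hm2 : AEMeasurable (Function.uncurry fun x w => ‖ψ w‖ₑ * ‖f (x + A w)‖ₑ ^ p) (μ.prod ν) := by
    refine AEMeasurable.mul ?_ ?_
    · exact (hψ.enorm).comp_snd
    · have hAm : Measurable fun q : V × W => A q.2 := hA.measurable.comp measurable_snd
      exact ((hf.measurable.comp (measurable_fst.add hAm)).enorm.pow_const p).aemeasurable
  calc ∫⁻ x, ‖avg ν ψ A f x‖ₑ ^ p ∂μ
      ≤ ∫⁻ x, (∫⁻ w, ‖ψ w‖ₑ ∂ν) ^ (p - 1) * ∫⁻ w, ‖ψ w‖ₑ * ‖f (x + A w)‖ₑ ^ p ∂ν ∂μ := by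
        refine lintegral_mono fun x => ?_
        refine le_trans ?_ (lintegral_mul_rpow_le hp hψ.enorm (hm x))
        refine ENNReal.rpow_le_rpow ?_ hp0.le
        refine (enorm_integral_le_lintegral_enorm _).trans (le_of_eq ?_)
        simp only [enorm_mul]
    _ ≤ (∫⁻ w, ‖ψ w‖ₑ ∂ν) ^ (p - 1) * ∫⁻ x, ∫⁻ w, ‖ψ w‖ₑ * ‖f (x + A w)‖ₑ ^ p ∂ν ∂μ := by
        rw [lintegral_const_mul'']
        exact hm2.lintegral_prod_right'
    _ = (∫⁻ w, ‖ψ w‖ₑ ∂ν) ^ (p - 1) *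
          ∫⁻ w, ‖ψ w‖ₑ * ∫⁻ x, ‖f x‖ₑ ^ p ∂μ ∂ν := by
        rw [lintegral_lintegral_swap hm2]
        congr 2; funext w
        rw [lintegral_const_mul, lintegral_add_right_eq_self (fun x => ‖f x‖ₑ ^ p) (A w)]
        have := hf.measurable
        fun_prop
    _ = _ := by
        rw [lintegral_mul_const'' _ hψ.enorm, ← mul_assoc]
        congr 1
        nth_rewrite 2 [← ENNReal.rpow_one (∫⁻ w, ‖ψ w‖ₑ ∂ν)]
        rw [← ENNReal.rpow_add_of_nonneg _ _ (by linarith) (by norm_num)]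
        congr 1; ring

end Averages

section IBP

variable {V : Type*} [NormedAddCommGroup V] [NormedSpace ℝ V] [FiniteDimensional ℝ V]
  [MeasurableSpace V] [BorelSpace V] (μ : Measure V) [μ.IsAddHaarMeasure]

theorem integral_mul_dirD {f g : V → ℝ} (v : V) (hf : Differentiable ℝ f)
    (hg : Differentiable ℝ g) (h1 : Integrable (fun x => dirD v f x * g x) μ)
    (h2 : Integrable (fun x => f x * dirD v g x) μ) (h3 : Integrable (fun x => f x * g x) μ) :
    ∫ x, f x * dirD v g x ∂μ = -∫ x, dirD v f x * g x ∂μ :=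
  integral_mul_fderiv_eq_neg_fderiv_mul_of_integrable h1 h2 h3 (fun x _ => hf x)
    (fun x _ => hg x)

theorem integral_dirD_eq_zero {f : V → ℝ} (v : V) (hf : Differentiable ℝ f)
    (h1 : Integrable f μ) (h2 : Integrable (dirD v f) μ) : ∫ x, dirD v f x ∂μ = 0 := by
  have := integral_mul_dirD μ (f := fun _ => (1 : ℝ)) v (differentiable_const _) hf
    (by simp [dirD_const]) (by simpa using h2) (by simpa using h1)
  simpa [dirD_const] using this

end IBP

section Gaussian

open ProbabilityTheory

variable {ι : Type*} [Fintype ι]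

/-- The standard Gaussian density. -/
noncomputable def gau (ι : Type*) [Fintype ι] (z : ι → ℝ) : ℝ := ∏ i, gaussianPDFReal 0 1 (z i)

theorem gaussianPDFReal_zero_one (x : ℝ) :
    gaussianPDFReal 0 1 x = (Real.sqrt (2 * Real.pi))⁻¹ * Real.exp (-(1 / 2) * x ^ 2) := by
  rw [gaussianPDFReal]; simp; ring_nf; trivial

theorem gau_nonneg (z : ι → ℝ) : 0 ≤ gau ι z :=
  Finset.prod_nonneg fun _ _ => gaussianPDFReal_nonneg _ _ _

theorem integrable_gau : Integrable (gau ι) :=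
  Integrable.fintype_prod fun _ => integrable_gaussianPDFReal 0 1

theorem integral_gau : ∫ z, gau ι z = 1 := by
  unfold gau
  rw [integral_fintype_prod_volume_eq_prod (fun _ => gaussianPDFReal 0 1)]
  simp [integral_gaussianPDFReal_eq_one]

theorem lintegral_gau : ∫⁻ z, ‖gau ι z‖ₑ = 1 := by
  rw [← ofReal_integral_norm_eq_lintegral_enorm integrable_gau]
  simp [abs_of_nonneg (gau_nonneg _), integral_gau]

theorem integral_abs_gau : ∫ z, |gau ι z| = 1 := by
  simp [abs_of_nonneg (gau_nonneg _), integral_gau]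

theorem integrable_coord_mul_gau (j : ι) : Integrable fun z : ι → ℝ => z j * gau ι z := by
  classical
  have h : (fun z : ι → ℝ => z j * gau ι z) = fun z =>
      ∏ i, (if i = j then fun t => t * gaussianPDFReal 0 1 t else gaussianPDFReal 0 1) (z i) := by
    funext z
    rw [gau, ← Finset.mul_prod_erase _ _ (Finset.mem_univ j),
      ← Finset.mul_prod_erase _ _ (Finset.mem_univ j)]
    simp only [if_true, mul_assoc]
    congr 2
    refine Finset.prod_congr rfl fun i hi => ?_
    simp [Finset.ne_of_mem_erase hi]
  rw [h]
  refine Integrable.fintype_prod fun i => ?_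
  split_ifs
  · have := (integrable_mul_exp_neg_mul_sq (b := 1 / 2) (by norm_num)).const_mul
      (Real.sqrt (2 * Real.pi))⁻¹
    refine this.congr (Filter.Eventually.of_forall fun t => ?_)
    simp only [gaussianPDFReal_zero_one]
    ring
  · exact integrable_gaussianPDFReal 0 1

theorem contDiff_gau : ContDiff ℝ (⊤ : ℕ∞) (gau ι) := by
  unfold gau
  simp only [gaussianPDFReal_zero_one]
  fun_prop

theorem dirD_gau [DecidableEq ι] (j : ι) (z : ι → ℝ) :
    dirD (Pi.single j 1) (gau ι) z = -(z j * gau ι z) := by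
  have h : gau ι = fun z => (∏ _i : ι, (Real.sqrt (2 * Real.pi))⁻¹) *
      Real.exp (∑ i, -(1 / 2) * z i ^ 2) := by
    funext z
    simp only [gau, gaussianPDFReal_zero_one, Finset.prod_mul_distrib, Real.exp_sum]
  have hd : HasFDerivAt (fun z : ι → ℝ => ∑ i, -(1 / 2) * z i ^ 2)
      (∑ i, (-(1 / 2) : ℝ) • ((2 * z i) •
        (ContinuousLinearMap.proj (R := ℝ) (φ := fun _ : ι => ℝ) i))) z := by
    refine HasFDerivAt.fun_sum fun i _ => HasFDerivAt.const_mul ?_ _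
    simpa using (ContinuousLinearMap.hasFDerivAt (x := z)
      (ContinuousLinearMap.proj (R := ℝ) (φ := fun _ : ι => ℝ) i)).pow 2
  have h2 := (hd.exp.const_mul (∏ _i : ι, (Real.sqrt (2 * Real.pi))⁻¹)).fderiv
  rw [dirD, h, h2]
  simp [Pi.single_apply]
  ring

/-- Heat flow with respect to `∑ ∂_{e i}²`, at time `σ ^ 2 / 2`. -/
noncomputable def heat {V : Type*} [NormedAddCommGroup V] [NormedSpace ℝ V] (e : ι → V) (σ : ℝ)
    (f : V → ℝ) : V → ℝ :=
  avg volume (gau ι) (fun z => σ • ∑ i, z i • e i) f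

variable {V : Type*} [NormedAddCommGroup V] [NormedSpace ℝ V] [FiniteDimensional ℝ V]

theorem continuous_heatShift (e : ι → V) (σ : ℝ) :
    Continuous fun z : ι → ℝ => σ • ∑ i, z i • e i := by fun_prop

theorem heat_stein (e : ι → V) (σ : ℝ) {f : V → ℝ} (hf : IsTest f) (j : ι) (x : V) :
    σ * heat e σ (dirD (e j) f) x =
      ∫ z : ι → ℝ, z j * gau ι z * f (x + σ • ∑ i, z i • e i) := by
  classical
  obtain ⟨C, -, hC⟩ := hf.exists_bound
  obtain ⟨C', -, hC'⟩ := (hf.dirD (e j)).exists_bound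
  have hd : ∀ z, dirD (Pi.single j 1) (fun z : ι → ℝ => f (x + σ • ∑ i, z i • e i)) z =
      σ * dirD (e j) f (x + σ • ∑ i, z i • e i) := by
    intro z
    have hlin : HasFDerivAt (fun z : ι → ℝ => x + σ • ∑ i, z i • e i)
        (σ • ∑ i, (ContinuousLinearMap.proj (R := ℝ) (φ := fun _ : ι => ℝ) i).smulRight (e i)) z := by
      refine HasFDerivAt.const_add _ (HasFDerivAt.const_smul ?_ σ)
      refine HasFDerivAt.fun_sum fun i _ => ?_
      exact (ContinuousLinearMap.hasFDerivAt (ContinuousLinearMap.proj (R := ℝ) (φ := fun _ : ι => ℝ) i)).smul_const (e i)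
    have := ((hf.differentiable (x + σ • ∑ i, z i • e i)).hasFDerivAt.comp z hlin).fderiv
    simp only [dirD]
    change fderiv ℝ (f ∘ _) z _ = _
    rw [this]
    simp [Pi.single_apply]
  have hb : Continuous (fun z : ι → ℝ => f (x + σ • ∑ i, z i • e i)) :=
    hf.continuous.comp (continuous_const.add (continuous_heatShift e σ))
  have hb' : Continuous (fun z : ι → ℝ => dirD (e j) f (x + σ • ∑ i, z i • e i)) :=
    (hf.dirD _).continuous.comp (continuous_const.add (continuous_heatShift e σ))
  have key := integral_mul_dirD (volume : Measure (ι → ℝ)) (f := gau ι)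
    (g := fun z : ι → ℝ => f (x + σ • ∑ i, z i • e i)) (Pi.single j 1)
    (contDiff_gau.differentiable (by simp))
    (hf.differentiable.comp (by fun_prop))
    (by
      simp only [dirD_gau]
      exact (integrable_coord_mul_gau j).neg.mul_bdd hb.aestronglyMeasurable
        (Filter.Eventually.of_forall fun z => hC _))
    (by
      simp only [hd]
      exact integrable_gau.mul_bdd (hb'.const_mul _).aestronglyMeasurable (c := |σ| * C')
        (Filter.Eventually.of_forall fun z => by
          rw [norm_mul]; exact mul_le_mul_of_nonneg_left (hC' _) (abs_nonneg _)))
    (integrable_gau.mul_bdd hb.aestronglyMeasurable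
        (Filter.Eventually.of_forall fun z => hC _))
  simp only [hd, dirD_gau, neg_mul, integral_neg, neg_neg] at key
  rw [← key, heat, avg, ← integral_const_mul]
  congr 1; funext z; ring

/-- The sum-of-squares operator `∑ ∂_{e i}²`. -/
noncomputable def sumSq (e : ι → V) (f : V → ℝ) : V → ℝ := fun x => ∑ i, dirD (e i) (dirD (e i) f) x

theorem IsTest.sumSq {e : ι → V} {f : V → ℝ} (hf : IsTest f) : IsTest (sumSq e f) :=
  IsTest.sum _ fun _ _ => (hf.dirD _).dirD _

theorem hasDerivAt_heat (e : ι → V) {f : V → ℝ} (hf : IsTest f) (σ : ℝ) (x : V) :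
    HasDerivAt (fun σ => heat e σ f x) (σ * heat e σ (sumSq e f) x) σ := by
  choose C hC0 hC using fun i => (hf.dirD (e i)).exists_bound
  obtain ⟨C0, -, hC0'⟩ := hf.exists_bound
  have hexp : ∀ τ : ℝ, ∀ z : ι → ℝ, gau ι z * dirD (∑ i, z i • e i) f (x + τ • ∑ i, z i • e i) =
      ∑ i, z i * gau ι z * dirD (e i) f (x + τ • ∑ i, z i • e i) := by
    intro τ z
    simp only [dirD, map_sum, map_smul, smul_eq_mul, Finset.mul_sum]
    refine Finset.sum_congr rfl fun i _ => by ring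
  have hInt : ∀ i, Integrable fun z : ι → ℝ =>
      z i * gau ι z * dirD (e i) f (x + σ • ∑ i, z i • e i) := fun i =>
    (integrable_coord_mul_gau i).mul_bdd (((hf.dirD (e i)).continuous.comp
      (continuous_const.add (continuous_heatShift e σ))).aestronglyMeasurable)
      (Filter.Eventually.of_forall fun z => hC i _)
  have h := hasDerivAt_integral_of_dominated_loc_of_deriv_le (μ := (volume : Measure (ι → ℝ)))
    (F := fun τ z => gau ι z * f (x + τ • ∑ i, z i • e i))
    (F' := fun τ z => gau ι z * dirD (∑ i, z i • e i) f (x + τ • ∑ i, z i • e i))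
    (x₀ := σ) (s := Set.univ) (bound := fun z => ∑ i, |z i * gau ι z| * C i) Filter.univ_mem
    (Filter.Eventually.of_forall fun τ => (integrable_avg_integrand integrable_gau
      (continuous_heatShift e τ) hf.continuous hC0' x).1)
    (integrable_avg_integrand integrable_gau (continuous_heatShift e σ) hf.continuous hC0' x)
    (by simp only [hexp]; exact (integrable_finsetSum _ fun i _ => hInt i).1)
    (by
      refine Filter.Eventually.of_forall fun z τ _ => ?_
      simp only [hexp]
      refine (norm_sum_le _ _).trans (Finset.sum_le_sum fun i _ => ?_)
      rw [norm_mul]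
      exact mul_le_mul_of_nonneg_left (hC i _) (abs_nonneg _))
    (integrable_finsetSum _ fun i _ => (integrable_coord_mul_gau i).abs.mul_const _)
    (by
      refine Filter.Eventually.of_forall fun z τ _ => ?_
      exact (hasDerivAt_line (hf.differentiable _)).const_mul _)
  suffices hh : σ * heat e σ (sumSq e f) x =
      ∫ z, gau ι z * dirD (∑ i, z i • e i) f (x + σ • ∑ i, z i • e i) by
    rw [hh]; exact h.2
  simp only [hexp]
  rw [integral_finsetSum _ fun i _ => hInt i]
  have := avg_sum integrable_gau (continuous_heatShift e σ) Finset.univ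
    (f := fun i => dirD (e i) (dirD (e i) f)) (fun i _ => (hf.dirD _).dirD _)
  unfold sumSq
  rw [heat, this, Finset.mul_sum]
  exact Finset.sum_congr rfl fun i _ => heat_stein e σ (hf.dirD (e i)) i x

end Gaussian

section HeatProperties

variable {ι : Type*} [Fintype ι]
variable {V : Type*} [NormedAddCommGroup V] [NormedSpace ℝ V] [FiniteDimensional ℝ V]

theorem heat_zero (e : ι → V) (f : V → ℝ) : heat e 0 f = f := by
  funext x
  simp [heat, avg, integral_mul_const, integral_gau]

theorem abs_heat_le (e : ι → V) (σ : ℝ) {f : V → ℝ} {C : ℝ} (hC : ∀ x, |f x| ≤ C) (x : V) :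
    |heat e σ f x| ≤ C := by
  simpa [heat, integral_abs_gau] using abs_avg_le (A := fun z => σ • ∑ i, z i • e i)
    (integrable_gau (ι := ι)) hC x

theorem continuous_heat (e : ι → V) {f : V → ℝ} (hf : IsTest f) :
    Continuous fun q : ℝ × V => heat e q.1 f q.2 := by
  obtain ⟨C, -, hC⟩ := hf.exists_bound
  exact continuous_avg (P := ℝ) (A := fun σ z => σ • ∑ i, z i • e i) integrable_gau
    (by fun_prop) hf.continuous hC

theorem contDiff_heat (e : ι → V) (σ : ℝ) {f : V → ℝ} (hf : IsTest f) :
    ContDiff ℝ (⊤ : ℕ∞) (heat e σ f) := contDiff_avg integrable_gau (continuous_heatShift e σ) hf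

theorem dirD_heat (e : ι → V) (σ : ℝ) {f : V → ℝ} (hf : IsTest f) (v : V) :
    dirD v (heat e σ f) = heat e σ (dirD v f) :=
  dirD_avg integrable_gau (continuous_heatShift e σ) hf v

theorem heat_sum (e : ι → V) (σ : ℝ) {κ : Type*} (s : Finset κ) {f : κ → V → ℝ}
    (hf : ∀ i ∈ s, IsTest (f i)) :
    heat e σ (fun x => ∑ i ∈ s, f i x) = fun x => ∑ i ∈ s, heat e σ (f i) x :=
  avg_sum integrable_gau (continuous_heatShift e σ) s hf

theorem exists_abs_heat_dirD_le (e : ι → V) {f : V → ℝ} (hf : IsTest f) (j : ι) :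
    ∃ C, ∀ σ x, 0 < σ → |heat e σ (dirD (e j) f) x| ≤ C / σ := by
  obtain ⟨C, -, hC⟩ := hf.exists_bound
  refine ⟨(∫ z : ι → ℝ, |z j * gau ι z|) * C, fun σ x hσ => ?_⟩
  rw [le_div_iff₀ hσ]
  have h := heat_stein e σ hf j x
  rw [mul_comm, ← abs_of_pos hσ, ← abs_mul, abs_of_pos hσ, h]
  exact abs_avg_le (A := fun z => σ • ∑ i, z i • e i) (integrable_coord_mul_gau j) hC x

variable [MeasurableSpace V] [BorelSpace V] (μ : Measure V) [μ.IsAddHaarMeasure]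

theorem lintegral_heat_le (e : ι → V) (σ : ℝ) {f : V → ℝ} (hf : IsTest f) :
    ∫⁻ x, ‖heat e σ f x‖ₑ ∂μ ≤ ∫⁻ x, ‖f x‖ₑ ∂μ := by
  simpa [heat, lintegral_gau] using lintegral_avg_rpow_le μ (p := 1) le_rfl
    (integrable_gau (ι := ι)).1.aemeasurable (continuous_heatShift e σ) hf.continuous

theorem integrable_heat (e : ι → V) (σ : ℝ) {f : V → ℝ} (hf : IsTest f) :
    Integrable (heat e σ f) μ :=
  ⟨(contDiff_heat e σ hf).continuous.aestronglyMeasurable,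
    (lintegral_heat_le μ e σ hf).trans_lt (hf.integrable μ).2⟩

theorem integral_abs_heat_le (e : ι → V) (σ : ℝ) {f : V → ℝ} (hf : IsTest f) :
    ∫ x, |heat e σ f x| ∂μ ≤ ∫ x, |f x| ∂μ := by
  have h1 := integral_norm_eq_lintegral_enorm (integrable_heat μ e σ hf).1
  have h2 := integral_norm_eq_lintegral_enorm (hf.integrable μ).1
  simp only [Real.norm_eq_abs] at h1 h2
  rw [h1, h2]
  exact ENNReal.toReal_mono (hf.integrable μ).2.ne (lintegral_heat_le μ e σ hf)

theorem integrable_strip {Q : ℝ × V → ℝ} (hQ : Continuous Q) {C T : ℝ}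
    (h1 : ∀ σ, Integrable (fun x => Q (σ, x)) μ)
    (h2 : ∀ σ ∈ Set.Ioc 0 T, ∫ x, |Q (σ, x)| ∂μ ≤ C) :
    Integrable Q ((volume.restrict (Set.Ioc 0 T)).prod μ) := by
  rw [integrable_prod_iff hQ.aestronglyMeasurable]
  refine ⟨Filter.Eventually.of_forall h1, ?_⟩
  refine Integrable.mono' (g := fun _ => C) (by simp)
    hQ.aestronglyMeasurable.norm.integral_prod_right' ?_
  filter_upwards [ae_restrict_mem measurableSet_Ioc] with σ hσ
  rw [Real.norm_of_nonneg (integral_nonneg fun _ => norm_nonneg _)]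
  exact h2 σ hσ

/-- The pair of heat flows of `f` and `g`. -/
noncomputable def heat2 (e : ι → V) (f g : V → ℝ) (q : ℝ × V) : ℝ × ℝ :=
  (heat e q.1 f q.2, heat e q.1 g q.2)

/-- Chain rule for second directional derivatives. -/
theorem dirD_dirD_comp_pair {b : ℝ × ℝ → ℝ} (hb : ContDiff ℝ (⊤ : ℕ∞) b) {u w : V → ℝ}
    (hu : ContDiff ℝ (⊤ : ℕ∞) u) (hw : ContDiff ℝ (⊤ : ℕ∞) w) (v : V) (x : V) :
    dirD v (fun x => b (u x, w x)) x = fderiv ℝ b (u x, w x) (dirD v u x, dirD v w x) ∧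
    dirD v (dirD v (fun x => b (u x, w x))) x =
      fderiv ℝ (fderiv ℝ b) (u x, w x) (dirD v u x, dirD v w x) (dirD v u x, dirD v w x) +
      fderiv ℝ b (u x, w x) (dirD v (dirD v u) x, dirD v (dirD v w) x) := by
  have hd : ∀ {f : V → ℝ}, ContDiff ℝ (⊤ : ℕ∞) f → Differentiable ℝ f := fun h =>
    h.differentiable (by simp)
  have hpair : ∀ {f g : V → ℝ}, Differentiable ℝ f → Differentiable ℝ g → ∀ x,
      HasFDerivAt (fun x => (f x, g x)) ((fderiv ℝ f x).prod (fderiv ℝ g x)) x :=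
    fun hf hg x => (hf x).hasFDerivAt.prodMk (hg x).hasFDerivAt
  have hbd : Differentiable ℝ b := hb.differentiable (by simp)
  have hb2 : Differentiable ℝ (fderiv ℝ b) :=
    (hb.fderiv_right (m := (⊤ : ℕ∞)) (by simp)).differentiable (by simp)
  have h1 : dirD v (fun x => b (u x, w x)) =
      fun x => fderiv ℝ b (u x, w x) (dirD v u x, dirD v w x) := by
    funext x
    have := ((hbd (u x, w x)).hasFDerivAt.comp x (hpair (hd hu) (hd hw) x)).fderiv
    change fderiv ℝ (b ∘ _) x v = _
    rw [this]; rfl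
  refine ⟨congrFun h1 x, ?_⟩
  rw [h1]
  have hA := (hb2 (u x, w x)).hasFDerivAt.comp x (hpair (hd hu) (hd hw) x)
  have hB := hpair (hd (hu.dirD v)) (hd (hw.dirD v)) x
  have := (hA.clm_apply hB).fderiv
  change fderiv ℝ (fun x => (fderiv ℝ b ∘ fun x => (u x, w x)) x (dirD v u x, dirD v w x)) x v = _
  rw [this]
  simp [dirD, add_comm]

/-- Evolution of `∫ b(u, w)` along the heat flow. -/
theorem integral_heat_evolution (e : ι → V) {b : ℝ × ℝ → ℝ} (hb : ContDiff ℝ (⊤ : ℕ∞) b)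
    (hb0 : b 0 = 0) {f g : V → ℝ} (hf : IsTest f) (hg : IsTest g) {T : ℝ} (hT : 0 ≤ T) :
    IntervalIntegrable (fun σ => σ * ∫ x, ∑ i, fderiv ℝ (fderiv ℝ b) (heat2 e f g (σ, x))
      (heat2 e (dirD (e i) f) (dirD (e i) g) (σ, x))
      (heat2 e (dirD (e i) f) (dirD (e i) g) (σ, x)) ∂μ) volume 0 T ∧
    (∫ x, b (f x, g x) ∂μ) - ∫ x, b (heat2 e f g (T, x)) ∂μ =
      ∫ σ in 0..T, σ * ∫ x, ∑ i, fderiv ℝ (fderiv ℝ b) (heat2 e f g (σ, x))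
        (heat2 e (dirD (e i) f) (dirD (e i) g) (σ, x))
        (heat2 e (dirD (e i) f) (dirD (e i) g) (σ, x)) ∂μ := by
  obtain ⟨Cf, hCf0, hCf⟩ := hf.exists_bound
  obtain ⟨Cg, hCg0, hCg⟩ := hg.exists_bound
  set K : Set (ℝ × ℝ) := Metric.closedBall 0 (max Cf Cg) with hK
  have hKc : IsCompact K := isCompact_closedBall _ _
  have hU : ∀ q, heat2 e f g q ∈ K := by
    intro q
    rw [hK, mem_closedBall_zero_iff]
    exact max_le_max (abs_heat_le e q.1 hCf q.2) (abs_heat_le e q.1 hCg q.2)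
  have hcb1 : Continuous (fderiv ℝ b) := hb.continuous_fderiv (by simp)
  have hbs : ContDiff ℝ (⊤ : ℕ∞) (fderiv ℝ b) := hb.fderiv_right (m := (⊤ : ℕ∞)) (by simp)
  have hcb2 : Continuous (fderiv ℝ (fderiv ℝ b)) := hbs.continuous_fderiv (by simp)
  obtain ⟨C1, hC1⟩ := hKc.exists_bound_of_continuousOn hcb1.continuousOn
  obtain ⟨C2, hC2⟩ := hKc.exists_bound_of_continuousOn
    (f := fderiv ℝ (fderiv ℝ b)) hcb2.continuousOn
  have hcont : ∀ {f g : V → ℝ}, IsTest f → IsTest g → Continuous (heat2 e f g) := fun hf hg =>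
    (continuous_heat e hf).prodMk (continuous_heat e hg)
  have hnorm : ∀ {f g : V → ℝ} (q : ℝ × V), ‖heat2 e f g q‖ ≤ |heat e q.1 f q.2| + |heat e q.1 g q.2| :=
    fun q => max_le_add_of_nonneg (abs_nonneg _) (abs_nonneg _)
  have hint2 : ∀ {f g : V → ℝ}, IsTest f → IsTest g → ∀ (σ : ℝ) (C : ℝ),
      Integrable (fun x => C * (|heat e σ f x| + |heat e σ g x|)) μ := fun hf hg σ C =>
    ((integrable_heat μ e σ hf).abs.add (integrable_heat μ e σ hg).abs).const_mul C
  have hC1' : 0 ≤ C1 := (norm_nonneg _).trans (hC1 _ (hU (0, 0)))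
  have hC2' : 0 ≤ C2 := (norm_nonneg _).trans (hC2 _ (hU (0, 0)))
  -- the first-order term
  set Q1 : ℝ × V → ℝ := fun q =>
    fderiv ℝ b (heat2 e f g q) (heat2 e (sumSq e f) (sumSq e g) q) with hQ1
  have hQ1c : Continuous Q1 := (hcb1.comp (hcont hf hg)).clm_apply (hcont hf.sumSq hg.sumSq)
  have hQ1b : ∀ q, |Q1 q| ≤ C1 * (|heat e q.1 (sumSq e f) q.2| + |heat e q.1 (sumSq e g) q.2|) := by
    intro q
    refine (ContinuousLinearMap.le_opNorm (fderiv ℝ b (heat2 e f g q)) _).trans ?_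
    exact mul_le_mul (hC1 _ (hU q)) (hnorm q) (norm_nonneg _) hC1'
  have hQ1i : ∀ σ, Integrable (fun x => Q1 (σ, x)) μ := fun σ =>
    (hint2 hf.sumSq hg.sumSq σ C1).mono' (by fun_prop : Continuous fun x => Q1 (σ, x)).aestronglyMeasurable
      (Filter.Eventually.of_forall fun x => hQ1b (σ, x))
  -- spatial integration by parts
  have hibp : ∀ σ, ∫ x, Q1 (σ, x) ∂μ = -∫ x, ∑ i, fderiv ℝ (fderiv ℝ b) (heat2 e f g (σ, x))
        (heat2 e (dirD (e i) f) (dirD (e i) g) (σ, x))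
        (heat2 e (dirD (e i) f) (dirD (e i) g) (σ, x)) ∂μ := by
    intro σ
    set Q2 : ι → V → ℝ := fun i x => fderiv ℝ (fderiv ℝ b) (heat2 e f g (σ, x))
        (heat2 e (dirD (e i) f) (dirD (e i) g) (σ, x))
        (heat2 e (dirD (e i) f) (dirD (e i) g) (σ, x)) with hQ2
    set Q3 : ι → V → ℝ := fun i x => fderiv ℝ b (heat2 e f g (σ, x))
        (heat2 e (dirD (e i) (dirD (e i) f)) (dirD (e i) (dirD (e i) g)) (σ, x)) with hQ3
    have hc' : ∀ {f g : V → ℝ}, IsTest f → IsTest g → Continuous fun x => heat2 e f g (σ, x) :=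
      fun hf hg => (hcont hf hg).comp (by fun_prop)
    have hQ2i : ∀ i, Integrable (Q2 i) μ := by
      intro i
      obtain ⟨A1, hA1, hA1'⟩ := (hf.dirD (e i)).exists_bound
      obtain ⟨A2, hA2, hA2'⟩ := (hg.dirD (e i)).exists_bound
      have hi := hc' (hf.dirD (e i)) (hg.dirD (e i))
      refine (hint2 (hf.dirD (e i)) (hg.dirD (e i)) σ (C2 * (A1 + A2))).mono' ?_
        (Filter.Eventually.of_forall fun x => ?_)
      · exact (((hcb2.comp (hc' hf hg)).clm_apply hi).clm_apply hi).aestronglyMeasurable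
      · refine (ContinuousLinearMap.le_opNorm _ _).trans ?_
        refine mul_le_mul ((ContinuousLinearMap.le_opNorm _ _).trans ?_) (hnorm (σ, x))
          (norm_nonneg _) (by positivity)
        refine mul_le_mul (hC2 _ (hU _)) ((hnorm (σ, x)).trans ?_) (norm_nonneg _) hC2'
        exact add_le_add (abs_heat_le e σ hA1' x) (abs_heat_le e σ hA2' x)
    have hQ3i : ∀ i, Integrable (Q3 i) μ := by
      intro i
      have hi := hc' ((hf.dirD (e i)).dirD (e i)) ((hg.dirD (e i)).dirD (e i))
      refine (hint2 ((hf.dirD (e i)).dirD (e i)) ((hg.dirD (e i)).dirD (e i)) σ C1).mono' ?_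
        (Filter.Eventually.of_forall fun x => ?_)
      · exact ((hcb1.comp (hc' hf hg)).clm_apply hi).aestronglyMeasurable
      · refine (ContinuousLinearMap.le_opNorm _ _).trans ?_
        exact mul_le_mul (hC1 _ (hU _)) (hnorm (σ, x)) (norm_nonneg _) hC1'
    have hz : ∀ i, ∫ x, (Q2 i x + Q3 i x) ∂μ = 0 := by
      intro i
      have hcd := fun x => dirD_dirD_comp_pair hb (contDiff_heat e σ hf) (contDiff_heat e σ hg) (e i) x
      simp only [dirD_heat e σ hf, dirD_heat e σ hg, dirD_heat e σ (hf.dirD _),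
        dirD_heat e σ (hg.dirD _)] at hcd
      have hs : ContDiff ℝ (⊤ : ℕ∞) fun x => b (heat e σ f x, heat e σ g x) :=
        hb.comp ((contDiff_heat e σ hf).prodMk (contDiff_heat e σ hg))
      have h2 : dirD (e i) (dirD (e i) fun x => b (heat e σ f x, heat e σ g x)) =
          fun x => Q2 i x + Q3 i x := funext fun x => (hcd x).2
      rw [← h2]
      refine integral_dirD_eq_zero μ (e i) ((hs.dirD _).differentiable (by simp)) ?_ ?_
      · refine (hint2 (hf.dirD (e i)) (hg.dirD (e i)) σ C1).mono'
          (hs.dirD _).continuous.aestronglyMeasurable (Filter.Eventually.of_forall fun x => ?_)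
        rw [(hcd x).1]
        refine (ContinuousLinearMap.le_opNorm _ _).trans ?_
        exact mul_le_mul (hC1 _ (hU (σ, x)))
          (hnorm (f := dirD (e i) f) (g := dirD (e i) g) (σ, x)) (norm_nonneg _) hC1'
      · rw [h2]; exact (hQ2i i).add (hQ3i i)
    have hsum : ∀ x, Q1 (σ, x) = ∑ i, Q3 i x := by
      intro x
      simp only [hQ1, hQ3]
      rw [← map_sum]
      congr 1
      simp only [heat2]
      rw [show sumSq e f = fun x => ∑ i, dirD (e i) (dirD (e i) f) x from rfl,
        show sumSq e g = fun x => ∑ i, dirD (e i) (dirD (e i) g) x from rfl,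
        heat_sum e σ _ fun i _ => (hf.dirD _).dirD _, heat_sum e σ _ fun i _ => (hg.dirD _).dirD _]
      ext <;> simp [Prod.fst_sum, Prod.snd_sum]
    simp only [hsum]
    rw [integral_finsetSum _ fun i _ => hQ3i i, integral_finsetSum _ fun i _ => hQ2i i,
      eq_neg_iff_add_eq_zero, ← Finset.sum_add_distrib]
    refine Finset.sum_eq_zero fun i _ => ?_
    rw [add_comm, ← integral_add (hQ2i i) (hQ3i i)]
    exact hz i
  -- time integration
  have hQs : Integrable (fun q : ℝ × V => q.1 * Q1 q) ((volume.restrict (Set.Ioc 0 T)).prod μ) := by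
    refine integrable_strip μ (by fun_prop)
      (C := T * (C1 * ((∫ x, |sumSq e f x| ∂μ) + ∫ x, |sumSq e g x| ∂μ)))
      (fun σ => (hQ1i σ).const_mul σ) ?_
    intro σ hσ
    have h1 : ∫ x, |Q1 (σ, x)| ∂μ ≤ C1 * ((∫ x, |sumSq e f x| ∂μ) + ∫ x, |sumSq e g x| ∂μ) := by
      refine (integral_mono (hQ1i σ).abs (hint2 hf.sumSq hg.sumSq σ C1)
        fun x => hQ1b (σ, x)).trans ?_
      rw [integral_const_mul, integral_add (integrable_heat μ e σ hf.sumSq).abs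
        (integrable_heat μ e σ hg.sumSq).abs]
      exact mul_le_mul_of_nonneg_left (add_le_add (integral_abs_heat_le μ e σ hf.sumSq)
        (integral_abs_heat_le μ e σ hg.sumSq)) hC1'
    simp only [abs_mul, abs_of_pos hσ.1]
    rw [integral_const_mul]
    exact mul_le_mul hσ.2 h1 (integral_nonneg fun _ => abs_nonneg _) hT
  have hder : ∀ x σ, HasDerivAt (fun σ => b (heat2 e f g (σ, x))) (σ * Q1 (σ, x)) σ := by
    intro x σ
    have h1 := (hasDerivAt_heat e hf σ x).prodMk (hasDerivAt_heat e hg σ x)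
    have h2 := ((hb.differentiable (by simp)) (heat2 e f g (σ, x))).hasFDerivAt.comp_hasDerivAt σ h1
    rw [show (σ * heat e σ (sumSq e f) x, σ * heat e σ (sumSq e g) x) =
      σ • heat2 e (sumSq e f) (sumSq e g) (σ, x) from rfl, map_smul] at h2
    exact h2
  have hftc : ∀ x, ∫ σ in 0..T, σ * Q1 (σ, x) = b (heat2 e f g (T, x)) - b (f x, g x) := by
    intro x
    rw [intervalIntegral.integral_eq_sub_of_hasDerivAt (fun σ _ => hder x σ)
      ((by fun_prop : Continuous fun σ => σ * Q1 (σ, x)).intervalIntegrable _ _)]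
    simp [heat2, heat_zero]
  have hbint : ∀ σ, Integrable (fun x => b (heat2 e f g (σ, x))) μ := by
    intro σ
    refine (hint2 hf hg σ C1).mono'
      (hb.continuous.comp ((hcont hf hg).comp (by fun_prop))).aestronglyMeasurable
      (Filter.Eventually.of_forall fun x => ?_)
    have h0 : (0 : ℝ × ℝ) ∈ K := by
      simp [hK, hCf0]
    have := (convex_closedBall (0 : ℝ × ℝ) (max Cf Cg)).norm_image_sub_le_of_norm_fderiv_le
      (𝕜 := ℝ) (f := b) (fun z _ => (hb.differentiable (by simp)) z) hC1 h0 (hU (σ, x))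
    rw [hb0, sub_zero, sub_zero] at this
    exact this.trans (mul_le_mul_of_nonneg_left (hnorm (σ, x)) hC1')
  have hQ1int : ∀ σ, σ * ∫ x, ∑ i, fderiv ℝ (fderiv ℝ b) (heat2 e f g (σ, x))
        (heat2 e (dirD (e i) f) (dirD (e i) g) (σ, x))
        (heat2 e (dirD (e i) f) (dirD (e i) g) (σ, x)) ∂μ = -∫ x, σ * Q1 (σ, x) ∂μ := by
    intro σ
    rw [integral_const_mul, hibp]; ring
  simp only [hQ1int]
  constructor
  · rw [intervalIntegrable_iff_integrableOn_Ioc_of_le hT]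
    exact hQs.integral_prod_left.neg
  · rw [intervalIntegral.integral_neg, intervalIntegral.integral_of_le hT,
      integral_integral_swap (f := fun σ x => σ * Q1 (σ, x)) hQs]
    simp only [← intervalIntegral.integral_of_le hT, hftc]
    have hb0' : Integrable (fun x => b (f x, g x)) μ := by
      simpa [heat2, heat_zero] using hbint 0
    rw [integral_sub (hbint T) hb0']
    ring

end HeatProperties

section Bellman

theorem fderiv_fderiv_eq_of_line {V : Type*} [NormedAddCommGroup V] [NormedSpace ℝ V] {b : V → ℝ}
    (hb : ContDiff ℝ (⊤ : ℕ∞) b) {z v : V} {φ1 : ℝ → ℝ} {φ2 : ℝ}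
    (h1 : ∀ t, HasDerivAt (fun t : ℝ => b (z + t • v)) (φ1 t) t) (h2 : HasDerivAt φ1 φ2 0) :
    fderiv ℝ (fderiv ℝ b) z v v = φ2 := by
  have hb1 : Differentiable ℝ b := hb.differentiable (by simp)
  have hb2 : Differentiable ℝ (fderiv ℝ b) :=
    (hb.fderiv_right (m := (⊤ : ℕ∞)) (by simp)).differentiable (by simp)
  have e1 : φ1 = fun t => dirD v b (z + t • v) :=
    funext fun t => (h1 t).unique (hasDerivAt_line (hb1 _))
  have h3 : HasDerivAt (fun t : ℝ => dirD v b (z + t • v)) (dirD v (dirD v b) (z + (0 : ℝ) • v)) 0 :=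
    hasDerivAt_line ((hb.dirD v).differentiable (by simp) _)
  rw [e1] at h2
  rw [h2.unique h3]
  change _ = fderiv ℝ (fun y => fderiv ℝ b y v) (z + (0 : ℝ) • v) v
  rw [zero_smul, add_zero, fderiv_clm_apply (hb2 z) (differentiableAt_const v)]
  simp

/-- `(ζ² + ε)^{p/2} + (η² + ε)^{q/2}`. -/
noncomputable def bellG (p q ε : ℝ) (z : ℝ × ℝ) : ℝ :=
  (z.1 ^ 2 + ε) ^ (p / 2) + (z.2 ^ 2 + ε) ^ (q / 2)

/-- A Bellman function for bilinear embeddings. -/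
noncomputable def bell (p q K ε : ℝ) (z : ℝ × ℝ) : ℝ :=
  K * bellG p q ε z + (z.1 ^ 2 + ε) * bellG p q ε z ^ (1 - 2 / p)

set_option maxHeartbeats 1000000 in
theorem bellman_algebra {P Q θ K c a b ζ η α β A B G M H : ℝ} (hP : 1 ≤ P) (hQ1 : Q ≤ 1) (hQ : 0 < Q)
    (hθ0 : 0 ≤ θ) (hθ1 : θ ≤ 1) (hPθ : (1 - θ) * P = 1) (hc : c = 2 * Q * (2 * Q - 1))
    (hc0 : 0 < c)
    (hK0 : 0 ≤ K) (hK : 21 ≤ K * c) (hα : 0 < α) (hβ : 0 < β) (hζ : ζ ^ 2 ≤ α) (hη : η ^ 2 ≤ β)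
    (hA : 0 < A) (hB : 0 < B) (hG : G = A + B) (hM : M * β = B) (hH : 0 < H) (hαH : α * H ≤ G) :
    H * a ^ 2 + M * b ^ 2 ≤
      K * (P * ((A / α) * (2 * a ^ 2) + (P - 1) * (A / α ^ 2) * (2 * ζ * a) ^ 2) +
          Q * (M * (2 * b ^ 2) + (Q - 1) * (M / β) * (2 * η * b) ^ 2)) +
      (2 * a ^ 2 * H + 2 * ((2 * ζ * a) * (θ * (H / G) *
          (P * (A / α) * (2 * ζ * a) + Q * M * (2 * η * b)))) +
        α * (θ * ((θ - 1) * (H / G ^ 2) * (P * (A / α) * (2 * ζ * a) + Q * M * (2 * η * b)) ^ 2 +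
          (H / G) * (P * ((A / α) * (2 * a ^ 2) + (P - 1) * (A / α ^ 2) * (2 * ζ * a) ^ 2) +
          Q * (M * (2 * b ^ 2) + (Q - 1) * (M / β) * (2 * η * b) ^ 2))))) := by
  have hM0 : 0 < M := by
    rcases lt_trichotomy M 0 with h | h | h
    · nlinarith
    · subst h; linarith
    · exact h
  have hG0 : 0 < G := by linarith
  have hAG : A / G ≤ 1 := (div_le_one hG0).2 (by linarith)
  have hBG : M * β / G ≤ 1 := (div_le_one hG0).2 (by linarith)
  have hαG : α * H / G ≤ 1 := (div_le_one hG0).2 hαH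
  have hA1 : 0 ≤ A / α := by positivity
  have hAG0 : 0 ≤ A / G := by positivity
  set X2 := P * ((A / α) * (2 * a ^ 2) + (P - 1) * (A / α ^ 2) * (2 * ζ * a) ^ 2) with hX2
  set Y2 := Q * (M * (2 * b ^ 2) + (Q - 1) * (M / β) * (2 * η * b) ^ 2) with hY2
  have hX20 : 0 ≤ X2 := by
    have : 0 ≤ P - 1 := by linarith
    positivity
  have hY20 : c * M * b ^ 2 ≤ Y2 := by
    have h1 : M / β * η ^ 2 ≤ M := by
      rw [div_mul_eq_mul_div, div_le_iff₀ hβ]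
      exact mul_le_mul_of_nonneg_left hη hM0.le
    have h2 : 0 ≤ Q * (1 - Q) * 4 * b ^ 2 := by
      have : 0 ≤ 1 - Q := by linarith
      positivity
    have h3 := mul_le_mul_of_nonneg_left h1 h2
    have e : Y2 - c * M * b ^ 2 =
        Q * (1 - Q) * 4 * b ^ 2 * M - Q * (1 - Q) * 4 * b ^ 2 * (M / β * η ^ 2) := by
      rw [hY2, hc]; ring
    linarith
  have hY2nn : 0 ≤ Y2 := le_trans (by positivity) hY20
  have t1 : 21 * (M * b ^ 2) ≤ K * Y2 := by
    have := mul_le_mul_of_nonneg_left hY20 hK0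
    have h2 : 21 * (M * b ^ 2) ≤ K * c * (M * b ^ 2) :=
      mul_le_mul_of_nonneg_right hK (by positivity)
    linarith [this, h2, (by ring : K * c * (M * b ^ 2) = K * (c * M * b ^ 2))]
  -- the mixed term
  set y := (H / G) * M * (ζ * η * (a * b)) with hy
  have hy2 : y ^ 2 ≤ H * M * (a * b) ^ 2 := by
    have e : y ^ 2 = (ζ ^ 2 * H / G) * (M * η ^ 2 / G) * (H * M * (a * b) ^ 2) := by
      rw [hy]; ring
    rw [e]
    have i1 : ζ ^ 2 * H / G ≤ 1 := le_trans (by gcongr) hαG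
    have i2 : M * η ^ 2 / G ≤ 1 := le_trans (by gcongr) hBG
    have i3 : (ζ ^ 2 * H / G) * (M * η ^ 2 / G) ≤ 1 := mul_le_one₀ i1 (by positivity) i2
    exact mul_le_of_le_one_left (by positivity) i3
  have hyabs : 8 * |y| ≤ H * a ^ 2 + 16 * (M * b ^ 2) := by
    refine abs_le_of_sq_le_sq' ?_ (by positivity) |>.2
    rw [mul_pow, sq_abs]
    nlinarith [sq_nonneg (H * a ^ 2 - 16 * (M * b ^ 2))]
  have t2 : -(H * a ^ 2 + 16 * (M * b ^ 2)) ≤ θ * (8 * Q * y * (1 - A / G)) := by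
    have h0 : 0 ≤ θ * Q * (1 - A / G) := by
      have : 0 ≤ 1 - A / G := by linarith
      positivity
    have h1 : θ * Q * (1 - A / G) ≤ 1 :=
      mul_le_one₀ (mul_le_one₀ hθ1 hQ.le hQ1) (by linarith) (by linarith)
    have h2 : |θ * Q * (1 - A / G) * (8 * y)| ≤ 8 * |y| := by
      rw [abs_mul, abs_of_nonneg h0, abs_mul, abs_of_pos (by norm_num : (0:ℝ) < 8)]
      exact mul_le_of_le_one_left (by positivity) h1
    have h3 := neg_abs_le (θ * Q * (1 - A / G) * (8 * y))
    linarith [(by ring : θ * (8 * Q * y * (1 - A / G)) = θ * Q * (1 - A / G) * (8 * y))]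
  -- the square of the second gradient term
  have t3 : θ * (1 - θ) * (α * H / G) * ((Q * M * (2 * η * b)) ^ 2 / G) ≤ 4 * (M * b ^ 2) := by
    have i1 : (Q * M * (2 * η * b)) ^ 2 / G ≤ 4 * (M * b ^ 2) := by
      have e : (Q * M * (2 * η * b)) ^ 2 / G = Q ^ 2 * (M * η ^ 2 / G) * (4 * (M * b ^ 2)) := by ring
      rw [e]
      have i2 : M * η ^ 2 / G ≤ 1 := le_trans (by gcongr) hBG
      exact mul_le_of_le_one_left (by positivity)
        (mul_le_one₀ (pow_le_one₀ hQ.le hQ1) (by positivity) i2)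
    have h1 : 0 ≤ 1 - θ := by linarith
    exact (mul_le_of_le_one_left (by positivity) (mul_le_one₀ (mul_le_one₀ hθ1 h1 (by linarith))
      (by positivity) hαG)).trans i1
  -- the pure first-variable term
  have t4 : 0 ≤ θ * (H / G) * (8 * P * (A / α) * ζ ^ 2 * a ^ 2 -
      4 * P * (A / α) * (A / G) * ζ ^ 2 * a ^ 2) := by
    have : 8 * P * (A / α) * ζ ^ 2 * a ^ 2 - 4 * P * (A / α) * (A / G) * ζ ^ 2 * a ^ 2 =
      4 * P * (A / α) * ζ ^ 2 * a ^ 2 * (2 - A / G) := by ring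
    rw [this]
    have : 0 ≤ 2 - A / G := by linarith
    positivity
  have t5 : 0 ≤ α * (θ * ((H / G) * (X2 + Y2))) := by positivity
  have t6 : 0 ≤ K * X2 := by positivity
  have e1 : α * (A / α) = A := by field_simp
  have key : 2 * a ^ 2 * H + 2 * ((2 * ζ * a) * (θ * (H / G) *
          (P * (A / α) * (2 * ζ * a) + Q * M * (2 * η * b)))) +
        α * (θ * ((θ - 1) * (H / G ^ 2) * (P * (A / α) * (2 * ζ * a) + Q * M * (2 * η * b)) ^ 2 +
          (H / G) * (X2 + Y2))) =
      2 * a ^ 2 * H + θ * (H / G) * (8 * P * (A / α) * ζ ^ 2 * a ^ 2 -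
      4 * ((1 - θ) * P) * P * (A / α) * (α * (A / α) / G) * ζ ^ 2 * a ^ 2) +
      θ * (8 * Q * y * (1 - ((1 - θ) * P) * (α * (A / α)) / G)) -
      θ * (1 - θ) * (α * H / G) * ((Q * M * (2 * η * b)) ^ 2 / G) +
      α * (θ * ((H / G) * (X2 + Y2))) := by
    rw [hy]; ring
  rw [hPθ, e1] at key
  simp only [mul_one, one_mul] at key
  rw [key, mul_add K X2 Y2]
  clear key
  generalize θ * (8 * Q * y * (1 - A / G)) = u1 at *
  generalize θ * (1 - θ) * (α * H / G) * ((Q * M * (2 * η * b)) ^ 2 / G) = u2 at *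
  generalize α * (θ * ((H / G) * (X2 + Y2))) = u3 at *
  generalize θ * (H / G) * (8 * P * (A / α) * ζ ^ 2 * a ^ 2 -
      4 * P * (A / α) * (A / G) * ζ ^ 2 * a ^ 2) = u4 at *
  generalize K * X2 = u5 at *
  generalize K * Y2 = u6 at *
  generalize M * b ^ 2 = u7 at *
  linarith

theorem bellG_pos {p q ε : ℝ} (hε : 0 < ε) (z : ℝ × ℝ) : 0 < bellG p q ε z :=
  add_pos (Real.rpow_pos_of_pos (by positivity) _) (Real.rpow_pos_of_pos (by positivity) _)

theorem contDiff_bell {p q K ε : ℝ} (hε : 0 < ε) : ContDiff ℝ (⊤ : ℕ∞) (bell p q K ε) := by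
  have hG : ContDiff ℝ (⊤ : ℕ∞) (bellG p q ε) := by
    unfold bellG
    refine ContDiff.add (ContDiff.rpow_const_of_ne (by fun_prop) fun z => ?_)
      (ContDiff.rpow_const_of_ne (by fun_prop) fun z => ?_)
    all_goals positivity
  unfold bell
  exact (contDiff_const.mul hG).add ((by fun_prop : ContDiff ℝ (⊤ : ℕ∞) fun z : ℝ × ℝ => z.1 ^ 2 + ε).mul
    (hG.rpow_const_of_ne fun z => (bellG_pos hε z).ne'))

theorem bell_hessian {p q K ε : ℝ} (hp : 2 ≤ p) (hpq : p.HolderConjugate q) (hε : 0 < ε)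
    (hK : 21 ≤ K * (q * (q - 1))) (z : ℝ × ℝ) :
    ∃ τ, 0 < τ ∧ ∀ v : ℝ × ℝ,
      τ * v.1 ^ 2 + τ⁻¹ * v.2 ^ 2 ≤ fderiv ℝ (fderiv ℝ (bell p q K ε)) z v v := by
  have hp0 : 0 < p := by linarith
  have hq1 : 1 < q := hpq.symm.lt
  have hq0 : 0 < q := by linarith
  have hinv : p⁻¹ + q⁻¹ = 1 := hpq.inv_add_inv_eq_one
  have hpi : p⁻¹ ≤ 1 / 2 := by rw [inv_le_comm₀ hp0 (by norm_num)]; simpa using hp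
  have hq2 : q ≤ 2 := by
    have : (1 / 2 : ℝ) ≤ q⁻¹ := by linarith
    rw [le_inv_comm₀ (by norm_num) hq0] at this
    simpa using this
  have hpi0 : 0 < p⁻¹ := by positivity
  set P := p / 2 with hP
  set Q := q / 2 with hQ
  set θ := 1 - 2 / p with hθ
  have hPθ : (1 - θ) * P = 1 := by rw [hθ, hP]; field_simp; ring
  have hQθ : Q * (1 + θ) = 1 := by
    have : q⁻¹ = 1 - p⁻¹ := by linarith
    have h2 : q * (1 - p⁻¹) = 1 := by rw [← this]; exact mul_inv_cancel₀ hq0.ne'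
    rw [hQ, hθ, div_eq_mul_inv 2 p]; linarith [h2, (by ring : q / 2 * (1 + (1 - 2 * p⁻¹)) = q * (1 - p⁻¹))]
  have hθ0 : 0 ≤ θ := by rw [hθ, div_eq_mul_inv]; linarith
  have hθ1 : θ ≤ 1 := by rw [hθ, div_eq_mul_inv]; linarith
  set α := z.1 ^ 2 + ε with hα
  set β := z.2 ^ 2 + ε with hβ
  have hα0 : 0 < α := by positivity
  have hβ0 : 0 < β := by positivity
  set G := bellG p q ε z with hG
  have hGe : G = α ^ P + β ^ Q := rfl
  have hG0 : 0 < G := bellG_pos hε z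
  set H := G ^ θ with hH
  have hH0 : 0 < H := Real.rpow_pos_of_pos hG0 _
  have hA0 : 0 < α ^ P := Real.rpow_pos_of_pos hα0 _
  have hB0 : 0 < β ^ Q := Real.rpow_pos_of_pos hβ0 _
  have hαH : α * H ≤ G := by
    have h1 : α ≤ G ^ (1 - θ) := by
      calc α = (α ^ P) ^ (1 - θ) := by
            rw [← Real.rpow_mul hα0.le, mul_comm P, hPθ, Real.rpow_one]
        _ ≤ _ := Real.rpow_le_rpow hA0.le (by linarith) (by linarith)
    calc α * H ≤ G ^ (1 - θ) * G ^ θ := mul_le_mul_of_nonneg_right h1 hH0.le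
      _ = G := by rw [← Real.rpow_add hG0]; simp
  have hMH : H⁻¹ ≤ β ^ Q / β := by
    have h1 : (β ^ Q) ^ θ ≤ H := Real.rpow_le_rpow hB0.le (by linarith) hθ0
    have h2 : (β ^ Q) ^ θ * (β ^ Q / β) = 1 := by
      rw [← Real.rpow_mul hβ0.le, ← Real.rpow_sub_one hβ0.ne', ← Real.rpow_add hβ0]
      rw [show Q * θ + (Q - 1) = 0 by linarith, Real.rpow_zero]
    rw [inv_le_iff_one_le_mul₀' hH0, ← h2]
    exact mul_le_mul_of_nonneg_right h1 (by positivity)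
  have hc0 : 0 < q * (q - 1) := mul_pos hq0 (by linarith)
  have hK0 : 0 ≤ K := by
    by_contra h
    push Not at h
    nlinarith
  refine ⟨H, hH0, fun v => ?_⟩
  set a := v.1 with ha
  set b := v.2 with hb
  have dα : ∀ t : ℝ, HasDerivAt (fun t : ℝ => (z.1 + t * a) ^ 2 + ε) (2 * (z.1 + t * a) * a) t := by
    intro t
    have := ((((hasDerivAt_id t).mul_const a).const_add z.1).pow 2).add_const ε
    simpa using this
  have dβ : ∀ t : ℝ, HasDerivAt (fun t : ℝ => (z.2 + t * b) ^ 2 + ε) (2 * (z.2 + t * b) * b) t := by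
    intro t
    have := ((((hasDerivAt_id t).mul_const b).const_add z.2).pow 2).add_const ε
    simpa using this
  have dα' : HasDerivAt (fun t : ℝ => 2 * (z.1 + t * a) * a) (2 * a ^ 2) 0 := by
    have := ((((hasDerivAt_id (0 : ℝ)).mul_const a).const_add z.1).const_mul 2).mul_const a
    refine this.congr_deriv ?_
    ring
  have dβ' : HasDerivAt (fun t : ℝ => 2 * (z.2 + t * b) * b) (2 * b ^ 2) 0 := by
    have := ((((hasDerivAt_id (0 : ℝ)).mul_const b).const_add z.2).const_mul 2).mul_const b
    refine this.congr_deriv ?_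
    ring
  have pα : ∀ t : ℝ, (z.1 + t * a) ^ 2 + ε ≠ 0 := fun t => by positivity
  have pβ : ∀ t : ℝ, (z.2 + t * b) ^ 2 + ε ≠ 0 := fun t => by positivity
  have dG : ∀ t : ℝ, HasDerivAt (fun t : ℝ => ((z.1 + t * a) ^ 2 + ε) ^ P + ((z.2 + t * b) ^ 2 + ε) ^ Q)
      ((2 * (z.1 + t * a) * a) * P * ((z.1 + t * a) ^ 2 + ε) ^ (P - 1) +
       (2 * (z.2 + t * b) * b) * Q * ((z.2 + t * b) ^ 2 + ε) ^ (Q - 1)) t := fun t =>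
    ((dα t).rpow_const (Or.inl (pα t))).add ((dβ t).rpow_const (Or.inl (pβ t)))
  have pG : ∀ t : ℝ, ((z.1 + t * a) ^ 2 + ε) ^ P + ((z.2 + t * b) ^ 2 + ε) ^ Q ≠ 0 := fun t =>
    (bellG_pos (p := p) (q := q) hε (z.1 + t * a, z.2 + t * b)).ne'
  have hline := fun t : ℝ => ((dG t).const_mul K).add
    ((dα t).mul ((dG t).rpow_const (p := θ) (Or.inl (pG t))))
  have dG' := (((dα'.mul_const P).mul ((dα 0).rpow_const (p := P - 1) (Or.inl (pα 0))))).add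
    ((dβ'.mul_const Q).mul ((dβ 0).rpow_const (p := Q - 1) (Or.inl (pβ 0))))
  have hline2 := (dG'.const_mul K).add ((dα'.mul ((dG 0).rpow_const (p := θ) (Or.inl (pG 0)))).add
    ((dα 0).mul ((dG'.mul_const θ).mul ((dG 0).rpow_const (p := θ - 1) (Or.inl (pG 0))))))
  have main := fderiv_fderiv_eq_of_line (contDiff_bell (p := p) (q := q) (K := K) hε)
    (z := z) (v := v) (φ1 := _) hline hline2
  rw [main]
  have rA : α ^ (P - 1) = α ^ P / α := Real.rpow_sub_one hα0.ne' _
  have rA2 : α ^ (P - 1 - 1) = α ^ P / α ^ 2 := by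
    rw [Real.rpow_sub_one hα0.ne', rA]; field_simp
  have rB : β ^ (Q - 1) = β ^ Q / β := Real.rpow_sub_one hβ0.ne' _
  have rB2 : β ^ (Q - 1 - 1) = β ^ Q / β / β := by
    rw [Real.rpow_sub_one hβ0.ne', rB]
  have rG : G ^ (θ - 1) = H / G := Real.rpow_sub_one hG0.ne' _
  have rG2 : G ^ (θ - 1 - 1) = H / G ^ 2 := by
    rw [Real.rpow_sub_one hG0.ne', rG]; field_simp
  have alg := bellman_algebra (P := P) (Q := Q) (θ := θ) (K := K) (c := q * (q - 1)) (a := a) (b := b)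
    (ζ := z.1) (η := z.2) (α := α) (β := β) (A := α ^ P) (B := β ^ Q) (G := G) (M := β ^ Q / β) (H := H)
    (by rw [hP]; linarith) (by rw [hQ]; linarith) (by positivity) hθ0 hθ1 hPθ (by rw [hQ]; ring) hc0
    hK0 hK hα0 hβ0 (by linarith) (by linarith) hA0 hB0 hGe (by field_simp) hH0 hαH
  have hfin : H * a ^ 2 + H⁻¹ * b ^ 2 ≤ H * a ^ 2 + β ^ Q / β * b ^ 2 :=
    add_le_add_right (mul_le_mul_of_nonneg_right hMH (sq_nonneg b)) _
  refine hfin.trans (alg.trans (le_of_eq ?_))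
  simp only [Pi.add_apply, Pi.mul_apply, zero_mul, add_zero]
  rw [← hα, ← hβ, ← hGe, rA, rA2, rB, rB2, rG, rG2, ← hH]
  ring

theorem bell_zero_le {p q K ε : ℝ} (hp : 2 ≤ p) (hq : 0 < q) (hK : 0 ≤ K) (hε : 0 < ε) (z : ℝ × ℝ) :
    bell p q K ε 0 ≤ bell p q K ε z := by
  have h1 : bellG p q ε 0 ≤ bellG p q ε z := by
    refine add_le_add (Real.rpow_le_rpow ?_ ?_ (by linarith)) (Real.rpow_le_rpow ?_ ?_ (by linarith))
    all_goals simp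
    all_goals positivity
  have hθ : 0 ≤ 1 - 2 / p := by
    rw [sub_nonneg, div_le_one (by linarith)]; exact hp
  refine add_le_add (mul_le_mul_of_nonneg_left h1 hK) (mul_le_mul ?_
    (Real.rpow_le_rpow (bellG_pos hε 0).le h1 hθ) (Real.rpow_nonneg (bellG_pos hε 0).le _) (by positivity))
  simp; positivity

theorem bell_le {p q K ε : ℝ} (hp : 2 ≤ p) (hε : 0 < ε) (z : ℝ × ℝ) :
    bell p q K ε z ≤ (K + 1) * bellG p q ε z := by
  have hp0 : 0 < p := by linarith
  have hG := bellG_pos (p := p) (q := q) hε z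
  have h1 : z.1 ^ 2 + ε ≤ bellG p q ε z ^ (2 / p) := by
    calc z.1 ^ 2 + ε = ((z.1 ^ 2 + ε) ^ (p / 2)) ^ (2 / p) := by
          rw [← Real.rpow_mul (by positivity)]; field_simp; simp
      _ ≤ _ := Real.rpow_le_rpow (by positivity)
          (le_add_of_nonneg_right (Real.rpow_nonneg (by positivity) _)) (by positivity)
  have h2 : (z.1 ^ 2 + ε) * bellG p q ε z ^ (1 - 2 / p) ≤ bellG p q ε z := by
    calc _ ≤ bellG p q ε z ^ (2 / p) * bellG p q ε z ^ (1 - 2 / p) :=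
          mul_le_mul_of_nonneg_right h1 (Real.rpow_nonneg hG.le _)
      _ = _ := by rw [← Real.rpow_add hG]; simp
  unfold bell
  linarith

end Bellman

section BilinearEmbedding

/-- Smooth functions of two variables with the convexity needed for bilinear embeddings. -/
structure IsBellman (b : ℝ × ℝ → ℝ) : Prop where
  smooth : ContDiff ℝ (⊤ : ℕ∞) b
  zero : b 0 = 0
  nonneg : ∀ z, 0 ≤ b z
  convex : ∀ z, ∃ τ, 0 < τ ∧ ∀ v : ℝ × ℝ,
    τ * v.1 ^ 2 + τ⁻¹ * v.2 ^ 2 ≤ fderiv ℝ (fderiv ℝ b) z v v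

theorem fderiv_fderiv_eq_dirD {V : Type*} [NormedAddCommGroup V] [NormedSpace ℝ V] {b : V → ℝ}
    (hb : ContDiff ℝ (⊤ : ℕ∞) b) (z v : V) :
    fderiv ℝ (fderiv ℝ b) z v v = dirD v (dirD v b) z := by
  have h := fderiv_fderiv_eq_of_line hb (z := z) (v := v)
    (fun t => hasDerivAt_line (hb.differentiable (by simp) _))
    (hasDerivAt_line ((hb.dirD v).differentiable (by simp) _))
  simpa using h

theorem IsBellman.swap {b : ℝ × ℝ → ℝ} (hb : IsBellman b) : IsBellman fun z => b (z.2, z.1) := by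
  have hs : ContDiff ℝ (⊤ : ℕ∞) fun z : ℝ × ℝ => b (z.2, z.1) := hb.smooth.comp (by fun_prop)
  refine ⟨hs, hb.zero, fun z => hb.nonneg _, fun z => ?_⟩
  obtain ⟨τ, hτ, h⟩ := hb.convex (z.2, z.1)
  refine ⟨τ⁻¹, inv_pos.2 hτ, fun v => ?_⟩
  have e : fderiv ℝ (fderiv ℝ fun z : ℝ × ℝ => b (z.2, z.1)) z v v =
      fderiv ℝ (fderiv ℝ b) (z.2, z.1) (v.2, v.1) (v.2, v.1) := by
    rw [fderiv_fderiv_eq_dirD hb.smooth]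
    have h2 := hasDerivAt_line (f := dirD (v.2, v.1) b) (x := (z.2, z.1)) (v := (v.2, v.1))
      (t := 0) ((hb.smooth.dirD _).differentiable (by simp) _)
    rw [zero_smul, add_zero] at h2
    refine fderiv_fderiv_eq_of_line hs (fun t => ?_) h2
    exact hasDerivAt_line (f := b) (x := (z.2, z.1)) (v := (v.2, v.1)) (t := t)
      (hb.smooth.differentiable (by simp) _)
  rw [e, inv_inv]
  linarith [h (v.2, v.1)]

theorem isBellman_bell {p q K ε : ℝ} (hp : 2 ≤ p) (hpq : p.HolderConjugate q) (hε : 0 < ε)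
    (hK : 21 ≤ K * (q * (q - 1))) (hK0 : 0 ≤ K) :
    IsBellman fun z => bell p q K ε z - bell p q K ε 0 := by
  refine ⟨(contDiff_bell hε).sub contDiff_const, sub_self _, fun z => sub_nonneg.2
    (bell_zero_le hp hpq.symm.pos hK0 hε z), fun z => ?_⟩
  obtain ⟨τ, hτ, h⟩ := bell_hessian hp hpq hε hK z
  refine ⟨τ, hτ, fun v => ?_⟩
  have : fderiv ℝ (fun z => bell p q K ε z - bell p q K ε 0) = fderiv ℝ (bell p q K ε) := by
    funext z
    rw [fderiv_sub_const]
  rw [this]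
  exact h v

variable {ι : Type*} [Fintype ι]
variable {V : Type*} [NormedAddCommGroup V] [NormedSpace ℝ V] [FiniteDimensional ℝ V]
variable [MeasurableSpace V] [BorelSpace V] (μ : Measure V) [μ.IsAddHaarMeasure]

theorem integrable_heat_mul (e : ι → V) (σ : ℝ) {f g : V → ℝ} (hf : IsTest f) (hg : IsTest g) :
    Integrable (fun x => heat e σ f x * heat e σ g x) μ := by
  obtain ⟨C, -, hC⟩ := hg.exists_bound
  exact (integrable_heat μ e σ hf).mul_bdd (contDiff_heat e σ hg).continuous.aestronglyMeasurable
    (Filter.Eventually.of_forall fun x => abs_heat_le e σ hC x)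

theorem continuous_heat2 (e : ι → V) {f g : V → ℝ} (hf : IsTest f) (hg : IsTest g) :
    Continuous (heat2 e f g) := (continuous_heat e hf).prodMk (continuous_heat e hg)

theorem integrable_hessian_heat2 (e : ι → V) {b : ℝ × ℝ → ℝ} (hb : ContDiff ℝ (⊤ : ℕ∞) b)
    {f g f' g' : V → ℝ} (hf : IsTest f) (hg : IsTest g) (hf' : IsTest f') (hg' : IsTest g') (σ : ℝ) :
    Integrable (fun x => fderiv ℝ (fderiv ℝ b) (heat2 e f g (σ, x))
      (heat2 e f' g' (σ, x)) (heat2 e f' g' (σ, x))) μ := by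
  obtain ⟨Cf, hCf0, hCf⟩ := hf.exists_bound
  obtain ⟨Cg, hCg0, hCg⟩ := hg.exists_bound
  obtain ⟨A1, hA1, hA1'⟩ := hf'.exists_bound
  obtain ⟨A2, hA2, hA2'⟩ := hg'.exists_bound
  have hbs : ContDiff ℝ (⊤ : ℕ∞) (fderiv ℝ b) := hb.fderiv_right (m := (⊤ : ℕ∞)) (by simp)
  have hcb2 : Continuous (fderiv ℝ (fderiv ℝ b)) := hbs.continuous_fderiv (by simp)
  obtain ⟨C2, hC2⟩ := (isCompact_closedBall (0 : ℝ × ℝ) (max Cf Cg)).exists_bound_of_continuousOn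
    (f := fderiv ℝ (fderiv ℝ b)) hcb2.continuousOn
  have hU : ∀ q, heat2 e f g q ∈ Metric.closedBall (0 : ℝ × ℝ) (max Cf Cg) := by
    intro q
    rw [mem_closedBall_zero_iff]
    exact max_le_max (abs_heat_le e q.1 hCf q.2) (abs_heat_le e q.1 hCg q.2)
  have hC2' : 0 ≤ C2 := (norm_nonneg _).trans (hC2 _ (hU (0, 0)))
  have hc' : ∀ {f g : V → ℝ}, IsTest f → IsTest g → Continuous fun x => heat2 e f g (σ, x) :=
    fun hf hg => (continuous_heat2 e hf hg).comp (by fun_prop)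
  have hnorm : ∀ x, ‖heat2 e f' g' (σ, x)‖ ≤ |heat e σ f' x| + |heat e σ g' x| :=
    fun q => max_le_add_of_nonneg (abs_nonneg _) (abs_nonneg _)
  refine ((((integrable_heat μ e σ hf').abs.add (integrable_heat μ e σ hg').abs)).const_mul
    (C2 * (A1 + A2))).mono' ?_ (Filter.Eventually.of_forall fun x => ?_)
  · exact (((hcb2.comp (hc' hf hg)).clm_apply (hc' hf' hg')).clm_apply (hc' hf' hg')).aestronglyMeasurable
  · refine (ContinuousLinearMap.le_opNorm _ _).trans ?_
    refine mul_le_mul ((ContinuousLinearMap.le_opNorm _ _).trans ?_) (hnorm x)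
      (norm_nonneg _) (by positivity)
    refine mul_le_mul (hC2 _ (hU _)) ((hnorm x).trans ?_) (norm_nonneg _) hC2'
    exact add_le_add (abs_heat_le e σ hA1' x) (abs_heat_le e σ hA2' x)

theorem integrable_strip_heat_mul (e : ι → V) {f g : V → ℝ} (hf : IsTest f) (hg : IsTest g)
    {T : ℝ} (hT : 0 ≤ T) :
    IntervalIntegrable (fun σ => σ * ∫ x, |heat e σ f x * heat e σ g x| ∂μ) volume 0 T := by
  rw [intervalIntegrable_iff_integrableOn_Ioc_of_le hT]
  obtain ⟨C, hC0, hC⟩ := hg.exists_bound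
  have hc1 := continuous_heat e hf
  have hc2 := continuous_heat e hg
  have := (integrable_strip μ (Q := fun q : ℝ × V => q.1 * |heat e q.1 f q.2 * heat e q.1 g q.2|)
    (T := T) (C := T * ((∫ x, |f x| ∂μ) * C))
    (by fun_prop) (fun σ => (integrable_heat_mul μ e σ hf hg).abs.const_mul σ) ?_).integral_prod_left
  · simp only [integral_const_mul] at this
    exact this
  · intro σ hσ
    simp only [abs_mul, abs_abs, abs_of_pos hσ.1]
    rw [integral_const_mul]
    refine mul_le_mul hσ.2 ?_ (integral_nonneg fun _ => by positivity) hT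
    calc ∫ x, |heat e σ f x| * |heat e σ g x| ∂μ ≤ ∫ x, |heat e σ f x| * C ∂μ := by
          refine integral_mono ?_ ((integrable_heat μ e σ hf).abs.mul_const C) fun x =>
            mul_le_mul_of_nonneg_left (abs_heat_le e σ hC x) (abs_nonneg _)
          simpa only [abs_mul] using (integrable_heat_mul μ e σ hf hg).abs
      _ ≤ _ := by
          rw [integral_mul_const]
          exact mul_le_mul_of_nonneg_right (integral_abs_heat_le μ e σ hf) hC0

theorem bilinear_embedding (e : ι → V) {b : ℝ × ℝ → ℝ} (hb : IsBellman b) {f g : V → ℝ}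
    (hf : IsTest f) (hg : IsTest g) {T : ℝ} (hT : 0 ≤ T) (k j : ι) :
    ∫ σ in 0..T, 2 * (σ * ∫ x, |heat e σ (dirD (e k) f) x * heat e σ (dirD (e j) g) x| ∂μ) ≤
      ∫ x, b (f x, g x) ∂μ := by
  obtain ⟨h1, h2⟩ := integral_heat_evolution μ e hb.smooth hb.zero hf hg hT
  have h3 : 0 ≤ ∫ x, b (heat2 e f g (T, x)) ∂μ := integral_nonneg fun _ => hb.nonneg _
  refine le_trans ?_ (h2.symm.le.trans (sub_le_self _ h3))
  refine intervalIntegral.integral_mono_on hT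
    ((integrable_strip_heat_mul μ e (hf.dirD _) (hg.dirD _) hT).const_mul 2) h1 fun σ hσ => ?_
  rw [mul_left_comm]
  refine mul_le_mul_of_nonneg_left ?_ hσ.1
  rw [← integral_const_mul]
  refine integral_mono ((integrable_heat_mul μ e σ (hf.dirD _) (hg.dirD _)).abs.const_mul 2)
    (integrable_finsetSum _ fun i _ =>
      integrable_hessian_heat2 μ e hb.smooth hf hg (hf.dirD _) (hg.dirD _) σ) fun x => ?_
  obtain ⟨τ, hτ, h⟩ := hb.convex (heat2 e f g (σ, x))
  set u : ι → ℝ := fun i => heat e σ (dirD (e i) f) x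
  set w : ι → ℝ := fun i => heat e σ (dirD (e i) g) x
  have h4 : ∑ i, (τ * u i ^ 2 + τ⁻¹ * w i ^ 2) ≤
      ∑ i, fderiv ℝ (fderiv ℝ b) (heat2 e f g (σ, x))
      (heat2 e (dirD (e i) f) (dirD (e i) g) (σ, x))
      (heat2 e (dirD (e i) f) (dirD (e i) g) (σ, x)) :=
    Finset.sum_le_sum fun i _ => h (heat2 e (dirD (e i) f) (dirD (e i) g) (σ, x))
  refine le_trans ?_ h4
  rw [Finset.sum_add_distrib]
  have h5 : τ * u k ^ 2 ≤ ∑ i, τ * u i ^ 2 :=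
    Finset.single_le_sum (f := fun i => τ * u i ^ 2) (fun i _ => by positivity) (Finset.mem_univ k)
  have h6 : τ⁻¹ * w j ^ 2 ≤ ∑ i, τ⁻¹ * w i ^ 2 :=
    Finset.single_le_sum (f := fun i => τ⁻¹ * w i ^ 2) (fun i _ => by positivity) (Finset.mem_univ j)
  refine le_trans ?_ (add_le_add h5 h6)
  change 2 * |u k * w j| ≤ _
  rw [abs_mul, ← sq_abs (u k), ← sq_abs (w j)]
  have e1 : τ * |u k| ^ 2 + τ⁻¹ * |w j| ^ 2 - 2 * (|u k| * |w j|) = τ * (|u k| - τ⁻¹ * |w j|) ^ 2 := by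
    field_simp
    ring
  have : 0 ≤ τ * (|u k| - τ⁻¹ * |w j|) ^ 2 := by positivity
  linarith

theorem fderiv_fderiv_mul_apply (z v : ℝ × ℝ) :
    fderiv ℝ (fderiv ℝ fun z : ℝ × ℝ => z.1 * z.2) z v v = 2 * (v.1 * v.2) := by
  have h1 : ∀ (a c t : ℝ), HasDerivAt (fun t : ℝ => a + t * c) c t := fun a c t => by
    simpa using ((hasDerivAt_id t).mul_const c).const_add a
  refine fderiv_fderiv_eq_of_line (by fun_prop)
    (φ1 := fun t => v.1 * (z.2 + t * v.2) + (z.1 + t * v.1) * v.2) (fun t => ?_) ?_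
  · exact (h1 z.1 v.1 t).mul (h1 z.2 v.2 t)
  · refine (((h1 z.2 v.2 0).const_mul v.1).add ((h1 z.1 v.1 0).mul_const v.2)).congr_deriv ?_
    ring

theorem abs_integral_pairing_le (e : ι → V) {b : ℝ × ℝ → ℝ} (hb : IsBellman b) {W g : V → ℝ}
    {F : ι → V → ℝ} (hW : IsTest W) (hg : IsTest g) (hF : ∀ k, IsTest (F k))
    (hL : sumSq e W = fun x => ∑ k, dirD (e k) (F k) x) (j : ι) :
    |∫ x, W x * dirD (e j) g x ∂μ| ≤ ∑ k, ∫ x, b (F k x, g x) ∂μ := by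
  have hg' := hg.dirD (e j)
  obtain ⟨C, hC⟩ := exists_abs_heat_dirD_le e hg j
  have key : ∀ T : ℝ, 0 < T → |∫ x, W x * dirD (e j) g x ∂μ| ≤
      (∑ k, ∫ x, b (F k x, g x) ∂μ) + (∫ x, |W x| ∂μ) * (C / T) := by
    intro T hT
    obtain ⟨-, h2⟩ := integral_heat_evolution μ e (b := fun z => z.1 * z.2) (by fun_prop) (by simp)
      hW hg' hT.le
    simp only [fderiv_fderiv_mul_apply] at h2
    simp only [heat2] at h2
    have hC0 : 0 ≤ C / T := (abs_nonneg _).trans (hC T 0 hT)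
    have hlast : |∫ x, heat e T W x * heat e T (dirD (e j) g) x ∂μ| ≤ (∫ x, |W x| ∂μ) * (C / T) := by
      refine (abs_integral_le_integral_abs).trans ?_
      calc _ ≤ ∫ x, |heat e T W x| * (C / T) ∂μ := by
            refine integral_mono (integrable_heat_mul μ e T hW hg').abs
              ((integrable_heat μ e T hW).abs.mul_const _) fun x => ?_
            rw [abs_mul]
            exact mul_le_mul_of_nonneg_left (hC T x hT) (abs_nonneg _)
        _ ≤ _ := by
            rw [integral_mul_const]
            exact mul_le_mul_of_nonneg_right (integral_abs_heat_le μ e T hW) hC0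
    have hsp : ∀ σ, ∫ x, ∑ i, 2 * (heat e σ (dirD (e i) W) x *
        heat e σ (dirD (e i) (dirD (e j) g)) x) ∂μ =
        -∑ k, 2 * ∫ x, heat e σ (dirD (e k) (F k)) x * heat e σ (dirD (e j) g) x ∂μ := by
      intro σ
      have h3 : ∀ i, ∫ x, 2 * (heat e σ (dirD (e i) W) x *
          heat e σ (dirD (e i) (dirD (e j) g)) x) ∂μ =
          -(2 * ∫ x, heat e σ (dirD (e i) (dirD (e i) W)) x * heat e σ (dirD (e j) g) x ∂μ) := by
        intro i
        rw [integral_const_mul]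
        have := integral_mul_dirD μ (f := heat e σ (dirD (e i) W)) (g := heat e σ (dirD (e j) g)) (e i)
          ((contDiff_heat e σ (hW.dirD _)).differentiable (by simp))
          ((contDiff_heat e σ hg').differentiable (by simp))
          (by rw [dirD_heat e σ (hW.dirD _)]
              exact integrable_heat_mul μ e σ ((hW.dirD _).dirD _) hg')
          (by rw [dirD_heat e σ hg']
              exact integrable_heat_mul μ e σ (hW.dirD _) (hg'.dirD _))
          (integrable_heat_mul μ e σ (hW.dirD _) hg')
        rw [dirD_heat e σ hg', dirD_heat e σ (hW.dirD _)] at this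
        rw [this]; ring
      rw [integral_finsetSum _ fun i _ =>
        (integrable_heat_mul μ e σ (hW.dirD _) (hg'.dirD _)).const_mul 2]
      simp only [h3]
      rw [Finset.sum_neg_distrib]
      congr 1
      rw [← Finset.mul_sum, ← Finset.mul_sum]
      congr 1
      rw [← integral_finsetSum _ fun i _ => integrable_heat_mul μ e σ ((hW.dirD _).dirD _) hg',
        ← integral_finsetSum _ fun i _ => integrable_heat_mul μ e σ ((hF i).dirD _) hg']
      congr 1
      funext x
      rw [← Finset.sum_mul, ← Finset.sum_mul]
      congr 1
      have e1 := congrFun (heat_sum e σ Finset.univ (f := fun i => dirD (e i) (dirD (e i) W))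
        fun i _ => (hW.dirD _).dirD _) x
      have e2 := congrFun (heat_sum e σ Finset.univ (f := fun i => dirD (e i) (F i))
        fun i _ => (hF i).dirD _) x
      rw [← e1, ← e2, ← hL]
      rfl
    simp only [hsp] at h2
    have hI : |∫ σ in 0..T, σ * -∑ k, 2 * ∫ x, heat e σ (dirD (e k) (F k)) x *
        heat e σ (dirD (e j) g) x ∂μ| ≤ ∑ k, ∫ x, b (F k x, g x) ∂μ := by
      have hii : ∀ k, IntervalIntegrable (fun σ => 2 * (σ * ∫ x, |heat e σ (dirD (e k) (F k)) x *
          heat e σ (dirD (e j) g) x| ∂μ)) volume 0 T := fun k =>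
        (integrable_strip_heat_mul μ e ((hF k).dirD _) hg' hT.le).const_mul 2
      have hs : IntervalIntegrable (fun σ => ∑ k, 2 * (σ * ∫ x, |heat e σ (dirD (e k) (F k)) x *
          heat e σ (dirD (e j) g) x| ∂μ)) volume 0 T := by
        have := IntervalIntegrable.sum Finset.univ fun k _ => hii k
        simpa only [Finset.sum_fn] using this
      rw [← Real.norm_eq_abs]
      refine (intervalIntegral.norm_integral_le_of_norm_le hT.le
        (Filter.Eventually.of_forall fun σ hσ => ?_) hs).trans ?_
      · rw [norm_mul, norm_neg, Real.norm_of_nonneg hσ.1.le]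
        refine (mul_le_mul_of_nonneg_left (norm_sum_le _ _) hσ.1.le).trans ?_
        rw [Finset.mul_sum]
        refine Finset.sum_le_sum fun k _ => ?_
        rw [norm_mul, mul_left_comm, Real.norm_of_nonneg (by norm_num : (0:ℝ) ≤ 2)]
        gcongr
        · exact hσ.1.le
        exact abs_integral_le_integral_abs
      · rw [intervalIntegral.integral_finsetSum fun k _ => hii k]
        exact Finset.sum_le_sum fun k _ => bilinear_embedding μ e hb (hF k) hg hT.le k j
    rw [← h2] at hI
    have i1 := le_of_abs_le hI
    have i2 := le_of_abs_le hlast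
    have i3 := neg_le_of_abs_le hI
    have i4 := neg_le_of_abs_le hlast
    exact abs_le.2 ⟨by linarith, by linarith⟩
  have hlim : Filter.Tendsto (fun T : ℝ => (∑ k, ∫ x, b (F k x, g x) ∂μ) +
      (∫ x, |W x| ∂μ) * (C / T)) Filter.atTop (nhds ((∑ k, ∫ x, b (F k x, g x) ∂μ) +
      (∫ x, |W x| ∂μ) * 0)) :=
    ((tendsto_const_nhds.div_atTop Filter.tendsto_id).const_mul _).const_add _
  rw [mul_zero, add_zero] at hlim
  refine ge_of_tendsto hlim ?_
  filter_upwards [Filter.eventually_gt_atTop 0] with T hT using key T hT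

end BilinearEmbedding

section CalderonZygmund

theorem exists_isBellman {p q : ℝ} (hpq : p.HolderConjugate q) :
    ∃ C, 0 < C ∧ ∀ ε, 0 < ε → ∃ b, IsBellman b ∧ ∀ z, b z ≤ C * bellG p q ε z := by
  have main : ∀ {p q : ℝ}, p.HolderConjugate q → 2 ≤ p →
      ∃ C, 0 < C ∧ ∀ ε, 0 < ε → ∃ b, IsBellman b ∧ ∀ z, b z ≤ C * bellG p q ε z := by
    intro p q hpq hp
    have hq : 0 < q * (q - 1) := mul_pos hpq.symm.pos (by linarith [hpq.symm.lt])
    set K := 21 / (q * (q - 1)) with hK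
    have hK0 : 0 < K := by positivity
    refine ⟨K + 1, by positivity, fun ε hε => ⟨_, isBellman_bell hp hpq hε
      (by rw [hK, div_mul_cancel₀ _ hq.ne']) hK0.le, fun z => ?_⟩⟩
    have h1 := bell_le (q := q) (K := K) hp hε z
    have h0 : 0 ≤ bell p q K ε 0 := by
      have h2 := (bellG_pos (p := p) (q := q) hε 0).le
      unfold bell
      positivity
    linarith
  rcases le_total 2 p with hp | hp
  · exact main hpq hp
  · have hq : 2 ≤ q := by
      have h1 := hpq.inv_add_inv_eq_one
      have h2 : (1 / 2 : ℝ) ≤ p⁻¹ := by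
        rw [le_inv_comm₀ (by norm_num) hpq.pos]; simpa using hp
      have h3 : q⁻¹ ≤ 1 / 2 := by linarith
      rw [inv_le_comm₀ hpq.symm.pos (by norm_num)] at h3
      simpa using h3
    obtain ⟨C, hC, h⟩ := main hpq.symm hq
    refine ⟨C, hC, fun ε hε => ?_⟩
    obtain ⟨b, hb, hb'⟩ := h ε hε
    refine ⟨_, hb.swap, fun z => (hb' _).trans (le_of_eq ?_)⟩
    simp only [bellG]
    ring

variable {ι : Type*} [Fintype ι]
variable {V : Type*} [NormedAddCommGroup V] [NormedSpace ℝ V] [FiniteDimensional ℝ V]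
variable [MeasurableSpace V] [BorelSpace V] (μ : Measure V) [μ.IsAddHaarMeasure]

theorem abs_rpow_eq_sq_rpow {p : ℝ} (x : ℝ) : |x| ^ p = (x ^ 2) ^ (p / 2) := by
  rw [← sq_abs, ← Real.rpow_natCast, ← Real.rpow_mul (abs_nonneg _)]
  congr 1
  push_cast
  ring

theorem IsTest.continuous_abs_rpow {f : V → ℝ} (hf : IsTest f) {p : ℝ} (hp : 0 < p) :
    Continuous fun x => |f x| ^ p :=
  hf.continuous.abs.rpow_const fun _ => Or.inr hp.le

theorem IsTest.integrable_abs_rpow {f : V → ℝ} (hf : IsTest f) {p : ℝ} (hp : 0 < p) :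
    Integrable (fun x => |f x| ^ p) μ := by
  refine (hf.continuous_abs_rpow hp).integrable_of_hasCompactSupport (hf.2.mono' ?_)
  refine Function.support_subset_iff'.2 fun x hx => ?_
  rw [image_eq_zero_of_notMem_tsupport hx, abs_zero, Real.zero_rpow hp.ne']

theorem exists_integral_pairing_bound {p q : ℝ} (hpq : p.HolderConjugate q) :
    ∃ C, 0 < C ∧ ∀ (e : ι → V) {W g : V → ℝ} {F : ι → V → ℝ}, IsTest W → IsTest g →
      (∀ k, IsTest (F k)) → sumSq e W = (fun x => ∑ k, dirD (e k) (F k) x) → ∀ j,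
      |∫ x, W x * dirD (e j) g x ∂μ| ≤
        C * ∑ k, ((∫ x, |F k x| ^ p ∂μ) + ∫ x, |g x| ^ q ∂μ) := by
  obtain ⟨C, hC, hb⟩ := exists_isBellman hpq
  refine ⟨C, hC, fun e W g F hW hg hF hL j => ?_⟩
  set S : ι → Set V := fun k => tsupport (F k) ∪ tsupport g with hS
  have hSc : ∀ k, IsCompact (S k) := fun k => (hF k).2.isCompact.union hg.2.isCompact
  have hout : ∀ k x, x ∉ S k → F k x = 0 ∧ g x = 0 := fun k x hx => by
    simp only [hS, Set.mem_union, not_or] at hx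
    exact ⟨image_eq_zero_of_notMem_tsupport hx.1, image_eq_zero_of_notMem_tsupport hx.2⟩
  set J : ι → ℝ → ℝ := fun k ε => ∫ x in S k, bellG p q ε (F k x, g x) ∂μ with hJ
  have hcont : ∀ k, Continuous fun y : ℝ × V => bellG p q y.1 (F k y.2, g y.2) := by
    intro k
    have h1 := (hF k).continuous
    have h2 := hg.continuous
    unfold bellG
    exact ((by fun_prop : Continuous fun y : ℝ × V => (F k y.2) ^ 2 + y.1).rpow_const
        fun _ => Or.inr (by linarith [hpq.pos])).add
      ((by fun_prop : Continuous fun y : ℝ × V => (g y.2) ^ 2 + y.1).rpow_const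
        fun _ => Or.inr (by linarith [hpq.symm.pos]))
  have hJc : ∀ k, Continuous (J k) := fun k =>
    continuous_parametric_integral_of_continuous (hcont k) (hSc k)
  have hJ0 : ∀ k, J k 0 = (∫ x, |F k x| ^ p ∂μ) + ∫ x, |g x| ^ q ∂μ := by
    intro k
    rw [hJ, ← integral_add ((hF k).integrable_abs_rpow μ hpq.pos) (hg.integrable_abs_rpow μ hpq.symm.pos)]
    simp only [bellG, add_zero, ← abs_rpow_eq_sq_rpow]
    refine setIntegral_eq_integral_of_forall_compl_eq_zero fun x hx => ?_
    rw [(hout k x hx).1, (hout k x hx).2, abs_zero, Real.zero_rpow hpq.pos.ne',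
      Real.zero_rpow hpq.symm.pos.ne', add_zero]
  have hε : ∀ ε, 0 < ε → |∫ x, W x * dirD (e j) g x ∂μ| ≤ C * ∑ k, J k ε := by
    intro ε hε
    obtain ⟨b, hb1, hb2⟩ := hb ε hε
    refine (abs_integral_pairing_le μ e hb1 hW hg hF hL j).trans ?_
    rw [Finset.mul_sum]
    refine Finset.sum_le_sum fun k _ => ?_
    rw [← setIntegral_eq_integral_of_forall_compl_eq_zero (s := S k) (fun x hx => by
      rw [(hout k x hx).1, (hout k x hx).2]; exact hb1.zero), hJ, ← integral_const_mul]
    have hbc : Continuous fun x => b (F k x, g x) :=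
      hb1.smooth.continuous.comp ((hF k).continuous.prodMk hg.continuous)
    refine setIntegral_mono (hbc.continuousOn.integrableOn_compact (hSc k))
      (Continuous.continuousOn ?_ |>.integrableOn_compact (hSc k)) fun x => hb2 _
    exact ((hcont k).comp (by fun_prop : Continuous fun x : V => (ε, x))).const_mul _
  simp only [← hJ0]
  have hlim : Filter.Tendsto (fun ε => C * ∑ k, J k ε) (nhdsWithin 0 (Set.Ioi 0))
      (nhds (C * ∑ k, J k 0)) :=
    ((continuous_const.mul (continuous_finsetSum _ fun k _ => hJc k)).tendsto 0).mono_left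
      nhdsWithin_le_nhds
  exact ge_of_tendsto hlim (by filter_upwards [self_mem_nhdsWithin] with ε h using hε ε h)

theorem mul_rpow_tendsto {p : ℝ} (v : ℝ) :
    Filter.Tendsto (fun ε : ℝ => v * (v ^ 2 + ε) ^ ((p - 2) / 2)) (nhdsWithin 0 (Set.Ioi 0))
      (nhds (v * |v| ^ (p - 2))) := by
  rcases eq_or_ne v 0 with rfl | hv
  · simp
  · have hv2 : 0 < v ^ 2 := by positivity
    have : ContinuousAt (fun ε : ℝ => v * (v ^ 2 + ε) ^ ((p - 2) / 2)) 0 := by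
      refine continuousAt_const.mul (ContinuousAt.rpow_const (by fun_prop) (Or.inl ?_))
      simpa using hv
    have h := this.tendsto
    rw [add_zero, ← abs_rpow_eq_sq_rpow] at h
    exact h.mono_left nhdsWithin_le_nhds

theorem abs_mul_rpow_le {p : ℝ} (hp : 1 < p) {ε : ℝ} (hε : 0 < ε) (hε1 : ε ≤ 1) (v : ℝ) :
    |v * (v ^ 2 + ε) ^ ((p - 2) / 2)| ≤ (v ^ 2 + 1) ^ ((p - 1) / 2) := by
  have h1 : 0 < v ^ 2 + ε := by positivity
  have h2 : |v| ≤ (v ^ 2 + ε) ^ (1 / 2 : ℝ) := by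
    rw [← Real.sqrt_eq_rpow]
    exact Real.abs_le_sqrt (by linarith)
  rw [abs_mul, abs_of_nonneg (Real.rpow_nonneg h1.le _)]
  calc _ ≤ (v ^ 2 + ε) ^ (1 / 2 : ℝ) * (v ^ 2 + ε) ^ ((p - 2) / 2) :=
        mul_le_mul_of_nonneg_right h2 (Real.rpow_nonneg h1.le _)
    _ = (v ^ 2 + ε) ^ ((p - 1) / 2) := by
        rw [← Real.rpow_add h1]; congr 1; ring
    _ ≤ _ := Real.rpow_le_rpow h1.le (by linarith) (by linarith)

theorem exists_integral_dirD_rpow_le {p : ℝ} (hp : 1 < p) :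
    ∃ C, 0 < C ∧ ∀ (e : ι → V) {W : V → ℝ} {F : ι → V → ℝ}, IsTest W →
      (∀ k, IsTest (F k)) → sumSq e W = (fun x => ∑ k, dirD (e k) (F k) x) → ∀ j,
      ∫ x, |dirD (e j) W x| ^ p ∂μ ≤ C * ∑ k, ∫ x, |F k x| ^ p ∂μ := by
  obtain ⟨q, hpq⟩ : ∃ q, p.HolderConjugate q := ⟨_, Real.HolderConjugate.conjExponent hp⟩
  obtain ⟨C, hC, hb⟩ := exists_integral_pairing_bound (ι := ι) μ hpq
  set N : ℝ := Fintype.card ι + 1 with hN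
  have hN0 : 0 < N := by positivity
  have hq1 : 0 < q - 1 := by linarith [hpq.symm.lt]
  set m : ℝ := (2 * C * N) ^ (-(1 / (q - 1))) with hm
  have hm0 : 0 < m := Real.rpow_pos_of_pos (by positivity) _
  have hmq : C * N * m ^ q = m / 2 := by
    have h1 : m ^ (q - 1) = (2 * C * N)⁻¹ := by
      rw [hm, ← Real.rpow_mul (by positivity)]
      rw [show -(1 / (q - 1)) * (q - 1) = -1 by field_simp, Real.rpow_neg_one]
    have h2 : m ^ q = m ^ (q - 1) * m := by
      rw [← Real.rpow_add_one hm0.ne']; ring_nf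
    rw [h2, h1]; field_simp
  refine ⟨2 * C / m, by positivity, fun e W F hW hF hL j => ?_⟩
  set v := dirD (e j) W with hv
  have hvt : IsTest v := hW.dirD _
  set A := ∑ k, ∫ x, |F k x| ^ p ∂μ
  set I := ∫ x, |v x| ^ p ∂μ with hI
  have hI0 : 0 ≤ I := integral_nonneg fun _ => by positivity
  set g : ℝ → V → ℝ := fun ε x => v x * (v x ^ 2 + ε) ^ ((p - 2) / 2) with hg
  have hgt : ∀ ε, 0 < ε → IsTest (g ε) := by
    intro ε hε
    have h1 : ContDiff ℝ (⊤ : ℕ∞) fun x => (v x ^ 2 + ε) ^ ((p - 2) / 2) :=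
      ((hvt.1.pow 2).add contDiff_const).rpow_const_of_ne fun x => by positivity
    refine ⟨hvt.1.mul h1, hvt.2.mul_right⟩
  have hgc : ∀ ε, 0 < ε → Continuous (g ε) := fun ε hε => (hgt ε hε).continuous
  -- the inequality before passing to the limit
  have key : ∀ ε, 0 < ε → m * ∫ x, v x * g ε x ∂μ ≤ C * A + C * N * m ^ q * ∫ x, |g ε x| ^ q ∂μ := by
    intro ε hε
    have h1 := hb e hW ((hgt ε hε).const_mul m) hF hL j
    rw [dirD_const_mul _ _ (hgt ε hε).differentiable] at h1
    have h2 : ∫ x, W x * (m * dirD (e j) (g ε) x) ∂μ = -(m * ∫ x, v x * g ε x ∂μ) := by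
      have h3 := integral_mul_dirD μ (e j) hW.differentiable (hgt ε hε).differentiable
        ((IsTest.mul_left hvt.1 (hgt ε hε)).integrable μ)
        ((IsTest.mul_left hW.1 ((hgt ε hε).dirD _)).integrable μ)
        ((IsTest.mul_left hW.1 (hgt ε hε)).integrable μ)
      simp only [mul_left_comm _ m]
      rw [integral_const_mul, h3]
      ring
    rw [h2, abs_neg] at h1
    refine (le_abs_self _).trans (h1.trans ?_)
    have h4 : ∫ x, |m * g ε x| ^ q ∂μ = m ^ q * ∫ x, |g ε x| ^ q ∂μ := by
      rw [← integral_const_mul]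
      congr 1; funext x
      rw [abs_mul, abs_of_pos hm0, Real.mul_rpow hm0.le (abs_nonneg _)]
    have h5 : 0 ≤ C * (m ^ q * ∫ x, |g ε x| ^ q ∂μ) :=
      mul_nonneg hC.le (mul_nonneg (by positivity) (integral_nonneg fun _ => by positivity))
    rw [Finset.sum_add_distrib, h4, Finset.sum_const, Finset.card_univ, nsmul_eq_mul, hN]
    linarith
  -- limits
  have hbd : ∀ ε, 0 < ε → ε ≤ 1 → ∀ x, |g ε x| ≤
      (tsupport v).indicator (fun x => (v x ^ 2 + 1) ^ ((p - 1) / 2)) x := by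
    intro ε h0 h1 x
    by_cases hx : x ∈ tsupport v
    · rw [Set.indicator_of_mem hx]; exact abs_mul_rpow_le hp h0 h1 _
    · rw [Set.indicator_of_notMem hx]
      simp [hg, image_eq_zero_of_notMem_tsupport hx]
  obtain ⟨B, hB0, hB⟩ := hvt.exists_bound
  set D := (B ^ 2 + 1) ^ ((p - 1) / 2) with hD
  have hD0 : 0 ≤ D := by positivity
  have hbd' : ∀ ε, 0 < ε → ε ≤ 1 → ∀ x, |g ε x| ≤ (tsupport v).indicator (fun _ => D) x := by
    intro ε h0 h1 x
    refine (hbd ε h0 h1 x).trans (Set.indicator_le_indicator ?_)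
    refine Real.rpow_le_rpow (by positivity) ?_ (by linarith)
    have := sq_le_sq' (by linarith [neg_le_of_abs_le (hB x)]) (le_of_abs_le (hB x))
    linarith
  have hindi : ∀ c : ℝ, Integrable ((tsupport v).indicator fun _ => c) μ := fun c =>
    (integrable_indicator_iff (isClosed_tsupport v).measurableSet).2
      (integrableOn_const hvt.2.isCompact.measure_lt_top.ne)
  have hev : ∀ᶠ ε in nhdsWithin (0 : ℝ) (Set.Ioi 0), 0 < ε ∧ ε ≤ 1 := by
    have := Ioc_mem_nhdsGT (zero_lt_one' ℝ)
    filter_upwards [this] with ε h using h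
  have hp1 : ∀ x : ℝ, |x * |x| ^ (p - 2)| = |x| ^ (p - 1) := by
    intro x
    rw [abs_mul, abs_of_nonneg (Real.rpow_nonneg (abs_nonneg x) _)]
    rcases eq_or_ne x 0 with rfl | hx
    · simp [Real.zero_rpow (by linarith : p - 1 ≠ 0)]
    · rw [mul_comm, ← Real.rpow_add_one (abs_ne_zero.2 hx)]; ring_nf
  have lim1 : Filter.Tendsto (fun ε => ∫ x, v x * g ε x ∂μ) (nhdsWithin 0 (Set.Ioi 0)) (nhds I) := by
    refine tendsto_integral_filter_of_dominated_convergence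
      (fun x => B * (tsupport v).indicator (fun _ => D) x) ?_ ?_ ((hindi D).const_mul B) ?_
    · filter_upwards [hev] with ε h
      exact (hvt.continuous.mul (hgc ε h.1)).aestronglyMeasurable
    · filter_upwards [hev] with ε h
      refine Filter.Eventually.of_forall fun x => ?_
      rw [norm_mul]
      exact mul_le_mul (hB x) (hbd' ε h.1 h.2 x) (abs_nonneg _) hB0
    · refine Filter.Eventually.of_forall fun x => ?_
      have := (mul_rpow_tendsto (p := p) (v x)).const_mul (v x)
      convert this using 2
      rw [← mul_assoc, ← abs_mul_abs_self, mul_assoc]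
      rcases eq_or_ne (v x) 0 with h0 | h0
      · simp [h0, Real.zero_rpow (by linarith : p ≠ 0)]
      · rw [mul_comm (|v x|) (|v x| ^ (p - 2)), ← Real.rpow_add_one (abs_ne_zero.2 h0), mul_comm,
          ← Real.rpow_add_one (abs_ne_zero.2 h0)]
        ring_nf
  have lim2 : Filter.Tendsto (fun ε => ∫ x, |g ε x| ^ q ∂μ) (nhdsWithin 0 (Set.Ioi 0)) (nhds I) := by
    refine tendsto_integral_filter_of_dominated_convergence
      (fun x => (tsupport v).indicator (fun _ => D ^ q) x) ?_ ?_ (hindi (D ^ q)) ?_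
    · filter_upwards [hev] with ε h
      exact ((hgt ε h.1).continuous_abs_rpow hpq.symm.pos).aestronglyMeasurable
    · filter_upwards [hev] with ε h
      refine Filter.Eventually.of_forall fun x => ?_
      rw [Real.norm_of_nonneg (by positivity)]
      refine (Real.rpow_le_rpow (abs_nonneg _) (hbd' ε h.1 h.2 x) hpq.symm.nonneg).trans (le_of_eq ?_)
      by_cases hx : x ∈ tsupport v
      · simp [hx]
      · simp [hx, Real.zero_rpow hpq.symm.pos.ne']
    · refine Filter.Eventually.of_forall fun x => ?_
      have := ((mul_rpow_tendsto (p := p) (v x)).abs.rpow_const (p := q) (Or.inr hpq.symm.nonneg))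
      rw [hp1, ← Real.rpow_mul (abs_nonneg _), hpq.sub_one_mul_conj] at this
      exact this
  have hfin : m * I ≤ C * A + C * N * m ^ q * I :=
    le_of_tendsto_of_tendsto (lim1.const_mul m) ((lim2.const_mul _).const_add _)
      (by filter_upwards [hev] with ε h using key ε h.1)
  rw [hmq] at hfin
  rw [div_mul_eq_mul_div, le_div_iff₀ hm0]
  linarith

end CalderonZygmund

section DivergenceForm

variable {ι : Type*} [Fintype ι]
variable {V : Type*} [NormedAddCommGroup V] [NormedSpace ℝ V] [FiniteDimensional ℝ V]
variable [MeasurableSpace V] [BorelSpace V] (μ : Measure V) [μ.IsAddHaarMeasure]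

theorem lintegral_enorm_rpow_eq_ofReal {f : V → ℝ} (hf : IsTest f) {p : ℝ} (hp : 0 < p) :
    ∫⁻ x, ‖f x‖ₑ ^ p ∂μ = ENNReal.ofReal (∫ x, |f x| ^ p ∂μ) := by
  rw [ofReal_integral_eq_lintegral_ofReal (hf.integrable_abs_rpow μ hp)
    (Filter.Eventually.of_forall fun x => by positivity)]
  congr 1; funext x
  rw [Real.enorm_eq_ofReal_abs, ENNReal.ofReal_rpow_of_nonneg (abs_nonneg _) hp.le]

theorem IsTest.lintegral_rpow_lt_top {f : V → ℝ} (hf : IsTest f) {p : ℝ} (hp : 0 < p) :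
    ∫⁻ x, ‖f x‖ₑ ^ p ∂μ < ⊤ := by
  rw [lintegral_enorm_rpow_eq_ofReal μ hf hp]; exact ENNReal.ofReal_lt_top

theorem exists_lintegral_dirD_rpow_le {p : ℝ} (hp : 1 < p) :
    ∃ C : ℝ≥0, ∀ (e : ι → V) {W : V → ℝ} {F : ι → V → ℝ}, IsTest W →
      (∀ k, IsTest (F k)) → sumSq e W = (fun x => ∑ k, dirD (e k) (F k) x) → ∀ j,
      ∫⁻ x, ‖dirD (e j) W x‖ₑ ^ p ∂μ ≤ C * ∑ k, ∫⁻ x, ‖F k x‖ₑ ^ p ∂μ := by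
  obtain ⟨C, hC, h⟩ := exists_integral_dirD_rpow_le (ι := ι) μ hp
  refine ⟨C.toNNReal, fun e W F hW hF hL j => ?_⟩
  have hp0 : 0 < p := by linarith
  rw [lintegral_enorm_rpow_eq_ofReal μ (hW.dirD _) hp0]
  simp only [fun k => lintegral_enorm_rpow_eq_ofReal μ (hF k) hp0]
  rw [← ENNReal.ofReal_sum_of_nonneg fun k _ => integral_nonneg fun _ => by positivity]
  change _ ≤ ENNReal.ofReal C * _
  rw [← ENNReal.ofReal_mul hC.le]
  exact ENNReal.ofReal_le_ofReal (h e hW hF hL j)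

theorem enorm_add_rpow_le {p : ℝ} (hp : 1 ≤ p) (a b : ℝ) :
    ‖a + b‖ₑ ^ p ≤ 2 ^ (p - 1) * (‖a‖ₑ ^ p + ‖b‖ₑ ^ p) :=
  (ENNReal.rpow_le_rpow (enorm_add_le a b) (by linarith)).trans
    (ENNReal.rpow_add_le_mul_rpow_add_rpow _ _ hp)

theorem lintegral_add_rpow_le {α : Type*} [MeasurableSpace α] {μ : Measure α} {p : ℝ} (hp : 1 ≤ p)
    {f g : α → ℝ} (hf : AEMeasurable f μ) :
    ∫⁻ x, ‖f x + g x‖ₑ ^ p ∂μ ≤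
      2 ^ (p - 1) * ((∫⁻ x, ‖f x‖ₑ ^ p ∂μ) + ∫⁻ x, ‖g x‖ₑ ^ p ∂μ) := by
  rw [← lintegral_add_left' (hf.enorm.pow_const p),
    ← lintegral_const_mul' _ _ (ENNReal.rpow_ne_top_of_nonneg (by linarith) (by simp))]
  exact lintegral_mono fun x => enorm_add_rpow_le hp _ _

theorem lintegral_sub_translate_rpow_le {p : ℝ} (hp : 1 ≤ p) {f : V → ℝ} (hf : Continuous f) (a : V) :
    ∫⁻ x, ‖f x - f (x + a)‖ₑ ^ p ∂μ ≤ 2 ^ p * ∫⁻ x, ‖f x‖ₑ ^ p ∂μ := by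
  have h := lintegral_add_rpow_le (μ := μ) hp (g := fun x => -f (x + a)) hf.measurable.aemeasurable
  simp only [enorm_neg, ← sub_eq_add_neg] at h
  refine h.trans (le_of_eq ?_)
  rw [lintegral_add_right_eq_self (fun x => ‖f x‖ₑ ^ p) a, ← two_mul, ← mul_assoc]
  congr 1
  nth_rewrite 2 [← ENNReal.rpow_one 2]
  rw [← ENNReal.rpow_add _ _ (by simp) (by simp)]
  ring_nf

theorem sub_translate_eq_dirD_avg {G : V → ℝ} (hG : IsTest G) (a : V) {l : ℝ} (hl : 0 ≤ l) (x : V) :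
    G x - G (x + l • a) =
      dirD a (avg volume ((Set.Icc 0 l).indicator fun _ => (-1 : ℝ)) (fun s : ℝ => s • a) G) x := by
  have hψ : Integrable ((Set.Icc 0 l).indicator fun _ => (-1 : ℝ)) volume :=
    (integrable_indicator_iff measurableSet_Icc).2 (integrableOn_const (by simp))
  rw [dirD_avg hψ (by fun_prop) hG]
  have h1 : ∫ s in 0..l, dirD a G (x + s • a) = G (x + l • a) - G (x + (0 : ℝ) • a) :=
    intervalIntegral.integral_eq_sub_of_hasDerivAt
      (fun s _ => hasDerivAt_line (hG.differentiable _))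
      (((hG.dirD a).continuous.comp (by fun_prop)).intervalIntegrable _ _)
  rw [zero_smul, add_zero, intervalIntegral.integral_of_le hl, ← integral_Icc_eq_integral_Ioc] at h1
  rw [avg, ← neg_sub, ← h1, ← integral_neg, ← integral_indicator measurableSet_Icc]
  congr 1; funext s
  by_cases hs : s ∈ Set.Icc 0 l
  · simp [hs]
  · simp [hs]

theorem exists_lintegral_dirD_rpow_le_add {p : ℝ} (hp : 1 < p) :
    ∃ C : ℝ≥0, ∀ (e : ι → V) {W G : V → ℝ} {F : ι → V → ℝ}, IsTest W → IsTest G →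
      (∀ k, IsTest (F k)) → sumSq e W = (fun x => (∑ k, dirD (e k) (F k) x) + G x) →
      ∀ (i : ι) (l : ℝ), 0 ≤ l → (∀ z ∈ tsupport W, z + l • e i ∉ tsupport W) → ∀ j,
      ∫⁻ x, ‖dirD (e j) W x‖ₑ ^ p ∂μ ≤
        C * ((∑ k, ∫⁻ x, ‖F k x‖ₑ ^ p ∂μ) + ENNReal.ofReal l ^ p * ∫⁻ x, ‖G x‖ₑ ^ p ∂μ) := by
  classical
  obtain ⟨C, h⟩ := exists_lintegral_dirD_rpow_le (ι := ι) μ hp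
  refine ⟨C * 4 ^ p, fun e W G F hW hG hF hL i l hl hsupp j => ?_⟩
  set a := l • e i with ha
  set ψ : ℝ → ℝ := (Set.Icc 0 l).indicator fun _ => (-1 : ℝ) with hψd
  have hψ : Integrable ψ volume :=
    (integrable_indicator_iff measurableSet_Icc).2 (integrableOn_const (by simp))
  have hψc : HasCompactSupport ψ :=
    HasCompactSupport.intro isCompact_Icc fun s hs => Set.indicator_of_notMem hs _
  set J := avg volume ψ (fun s : ℝ => s • e i) G with hJ
  have hJt : IsTest J := ⟨contDiff_avg hψ (by fun_prop) hG,
    hasCompactSupport_avg (by fun_prop) hψc hG.2⟩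
  have hJn : ∫⁻ x, ‖J x‖ₑ ^ p ∂μ ≤ ENNReal.ofReal l ^ p * ∫⁻ x, ‖G x‖ₑ ^ p ∂μ := by
    refine (lintegral_avg_rpow_le μ hp.le hψ.1.aemeasurable (by fun_prop) hG.continuous).trans
      (le_of_eq ?_)
    congr 2
    have : ∀ s, ‖ψ s‖ₑ = (Set.Icc 0 l).indicator (fun _ => 1) s := fun s => by
      by_cases hs : s ∈ Set.Icc 0 l <;> simp [hψd, hs]
    simp only [this]
    rw [lintegral_indicator measurableSet_Icc]
    simp
  set F' : ι → V → ℝ := fun k x => (F k x - F k (x + a)) + (if k = i then J x else 0) with hF'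
  have hsub : ∀ k, IsTest fun x => F k x - F k (x + a) := fun k =>
    (hF k).sub ((hF k).comp_add_const a)
  have hite : ∀ k, IsTest fun x => if k = i then J x else 0 := fun k => by
    by_cases hk : k = i
    · simpa [hk] using hJt
    · simpa [hk] using IsTest.zero
  have hF't : ∀ k, IsTest (F' k) := fun k => (hsub k).add (hite k)
  have hWt : IsTest fun x => W x - W (x + a) := hW.sub (hW.comp_add_const a)
  have hL' : sumSq e (fun x => W x - W (x + a)) = fun x => ∑ k, dirD (e k) (F' k) x := by
    have h1 : sumSq e (fun x => W x - W (x + a)) = fun x => sumSq e W x - sumSq e W (x + a) := by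
      funext x
      simp only [sumSq, ← Finset.sum_sub_distrib]
      refine Finset.sum_congr rfl fun k _ => ?_
      rw [dirD_sub _ hW.differentiable (hW.comp_add_const a).differentiable, dirD_comp_add_const,
        dirD_sub _ (hW.dirD _).differentiable ((hW.dirD _).comp_add_const a).differentiable,
        dirD_comp_add_const]
    rw [h1, hL]
    funext x
    have h2 : ∀ k, dirD (e k) (F' k) x = (dirD (e k) (F k) x - dirD (e k) (F k) (x + a)) +
        (if k = i then dirD (e i) J x else 0) := by
      intro k
      rw [hF', dirD_add _ (hsub k).differentiable (hite k).differentiable,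
        dirD_sub _ (hF k).differentiable ((hF k).comp_add_const a).differentiable,
        dirD_comp_add_const]
      by_cases hk : k = i
      · subst hk; simp
      · simp [hk, dirD_const]
    simp only [h2]
    rw [Finset.sum_add_distrib, Finset.sum_sub_distrib, Finset.sum_ite_eq' Finset.univ i]
    simp only [Finset.mem_univ, if_true]
    rw [hJ, ← sub_translate_eq_dirD_avg hG (e i) hl]
    ring
  have hmain := h e hWt hF't hL' j
  have hleft : ∫⁻ x, ‖dirD (e j) W x‖ₑ ^ p ∂μ ≤
      ∫⁻ x, ‖dirD (e j) (fun x => W x - W (x + a)) x‖ₑ ^ p ∂μ := by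
    refine lintegral_mono fun x => ?_
    dsimp only
    rw [dirD_sub _ hW.differentiable (hW.comp_add_const a).differentiable, dirD_comp_add_const]
    beta_reduce
    have hz : ∀ y, y ∉ tsupport W → dirD (e j) W y = 0 := fun y hy => by
      rw [dirD, image_eq_zero_of_notMem_tsupport fun hy' => hy (tsupport_fderiv_subset ℝ hy')]
      simp
    by_cases hx : x ∈ tsupport W
    · rw [hz _ (hsupp x hx), sub_zero]
    · rw [hz x hx]; simp [ENNReal.zero_rpow_of_pos (by linarith : 0 < p)]
  have h4 : ((4 : ℝ≥0∞)) ^ p = 2 ^ p * 2 ^ p := by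
    rw [← ENNReal.mul_rpow_of_nonneg _ _ (by linarith)]; norm_num
  have h2p : (2 : ℝ≥0∞) ^ (p - 1) ≤ 2 ^ p := ENNReal.rpow_le_rpow_of_exponent_le (by simp) (by linarith)
  have h1p : (1 : ℝ≥0∞) ≤ 2 ^ p := ENNReal.one_le_rpow (by simp) (by linarith)
  have hFk : ∀ k, ∫⁻ x, ‖F' k x‖ₑ ^ p ∂μ ≤ 4 ^ p * ((∫⁻ x, ‖F k x‖ₑ ^ p ∂μ) +
      (if k = i then ENNReal.ofReal l ^ p * ∫⁻ x, ‖G x‖ₑ ^ p ∂μ else 0)) := by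
    intro k
    refine (lintegral_add_rpow_le hp.le (hsub k).continuous.measurable.aemeasurable).trans ?_
    rw [h4, mul_assoc]
    refine mul_le_mul' h2p ?_
    rw [mul_add]
    refine add_le_add (lintegral_sub_translate_rpow_le μ hp.le (hF k).continuous a) ?_
    by_cases hk : k = i
    · simp only [hk, if_true]
      exact hJn.trans (le_mul_of_one_le_left zero_le h1p)
    · simp [hk, ENNReal.zero_rpow_of_pos (by linarith : 0 < p)]
  refine hleft.trans (hmain.trans ?_)
  have hC4 : ((C * 4 ^ p : ℝ≥0) : ℝ≥0∞) = C * 4 ^ p := by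
    rw [ENNReal.coe_mul, ENNReal.coe_rpow_of_nonneg _ (by linarith)]; simp
  rw [hC4, mul_assoc]
  gcongr
  refine (Finset.sum_le_sum fun k _ => hFk k).trans (le_of_eq ?_)
  rw [← Finset.mul_sum, Finset.sum_add_distrib, Finset.sum_ite_eq' Finset.univ i]
  simp

end DivergenceForm

section Localization
variable {V : Type*} [NormedAddCommGroup V] [NormedSpace ℝ V]
variable {ι κ : Type*} [Fintype ι] [Fintype κ] [DecidableEq ι] [DecidableEq κ]

/-- The frame `∂_{u_i}` (`i ∈ ι`), `τ ∂_{u_k}` (`k ∈ κ`). -/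
def scaledFrame (u : ι ⊕ κ → V) (τ : ℝ) : ι ⊕ κ → V
  | Sum.inl j => u (Sum.inl j)
  | Sum.inr l => τ • u (Sum.inr l)

/-- Divergence-form part of the localized frozen equation. -/
noncomputable def locFlux (u : ι ⊕ κ → V) (τ : ℝ) (A χ w F : V → ℝ) (k : ι ⊕ κ) : ι ⊕ κ → V → ℝ
  | Sum.inl j => fun z => 2 * (dirD (u (Sum.inl j)) χ z * w z) -
      if k = Sum.inl j then χ z * F z else 0
  | Sum.inr l => fun z => τ⁻¹ * ((τ ^ 2 - A z) * (χ z * dirD (u (Sum.inr l)) w z)) -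
      if k = Sum.inr l then τ⁻¹ * (χ z * F z) else 0

/-- Zero-order part of the localized frozen equation. -/
noncomputable def locSource (u : ι ⊕ κ → V) (χ w F G : V → ℝ) (k : ι ⊕ κ) : V → ℝ :=
  fun z => dirD (u k) χ z * F z - χ z * G z -
    (∑ j, dirD (u (Sum.inl j)) (dirD (u (Sum.inl j)) χ) z) * w z

variable {u : ι ⊕ κ → V} {τ : ℝ} {A χ w F G : V → ℝ}

theorem isTest_locFlux (hA : ContDiff ℝ (⊤ : ℕ∞) A) (hχ : ContDiff ℝ (⊤ : ℕ∞) χ) (hw : IsTest w)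
    (hF : IsTest F) (k i : ι ⊕ κ) : IsTest (locFlux u τ A χ w F k i) := by
  rcases i with j | l
  · refine IsTest.sub (IsTest.const_mul 2 (IsTest.mul_left (hχ.dirD _) hw)) ?_
    split_ifs
    · exact IsTest.mul_left hχ hF
    · exact IsTest.zero
  · refine IsTest.sub (IsTest.const_mul _ (IsTest.mul_left (contDiff_const.sub hA)
      (IsTest.mul_left hχ (hw.dirD _)))) ?_
    split_ifs
    · exact IsTest.const_mul _ (IsTest.mul_left hχ hF)
    · exact IsTest.zero

theorem isTest_locSource (hχ : ContDiff ℝ (⊤ : ℕ∞) χ) (hw : IsTest w)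
    (hF : IsTest F) (hG : IsTest G) (k : ι ⊕ κ) : IsTest (locSource u χ w F G k) :=
  ((IsTest.mul_left (hχ.dirD _) hF).sub (IsTest.mul_left hχ hG)).sub
    (IsTest.mul_left (ContDiff.sum fun _ _ => (hχ.dirD _).dirD _) hw)

theorem sumSq_localized (hτ : τ ≠ 0) (hA : ContDiff ℝ (⊤ : ℕ∞) A) (hχ : ContDiff ℝ (⊤ : ℕ∞) χ)
    (hw : IsTest w) (hF : IsTest F)
    (hAu : ∀ l, dirD (u (Sum.inr l)) A = fun _ => 0) (hχu : ∀ l, dirD (u (Sum.inr l)) χ = fun _ => 0)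
    (k : ι ⊕ κ)
    (heq : ∀ z, -(∑ j, dirD (u (Sum.inl j)) (dirD (u (Sum.inl j)) w) z) -
      A z * ∑ l, dirD (u (Sum.inr l)) (dirD (u (Sum.inr l)) w) z = dirD (u k) F z + G z) :
    sumSq (scaledFrame u τ) (fun z => χ z * w z) = fun z =>
      (∑ i, dirD (scaledFrame u τ i) (locFlux u τ A χ w F k i) z) + locSource u χ w F G k z := by
  have dχ : Differentiable ℝ χ := hχ.differentiable (by simp)
  have dA : Differentiable ℝ A := hA.differentiable (by simp)
  have dw := hw.differentiable
  have dF := hF.differentiable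
  have dχ' : ∀ v, Differentiable ℝ (dirD v χ) := fun v => (hχ.dirD v).differentiable (by simp)
  have dw' : ∀ v, Differentiable ℝ (dirD v w) := fun v => (hw.dirD v).differentiable
  have dm : ∀ {f g : V → ℝ}, Differentiable ℝ f → Differentiable ℝ g →
      Differentiable ℝ (fun z => f z * g z) := fun hf hg => hf.mul hg
  have dif : ∀ i, Differentiable ℝ (fun z => if k = i then χ z * F z else 0) := by
    intro i; split_ifs
    · exact dχ.mul dF
    · exact differentiable_const _
  have dif2 : ∀ i, Differentiable ℝ (fun z => if k = i then τ⁻¹ * (χ z * F z) else 0) := by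
    intro i; split_ifs
    · exact (dχ.mul dF).const_mul _
    · exact differentiable_const _
  funext z
  have hif : ∀ i : ι ⊕ κ, dirD (u i) (fun z => if k = i then χ z * F z else 0) z =
      if k = i then dirD (u k) χ z * F z + χ z * dirD (u k) F z else 0 := by
    intro i; split_ifs with h
    · subst h; rw [dirD_mul _ dχ dF]
    · rw [dirD_const]
  have hif2 : ∀ i : ι ⊕ κ, dirD (u i) (fun z => if k = i then τ⁻¹ * (χ z * F z) else 0) z =
      if k = i then τ⁻¹ * (dirD (u k) χ z * F z + χ z * dirD (u k) F z) else 0 := by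
    intro i; split_ifs with h
    · subst h; rw [dirD_const_mul _ _ (dm dχ dF), dirD_mul _ dχ dF]
    · rw [dirD_const]
  have e1 : ∀ j, dirD (scaledFrame u τ (Sum.inl j)) (dirD (scaledFrame u τ (Sum.inl j))
      (fun z => χ z * w z)) z = dirD (u (Sum.inl j)) (dirD (u (Sum.inl j)) χ) z * w z +
      2 * (dirD (u (Sum.inl j)) χ z * dirD (u (Sum.inl j)) w z) +
      χ z * dirD (u (Sum.inl j)) (dirD (u (Sum.inl j)) w) z := by
    intro j
    simp only [scaledFrame]
    rw [dirD_mul _ dχ dw, dirD_add _ (dm (dχ' _) dw) (dm dχ (dw' _)), dirD_mul _ (dχ' _) dw,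
      dirD_mul _ dχ (dw' _)]
    beta_reduce
    ring
  have e2 : ∀ l, dirD (scaledFrame u τ (Sum.inr l)) (dirD (scaledFrame u τ (Sum.inr l))
      (fun z => χ z * w z)) z =
      τ ^ 2 * (χ z * dirD (u (Sum.inr l)) (dirD (u (Sum.inr l)) w) z) := by
    intro l
    simp only [scaledFrame]
    rw [dirD_smul_dir, dirD_smul_dir, dirD_mul _ dχ dw, hχu]
    simp only [zero_mul, zero_add]
    rw [dirD_const_mul _ _ (dm dχ (dw' _)), dirD_mul _ dχ (dw' _), hχu]
    beta_reduce
    ring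
  have e3 : ∀ j, dirD (scaledFrame u τ (Sum.inl j)) (locFlux u τ A χ w F k (Sum.inl j)) z =
      2 * (dirD (u (Sum.inl j)) (dirD (u (Sum.inl j)) χ) z * w z +
        dirD (u (Sum.inl j)) χ z * dirD (u (Sum.inl j)) w z) -
      if k = Sum.inl j then dirD (u k) χ z * F z + χ z * dirD (u k) F z else 0 := by
    intro j
    simp only [scaledFrame, locFlux]
    rw [dirD_sub _ ((dm (dχ' _) dw).const_mul 2) (dif _), dirD_const_mul _ _ (dm (dχ' _) dw),
      dirD_mul _ (dχ' _) dw]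
    beta_reduce
    rw [hif]
  have e4 : ∀ l, dirD (scaledFrame u τ (Sum.inr l)) (locFlux u τ A χ w F k (Sum.inr l)) z =
      (τ ^ 2 - A z) * (χ z * dirD (u (Sum.inr l)) (dirD (u (Sum.inr l)) w) z) -
      if k = Sum.inr l then dirD (u k) χ z * F z + χ z * dirD (u k) F z else 0 := by
    intro l
    simp only [scaledFrame, locFlux]
    have d1 : Differentiable ℝ (fun z => τ ^ 2 - A z) := (differentiable_const _).sub dA
    have d2 : Differentiable ℝ fun z => χ z * dirD (u (Sum.inr l)) w z := dm dχ (dw' _)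
    have hA0 : dirD (u (Sum.inr l)) (fun z => τ ^ 2 - A z) = fun _ => 0 := by
      rw [dirD_sub _ (differentiable_const _) dA, hAu, dirD_const]; simp
    rw [dirD_smul_dir, dirD_sub _ ((dm d1 d2).const_mul _) (dif2 _),
      dirD_const_mul _ _ (dm d1 d2), dirD_mul _ d1 d2, hA0, dirD_mul _ dχ (dw' _), hχu]
    beta_reduce
    rw [hif2]
    split_ifs <;> field_simp <;> ring
  have hsum : ∀ c : ℝ, (∑ j : ι, if k = Sum.inl j then c else 0) +
      (∑ l : κ, if k = Sum.inr l then c else 0) = c := by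
    intro c
    have := Fintype.sum_sum_type (fun i : ι ⊕ κ => if k = i then c else 0)
    rw [← this]; simp
  have hs := hsum (dirD (u k) χ z * F z + χ z * dirD (u k) F z)
  have hE := heq z
  rw [sumSq]
  simp only [Fintype.sum_sum_type, e1, e2, e3, e4, Finset.sum_sub_distrib, Finset.sum_add_distrib,
    ← Finset.mul_sum, locSource, ← Finset.sum_mul]
  linear_combination hs - χ z * hE

end Localization

section LocalEstimate

theorem enorm_rpow_le_of_abs_le {p : ℝ} (hp : 0 < p) {A a1 a2 a3 b c κ : ℝ} (hc : 0 ≤ c) (hκ : 0 ≤ κ)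
    (h : |A| ≤ c * (|a1| + |a2| + |a3|) + κ * |b|) :
    ‖A‖ₑ ^ p ≤ ENNReal.ofReal (4 * c) ^ p * (‖a1‖ₑ ^ p + ‖a2‖ₑ ^ p + ‖a3‖ₑ ^ p) +
      ENNReal.ofReal (4 * κ) ^ p * ‖b‖ₑ ^ p := by
  have key : ∀ {x d : ℝ}, 0 ≤ d → |A| ≤ d * |x| → ‖A‖ₑ ^ p ≤ ENNReal.ofReal d ^ p * ‖x‖ₑ ^ p := by
    intro x d hd hx
    rw [← ENNReal.mul_rpow_of_nonneg _ _ hp.le]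
    refine ENNReal.rpow_le_rpow ?_ hp.le
    rw [Real.enorm_eq_ofReal_abs, Real.enorm_eq_ofReal_abs, ← ENNReal.ofReal_mul hd]
    exact ENNReal.ofReal_le_ofReal hx
  have h4 : |A| ≤ 4 * c * |a1| ∨ |A| ≤ 4 * c * |a2| ∨ |A| ≤ 4 * c * |a3| ∨ |A| ≤ 4 * κ * |b| := by
    by_contra! hcon
    obtain ⟨h1, h2, h3, h5⟩ := hcon
    nlinarith
  simp only [mul_add]
  rcases h4 with h4 | h4 | h4 | h4
  · exact (key (by positivity) h4).trans (le_add_right (le_add_right (le_add_right le_rfl)))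
  · exact (key (by positivity) h4).trans (le_add_right (le_add_right (le_add_left le_rfl)))
  · exact (key (by positivity) h4).trans (le_add_right (le_add_left le_rfl))
  · exact (key (by positivity) h4).trans (le_add_left le_rfl)

theorem ENNReal.le_two_mul_of_le_add_half {X B : ℝ≥0∞} (hX : X ≠ ⊤) (h : X ≤ B + X / 2) : X ≤ 2 * B := by
  have h2 : X / 2 ≠ ⊤ := ENNReal.div_ne_top hX (by simp)
  have h1 : X / 2 + X / 2 ≤ B + X / 2 := by rwa [ENNReal.add_halves]
  have h3 : X / 2 ≤ B := ENNReal.le_of_add_le_add_right h2 h1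
  calc X = X / 2 + X / 2 := (ENNReal.add_halves X).symm
    _ ≤ B + B := add_le_add h3 h3
    _ = 2 * B := (two_mul B).symm

theorem dirD_eq_zero_of_notMem {V : Type*} [NormedAddCommGroup V] [NormedSpace ℝ V] {f : V → ℝ}
    {S : Set V} (hS : IsClosed S) (h : ∀ z ∉ S, f z = 0) (v : V) : ∀ z ∉ S, dirD v f z = 0 := by
  intro z hz
  have : f =ᶠ[nhds z] fun _ => 0 := by
    filter_upwards [hS.isOpen_compl.mem_nhds hz] with y hy using h y hy
  simp [dirD, this.fderiv_eq]

variable {n m : ℕ}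

instance volume_isAddHaarMeasure_pt : (volume : Measure (Pt n m)).IsAddHaarMeasure :=
  Measure.prod.instIsAddHaarMeasure (volume : Measure (Fin n → ℝ)) (volume : Measure (Fin m → ℝ))

/-- The coordinate direction in `ℝ^(n+m)` indexed by `Fin n ⊕ Fin m`. -/
def unitVec (n m : ℕ) : Fin n ⊕ Fin m → Pt n m
  | Sum.inl j => (Pi.single j 1, 0)
  | Sum.inr k => (0, Pi.single k 1)

/-- Number of powers of `|x|` accompanying each coordinate derivative in the homogeneous frame. -/
def dirWeight (N : ℕ) : Fin n ⊕ Fin m → ℕ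
  | Sum.inl _ => 0
  | Sum.inr _ => N

/-- The function `|x|²`. -/
def sqx (x : Fin n → ℝ) : ℝ := ∑ i, x i ^ 2

theorem grusin_apply (N : ℕ) (f : Pt n m → ℝ) (z : Pt n m) : grusin n m N f z =
    -(∑ j, dirD (unitVec n m (Sum.inl j)) (dirD (unitVec n m (Sum.inl j)) f) z) -
      sqx z.1 ^ N * ∑ k, dirD (unitVec n m (Sum.inr k)) (dirD (unitVec n m (Sum.inr k)) f) z := rfl

theorem contDiff_sqx : ContDiff ℝ (⊤ : ℕ∞) fun z : Pt n m => sqx z.1 := by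
  unfold sqx; fun_prop

theorem sqx_nonneg (x : Fin n → ℝ) : 0 ≤ sqx x := Finset.sum_nonneg fun _ _ => sq_nonneg _

theorem norm_sq_le_sqx (x : Fin n → ℝ) : ‖x‖ ^ 2 ≤ sqx x := by
  have h : ‖x‖ ≤ Real.sqrt (sqx x) := by
    refine (pi_norm_le_iff_of_nonneg (Real.sqrt_nonneg _)).2 fun i => ?_
    rw [Real.norm_eq_abs]
    refine Real.abs_le_sqrt ?_
    exact Finset.single_le_sum (f := fun i => x i ^ 2) (fun _ _ => sq_nonneg _) (Finset.mem_univ i)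
  calc ‖x‖ ^ 2 ≤ Real.sqrt (sqx x) ^ 2 := by gcongr
    _ = sqx x := Real.sq_sqrt (sqx_nonneg x)

theorem dirD_comp_fst_inr (g : (Fin n → ℝ) → ℝ) (l : Fin m) :
    dirD (unitVec n m (Sum.inr l)) (fun z : Pt n m => g z.1) = fun _ => 0 := by
  funext z
  by_cases h : DifferentiableAt ℝ (fun z : Pt n m => g z.1) z
  · have h1 := hasDerivAt_line (x := z) (v := unitVec n m (Sum.inr l)) (t := 0) (by simpa using h)
    simp only [unitVec, Prod.fst_add, Prod.smul_fst, smul_zero, add_zero] at h1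
    have := h1.unique (hasDerivAt_const (0 : ℝ) (g z.1))
    simpa [dirD, unitVec] using this
  · simp [dirD, fderiv_zero_of_not_differentiableAt h]

theorem dirD_cutoff {g : (Fin n → ℝ) → ℝ} (hg : Differentiable ℝ g) (c : ℝ) (x0 : Fin n → ℝ) (v : Pt n m) :
    dirD v (fun z : Pt n m => g (c • (z.1 - x0))) = fun z => c * dirD v.1 g (c • (z.1 - x0)) := by
  funext z
  have h2 : HasFDerivAt (fun z : Pt n m => c • (z.1 - x0))
      (c • ContinuousLinearMap.fst ℝ (Fin n → ℝ) (Fin m → ℝ)) z :=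
    ((hasFDerivAt_fst).sub_const x0).const_smul c
  have := ((hg (c • (z.1 - x0))).hasFDerivAt.comp z h2).fderiv
  rw [dirD]
  erw [this]
  simp [dirD]

theorem exists_sqx_pow_close (hn : 1 ≤ n) (N : ℕ) {κ : ℝ} (hκ : 0 < κ) : ∃ ε : ℝ, 0 < ε ∧ ε ≤ 1 / 8 ∧
    ∀ x0 x : Fin n → ℝ, ‖x - x0‖ ≤ 2 * ε * ‖x0‖ → |sqx x0 ^ N - sqx x ^ N| ≤ κ * sqx x0 ^ N := by
  have hc : Filter.Tendsto (fun t : ℝ => t ^ N) (nhds 1) (nhds 1) := by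
    have := (continuous_pow N (M := ℝ)).tendsto 1
    simpa using this
  obtain ⟨δ, hδ, h⟩ := Metric.tendsto_nhds_nhds.1 hc κ hκ
  have hn0 : (0 : ℝ) < n := by exact_mod_cast hn
  refine ⟨min (1 / 8) (δ / (12 * n)), by positivity, min_le_left _ _, fun x0 x hx => ?_⟩
  set ε := min (1 / 8) (δ / (12 * n)) with hε
  have hε1 : ε ≤ 1 / 8 := min_le_left _ _
  have hε2 : ε * (12 * n) ≤ δ := by
    rw [← le_div_iff₀ (by positivity)]; exact min_le_right _ _
  have hε0 : 0 < ε := by positivity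
  rcases eq_or_ne x0 0 with rfl | h0
  · have : x = 0 := by simpa using hx
    subst this; simp only [sub_self, abs_zero]; exact mul_nonneg hκ.le (pow_nonneg (sqx_nonneg _) _)
  have hρ : 0 < ‖x0‖ := norm_pos_iff.2 h0
  have hs0 : 0 < sqx x0 := lt_of_lt_of_le (by positivity) (norm_sq_le_sqx x0)
  have hd : |sqx x - sqx x0| ≤ n * (2 * ε * ‖x0‖ * (3 * ‖x0‖)) := by
    rw [sqx, sqx, ← Finset.sum_sub_distrib]
    refine (Finset.abs_sum_le_sum_abs _ _).trans ?_
    calc ∑ i, |x i ^ 2 - x0 i ^ 2| ≤ ∑ _i : Fin n, 2 * ε * ‖x0‖ * (3 * ‖x0‖) := by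
          refine Finset.sum_le_sum fun i _ => ?_
          have h1 : |x i - x0 i| ≤ 2 * ε * ‖x0‖ := (norm_le_pi_norm (x - x0) i).trans hx
          have h2 : |x0 i| ≤ ‖x0‖ := norm_le_pi_norm x0 i
          have h3 : |x i + x0 i| ≤ 3 * ‖x0‖ := by
            have : x i + x0 i = (x i - x0 i) + 2 * x0 i := by ring
            rw [this]
            refine (abs_add_le _ _).trans ?_
            rw [abs_mul, abs_two]
            nlinarith
          rw [show x i ^ 2 - x0 i ^ 2 = (x i - x0 i) * (x i + x0 i) by ring, abs_mul]
          gcongr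
      _ = _ := by simp
  have ht : dist (sqx x / sqx x0) 1 < δ := by
    rw [Real.dist_eq, div_sub_one hs0.ne', abs_div, abs_of_pos hs0, div_lt_iff₀ hs0]
    have h5 := norm_sq_le_sqx x0
    have : n * (2 * ε * ‖x0‖ * (3 * ‖x0‖)) = (ε * (12 * n)) * (‖x0‖ ^ 2 / 2) := by ring
    rw [this] at hd
    nlinarith [mul_pos hδ hs0, sq_nonneg ‖x0‖]
  have h6 := h ht
  rw [Real.dist_eq, div_pow, div_sub_one (by positivity), abs_div, abs_of_pos (pow_pos hs0 N),
    div_lt_iff₀ (by positivity)] at h6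
  rw [abs_sub_comm]
  exact h6.le

end LocalEstimate

section LocalEstimate
variable {n m : ℕ}

theorem abs_locFlux_le {N : ℕ} {ρ τ κ M : ℝ} (hρ : 0 < ρ) (hτ : ρ ^ N ≤ τ) (hκ : 0 ≤ κ) (hM : 0 ≤ M)
    {A χ w F : Pt n m → ℝ} (hχ : Differentiable ℝ χ) (hw : Differentiable ℝ w)
    (hχu : ∀ l, dirD (unitVec n m (Sum.inr l)) χ = fun _ => 0) {z : Pt n m}
    (hA : |τ ^ 2 - A z| ≤ κ * τ ^ 2) (h1 : |χ z| ≤ 1)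
    (h2 : ∀ j, |dirD (unitVec n m (Sum.inl j)) χ z| ≤ M * ρ⁻¹) (G : Pt n m → ℝ) (k i : Fin n ⊕ Fin m) :
    |locFlux (unitVec n m) τ A χ w F k i z| ≤
      (2 * M + 1) * (|(ρ ^ dirWeight N k)⁻¹ * F z| + |ρ * G z| + |ρ⁻¹ * w z|) +
        κ * |dirD (scaledFrame (unitVec n m) τ i) (fun z => χ z * w z) z| := by
  have hτ0 : 0 < τ := lt_of_lt_of_le (by positivity) hτ
  have p1 := abs_nonneg ((ρ ^ dirWeight N k)⁻¹ * F z)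
  have p2 := abs_nonneg (ρ * G z)
  have p3 := abs_nonneg (ρ⁻¹ * w z)
  rcases i with j | l
  · have hb : |locFlux (unitVec n m) τ A χ w F k (Sum.inl j) z| ≤
        2 * M * |ρ⁻¹ * w z| + |(ρ ^ dirWeight N k)⁻¹ * F z| := by
      simp only [locFlux]
      refine (abs_sub _ _).trans (add_le_add ?_ ?_)
      · rw [abs_mul, abs_mul, abs_mul, abs_two, abs_of_pos (inv_pos.2 hρ)]
        have := mul_le_mul_of_nonneg_right (h2 j) (abs_nonneg (w z))
        nlinarith
      · split_ifs with hk
        · subst hk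
          simp only [dirWeight, pow_zero, inv_one, one_mul]
          rw [abs_mul]
          exact mul_le_of_le_one_left (abs_nonneg _) h1
        · simp only [abs_zero]; exact p1
    have := mul_nonneg hκ (abs_nonneg (dirD (scaledFrame (unitVec n m) τ (Sum.inl j)) (fun z => χ z * w z) z))
    nlinarith [mul_nonneg hM p1, mul_nonneg hM p2]
  · have he : dirD (scaledFrame (unitVec n m) τ (Sum.inr l)) (fun z => χ z * w z) z =
        τ * (χ z * dirD (unitVec n m (Sum.inr l)) w z) := by
      simp only [scaledFrame]
      rw [dirD_smul_dir, dirD_mul _ hχ hw, hχu]; simp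
    have hb : |locFlux (unitVec n m) τ A χ w F k (Sum.inr l) z| ≤
        κ * |τ * (χ z * dirD (unitVec n m (Sum.inr l)) w z)| + |(ρ ^ dirWeight N k)⁻¹ * F z| := by
      simp only [locFlux]
      refine (abs_sub _ _).trans (add_le_add ?_ ?_)
      · rw [abs_mul, abs_mul, abs_mul τ, abs_of_pos hτ0, abs_of_pos (inv_pos.2 hτ0)]
        have := mul_le_mul_of_nonneg_right hA (abs_nonneg (χ z * dirD (unitVec n m (Sum.inr l)) w z))
        rw [inv_mul_le_iff₀ hτ0]
        refine this.trans (le_of_eq (by ring))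
      · split_ifs with hk
        · subst hk
          simp only [dirWeight]
          rw [abs_mul, abs_mul, abs_mul, abs_of_pos (inv_pos.2 hτ0), abs_of_pos (inv_pos.2 (pow_pos hρ N))]
          exact mul_le_mul (inv_anti₀ (by positivity) hτ)
            (mul_le_of_le_one_left (abs_nonneg _) h1) (by positivity) (by positivity)
        · simp only [abs_zero]; exact p1
    rw [he]
    nlinarith [mul_nonneg hM p1, mul_nonneg hM p2, mul_nonneg hM p3]

theorem abs_locSource_le {N : ℕ} {ρ M : ℝ} (hρ : 0 < ρ) (hM : 0 ≤ M)
    {χ w F G : Pt n m → ℝ} 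
    (hχu : ∀ l, dirD (unitVec n m (Sum.inr l)) χ = fun _ => 0) {z : Pt n m} (h1 : |χ z| ≤ 1)
    (h2 : ∀ j, |dirD (unitVec n m (Sum.inl j)) χ z| ≤ M * ρ⁻¹)
    (h3 : |∑ j, dirD (unitVec n m (Sum.inl j)) (dirD (unitVec n m (Sum.inl j)) χ) z| ≤ M * ρ⁻¹ ^ 2)
    (k : Fin n ⊕ Fin m) :
    |ρ * locSource (unitVec n m) χ w F G k z| ≤
      (2 * M + 1) * (|(ρ ^ dirWeight N k)⁻¹ * F z| + |ρ * G z| + |ρ⁻¹ * w z|) := by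
  have p1 := abs_nonneg ((ρ ^ dirWeight N k)⁻¹ * F z)
  have p2 := abs_nonneg (ρ * G z)
  have p3 := abs_nonneg (ρ⁻¹ * w z)
  have hF : |ρ * (dirD (unitVec n m k) χ z * F z)| ≤ M * |(ρ ^ dirWeight N k)⁻¹ * F z| := by
    rcases k with j | l
    · simp only [dirWeight, pow_zero, inv_one, one_mul]
      rw [abs_mul, abs_mul, abs_of_pos hρ]
      have := mul_le_mul_of_nonneg_right (h2 j) (mul_nonneg hρ.le (abs_nonneg (F z)))
      calc _ = |dirD (unitVec n m (Sum.inl j)) χ z| * (ρ * |F z|) := by ring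
        _ ≤ _ := this
        _ = _ := by field_simp
    · rw [hχu]; simp only [zero_mul, mul_zero, abs_zero]; positivity
  have hG : |ρ * (χ z * G z)| ≤ |ρ * G z| := by
    rw [show ρ * (χ z * G z) = χ z * (ρ * G z) by ring, abs_mul]
    exact mul_le_of_le_one_left (abs_nonneg _) h1
  have hw : |ρ * ((∑ j, dirD (unitVec n m (Sum.inl j)) (dirD (unitVec n m (Sum.inl j)) χ) z) * w z)| ≤
      M * |ρ⁻¹ * w z| := by
    rw [abs_mul, abs_mul, abs_mul, abs_of_pos hρ, abs_of_pos (inv_pos.2 hρ)]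
    have := mul_le_mul_of_nonneg_right h3 (mul_nonneg hρ.le (abs_nonneg (w z)))
    calc _ = _ := by ring
      _ ≤ _ := this
      _ = _ := by field_simp
  have : |ρ * locSource (unitVec n m) χ w F G k z| ≤ |ρ * (dirD (unitVec n m k) χ z * F z)| +
      |ρ * (χ z * G z)| + |ρ * ((∑ j, dirD (unitVec n m (Sum.inl j)) (dirD (unitVec n m (Sum.inl j)) χ) z) * w z)| := by
    rw [locSource, mul_sub, mul_sub]
    exact (abs_sub _ _).trans (add_le_add (abs_sub _ _) le_rfl)
  nlinarith [mul_nonneg hM p1, mul_nonneg hM p2, mul_nonneg hM p3]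

/-- A smooth cutoff in the `x` variables adapted to a ball of radius comparable to `ρ`. -/
theorem exists_cutoff (n m : ℕ) {ε : ℝ} (hε : 0 < ε) : ∃ M : ℝ, 0 ≤ M ∧ ∀ (x0 : Fin n → ℝ) {ρ : ℝ}, 0 < ρ →
    ∃ χ : Pt n m → ℝ, ContDiff ℝ (⊤ : ℕ∞) χ ∧ (∀ l, dirD (unitVec n m (Sum.inr l)) χ = fun _ => 0) ∧
      (∀ z, |χ z| ≤ 1) ∧ (∀ z, ∀ j, |dirD (unitVec n m (Sum.inl j)) χ z| ≤ M * ρ⁻¹) ∧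
      (∀ z, |∑ j, dirD (unitVec n m (Sum.inl j)) (dirD (unitVec n m (Sum.inl j)) χ) z| ≤ M * ρ⁻¹ ^ 2) ∧
      (∀ z : Pt n m, 2 * ε * ρ < ‖z.1 - x0‖ → χ z = 0) ∧
      (∀ z : Pt n m, ‖z.1 - x0‖ < ε * ρ → χ z = 1) := by
  classical
  let b : ContDiffBump (0 : Fin n → ℝ) := ⟨1, 2, by norm_num, by norm_num⟩
  have hb : IsTest (fun x => b x) := ⟨b.contDiff, b.hasCompactSupport⟩
  have hbd : ∀ v, ∃ C, 0 ≤ C ∧ ∀ x, |dirD v (fun x => b x) x| ≤ C := fun v => (hb.dirD v).exists_bound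
  have hbd2 : ∀ v, ∃ C, 0 ≤ C ∧ ∀ x, |dirD v (dirD v (fun x => b x)) x| ≤ C :=
    fun v => ((hb.dirD v).dirD v).exists_bound
  choose C1 hC1 hC1b using hbd
  choose C2 hC2 hC2b using hbd2
  set e : Fin n → (Fin n → ℝ) := fun j => Pi.single j 1
  have hs1 : ∀ j, C1 (e j) ≤ ∑ j, C1 (e j) := fun j =>
    Finset.single_le_sum (f := fun j => C1 (e j)) (fun j _ => hC1 _) (Finset.mem_univ j)
  have hn1 : 0 ≤ ∑ j, C1 (e j) := Finset.sum_nonneg fun _ _ => hC1 _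
  have hn2 : 0 ≤ ∑ j, C2 (e j) := Finset.sum_nonneg fun _ _ => hC2 _
  refine ⟨(∑ j, C1 (e j)) * ε⁻¹ + (∑ j, C2 (e j)) * ε⁻¹ ^ 2, by positivity, fun x0 ρ hρ => ?_⟩
  set c := (ε * ρ)⁻¹ with hc
  have hcp : 0 < c := by positivity
  have hce : c = ε⁻¹ * ρ⁻¹ := by rw [hc, mul_inv]
  refine ⟨fun z => b (c • (z.1 - x0)), ?_, ?_, ?_, ?_, ?_, ?_, ?_⟩
  · exact hb.1.comp (by fun_prop)
  · intro l; exact dirD_comp_fst_inr (fun x => b (c • (x - x0))) l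
  · intro z; rw [abs_of_nonneg b.nonneg]; exact b.le_one
  · intro z j
    rw [dirD_cutoff hb.differentiable]
    beta_reduce
    rw [abs_mul, abs_of_pos hcp, hce]
    have := (hC1b (e j) (c • (z.1 - x0))).trans (hs1 j)
    rw [hce] at this
    have hi : 0 < ρ⁻¹ := by positivity
    have hj : 0 < ε⁻¹ := by positivity
    calc _ ≤ ε⁻¹ * ρ⁻¹ * ∑ j, C1 (e j) := by gcongr; exact this
      _ ≤ _ := by nlinarith [mul_nonneg (mul_nonneg hn2 (sq_nonneg ε⁻¹)) hi.le]
  · intro z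
    have : ∀ j, dirD (unitVec n m (Sum.inl j)) (dirD (unitVec n m (Sum.inl j))
        (fun z => b (c • (z.1 - x0)))) z = c ^ 2 * dirD (e j) (dirD (e j) (fun x => b x)) (c • (z.1 - x0)) := by
      intro j
      rw [dirD_cutoff hb.differentiable, dirD_const_mul, dirD_cutoff (hb.dirD _).differentiable]
      · simp only [unitVec]; ring
      · exact (hb.dirD _).differentiable.comp (by fun_prop)
    simp only [this]
    rw [← Finset.mul_sum, abs_mul, abs_of_pos (by positivity : 0 < c ^ 2)]
    have h2 : |∑ j, dirD (e j) (dirD (e j) (fun x => b x)) (c • (z.1 - x0))| ≤ ∑ j, C2 (e j) :=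
      (Finset.abs_sum_le_sum_abs _ _).trans (Finset.sum_le_sum fun j _ => hC2b _ _)
    calc _ ≤ c ^ 2 * ∑ j, C2 (e j) := by gcongr
      _ = (∑ j, C2 (e j)) * ε⁻¹ ^ 2 * ρ⁻¹ ^ 2 := by rw [hce]; ring
      _ ≤ _ := by
        rw [add_mul]
        exact le_add_of_nonneg_left (by positivity)
  · intro z hz
    refine b.zero_of_le_dist ?_
    rw [dist_zero_right, norm_smul, Real.norm_of_nonneg hcp.le, hc]
    rw [le_inv_mul_iff₀ (by positivity)]
    have : b.rOut = 2 := rfl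
    rw [this]; linarith
  · intro z hz
    refine b.one_of_mem_closedBall ?_
    rw [mem_closedBall_zero_iff, norm_smul, Real.norm_of_nonneg hcp.le, hc]
    have : b.rIn = 1 := rfl
    rw [this, inv_mul_le_iff₀ (by positivity)]; linarith

end LocalEstimate

section LocalEstimate
variable {n m : ℕ}

theorem exists_local_estimate (hn : 1 ≤ n) (m N : ℕ) {p : ℝ} (hp : 1 < p) :
    ∃ ε : ℝ, 0 < ε ∧ ε ≤ 1 / 8 ∧ ∃ C : ℝ≥0, ∀ (k : Fin n ⊕ Fin m) {w F G : Pt n m → ℝ},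
      IsTest w → IsTest F → IsTest G →
      (∀ z, grusin n m N w z = dirD (unitVec n m k) F z + G z) →
      ∀ x0 : Fin n → ℝ, x0 ≠ 0 → ∀ j,
      ∫⁻ z in {z : Pt n m | ‖z.1 - x0‖ < ε * ‖x0‖},
          ‖‖x0‖ ^ dirWeight N j * dirD (unitVec n m j) w z‖ₑ ^ p ≤
        C * ∫⁻ z in {z : Pt n m | ‖z.1 - x0‖ ≤ 2 * ε * ‖x0‖},
          (‖(‖x0‖ ^ dirWeight N k)⁻¹ * F z‖ₑ ^ p + ‖‖x0‖ * G z‖ₑ ^ p + ‖‖x0‖⁻¹ * w z‖ₑ ^ p) := by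
  have hp0 : 0 < p := by linarith
  obtain ⟨CA, hCA⟩ := exists_lintegral_dirD_rpow_le_add (ι := Fin n ⊕ Fin m)
    (volume : Measure (Pt n m)) hp
  set c0 : ℝ := (CA + 1) * (n + m + 1) with hc0
  have hc0p : 1 ≤ c0 := by
    have h1 : (0 : ℝ) ≤ CA := CA.2
    have h2 : (0 : ℝ) ≤ n + m := by positivity
    nlinarith [mul_nonneg h1 h2]
  set κ : ℝ := 1 / (8 * c0) with hκ
  have hκ0 : 0 < κ := by positivity
  obtain ⟨ε, hε, hε8, hclose⟩ := exists_sqx_pow_close hn N hκ0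
  obtain ⟨M, hM, hcut⟩ := exists_cutoff n m hε
  set K : ℝ≥0 := Real.toNNReal (4 * (2 * M + 1)) ^ p with hK
  have hKe : (K : ℝ≥0∞) = ENNReal.ofReal (4 * (2 * M + 1)) ^ p := by
    rw [hK, ENNReal.coe_rpow_of_nonneg _ hp0.le]; rfl
  refine ⟨ε, hε, hε8, 2 * ((n + m : ℕ) * (CA * ((n + m : ℕ) * K + K))), ?_⟩
  intro k w F G hw hF hG heq x0 hx0 j0
  set ρ := ‖x0‖ with hρd
  have hρ : 0 < ρ := norm_pos_iff.2 hx0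
  obtain ⟨χ, hχ, hχu, hχ1, hχ2, hχ3, hχ0, hχe⟩ := hcut x0 hρ
  have dχ : Differentiable ℝ χ := hχ.differentiable (by simp)
  set S : Set (Pt n m) := {z | ‖z.1 - x0‖ ≤ 2 * ε * ρ} with hS
  have hSc : IsClosed S := isClosed_le (by fun_prop) continuous_const
  set U : Set (Pt n m) := {z | ‖z.1 - x0‖ < ε * ρ} with hU
  have hUo : IsOpen U := isOpen_lt (by fun_prop) continuous_const
  set τ := Real.sqrt (sqx x0) ^ N with hτd
  have hs0 : 0 < sqx x0 := lt_of_lt_of_le (by positivity) (norm_sq_le_sqx x0)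
  have hτ : ρ ^ N ≤ τ := pow_le_pow_left₀ hρ.le (Real.le_sqrt_of_sq_le (norm_sq_le_sqx x0)) N
  have hτ0 : 0 < τ := lt_of_lt_of_le (by positivity) hτ
  have hτ2 : τ ^ 2 = sqx x0 ^ N := by
    rw [hτd, ← pow_mul, mul_comm, pow_mul, Real.sq_sqrt hs0.le]
  set A : Pt n m → ℝ := fun z => sqx z.1 ^ N with hAd
  have hA : ContDiff ℝ (⊤ : ℕ∞) A := contDiff_sqx.pow N
  set u := unitVec n m with hu
  set e := scaledFrame u τ with he
  set W : Pt n m → ℝ := fun z => χ z * w z with hW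
  have hWt : IsTest W := IsTest.mul_left hχ hw
  have hFt : ∀ i, IsTest (locFlux u τ A χ w F k i) := isTest_locFlux hA hχ hw hF k
  have hGt : IsTest (locSource u χ w F G k) := isTest_locSource hχ hw hF hG k
  have hχS : ∀ z ∉ S, χ z = 0 := fun z hz => hχ0 z (not_le.1 hz)
  have hχS' : ∀ v, ∀ z ∉ S, dirD v χ z = 0 := fun v => dirD_eq_zero_of_notMem hSc hχS v
  have hχS2 : ∀ v v', ∀ z ∉ S, dirD v' (dirD v χ) z = 0 := fun v v' =>
    dirD_eq_zero_of_notMem hSc (hχS' v) v'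
  have hWsupp : tsupport W ⊆ S := by
    refine closure_minimal (fun z hz => ?_) hSc
    by_contra hzS
    exact hz (by simp [hW, hχS z hzS])
  have heqn := sumSq_localized (u := u) (τ := τ) (A := A) (χ := χ) (w := w) (F := F) (G := G) hτ0.ne' hA hχ hw hF
    (fun l => dirD_comp_fst_inr (fun x => sqx x ^ N) l) hχu k (fun z => by rw [← heq z]; rfl)
  let i0 : Fin n := ⟨0, hn⟩
  have hshift : ∀ z ∈ tsupport W, z + ρ • e (Sum.inl i0) ∉ tsupport W := by
    intro z hz hz2
    have h1 : ‖z.1 - x0‖ ≤ 2 * ε * ρ := hWsupp hz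
    have h2 : ‖(z + ρ • e (Sum.inl i0)).1 - x0‖ ≤ 2 * ε * ρ := hWsupp hz2
    have h3 := (norm_le_pi_norm _ i0).trans h1
    have h4 := (norm_le_pi_norm _ i0).trans h2
    simp only [he, scaledFrame, hu, unitVec, Prod.fst_add, Prod.smul_fst, Pi.sub_apply, Pi.add_apply,
      Pi.smul_apply, Pi.single_eq_same, smul_eq_mul, mul_one, Real.norm_eq_abs] at h3 h4
    have h5 := abs_le.1 h3
    have h6 := abs_le.1 h4
    nlinarith
  have hmain := hCA e hWt hGt hFt heqn (Sum.inl i0) ρ hρ.le hshift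
  set Tf : Pt n m → ℝ≥0∞ := fun z => ‖(ρ ^ dirWeight N k)⁻¹ * F z‖ₑ ^ p + ‖ρ * G z‖ₑ ^ p + ‖ρ⁻¹ * w z‖ₑ ^ p
    with hTf
  set T := ∫⁻ z in S, Tf z with hT
  set X := ∑ j, ∫⁻ z, ‖dirD (e j) W z‖ₑ ^ p with hX
  have hclose' : ∀ z ∈ S, |τ ^ 2 - A z| ≤ κ * τ ^ 2 := by
    intro z hz
    rw [hτ2]; exact hclose x0 z.1 hz
  have hFb : ∀ i, ∫⁻ z, ‖locFlux u τ A χ w F k i z‖ₑ ^ p ≤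
      K * T + ENNReal.ofReal (4 * κ) ^ p * ∫⁻ z, ‖dirD (e i) W z‖ₑ ^ p := by
    intro i
    have hmeas : Measurable fun z => ‖dirD (e i) W z‖ₑ ^ p :=
      (hWt.dirD _).continuous.measurable.enorm.pow_const p
    rw [hT, ← lintegral_indicator hSc.measurableSet, ← lintegral_const_mul' _ _ ENNReal.coe_ne_top,
      ← lintegral_const_mul _ hmeas, ← lintegral_add_right _ (hmeas.const_mul _)]
    refine lintegral_mono fun z => ?_
    by_cases hz : z ∈ S
    · simp only [Set.indicator_of_mem hz, hKe]
      exact enorm_rpow_le_of_abs_le hp0 (by positivity) hκ0.le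
        (abs_locFlux_le hρ hτ hκ0.le hM dχ hw.differentiable hχu (hclose' z hz) (hχ1 z) (hχ2 z) G k i)
    · have : locFlux u τ A χ w F k i z = 0 := by
        rcases i with j | l
        · simp [locFlux, hχS z hz, hχS' _ z hz]
        · simp [locFlux, hχS z hz]
      beta_reduce
      rw [this]
      simp [hp0]
  have hGb : ENNReal.ofReal ρ ^ p * ∫⁻ z, ‖locSource u χ w F G k z‖ₑ ^ p ≤ K * T := by
    rw [hT, ← lintegral_indicator hSc.measurableSet, ← lintegral_const_mul' _ _ ENNReal.coe_ne_top,
      ← lintegral_const_mul' _ _ (ENNReal.rpow_ne_top_of_nonneg hp0.le ENNReal.ofReal_ne_top)]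
    refine lintegral_mono fun z => ?_
    have e1 : ENNReal.ofReal ρ ^ p * ‖locSource u χ w F G k z‖ₑ ^ p = ‖ρ * locSource u χ w F G k z‖ₑ ^ p := by
      rw [enorm_mul, ENNReal.mul_rpow_of_nonneg _ _ hp0.le, Real.enorm_of_nonneg hρ.le]
    beta_reduce
    rw [e1]
    by_cases hz : z ∈ S
    · simp only [Set.indicator_of_mem hz, hKe]
      have := enorm_rpow_le_of_abs_le (A := ρ * locSource u χ w F G k z) (b := 0) hp0
        (by positivity : 0 ≤ 2 * M + 1) (le_refl (0 : ℝ))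
        ((abs_locSource_le (N := N) (w := w) (F := F) (G := G) hρ hM hχu (hχ1 z) (hχ2 z) (hχ3 z) k).trans
          (le_of_eq (by rw [zero_mul, add_zero])))
      exact this.trans (le_of_eq (by rw [enorm_zero, ENNReal.zero_rpow_of_pos hp0, mul_zero, add_zero]))
    · have : locSource u χ w F G k z = 0 := by
        simp [locSource, hχS z hz, hχS' _ z hz, hχS2 _ _ z hz]
      rw [this]
      simp [hp0]
  have hsumF : ∑ i, ∫⁻ z, ‖locFlux u τ A χ w F k i z‖ₑ ^ p ≤
      (n + m : ℕ) * (K * T) + ENNReal.ofReal (4 * κ) ^ p * X := by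
    refine (Finset.sum_le_sum fun i _ => hFb i).trans (le_of_eq ?_)
    rw [Finset.sum_add_distrib, Finset.mul_sum]
    simp
  have hXtop : X ≠ ⊤ := by
    rw [hX]
    exact (ENNReal.sum_lt_top.2 fun j _ => (hWt.dirD _).lintegral_rpow_lt_top volume hp0).ne
  have hsmall : ((n + m : ℕ) : ℝ≥0∞) * (CA * ENNReal.ofReal (4 * κ) ^ p) ≤ 2⁻¹ := by
    have h4 : ENNReal.ofReal (4 * κ) ^ p ≤ ENNReal.ofReal (4 * κ) := by
      have : ENNReal.ofReal (4 * κ) ≤ 1 := by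
        rw [ENNReal.ofReal_le_one, hκ]
        rw [mul_one_div, div_le_one (by positivity)]
        linarith
      calc _ ≤ ENNReal.ofReal (4 * κ) ^ (1 : ℝ) := ENNReal.rpow_le_rpow_of_exponent_ge this hp.le
        _ = _ := ENNReal.rpow_one _
    calc ((n + m : ℕ) : ℝ≥0∞) * (CA * ENNReal.ofReal (4 * κ) ^ p)
        ≤ ((n + m : ℕ) : ℝ≥0∞) * (CA * ENNReal.ofReal (4 * κ)) := by gcongr
      _ = ENNReal.ofReal (((n + m : ℕ) : ℝ) * ((CA : ℝ) * (4 * κ))) := by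
        rw [ENNReal.ofReal_mul (p := ((n + m : ℕ) : ℝ)) (by positivity),
          ENNReal.ofReal_mul (p := (CA : ℝ)) (by positivity),
          ENNReal.ofReal_natCast, ENNReal.ofReal_coe_nnreal]
      _ ≤ ENNReal.ofReal 2⁻¹ := by
        refine ENNReal.ofReal_le_ofReal ?_
        rw [hκ]
        have h1 : (0 : ℝ) ≤ CA := CA.2
        have h2 : (0 : ℝ) ≤ n + m := by positivity
        have h3 : ((n + m : ℕ) : ℝ) * CA ≤ c0 := by
          push_cast; rw [hc0]; nlinarith
        have h5 : ((n + m : ℕ) : ℝ) * ((CA : ℝ) * (4 * (1 / (8 * c0)))) =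
            (((n + m : ℕ) : ℝ) * CA) * (1 / 2 * c0⁻¹) := by field_simp; ring
        rw [h5]
        calc _ ≤ c0 * (1 / 2 * c0⁻¹) := by gcongr
          _ = 2⁻¹ := by field_simp
      _ = 2⁻¹ := by rw [ENNReal.ofReal_inv_of_pos (by norm_num)]; simp
  have hXle : X ≤ ((n + m : ℕ) * (CA * ((n + m : ℕ) * K + K))) * T + X / 2 := by
    calc X ≤ ∑ _j : Fin n ⊕ Fin m, CA * ((((n + m : ℕ) : ℝ≥0∞) * (K * T) +
          ENNReal.ofReal (4 * κ) ^ p * X) + K * T) :=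
          Finset.sum_le_sum fun j _ => (hmain j).trans (by gcongr)
      _ = ((n + m : ℕ) * (CA * ((n + m : ℕ) * K + K))) * T +
          (((n + m : ℕ) : ℝ≥0∞) * (CA * ENNReal.ofReal (4 * κ) ^ p)) * X := by
        rw [Finset.sum_const, Finset.card_univ, Fintype.card_sum, Fintype.card_fin, Fintype.card_fin,
          nsmul_eq_mul]
        ring
      _ ≤ _ := by
        gcongr
        rw [ENNReal.div_eq_inv_mul]
        gcongr
  have hXfin := ENNReal.le_two_mul_of_le_add_half hXtop hXle
  calc ∫⁻ z in U, ‖ρ ^ dirWeight N j0 * dirD (u j0) w z‖ₑ ^ p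
      ≤ ∫⁻ z in U, ‖dirD (e j0) W z‖ₑ ^ p := by
        refine setLIntegral_mono' hUo.measurableSet fun z hz => ?_
        have hWw : dirD (u j0) W z = dirD (u j0) w z := by
          have : W =ᶠ[nhds z] w := by
            filter_upwards [hUo.mem_nhds hz] with y hy
            simp [hW, hχe y hy]
          simp [dirD, this.fderiv_eq]
        refine ENNReal.rpow_le_rpow ?_ hp0.le
        rcases j0 with j | l
        · simp only [dirWeight, pow_zero, one_mul, he, scaledFrame]
          rw [hWw]
        · simp only [dirWeight, he, scaledFrame]
          rw [dirD_smul_dir]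
          beta_reduce
          rw [hWw, enorm_mul, enorm_mul, Real.enorm_of_nonneg (by positivity),
            Real.enorm_of_nonneg hτ0.le]
          gcongr
    _ ≤ ∫⁻ z, ‖dirD (e j0) W z‖ₑ ^ p := setLIntegral_le_lintegral _ _
    _ ≤ X := Finset.single_le_sum (f := fun j => ∫⁻ z, ‖dirD (e j) W z‖ₑ ^ p) (fun _ _ => zero_le)
        (Finset.mem_univ j0)
    _ ≤ _ := hXfin
    _ = _ := by push_cast; ring

end LocalEstimate

section BaseEstimate
variable {n m : ℕ}

theorem lintegral_averaged_swap {R : Set ((Fin n → ℝ) × (Fin n → ℝ))} (hR : MeasurableSet R)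
    {c : (Fin n → ℝ) → ℝ≥0∞} (hc : Measurable c) {f : Pt n m → ℝ≥0∞} (hf : Measurable f) :
    ∫⁻ x0, c x0 * ∫⁻ z in {z : Pt n m | (x0, z.1) ∈ R}, f z =
      ∫⁻ z, f z * ∫⁻ x0 in {x0 | (x0, z.1) ∈ R}, c x0 := by
  have hR1 : ∀ x0, MeasurableSet {z : Pt n m | (x0, z.1) ∈ R} := fun x0 =>
    (measurable_const.prodMk measurable_fst) hR
  have hR2 : ∀ z : Pt n m, MeasurableSet {x0 | (x0, z.1) ∈ R} := fun z =>
    (measurable_id.prodMk measurable_const) hR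
  have hR3 : MeasurableSet {q : (Fin n → ℝ) × Pt n m | (q.1, q.2.1) ∈ R} :=
    (measurable_fst.prodMk (measurable_fst.comp measurable_snd)) hR
  calc ∫⁻ x0, c x0 * ∫⁻ z in {z : Pt n m | (x0, z.1) ∈ R}, f z
      = ∫⁻ x0, ∫⁻ z, {q : (Fin n → ℝ) × Pt n m | (q.1, q.2.1) ∈ R}.indicator
          (fun q => c q.1 * f q.2) (x0, z) := by
        refine lintegral_congr fun x0 => ?_
        rw [← lintegral_indicator (hR1 x0), ← lintegral_const_mul _ (hf.indicator (hR1 x0))]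
        refine lintegral_congr fun z => ?_
        by_cases h : (x0, z.1) ∈ R <;> simp [Set.indicator, h]
    _ = ∫⁻ z, ∫⁻ x0, {q : (Fin n → ℝ) × Pt n m | (q.1, q.2.1) ∈ R}.indicator
          (fun q => c q.1 * f q.2) (x0, z) := by
        refine lintegral_lintegral_swap ?_
        exact (((hc.comp measurable_fst).mul (hf.comp measurable_snd)).indicator hR3).aemeasurable
    _ = _ := by
        refine lintegral_congr fun z => ?_
        rw [← lintegral_indicator (hR2 z), ← lintegral_const_mul _ (hc.indicator (hR2 z))]
        refine lintegral_congr fun x0 => ?_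
        by_cases h : (x0, z.1) ∈ R <;> simp [Set.indicator, h, mul_comm]

theorem measurable_inv_norm_pow : Measurable fun x : Fin n → ℝ => ENNReal.ofReal (‖x‖⁻¹ ^ n) := by
  fun_prop

theorem le_lintegral_ball_average {ε : ℝ} (hε : 0 < ε) (hε8 : ε ≤ 1 / 8) {f : Pt n m → ℝ≥0∞}
    (hf : Measurable f) (hf0 : ∀ z : Pt n m, z.1 = 0 → f z = 0) :
    ENNReal.ofReal ((ε / 2) ^ n) * ∫⁻ z, f z ≤
      ∫⁻ x0 : Fin n → ℝ, ENNReal.ofReal (‖x0‖⁻¹ ^ n) * ∫⁻ z in {z : Pt n m | ‖z.1 - x0‖ < ε * ‖x0‖}, f z := by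
  have hR : MeasurableSet {q : (Fin n → ℝ) × (Fin n → ℝ) | ‖q.2 - q.1‖ < ε * ‖q.1‖} :=
    (isOpen_lt (by fun_prop) (by fun_prop)).measurableSet
  have := lintegral_averaged_swap hR measurable_inv_norm_pow hf
  simp only [Set.mem_ofPred_eq] at this
  rw [this, ← lintegral_const_mul _ hf]
  refine lintegral_mono fun z => ?_
  beta_reduce
  rcases eq_or_ne z.1 0 with h0 | h0
  · rw [hf0 z h0]; simp
  rw [mul_comm]
  gcongr
  have hx : 0 < ‖z.1‖ := norm_pos_iff.2 h0
  have hsub : Metric.ball z.1 (ε / 2 * ‖z.1‖) ⊆ {x0 | ‖z.1 - x0‖ < ε * ‖x0‖} := by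
    intro x0 hx0
    rw [Metric.mem_ball, dist_comm, dist_eq_norm] at hx0
    have h1 := norm_sub_norm_le z.1 x0
    have h2 : ‖z.1‖ / 2 ≤ ‖x0‖ := by nlinarith
    have h3 : ε / 2 * ‖z.1‖ ≤ ε * ‖x0‖ := by nlinarith
    exact lt_of_lt_of_le hx0 h3
  calc ENNReal.ofReal ((ε / 2) ^ n)
      = ENNReal.ofReal ((2 * ‖z.1‖)⁻¹ ^ n) * volume (Metric.ball z.1 (ε / 2 * ‖z.1‖)) := by
        rw [Real.volume_pi_ball _ (by positivity), ← ENNReal.ofReal_mul (by positivity), Fintype.card_fin,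
          ← mul_pow]
        congr 2; field_simp
    _ = ∫⁻ _x0 in Metric.ball z.1 (ε / 2 * ‖z.1‖), ENNReal.ofReal ((2 * ‖z.1‖)⁻¹ ^ n) := by simp
    _ ≤ ∫⁻ x0 in Metric.ball z.1 (ε / 2 * ‖z.1‖), ENNReal.ofReal (‖x0‖⁻¹ ^ n) := by
        refine setLIntegral_mono' measurableSet_ball fun x0 hx0 => ?_
        rw [Metric.mem_ball, dist_comm, dist_eq_norm] at hx0
        have h1 := norm_sub_norm_le z.1 x0
        have h2 := norm_sub_norm_le x0 z.1
        rw [norm_sub_rev] at h2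
        have h3 : 0 < ‖x0‖ := by nlinarith
        have h4 : ‖x0‖ ≤ 2 * ‖z.1‖ := by nlinarith
        gcongr
    _ ≤ _ := lintegral_mono_set hsub

theorem lintegral_ball_average_le {ε : ℝ} (hε8 : ε ≤ 1 / 8) {f : Pt n m → ℝ≥0∞}
    (hn : 1 ≤ n) (hf : Measurable f) :
    ∫⁻ x0 : Fin n → ℝ, ENNReal.ofReal (‖x0‖⁻¹ ^ n) *
      ∫⁻ z in {z : Pt n m | ‖z.1 - x0‖ ≤ 2 * ε * ‖x0‖}, f z ≤ ENNReal.ofReal (4 ^ n) * ∫⁻ z, f z := by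
  have hR : MeasurableSet {q : (Fin n → ℝ) × (Fin n → ℝ) | ‖q.2 - q.1‖ ≤ 2 * ε * ‖q.1‖} :=
    (isClosed_le (by fun_prop) (by fun_prop)).measurableSet
  have := lintegral_averaged_swap hR measurable_inv_norm_pow hf
  simp only [Set.mem_ofPred_eq] at this
  rw [this, ← lintegral_const_mul _ hf]
  refine lintegral_mono fun z => ?_
  beta_reduce
  rw [mul_comm]
  gcongr
  have hmeas : MeasurableSet {x0 : Fin n → ℝ | ‖z.1 - x0‖ ≤ 2 * ε * ‖x0‖} :=
    (isClosed_le (by fun_prop) (by fun_prop)).measurableSet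
  have hb : ∀ x0 ∈ {x0 : Fin n → ℝ | ‖z.1 - x0‖ ≤ 2 * ε * ‖x0‖}, ‖x0‖ ≤ 2 * ‖z.1‖ ∧ ‖z.1‖ ≤ 2 * ‖x0‖ ∧
      ‖z.1 - x0‖ ≤ ‖z.1‖ := by
    intro x0 hx0
    simp only [Set.mem_ofPred_eq] at hx0
    have h1 := norm_sub_norm_le z.1 x0
    have h2 := norm_sub_norm_le x0 z.1
    rw [norm_sub_rev] at h2
    have h3 := norm_nonneg x0
    refine ⟨?_, ?_, ?_⟩ <;> nlinarith
  rcases eq_or_ne z.1 0 with h0 | h0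
  · refine le_trans (setLIntegral_mono' (g := fun _ => 0) hmeas fun x0 hx0 => ?_) (by simp)
    have := (hb x0 hx0).1
    rw [h0, norm_zero, mul_zero] at this
    have : ‖x0‖ = 0 := le_antisymm this (norm_nonneg _)
    rw [this]
    simp [show n ≠ 0 by omega]
  have hx : 0 < ‖z.1‖ := norm_pos_iff.2 h0
  calc ∫⁻ x0 in {x0 : Fin n → ℝ | ‖z.1 - x0‖ ≤ 2 * ε * ‖x0‖}, ENNReal.ofReal (‖x0‖⁻¹ ^ n)
      ≤ ∫⁻ _x0 in {x0 : Fin n → ℝ | ‖z.1 - x0‖ ≤ 2 * ε * ‖x0‖}, ENNReal.ofReal ((2 / ‖z.1‖) ^ n) := by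
        refine setLIntegral_mono' hmeas fun x0 hx0 => ?_
        have h2 := (hb x0 hx0).2.1
        have h3 : 0 < ‖x0‖ := by linarith
        gcongr
        rw [inv_eq_one_div, div_le_div_iff₀ h3 hx]; linarith
    _ ≤ ∫⁻ _x0 in Metric.closedBall z.1 ‖z.1‖, ENNReal.ofReal ((2 / ‖z.1‖) ^ n) := by
        refine lintegral_mono_set fun x0 hx0 => ?_
        rw [Metric.mem_closedBall, dist_comm, dist_eq_norm]
        exact (hb x0 hx0).2.2
    _ = ENNReal.ofReal (4 ^ n) := by
        rw [setLIntegral_const, Real.volume_pi_closedBall _ hx.le, ← ENNReal.ofReal_mul (by positivity),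
          Fintype.card_fin, ← mul_pow]
        congr 2; field_simp; norm_num

theorem exists_base_estimate (hn : 1 ≤ n) (m N a : ℕ) {p : ℝ} (hp : 1 < p) :
    ∃ C : ℝ≥0, ∀ (k : Fin n ⊕ Fin m) {w F G : Pt n m → ℝ},
      IsTest w → IsTest F → IsTest G →
      (∀ z, grusin n m N w z = dirD (unitVec n m k) F z + G z) → dirWeight N k ≤ a + 1 → ∀ j,
      ∫⁻ z : Pt n m, ‖‖z.1‖ ^ (a + 1 + dirWeight N j) * dirD (unitVec n m j) w z‖ₑ ^ p ≤
        C * ((∫⁻ z : Pt n m, ‖‖z.1‖ ^ (a + 1 - dirWeight N k) * F z‖ₑ ^ p) +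
          (∫⁻ z : Pt n m, ‖‖z.1‖ ^ (a + 2) * G z‖ₑ ^ p) + ∫⁻ z : Pt n m, ‖‖z.1‖ ^ a * w z‖ₑ ^ p) := by
  have hp0 : 0 < p := by linarith
  obtain ⟨ε, hε, hε8, C, hC⟩ := exists_local_estimate hn m N hp
  have hd : ∀ j : Fin n ⊕ Fin m, dirWeight N j ≤ N := by rintro (j | j) <;> simp [dirWeight]
  set B : ℝ≥0 := (2 ^ (a + N + 2)) ^ p with hB
  have hBe : (B : ℝ≥0∞) = ENNReal.ofReal (2 ^ (a + N + 2)) ^ p := by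
    rw [hB, ENNReal.coe_rpow_of_nonneg _ hp0.le, ENNReal.ofReal_pow (by norm_num)]; simp
  refine ⟨((2 / ε) ^ n).toNNReal * (B * (C * (B * (4 ^ n : ℝ).toNNReal))), ?_⟩
  intro k w F G hw hF hG heq hk j
  have cmp : ∀ {r r' : ℝ} {b : ℕ} (y : ℝ), 0 ≤ r → 0 ≤ r' → r ≤ 2 * r' → b ≤ a + N + 2 →
      ‖r ^ b * y‖ₑ ^ p ≤ B * ‖r' ^ b * y‖ₑ ^ p := by
    intro r r' b y hr hr' h hb
    rw [hBe, ← ENNReal.mul_rpow_of_nonneg _ _ hp0.le]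
    refine ENNReal.rpow_le_rpow ?_ hp0.le
    rw [enorm_mul, enorm_mul, ← mul_assoc]
    gcongr
    rw [Real.enorm_of_nonneg (by positivity), Real.enorm_of_nonneg (by positivity),
      ← ENNReal.ofReal_mul (by positivity)]
    refine ENNReal.ofReal_le_ofReal ?_
    calc r ^ b ≤ (2 * r') ^ b := by gcongr
      _ = 2 ^ b * r' ^ b := mul_pow _ _ _
      _ ≤ 2 ^ (a + N + 2) * r' ^ b := by gcongr; norm_num
  set f : Pt n m → ℝ≥0∞ := fun z => ‖‖z.1‖ ^ (a + 1 + dirWeight N j) * dirD (unitVec n m j) w z‖ₑ ^ p with hf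
  set h : Pt n m → ℝ≥0∞ := fun z => ‖‖z.1‖ ^ (a + 1 - dirWeight N k) * F z‖ₑ ^ p +
    ‖‖z.1‖ ^ (a + 2) * G z‖ₑ ^ p + ‖‖z.1‖ ^ a * w z‖ₑ ^ p with hh
  have meas : ∀ (b : ℕ) {g : Pt n m → ℝ}, Continuous g → Measurable fun z : Pt n m => ‖‖z.1‖ ^ b * g z‖ₑ ^ p :=
    fun b g hg => ((by fun_prop : Continuous fun z : Pt n m => ‖z.1‖ ^ b * g z)).measurable.enorm.pow_const p
  have hfm : Measurable f := meas _ (hw.dirD _).continuous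
  have hhm : Measurable h := ((meas _ hF.continuous).add (meas _ hG.continuous)).add (meas _ hw.continuous)
  have hf0 : ∀ z : Pt n m, z.1 = 0 → f z = 0 := by
    intro z hz; simp only [hf, hz, norm_zero]
    rw [zero_pow (by omega), zero_mul, enorm_zero, ENNReal.zero_rpow_of_pos hp0]
  have hloc : ∀ x0 : Fin n → ℝ, x0 ≠ 0 → ∫⁻ z in {z : Pt n m | ‖z.1 - x0‖ < ε * ‖x0‖}, f z ≤
      B * (C * (B * ∫⁻ z in {z : Pt n m | ‖z.1 - x0‖ ≤ 2 * ε * ‖x0‖}, h z)) := by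
    intro x0 hx0
    set ρ := ‖x0‖ with hρd
    have hρ : 0 < ρ := norm_pos_iff.2 hx0
    have hSm : MeasurableSet {z : Pt n m | ‖z.1 - x0‖ ≤ 2 * ε * ρ} :=
      (isClosed_le (by fun_prop) (by fun_prop)).measurableSet
    have hUm : MeasurableSet {z : Pt n m | ‖z.1 - x0‖ < ε * ρ} :=
      (isOpen_lt (by fun_prop) (by fun_prop)).measurableSet
    have htop : ENNReal.ofReal (ρ ^ (a + 1)) ^ p ≠ ⊤ :=
      ENNReal.rpow_ne_top_of_nonneg hp0.le ENNReal.ofReal_ne_top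
    have resc : ∀ y : ℝ, ENNReal.ofReal (ρ ^ (a + 1)) ^ p * ‖y‖ₑ ^ p = ‖ρ ^ (a + 1) * y‖ₑ ^ p := by
      intro y
      rw [enorm_mul, ENNReal.mul_rpow_of_nonneg _ _ hp0.le,
        Real.enorm_of_nonneg (r := ρ ^ (a + 1)) (by positivity)]
    calc ∫⁻ z in {z : Pt n m | ‖z.1 - x0‖ < ε * ρ}, f z
        ≤ ∫⁻ z in {z : Pt n m | ‖z.1 - x0‖ < ε * ρ}, B * (ENNReal.ofReal (ρ ^ (a + 1)) ^ p *
            ‖ρ ^ dirWeight N j * dirD (unitVec n m j) w z‖ₑ ^ p) := by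
          refine setLIntegral_mono' hUm fun z hz => ?_
          rw [resc, ← mul_assoc, ← pow_add]
          have h1 := norm_sub_norm_le z.1 x0
          have hz' : ‖z.1 - x0‖ < ε * ρ := hz
          exact cmp _ (norm_nonneg _) hρ.le (by nlinarith) (by have := hd j; omega)
      _ = B * (ENNReal.ofReal (ρ ^ (a + 1)) ^ p * ∫⁻ z in {z : Pt n m | ‖z.1 - x0‖ < ε * ρ},
            ‖ρ ^ dirWeight N j * dirD (unitVec n m j) w z‖ₑ ^ p) := by
          rw [lintegral_const_mul' _ _ ENNReal.coe_ne_top, lintegral_const_mul' _ _ htop]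
      _ ≤ B * (ENNReal.ofReal (ρ ^ (a + 1)) ^ p * (C * ∫⁻ z in {z : Pt n m | ‖z.1 - x0‖ ≤ 2 * ε * ρ},
          (‖(ρ ^ dirWeight N k)⁻¹ * F z‖ₑ ^ p + ‖ρ * G z‖ₑ ^ p + ‖ρ⁻¹ * w z‖ₑ ^ p))) := by
          gcongr
          exact hC k hw hF hG heq x0 hx0 j
      _ = B * (C * ∫⁻ z in {z : Pt n m | ‖z.1 - x0‖ ≤ 2 * ε * ρ}, ENNReal.ofReal (ρ ^ (a + 1)) ^ p *
          (‖(ρ ^ dirWeight N k)⁻¹ * F z‖ₑ ^ p + ‖ρ * G z‖ₑ ^ p + ‖ρ⁻¹ * w z‖ₑ ^ p)) := by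
          rw [lintegral_const_mul' _ _ htop]; ring
      _ ≤ B * (C * ∫⁻ z in {z : Pt n m | ‖z.1 - x0‖ ≤ 2 * ε * ρ}, B * h z) := by
          gcongr B * (C * ?_)
          refine setLIntegral_mono' hSm fun z hz => ?_
          have h1 := norm_sub_norm_le x0 z.1
          rw [norm_sub_rev] at h1
          have hz' : ‖z.1 - x0‖ ≤ 2 * ε * ρ := hz
          have h2 : ρ ≤ 2 * ‖z.1‖ := by nlinarith
          rw [mul_add, mul_add, resc, resc, resc, hh]
          simp only [mul_add]
          gcongr
          · have : ρ ^ (a + 1) * ((ρ ^ dirWeight N k)⁻¹ * F z) = ρ ^ (a + 1 - dirWeight N k) * F z := by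
              rw [pow_sub₀ _ hρ.ne' hk]; ring
            rw [this]
            exact cmp _ hρ.le (norm_nonneg _) h2 (by omega)
          · rw [← mul_assoc, ← pow_succ]
            exact cmp _ hρ.le (norm_nonneg _) h2 (by omega)
          · have : ρ ^ (a + 1) * (ρ⁻¹ * w z) = ρ ^ a * w z := by
              rw [pow_succ]; field_simp
            rw [this]
            exact cmp _ hρ.le (norm_nonneg _) h2 (by omega)
      _ = _ := by rw [lintegral_const_mul' _ _ ENNReal.coe_ne_top]
  have hInt : ENNReal.ofReal ((ε / 2) ^ n) * ∫⁻ z, f z ≤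
      B * (C * (B * (ENNReal.ofReal (4 ^ n) * ∫⁻ z, h z))) := by
    refine (le_lintegral_ball_average hε hε8 hfm hf0).trans ?_
    calc _ ≤ ∫⁻ x0 : Fin n → ℝ, (B * (C * B)) * (ENNReal.ofReal (‖x0‖⁻¹ ^ n) *
            ∫⁻ z in {z : Pt n m | ‖z.1 - x0‖ ≤ 2 * ε * ‖x0‖}, h z) := by
          refine lintegral_mono fun x0 => ?_
          rcases eq_or_ne x0 0 with rfl | h0
          · simp [show n ≠ 0 by omega]
          · calc _ ≤ ENNReal.ofReal (‖x0‖⁻¹ ^ n) * (B * (C * (B * ∫⁻ z in {z : Pt n m | ‖z.1 - x0‖ ≤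
                  2 * ε * ‖x0‖}, h z))) := by
                  gcongr; exact hloc x0 h0
              _ = _ := by ring
      _ = (B * (C * B)) * ∫⁻ x0 : Fin n → ℝ, ENNReal.ofReal (‖x0‖⁻¹ ^ n) *
            ∫⁻ z in {z : Pt n m | ‖z.1 - x0‖ ≤ 2 * ε * ‖x0‖}, h z := by
          rw [lintegral_const_mul']
          exact ENNReal.mul_ne_top ENNReal.coe_ne_top (ENNReal.mul_ne_top ENNReal.coe_ne_top ENNReal.coe_ne_top)
      _ ≤ (B * (C * B)) * (ENNReal.ofReal (4 ^ n) * ∫⁻ z, h z) := by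
          gcongr; exact lintegral_ball_average_le hε8 hn hhm
      _ = _ := by ring
  have hhsum : ∫⁻ z, h z = (∫⁻ z : Pt n m, ‖‖z.1‖ ^ (a + 1 - dirWeight N k) * F z‖ₑ ^ p) +
      (∫⁻ z : Pt n m, ‖‖z.1‖ ^ (a + 2) * G z‖ₑ ^ p) + ∫⁻ z : Pt n m, ‖‖z.1‖ ^ a * w z‖ₑ ^ p := by
    rw [hh, lintegral_add_right _ (meas _ hw.continuous), lintegral_add_right _ (meas _ hG.continuous)]
  rw [← hhsum]
  have hone : ENNReal.ofReal ((2 / ε) ^ n) * ENNReal.ofReal ((ε / 2) ^ n) = 1 := by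
    rw [← ENNReal.ofReal_mul (by positivity), ← mul_pow]
    have : 2 / ε * (ε / 2) = 1 := by field_simp
    rw [this]; simp
  calc ∫⁻ z, f z = ENNReal.ofReal ((2 / ε) ^ n) * (ENNReal.ofReal ((ε / 2) ^ n) * ∫⁻ z, f z) := by
        rw [← mul_assoc, hone, one_mul]
    _ ≤ ENNReal.ofReal ((2 / ε) ^ n) * (B * (C * (B * (ENNReal.ofReal (4 ^ n) * ∫⁻ z, h z)))) := by gcongr
    _ = _ := by
      push_cast
      simp only [ENNReal.ofReal]
      ring

end BaseEstimate

section Kernel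

open scoped FourierTransform SchwartzMap RealInnerProductSpace

variable (E : Type*) [NormedAddCommGroup E] [InnerProductSpace ℝ E] [FiniteDimensional ℝ E]
  [MeasurableSpace E] [BorelSpace E]

/-- A real Schwartz function of integral one which reproduces under convolution with its
dilates at comparatively small scales. -/
theorem exists_reproducing_kernel : ∃ χ : 𝓢(E, ℝ), ∫ w, χ w = 1 ∧
    ∀ ε : ℝ, 0 ≤ ε → ε ≤ 1 / 2 → ∀ v, ∫ w, χ (v - ε • w) * χ w = χ v := by
  let b : ContDiffBump (0 : E) := ⟨1, 2, one_pos, one_lt_two⟩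
  have hbc : HasCompactSupport (fun x => (b x : ℂ)) := by
    exact b.hasCompactSupport.comp_left (g := fun x : ℝ => (x : ℂ)) (by simp)
  let g : 𝓢(E, ℂ) := hbc.toSchwartzMap (Complex.ofRealCLM.contDiff.comp b.contDiff)
  have hg : ∀ x, g x = (b x : ℂ) := fun x => rfl
  have hgneg : ∀ x, g (-x) = g x := fun x => by rw [hg, hg, b.neg]
  let k : 𝓢(E, ℂ) := 𝓕⁻ g
  have hk : ∀ v, k v = ∫ ξ, (Real.fourierChar ⟪ξ, v⟫) • g ξ := fun v => by
    have : k v = 𝓕⁻ (g : E → ℂ) v := by rw [← SchwartzMap.fourierInv_coe]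
    rw [this, Real.fourierInv_eq]
  have hFk : ∀ ξ, g ξ = ∫ w, (Real.fourierChar (-⟪w, ξ⟫)) • k w := fun ξ => by
    have h1 : 𝓕 k = g := FourierTransform.fourier_fourierInv_eq g
    rw [← Real.fourier_eq, ← SchwartzMap.fourier_coe, h1]
  have hneg : ∀ v, ∫ ξ, (Real.fourierChar (-⟪ξ, v⟫)) • g ξ = k v := fun v => by
    rw [hk, ← integral_neg_eq_self]
    refine integral_congr_ae (Filter.Eventually.of_forall fun ξ => ?_)
    simp only [inner_neg_left, neg_neg, hgneg]
  have hreal : ∀ v, ((k v).re : ℂ) = k v := fun v => by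
    rw [← Complex.conj_eq_iff_re]
    conv_rhs => rw [← hneg]
    rw [hk, ← integral_conj]
    refine integral_congr_ae (Filter.Eventually.of_forall fun ξ => ?_)
    simp [Circle.smul_def, hg]
  let χ : 𝓢(E, ℝ) := SchwartzMap.postcompCLM Complex.reCLM k
  have hχ : ∀ v, (χ v : ℂ) = k v := fun v => hreal v
  refine ⟨χ, ?_, fun ε hε0 hε v => ?_⟩
  · have h := hFk 0
    simp only [inner_zero_right, neg_zero, AddChar.map_zero_eq_one, one_smul] at h
    have h1 : ((∫ w, χ w : ℝ) : ℂ) = 1 := by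
      rw [← integral_complex_ofReal]
      simp only [hχ]
      rw [← h, hg, b.one_of_mem_closedBall (by simp [b])]
      simp
    exact_mod_cast h1
  · have h1 : ((∫ w, χ (v - ε • w) * χ w : ℝ) : ℂ) = (χ v : ℂ) := by
      rw [← integral_complex_ofReal]
      push_cast
      simp only [hχ]
      let L : E →ₗ[ℝ] E →ₗ[ℝ] ℝ := ε • innerₗ E
      have hL : ∀ x y, L x y = ε * ⟪x, y⟫ := fun x y => by simp [L]
      let f : E → ℂ := fun ξ => (Real.fourierChar ⟪ξ, v⟫) • g ξ
      have hf : Integrable f := by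
        refine (g.integrable (μ := volume)).mono ?_ (Filter.Eventually.of_forall fun ξ => ?_)
        · have : Continuous fun ξ : E => Real.fourierChar ⟪ξ, v⟫ :=
            Real.continuous_fourierChar.comp (by fun_prop)
          exact (this.smul g.continuous).aestronglyMeasurable
        · simp [f]
      have h2 := VectorFourier.integral_fourierIntegral_smul_eq_flip (e := Real.fourierChar)
        (μ := volume) (ν := volume) (L := L) (f := f) (g := k) Real.continuous_fourierChar
        (by simp only [hL]; fun_prop) hf k.integrable
      have h3 : ∀ w, VectorFourier.fourierIntegral Real.fourierChar volume L f w
          = k (v - ε • w) := fun w => by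
        rw [hk]
        refine integral_congr_ae (Filter.Eventually.of_forall fun ξ => ?_)
        simp only [f, smul_smul, ← AddChar.map_add_eq_mul, hL, inner_sub_right, inner_smul_right]
        congr 2
        ring_nf
      have h4 : ∀ ξ, VectorFourier.fourierIntegral Real.fourierChar volume L.flip k ξ
          = g (ε • ξ) := fun ξ => by
        rw [hFk]
        refine integral_congr_ae (Filter.Eventually.of_forall fun w => ?_)
        simp only [LinearMap.flip_apply, hL, inner_smul_right, real_inner_comm]
      simp only [h3, h4, smul_eq_mul] at h2
      rw [h2, hk]
      refine integral_congr_ae (Filter.Eventually.of_forall fun ξ => ?_)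
      by_cases hξ : ‖ξ‖ ≤ 2
      · have : g (ε • ξ) = 1 := by
          rw [hg, b.one_of_mem_closedBall]
          · simp
          · simp only [mem_closedBall_zero_iff, norm_smul, Real.norm_of_nonneg hε0]
            calc ε * ‖ξ‖ ≤ 1 / 2 * 2 := by gcongr
              _ = 1 := by norm_num
        simp only [this, f, mul_one]
      · have : g ξ = 0 := by
          rw [hg, b.zero_of_le_dist]
          · simp
          · simpa using le_of_lt (not_le.mp hξ)
        simp [f, this]
    exact_mod_cast h1

end Kernel

section Smoothing

open scoped SchwartzMap
open Topology Filter

variable {V : Type*} [NormedAddCommGroup V] [NormedSpace ℝ V] [FiniteDimensional ℝ V]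
variable {E : Type*} [NormedAddCommGroup E] [InnerProductSpace ℝ E] [FiniteDimensional ℝ E]
  [MeasurableSpace E] [BorelSpace E]

/-- Averaging at scale `r` against the kernel `χ`, along the image of `L`. -/
noncomputable def smoothing (χ : 𝓢(E, ℝ)) (L : E →L[ℝ] V) (r : ℝ) (f : V → ℝ) : V → ℝ :=
  avg volume χ (fun w => r • L w) f

variable {χ : 𝓢(E, ℝ)} {L : E →L[ℝ] V}

theorem integrable_shear_mul (χ : 𝓢(E, ℝ)) (ε : ℝ) :
    Integrable (fun q : E × E => χ (q.2 - ε • q.1) * χ q.1) (volume.prod volume) := by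
  have hc : Continuous fun q : E × E => χ (q.2 - ε • q.1) * χ q.1 := by
    have := χ.continuous
    fun_prop
  rw [integrable_prod_iff hc.aestronglyMeasurable]
  refine ⟨Eventually.of_forall fun w => ?_, ?_⟩
  · exact ((χ.integrable (μ := volume)).comp_sub_right (ε • w)).mul_const (χ w)
  · have : (fun w : E => ∫ v, ‖χ (v - ε • w) * χ w‖) = fun w => (∫ v, ‖χ v‖) * ‖χ w‖ := by
      funext w
      simp only [norm_mul]
      rw [integral_mul_const, integral_sub_right_eq_self (fun v => ‖χ v‖) (ε • w)]
    simp only at this ⊢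
    rw [this]
    exact (χ.integrable (μ := volume)).norm.const_mul _

theorem smoothing_smoothing
    (hχ : ∀ ε : ℝ, 0 ≤ ε → ε ≤ 1 / 2 → ∀ v, ∫ w, χ (v - ε • w) * χ w = χ v)
    {r R : ℝ} (hr : 0 ≤ r) (hR : 0 < R) (hrR : 2 * r ≤ R) {f : V → ℝ} (hf : Continuous f)
    {C : ℝ} (hC : ∀ x, |f x| ≤ C) :
    smoothing χ L R (smoothing χ L r f) = smoothing χ L R f := by
  have hχc := χ.continuous
  funext x
  simp only [smoothing, avg]
  set ε := r / R with hε
  have hε0 : 0 ≤ ε := by positivity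
  have hε1 : ε ≤ 1 / 2 := by rw [hε, div_le_iff₀ hR]; linarith
  have hRε : R * ε = r := by rw [hε]; field_simp
  have hi2 : Integrable (fun q : E × E => (χ (q.2 - ε • q.1) * χ q.1) * f (x + R • L q.2))
      (volume.prod volume) :=
    (integrable_shear_mul χ ε).mul_bdd (c := C)
      (by fun_prop : Continuous fun q : E × E => f (x + R • L q.2)).aestronglyMeasurable
      (Eventually.of_forall fun _ => hC _)
  have hi1 : Integrable (fun q : E × E => (χ q.1 * χ q.2) * f (x + R • L q.1 + r • L q.2))
      (volume.prod volume) :=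
    ((χ.integrable (μ := volume)).mul_prod (χ.integrable (μ := volume))).mul_bdd (c := C)
      (by fun_prop : Continuous fun q : E × E => f (x + R • L q.1 + r • L q.2)).aestronglyMeasurable
      (Eventually.of_forall fun _ => hC _)
  calc ∫ w, χ w * ∫ w', χ w' * f (x + R • L w + r • L w')
      = ∫ w, ∫ w', (χ w * χ w') * f (x + R • L w + r • L w') := by
        congr 1; funext w; rw [← integral_const_mul]; congr 1; funext w'; ring
    _ = ∫ w', ∫ w, (χ w * χ w') * f (x + R • L w + r • L w') := integral_integral_swap hi1
    _ = ∫ w', ∫ w, (χ (w - ε • w') * χ w') * f (x + R • L w) := by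
        congr 1; funext w'
        rw [← integral_sub_right_eq_self _ (ε • w')]
        congr 1; funext w
        congr 2
        simp only [map_sub, map_smul, smul_sub, smul_smul, hRε]
        abel
    _ = ∫ w, ∫ w', (χ (w - ε • w') * χ w') * f (x + R • L w) := integral_integral_swap hi2
    _ = ∫ w, χ w * f (x + R • L w) := by
        congr 1; funext w
        rw [integral_mul_const, hχ ε hε0 hε1]

theorem smoothing_sub (r : ℝ) {f g : V → ℝ} (hf : Continuous f) (hg : Continuous g)
    {C C' : ℝ} (hC : ∀ x, |f x| ≤ C) (hC' : ∀ x, |g x| ≤ C') :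
    smoothing χ L r (fun x => f x - g x) = fun x => smoothing χ L r f x - smoothing χ L r g x := by
  funext x
  simp only [smoothing, avg, mul_sub]
  exact integral_sub (integrable_avg_integrand χ.integrable (by fun_prop) hf hC x)
    (integrable_avg_integrand χ.integrable (by fun_prop) hg hC' x)

theorem dirD_smoothing (r : ℝ) {f : V → ℝ} (hf : IsTest f) (v : V) :
    dirD v (smoothing χ L r f) = smoothing χ L r (dirD v f) :=
  dirD_avg χ.integrable (by fun_prop) hf v

theorem contDiff_smoothing (r : ℝ) {f : V → ℝ} (hf : IsTest f) :
    ContDiff ℝ (⊤ : ℕ∞) (smoothing χ L r f) :=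
  contDiff_avg χ.integrable (by fun_prop) hf

theorem abs_smoothing_le (r : ℝ) {f : V → ℝ} {C : ℝ} (hC : ∀ x, |f x| ≤ C) (x : V) :
    |smoothing χ L r f x| ≤ (∫ w, |χ w|) * C :=
  abs_avg_le χ.integrable hC x

/-- A difference of averages at scales below `R / 2` is recovered from its increments at scale
`R`. -/
theorem sub_smoothing_eq_integral (h1 : ∫ w, χ w = 1)
    (hχ : ∀ ε : ℝ, 0 ≤ ε → ε ≤ 1 / 2 → ∀ v, ∫ w, χ (v - ε • w) * χ w = χ v)
    {r r' R : ℝ} (hr : 0 ≤ r) (hr' : 0 ≤ r') (hR : 0 < R) (hrR : 2 * r ≤ R) (hrR' : 2 * r' ≤ R)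
    {f : V → ℝ} (hf : IsTest f) {u : V → ℝ}
    (hu : u = fun x => smoothing χ L r f x - smoothing χ L r' f x) (x : V) :
    u x = ∫ w, χ w * (u x - u (x + R • L w)) := by
  obtain ⟨C, -, hC⟩ := hf.exists_bound
  have hc : Continuous u := by
    rw [hu]; exact (contDiff_smoothing r hf).continuous.sub (contDiff_smoothing r' hf).continuous
  have hub : ∀ x, |u x| ≤ (∫ w, |χ w|) * C + (∫ w, |χ w|) * C := fun x => by
    rw [hu]
    exact (abs_sub _ _).trans (add_le_add (abs_smoothing_le r hC x) (abs_smoothing_le r' hC x))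
  have hz : smoothing χ L R u x = 0 := by
    rw [hu, smoothing_sub R (contDiff_smoothing r hf).continuous
      (contDiff_smoothing r' hf).continuous (abs_smoothing_le r hC) (abs_smoothing_le r' hC),
      smoothing_smoothing hχ hr hR hrR hf.continuous hC,
      smoothing_smoothing hχ hr' hR hrR' hf.continuous hC]
    simp
  simp only [mul_sub]
  rw [integral_sub (χ.integrable.mul_const _)
    (integrable_avg_integrand χ.integrable (by fun_prop) hc hub x), integral_mul_const, h1]
  have : ∫ w, χ w * u (x + R • L w) = 0 := hz
  rw [this]; simp

theorem tendsto_smoothing_zero (h1 : ∫ w, χ w = 1) {f : V → ℝ} (hf : IsTest f) {r : ℕ → ℝ}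
    (hr : Tendsto r atTop (𝓝 0)) (x : V) :
    Tendsto (fun k => smoothing χ L (r k) f x) atTop (𝓝 (f x)) := by
  obtain ⟨C, -, hC⟩ := hf.exists_bound
  have hfc := hf.continuous
  have e : f x = ∫ w, χ w * f x := by rw [integral_mul_const, h1, one_mul]
  rw [e]
  refine tendsto_integral_of_dominated_convergence (fun w => |χ w| * C) ?_
    (χ.integrable.abs.mul_const C) ?_ ?_
  · intro k
    have := χ.continuous
    exact (by fun_prop : Continuous fun w => χ w * f (x + r k • L w)).aestronglyMeasurable
  · intro k
    refine Eventually.of_forall fun w => ?_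
    rw [norm_mul]
    exact mul_le_mul_of_nonneg_left (hC _) (abs_nonneg _)
  · refine Eventually.of_forall fun w => Tendsto.const_mul _ ?_
    have h2 : Tendsto (fun k => x + r k • L w) atTop (𝓝 (x + (0 : ℝ) • L w)) :=
      tendsto_const_nhds.add (hr.smul_const _)
    simp only [zero_smul, add_zero] at h2
    exact (hfc.tendsto x).comp h2

theorem tendsto_smoothing_atTop [Nontrivial E] (hL : Function.Injective L) {f : V → ℝ}
    (hf : IsTest f) {r : ℕ → ℝ} (hr : Tendsto r atTop atTop) (x : V) :
    Tendsto (fun k => smoothing χ L (r k) f x) atTop (𝓝 0) := by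
  obtain ⟨C, -, hC⟩ := hf.exists_bound
  have hfc := hf.continuous
  have e : (0 : ℝ) = ∫ w : E, (0 : ℝ) := by simp
  rw [e]
  refine tendsto_integral_of_dominated_convergence (fun w => |χ w| * C) ?_
    (χ.integrable.abs.mul_const C) ?_ ?_
  · intro k
    have := χ.continuous
    exact (by fun_prop : Continuous fun w => χ w * f (x + r k • L w)).aestronglyMeasurable
  · intro k
    refine Eventually.of_forall fun w => ?_
    rw [norm_mul]
    exact mul_le_mul_of_nonneg_left (hC _) (abs_nonneg _)
  · have h0 : ∀ᵐ w : E, w ≠ 0 := by simp [ae_iff]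
    filter_upwards [h0] with w hw
    have hLw : 0 < ‖L w‖ := norm_pos_iff.2 fun h => hw (hL (by simpa using h))
    obtain ⟨B, hB⟩ := hf.2.isCompact.isBounded.exists_norm_le
    refine tendsto_const_nhds.congr' ?_
    filter_upwards [hr.eventually_gt_atTop ((B + ‖x‖) / ‖L w‖), hr.eventually_ge_atTop 0] with k hk hk0
    have hnot : x + r k • L w ∉ tsupport f := fun h => by
      have h3 := hB _ h
      have h4 : ‖r k • L w‖ ≤ ‖x + r k • L w‖ + ‖x‖ := by
        calc ‖r k • L w‖ = ‖(x + r k • L w) - x‖ := by congr 1; abel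
          _ ≤ _ := norm_sub_le _ _
      rw [norm_smul, Real.norm_of_nonneg hk0] at h4
      rw [div_lt_iff₀ hLw] at hk
      linarith
    rw [image_eq_zero_of_notMem_tsupport hnot, mul_zero]

variable [MeasurableSpace V] [BorelSpace V]

/-- A derivative of an average costs one power of the scale. -/
theorem lintegral_weighted_dirD_smoothing_le (μ : Measure V) [μ.IsAddHaarMeasure] {p : ℝ}
    (hp : 1 ≤ p) {r : ℝ} (hr : 0 < r) (χ : 𝓢(E, ℝ)) (e : E) {f : V → ℝ} (hf : IsTest f)
    {ω : V → ℝ} (hω : Continuous ω) (hinv : ∀ x w, ω (x + L w) = ω x) :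
    ∫⁻ x, ‖ω x * dirD (L e) (smoothing χ L r f) x‖ₑ ^ p ∂μ ≤
      (ENNReal.ofReal r⁻¹) ^ p * (∫⁻ w, ‖fderiv ℝ χ w e‖ₑ) ^ p * ∫⁻ x, ‖ω x * f x‖ₑ ^ p ∂μ := by
  have hp0 : 0 < p := by linarith
  have hfc := hf.continuous
  have hd : Integrable (fun w => fderiv ℝ χ w e) :=
    (SchwartzMap.evalCLM ℝ E ℝ e (SchwartzMap.fderivCLM ℝ E ℝ χ)).integrable
  have hdχ : Differentiable ℝ χ := (χ.smooth 1).differentiable (by simp)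
  obtain ⟨C, -, hC⟩ := hf.exists_bound
  obtain ⟨C', -, hC'⟩ := (hf.dirD (L e)).exists_bound
  have key : ∀ x, ω x * dirD (L e) (smoothing χ L r f) x =
      (-r⁻¹) * avg volume (fun w => fderiv ℝ χ w e) (fun w => r • L w) (fun z => ω z * f z) x := by
    intro x
    rw [dirD_smoothing r hf]
    have hline : ∀ w, HasFDerivAt (fun w => f (x + r • L w))
        ((fderiv ℝ f (x + r • L w)).comp (r • L)) w := fun w => by
      have h := (r • L).hasFDerivAt (x := w)
      exact ((hf.differentiable _).hasFDerivAt.comp w (h.const_add x))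
    have hdir : dirD e (fun w => f (x + r • L w)) = fun w => r * dirD (L e) f (x + r • L w) := by
      funext w
      simp [dirD, (hline w).fderiv]
    have hibp := integral_mul_dirD (volume : Measure E) (f := χ) (g := fun w => f (x + r • L w)) e
      hdχ (fun w => (hline w).differentiableAt)
      (integrable_avg_integrand hd (by fun_prop) hfc hC x)
      (by
        rw [hdir]
        have := (integrable_avg_integrand (χ.integrable (μ := volume)) (A := fun w => r • L w)
          (by fun_prop) (hf.dirD (L e)).continuous hC' x).const_mul r
        refine this.congr (Eventually.of_forall fun w => ?_)
        simp only; ring)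
      (integrable_avg_integrand χ.integrable (by fun_prop) hfc hC x)
    rw [hdir] at hibp
    have h1 : ∫ w, χ w * (r * dirD (L e) f (x + r • L w)) =
        r * smoothing χ L r (dirD (L e) f) x := by
      rw [smoothing, avg, ← integral_const_mul]; congr 1; funext w; ring
    have h2 : avg volume (fun w => fderiv ℝ χ w e) (fun w => r • L w) (fun z => ω z * f z) x =
        ω x * ∫ w, dirD e χ w * f (x + r • L w) := by
      rw [avg, ← integral_const_mul]; congr 1; funext w
      rw [← map_smul, hinv]
      simp only [dirD]; ring
    simp only [h1] at hibp
    rw [h2]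
    have h3 : smoothing χ L r (dirD (L e) f) x = r⁻¹ * -∫ w, dirD e χ w * f (x + r • L w) := by
      rw [← hibp]; field_simp
    rw [h3]; ring
  have h := lintegral_avg_rpow_le (ν := (volume : Measure E)) (A := fun w => r • L w) μ hp
    hd.1.aemeasurable (by fun_prop) (hω.mul hfc)
  simp only [key, enorm_mul, ENNReal.mul_rpow_of_nonneg _ _ hp0.le]
  rw [lintegral_const_mul' _ _ (ENNReal.rpow_ne_top_of_nonneg hp0.le (by simp)), mul_assoc, enorm_neg,
    Real.enorm_of_nonneg (r := r⁻¹) (by positivity)]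
  refine mul_le_mul_right (h.trans (le_of_eq ?_)) _
  simp [enorm_mul, ENNReal.mul_rpow_of_nonneg _ _ hp0.le]

end Smoothing

section Regular

open scoped SchwartzMap
open Topology Filter

variable {n m : ℕ}

/-- Smooth functions supported in a slab `‖x‖ ≤ R` all of whose derivatives are bounded and
integrable. -/
def IsReg (u : Pt n m → ℝ) : Prop :=
  ContDiff ℝ (⊤ : ℕ∞) u ∧ (∃ R, ∀ z : Pt n m, R < ‖z.1‖ → u z = 0) ∧
    ∀ l : List (Pt n m), Integrable (l.foldr dirD u) ∧ ∃ C, ∀ z, |l.foldr dirD u z| ≤ C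

theorem IsReg.continuous {u : Pt n m → ℝ} (hu : IsReg u) : Continuous u := hu.1.continuous

theorem IsReg.differentiable {u : Pt n m → ℝ} (hu : IsReg u) : Differentiable ℝ u :=
  hu.1.differentiable (by simp)

theorem IsReg.integrable {u : Pt n m → ℝ} (hu : IsReg u) : Integrable u := (hu.2.2 []).1

theorem IsReg.exists_bound {u : Pt n m → ℝ} (hu : IsReg u) : ∃ C, 0 ≤ C ∧ ∀ z, |u z| ≤ C := by
  obtain ⟨C, hC⟩ := (hu.2.2 []).2
  exact ⟨C, (abs_nonneg _).trans (hC 0), hC⟩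

theorem IsReg.dirD {u : Pt n m → ℝ} (hu : IsReg u) (v : Pt n m) : IsReg (dirD v u) := by
  refine ⟨hu.1.dirD v, ?_, fun l => ?_⟩
  · obtain ⟨R, hR⟩ := hu.2.1
    have hS : IsClosed {z : Pt n m | ‖z.1‖ ≤ R} := isClosed_le (by fun_prop) (by fun_prop)
    refine ⟨R, fun z hz => dirD_eq_zero_of_notMem hS (fun z hz => hR z ?_) v z ?_⟩
    · simpa using hz
    · simpa using hz
  · have h := hu.2.2 (l ++ [v])
    rw [List.foldr_append] at h
    exact h

theorem dirD_foldr_sub {f g : Pt n m → ℝ} (hf : ContDiff ℝ (⊤ : ℕ∞) f)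
    (hg : ContDiff ℝ (⊤ : ℕ∞) g) (l : List (Pt n m)) :
    ContDiff ℝ (⊤ : ℕ∞) (l.foldr dirD f) ∧ ContDiff ℝ (⊤ : ℕ∞) (l.foldr dirD g) ∧
    l.foldr dirD (fun x => f x - g x) = fun x => l.foldr dirD f x - l.foldr dirD g x := by
  induction l with
  | nil => exact ⟨hf, hg, rfl⟩
  | cons v l ih =>
    obtain ⟨h1, h2, h3⟩ := ih
    simp only [List.foldr_cons]
    exact ⟨h1.dirD v, h2.dirD v, by
      rw [h3, dirD_sub v (h1.differentiable (by simp)) (h2.differentiable (by simp))]⟩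

theorem IsReg.sub {f g : Pt n m → ℝ} (hf : IsReg f) (hg : IsReg g) :
    IsReg (fun x => f x - g x) := by
  refine ⟨hf.1.sub hg.1, ?_, fun l => ?_⟩
  · obtain ⟨R, hR⟩ := hf.2.1
    obtain ⟨R', hR'⟩ := hg.2.1
    refine ⟨max R R', fun z hz => ?_⟩
    beta_reduce
    rw [hR z ((le_max_left _ _).trans_lt hz), hR' z ((le_max_right _ _).trans_lt hz), sub_zero]
  · rw [(dirD_foldr_sub hf.1 hg.1 l).2.2]
    obtain ⟨C, hC⟩ := (hf.2.2 l).2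
    obtain ⟨C', hC'⟩ := (hg.2.2 l).2
    exact ⟨(hf.2.2 l).1.sub (hg.2.2 l).1, C + C',
      fun z => (abs_sub _ _).trans (add_le_add (hC z) (hC' z))⟩

theorem IsReg.smoothing {E : Type*} [NormedAddCommGroup E] [InnerProductSpace ℝ E]
    [FiniteDimensional ℝ E] [MeasurableSpace E] [BorelSpace E] (χ : 𝓢(E, ℝ)) {L : E →L[ℝ] Pt n m}
    (hL : ∀ w, (L w).1 = 0) (r : ℝ) {f : Pt n m → ℝ} (hf : IsTest f) :
    IsReg (smoothing χ L r f) := by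
  refine ⟨contDiff_smoothing r hf, ?_, fun l => ?_⟩
  · obtain ⟨R, hR⟩ := hf.2.isCompact.isBounded.exists_norm_le
    refine ⟨R, fun z hz => integral_eq_zero_of_ae (Eventually.of_forall fun w => ?_)⟩
    have : z + r • L w ∉ tsupport f := fun h => by
      have h1 := (norm_fst_le _).trans (hR _ h)
      simp [hL] at h1
      linarith
    simp [image_eq_zero_of_notMem_tsupport this]
  · have key : IsTest (l.foldr _root_.dirD f) ∧
        l.foldr _root_.dirD (_root_.smoothing χ L r f) =
          _root_.smoothing χ L r (l.foldr _root_.dirD f) := by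
      induction l with
      | nil => exact ⟨hf, rfl⟩
      | cons v l ih =>
        simp only [List.foldr_cons]
        exact ⟨ih.1.dirD v, by rw [ih.2, dirD_smoothing r ih.1]⟩
    rw [key.2]
    obtain ⟨C, -, hC⟩ := key.1.exists_bound
    refine ⟨⟨(contDiff_smoothing r key.1).continuous.aestronglyMeasurable, ?_⟩, _,
      abs_smoothing_le r hC⟩
    have h := lintegral_avg_rpow_le (ν := (volume : Measure E)) (A := fun w => r • L w)
      (volume : Measure (Pt n m)) le_rfl χ.integrable.1.aemeasurable (by fun_prop)
      key.1.continuous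
    simp only [ENNReal.rpow_one] at h
    exact h.trans_lt (ENNReal.mul_lt_top (χ.integrable (μ := volume)).2
      (key.1.integrable volume).2)

/-- Continuous functions bounded on every slab `‖x‖ ≤ R`. -/
def XBdd (g : Pt n m → ℝ) : Prop :=
  Continuous g ∧ ∀ R : ℝ, ∃ C, ∀ z : Pt n m, ‖z.1‖ ≤ R → |g z| ≤ C

theorem XBdd.mul {f g : Pt n m → ℝ} (hf : XBdd f) (hg : XBdd g) : XBdd (fun z => f z * g z) := by
  refine ⟨hf.1.mul hg.1, fun R => ?_⟩
  obtain ⟨C, hC⟩ := hf.2 R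
  obtain ⟨C', hC'⟩ := hg.2 R
  refine ⟨C * C', fun z hz => ?_⟩
  rw [abs_mul]
  exact mul_le_mul (hC z hz) (hC' z hz) (abs_nonneg _) ((abs_nonneg _).trans (hC z hz))

theorem XBdd.add {f g : Pt n m → ℝ} (hf : XBdd f) (hg : XBdd g) : XBdd (fun z => f z + g z) := by
  refine ⟨hf.1.add hg.1, fun R => ?_⟩
  obtain ⟨C, hC⟩ := hf.2 R
  obtain ⟨C', hC'⟩ := hg.2 R
  exact ⟨C + C', fun z hz => (abs_add_le _ _).trans (add_le_add (hC z hz) (hC' z hz))⟩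

theorem XBdd.of_fst {a : (Fin n → ℝ) → ℝ} (ha : Continuous a) :
    XBdd (fun z : Pt n m => a z.1) := by
  refine ⟨by fun_prop, fun R => ?_⟩
  obtain ⟨C, hC⟩ := (isCompact_closedBall (0 : Fin n → ℝ) R).exists_bound_of_continuousOn
    ha.continuousOn
  exact ⟨C, fun z hz => hC z.1 (by simpa using hz)⟩

theorem IsReg.xBdd_comp {u : Pt n m → ℝ} (hu : IsReg u) {θ : ℝ → ℝ} (hθ : Continuous θ) :
    XBdd (fun z => θ (u z)) := by
  refine ⟨hθ.comp hu.continuous, fun R => ?_⟩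
  obtain ⟨M, -, hM⟩ := hu.exists_bound
  obtain ⟨C, hC⟩ := (isCompact_closedBall (0 : ℝ) M).exists_bound_of_continuousOn hθ.continuousOn
  exact ⟨C, fun z _ => hC _ (by simpa using hM z)⟩

theorem IsReg.xBdd {u : Pt n m → ℝ} (hu : IsReg u) : XBdd u := hu.xBdd_comp continuous_id

theorem XBdd.integrable_mul {g u : Pt n m → ℝ} (hg : XBdd g) (hu : IsReg u) :
    Integrable (fun z => g z * u z) := by
  obtain ⟨R, hR⟩ := hu.2.1
  obtain ⟨C, hC⟩ := hg.2 R
  refine (hu.integrable.norm.const_mul C).mono (hg.1.mul hu.continuous).aestronglyMeasurable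
    (Eventually.of_forall fun z => ?_)
  rw [norm_mul]
  by_cases hz : ‖z.1‖ ≤ R
  · have h := hC z hz
    rw [Real.norm_of_nonneg (mul_nonneg ((abs_nonneg _).trans h) (norm_nonneg _))]
    exact mul_le_mul_of_nonneg_right h (norm_nonneg _)
  · rw [hR z (not_le.1 hz)]; simp

theorem continuous_dslope_zero {θ : ℝ → ℝ} (hθ : Differentiable ℝ θ) :
    Continuous (dslope θ 0) := by
  rw [continuous_iff_continuousAt]
  intro a
  by_cases ha : a = 0
  · rw [ha]; exact continuousAt_dslope_same.2 (hθ 0)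
  · exact (continuousAt_dslope_of_ne ha).2 (hθ a).continuousAt

theorem XBdd.integrable_mul_comp {g u : Pt n m → ℝ} (hg : XBdd g) (hu : IsReg u) {θ : ℝ → ℝ}
    (hθ : Differentiable ℝ θ) (h0 : θ 0 = 0) : Integrable (fun z => g z * θ (u z)) := by
  have h := (hg.mul (hu.xBdd_comp (continuous_dslope_zero hθ))).integrable_mul hu
  refine h.congr (Eventually.of_forall fun z => ?_)
  have h1 := sub_smul_dslope θ 0 (u z)
  simp only [sub_zero, h0, smul_eq_mul] at h1
  simp only [← h1]; ring

theorem dirD_comp_real {u : Pt n m → ℝ} (hu : Differentiable ℝ u) {θ : ℝ → ℝ}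
    (hθ : Differentiable ℝ θ) (v : Pt n m) :
    dirD v (fun z => θ (u z)) = fun z => deriv θ (u z) * dirD v u z := by
  funext z
  have h := ((hθ (u z)).hasDerivAt.comp_hasFDerivAt z (hu z).hasFDerivAt).fderiv
  simp only [Function.comp_def] at h
  simp [dirD, h]

/-- Integration by parts against a regular function. -/
theorem XBdd.integral_mul_dirD {f w : Pt n m → ℝ} (v : Pt n m) (hf : XBdd f)
    (hfd : Differentiable ℝ f) (hf' : XBdd (dirD v f)) (hw : IsReg w) :
    ∫ z, f z * dirD v w z = -∫ z, dirD v f z * w z :=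
  _root_.integral_mul_dirD volume v hfd hw.differentiable (hf'.integrable_mul hw)
    (hf.integrable_mul (hw.dirD v)) (hf.integrable_mul hw)

/-- Integration by parts against a function of a regular function. -/
theorem XBdd.integral_mul_comp {f u : Pt n m → ℝ} (v : Pt n m) (hf : XBdd f)
    (hfd : Differentiable ℝ f) (hf' : XBdd (dirD v f)) (hu : IsReg u) {θ : ℝ → ℝ}
    (hθ : ContDiff ℝ 1 θ) (h0 : θ 0 = 0) :
    ∫ z, f z * (deriv θ (u z) * dirD v u z) = -∫ z, dirD v f z * θ (u z) := by
  have hθd : Differentiable ℝ θ := hθ.differentiable (by simp)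
  have hd := dirD_comp_real hu.differentiable hθd v
  have h := _root_.integral_mul_dirD volume (f := f) (g := fun z => θ (u z)) v hfd
    (hθd.comp hu.differentiable) (hf'.integrable_mul_comp hu hθd h0)
    (by
      rw [hd]
      have := (hf.mul (hu.xBdd_comp (hθ.continuous_deriv le_rfl))).integrable_mul (hu.dirD v)
      simpa only [mul_assoc] using this)
    (hf.integrable_mul_comp hu hθd h0)
  rwa [hd] at h

end Regular

section ScalarFunctions

open Topology Filter

/-- Regularized `p`-th power. -/
noncomputable def regPow (p τ a : ℝ) : ℝ := (a ^ 2 + τ) ^ (p / 2) - τ ^ (p / 2)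

/-- Regularized signed power of exponent `p / 2`. -/
noncomputable def halfPow (p τ a : ℝ) : ℝ := a * (a ^ 2 + τ) ^ ((p - 2) / 4)

theorem regPow_zero (p τ : ℝ) : regPow p τ 0 = 0 := by simp [regPow]

theorem halfPow_zero (p τ : ℝ) : halfPow p τ 0 = 0 := by simp [halfPow]

theorem hasDerivAt_sq_add_rpow {τ : ℝ} (hτ : 0 < τ) (s a : ℝ) :
    HasDerivAt (fun a : ℝ => (a ^ 2 + τ) ^ s) (2 * s * a * (a ^ 2 + τ) ^ (s - 1)) a := by
  have h : HasDerivAt (fun a : ℝ => a ^ 2 + τ) (2 * a) a := by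
    simpa using (hasDerivAt_pow 2 a).add_const τ
  exact (h.rpow_const (p := s) (Or.inl (by positivity))).congr_deriv (by ring)

theorem contDiff_sq_add_rpow {τ : ℝ} (hτ : 0 < τ) (s : ℝ) :
    ContDiff ℝ (⊤ : ℕ∞) (fun a : ℝ => (a ^ 2 + τ) ^ s) :=
  ContDiff.rpow_const_of_ne (by fun_prop) fun a => by positivity

theorem contDiff_regPow (p : ℝ) {τ : ℝ} (hτ : 0 < τ) : ContDiff ℝ (⊤ : ℕ∞) (regPow p τ) :=
  (contDiff_sq_add_rpow hτ _).sub contDiff_const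

theorem contDiff_halfPow (p : ℝ) {τ : ℝ} (hτ : 0 < τ) : ContDiff ℝ (⊤ : ℕ∞) (halfPow p τ) :=
  contDiff_id.mul (contDiff_sq_add_rpow hτ _)

theorem deriv_regPow (p : ℝ) {τ : ℝ} (hτ : 0 < τ) :
    deriv (regPow p τ) = fun a => p * (a * (a ^ 2 + τ) ^ (p / 2 - 1)) := by
  funext a
  exact (((hasDerivAt_sq_add_rpow hτ (p / 2) a).sub_const _).congr_deriv (by ring)).deriv

theorem deriv_deriv_regPow (p : ℝ) {τ : ℝ} (hτ : 0 < τ) (a : ℝ) :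
    deriv (deriv (regPow p τ)) a =
      p * ((a ^ 2 + τ) ^ (p / 2 - 2) * ((p - 1) * a ^ 2 + τ)) := by
  rw [deriv_regPow p hτ]
  have h := ((hasDerivAt_id a).mul (hasDerivAt_sq_add_rpow hτ (p / 2 - 1) a)).const_mul p
  refine (h.congr_deriv ?_).deriv
  have e : (a ^ 2 + τ) ^ (p / 2 - 1) = (a ^ 2 + τ) ^ (p / 2 - 2) * (a ^ 2 + τ) := by
    rw [← Real.rpow_add_one (by positivity)]; ring_nf
  have e2 : p / 2 - 1 - 1 = p / 2 - 2 := by ring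
  simp only [id, e2, e]; ring

theorem deriv_halfPow_sq_le {p : ℝ} (hp : 1 < p) {τ : ℝ} (hτ : 0 < τ) (a : ℝ) :
    deriv (halfPow p τ) a ^ 2 ≤ p ^ 2 / (p - 1) * deriv (deriv (regPow p τ)) a := by
  have hb : 0 < a ^ 2 + τ := by positivity
  have h := ((hasDerivAt_id a).mul (hasDerivAt_sq_add_rpow hτ ((p - 2) / 4) a))
  have h1 : deriv (halfPow p τ) a =
      (a ^ 2 + τ) ^ ((p - 2) / 4 - 1) * (p / 2 * a ^ 2 + τ) := by
    refine (h.congr_deriv ?_).deriv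
    have e : (a ^ 2 + τ) ^ ((p - 2) / 4) = (a ^ 2 + τ) ^ ((p - 2) / 4 - 1) * (a ^ 2 + τ) := by
      rw [← Real.rpow_add_one hb.ne']; ring_nf
    simp only [id, e]; ring
  have e3 : ((a ^ 2 + τ) ^ ((p - 2) / 4 - 1)) ^ 2 * (a ^ 2 + τ) = (a ^ 2 + τ) ^ (p / 2 - 2) := by
    rw [← Real.rpow_natCast, ← Real.rpow_mul hb.le, ← Real.rpow_add_one hb.ne']
    congr 1; push_cast; ring
  rw [h1, deriv_deriv_regPow p hτ, mul_pow, ← e3]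
  set k := ((a ^ 2 + τ) ^ ((p - 2) / 4 - 1)) ^ 2
  have hk : 0 ≤ k := by positivity
  have hp1 : 0 < p - 1 := by linarith
  have e4 : p ^ 2 / (p - 1) * (p * (k * (a ^ 2 + τ) * ((p - 1) * a ^ 2 + τ))) =
      k * (p ^ 3 * (a ^ 2 + τ) * (a ^ 2 + τ / (p - 1))) := by
    field_simp
  rw [e4]
  refine mul_le_mul_of_nonneg_left ?_ hk
  have h5 : p * (τ / (p - 1)) ≥ τ := by
    rw [ge_iff_le, ← mul_div_assoc, le_div_iff₀ hp1]; nlinarith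
  have h6 : p / 2 * a ^ 2 + τ ≤ p * (a ^ 2 + τ) := by nlinarith [sq_nonneg a]
  have h7 : p / 2 * a ^ 2 + τ ≤ p * (a ^ 2 + τ / (p - 1)) := by nlinarith [sq_nonneg a]
  have h8 : 0 ≤ p / 2 * a ^ 2 + τ := by positivity
  have h9 : (p / 2 * a ^ 2 + τ) ^ 2 ≤ (p * (a ^ 2 + τ)) * (p * (a ^ 2 + τ / (p - 1))) := by
    rw [sq]; exact mul_le_mul h6 h7 h8 (by positivity)
  refine h9.trans ?_
  have h10 : 0 ≤ (a ^ 2 + τ) * (a ^ 2 + τ / (p - 1)) := by positivity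
  nlinarith [mul_nonneg (mul_nonneg (sq_nonneg p) hp1.le) h10]

theorem regPow_nonneg {p : ℝ} (hp : 1 < p) {τ : ℝ} (hτ : 0 < τ) (a : ℝ) : 0 ≤ regPow p τ a := by
  rw [regPow, sub_nonneg]
  exact Real.rpow_le_rpow hτ.le (by nlinarith [sq_nonneg a]) (by linarith)

theorem abs_deriv_regPow_le {p : ℝ} (hp : 1 < p) {τ : ℝ} (hτ : 0 < τ) (hτ1 : τ ≤ 1) {M a : ℝ}
    (ha : |a| ≤ M) : |deriv (regPow p τ) a| ≤ p * (M ^ 2 + 1) ^ ((p - 1) / 2) := by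
  have hb : 0 < a ^ 2 + τ := by positivity
  have hM : a ^ 2 ≤ M ^ 2 := by rw [← sq_abs]; gcongr
  have h1 : |a| ≤ (a ^ 2 + τ) ^ (1 / 2 : ℝ) := by
    rw [← Real.sqrt_eq_rpow]
    exact Real.abs_le_sqrt (by linarith)
  rw [deriv_regPow p hτ, abs_mul, abs_mul, abs_of_pos (by linarith : 0 < p),
    abs_of_nonneg (Real.rpow_nonneg hb.le _)]
  refine mul_le_mul_of_nonneg_left ?_ (by linarith)
  calc |a| * (a ^ 2 + τ) ^ (p / 2 - 1)
      ≤ (a ^ 2 + τ) ^ (1 / 2 : ℝ) * (a ^ 2 + τ) ^ (p / 2 - 1) := by gcongr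
    _ = (a ^ 2 + τ) ^ ((p - 1) / 2) := by rw [← Real.rpow_add hb]; ring_nf
    _ ≤ _ := Real.rpow_le_rpow hb.le (by linarith) (by linarith)

theorem regPow_le {p : ℝ} (hp : 1 < p) {τ : ℝ} (hτ : 0 < τ) (hτ1 : τ ≤ 1) {M a : ℝ}
    (ha : |a| ≤ M) : regPow p τ a ≤ p * (M ^ 2 + 1) ^ ((p - 1) / 2) * |a| := by
  have hM : 0 ≤ M := (abs_nonneg _).trans ha
  have h := Convex.norm_image_sub_le_of_norm_deriv_le (f := regPow p τ) (s := Metric.closedBall 0 M)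
    (x := 0) (y := a) (fun x _ => (contDiff_regPow p hτ).differentiable (by simp) x)
    (fun x hx => abs_deriv_regPow_le hp hτ hτ1 (by simpa using hx)) (convex_closedBall _ _)
    (by simpa using hM) (by simpa using ha)
  simp only [regPow_zero, sub_zero, Real.norm_eq_abs] at h
  exact (le_abs_self _).trans h

theorem tendsto_sq_add_rpow {a : ℝ} (ha : a ≠ 0) (s : ℝ) {τ : ℕ → ℝ}
    (hτ : Tendsto τ atTop (𝓝 0)) :
    Tendsto (fun k => (a ^ 2 + τ k) ^ s) atTop (𝓝 ((a ^ 2) ^ s)) := by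
  have h : Tendsto (fun k => a ^ 2 + τ k) atTop (𝓝 (a ^ 2)) := by
    simpa using hτ.const_add (a ^ 2)
  exact h.rpow_const (Or.inl (by positivity))

theorem tendsto_abs_deriv_regPow {p : ℝ} (hp : 1 < p) (a : ℝ) {τ : ℕ → ℝ} (hτ0 : ∀ k, 0 < τ k)
    (hτ : Tendsto τ atTop (𝓝 0)) :
    Tendsto (fun k => |deriv (regPow p (τ k)) a|) atTop (𝓝 (p * |a| ^ (p - 1))) := by
  simp only [fun k => deriv_regPow p (hτ0 k)]
  by_cases ha : a = 0
  · simp [ha, Real.zero_rpow (by linarith : p - 1 ≠ 0)]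
  · have h := (((tendsto_sq_add_rpow ha (p / 2 - 1) hτ).const_mul a).const_mul p).abs
    convert h using 2
    have h1 : 0 < |a| := abs_pos.2 ha
    rw [abs_mul, abs_mul, abs_of_pos (by linarith : 0 < p),
      abs_of_nonneg (Real.rpow_nonneg (sq_nonneg a) _), ← sq_abs a, ← Real.rpow_natCast,
      ← Real.rpow_mul h1.le, ← Real.rpow_one_add' h1.le]
    · congr 2; push_cast; ring
    · push_cast; intro h; linarith

theorem tendsto_regPow {p : ℝ} (hp : 1 < p) (a : ℝ) {τ : ℕ → ℝ}
    (hτ : Tendsto τ atTop (𝓝 0)) :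
    Tendsto (fun k => regPow p (τ k) a) atTop (𝓝 (|a| ^ p)) := by
  by_cases ha : a = 0
  · simp [ha, regPow_zero, Real.zero_rpow (by linarith : p ≠ 0)]
  · have h0 : Tendsto (fun k => τ k ^ (p / 2)) atTop (𝓝 0) := by
      have := hτ.rpow_const (p := p / 2) (Or.inr (by linarith))
      rwa [Real.zero_rpow (by linarith)] at this
    have h := (tendsto_sq_add_rpow ha (p / 2) hτ).sub h0
    rw [sub_zero] at h
    rw [abs_rpow_eq_sq_rpow]
    exact h

theorem tendsto_halfPow (p a : ℝ) {τ : ℕ → ℝ} (hτ : Tendsto τ atTop (𝓝 0)) :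
    Tendsto (fun k => halfPow p (τ k) a) atTop (𝓝 (halfPow p 0 a)) := by
  by_cases ha : a = 0
  · simp [ha, halfPow_zero]
  · have h := (tendsto_sq_add_rpow ha ((p - 2) / 4) hτ).const_mul a
    simpa [halfPow] using h

theorem halfPow_of_nonneg {p : ℝ} (hp : 1 < p) {a : ℝ} (ha : 0 ≤ a) :
    halfPow p 0 a = a ^ (p / 2) := by
  rw [halfPow, add_zero, ← Real.rpow_natCast, ← Real.rpow_mul ha, ← Real.rpow_one_add' ha]
  · congr 1; push_cast; ring
  · push_cast; intro h; linarith

theorem halfPow_neg (p τ a : ℝ) : halfPow p τ (-a) = -halfPow p τ a := by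
  simp [halfPow]

theorem halfPow_sq {p : ℝ} (hp : 1 < p) (a : ℝ) : halfPow p 0 a ^ 2 = |a| ^ p := by
  have h : halfPow p 0 a ^ 2 = halfPow p 0 |a| ^ 2 := by
    rcases abs_cases a with h | h <;> rw [h.1]
    rw [halfPow_neg]; ring
  rw [h, halfPow_of_nonneg hp (abs_nonneg a), ← Real.rpow_natCast, ← Real.rpow_mul (abs_nonneg a)]
  congr 1; push_cast; ring

/-- Differences are controlled by differences of signed powers, up to a small multiple of the
values. -/
theorem exists_abs_sub_rpow_le {p : ℝ} (hp : 1 < p) {η : ℝ} (hη : 0 < η) :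
    ∃ C : ℝ, 0 ≤ C ∧ ∀ a b : ℝ, |a - b| ^ p ≤
      C * (halfPow p 0 a - halfPow p 0 b) ^ 2 + η * (|a| ^ p + |b| ^ p) := by
  have hp0 : 0 < p := by linarith
  obtain ⟨δ, hδ0, hδ1, hδη⟩ : ∃ δ : ℝ, 0 < δ ∧ δ < 1 ∧ δ ^ p ≤ η := by
    refine ⟨min (1 / 2) (η ^ p⁻¹), lt_min (by norm_num) (by positivity),
      (min_le_left _ _).trans_lt (by norm_num), ?_⟩
    calc (min (1 / 2) (η ^ p⁻¹)) ^ p ≤ (η ^ p⁻¹) ^ p :=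
          Real.rpow_le_rpow (le_min (by norm_num) (by positivity)) (min_le_right _ _) hp0.le
      _ = η := by rw [← Real.rpow_mul hη.le, inv_mul_cancel₀ hp0.ne', Real.rpow_one]
  set c : ℝ := 1 - (1 - δ) ^ (p / 2) with hc
  have hc0 : 0 < c := by
    rw [hc, sub_pos]
    exact Real.rpow_lt_one (by linarith) (by linarith) (by linarith)
  refine ⟨2 ^ p / c ^ 2, by positivity, ?_⟩
  have main : ∀ a b : ℝ, 0 ≤ a → |b| ≤ a → |a - b| ^ p ≤
      2 ^ p / c ^ 2 * (halfPow p 0 a - halfPow p 0 b) ^ 2 + η * (|a| ^ p + |b| ^ p) := by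
    intro a b ha hb
    have hab : 0 ≤ a - b := by linarith [le_abs_self b]
    by_cases h : a - b ≤ δ * a
    · have h1 : |a - b| ^ p ≤ η * |a| ^ p := by
        rw [abs_of_nonneg hab, abs_of_nonneg ha]
        calc (a - b) ^ p ≤ (δ * a) ^ p := Real.rpow_le_rpow hab h hp0.le
          _ = δ ^ p * a ^ p := Real.mul_rpow hδ0.le ha
          _ ≤ η * a ^ p := by gcongr
      have h2 : 0 ≤ 2 ^ p / c ^ 2 * (halfPow p 0 a - halfPow p 0 b) ^ 2 := by positivity
      have h3 : 0 ≤ η * |b| ^ p := by positivity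
      linarith
    · push Not at h
      have hqb : halfPow p 0 b ≤ (1 - δ) ^ (p / 2) * a ^ (p / 2) := by
        rcases le_total 0 b with hb0 | hb0
        · rw [halfPow_of_nonneg hp hb0, ← Real.mul_rpow (by linarith) ha]
          exact Real.rpow_le_rpow hb0 (by nlinarith) (by linarith)
        · have : halfPow p 0 b ≤ 0 :=
            mul_nonpos_of_nonpos_of_nonneg hb0 (Real.rpow_nonneg (by positivity) _)
          exact this.trans (mul_nonneg (Real.rpow_nonneg (by linarith) _) (by positivity))
      have hq : c * a ^ (p / 2) ≤ halfPow p 0 a - halfPow p 0 b := by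
        rw [halfPow_of_nonneg hp ha, hc]; linarith
      have h1 : (c * a ^ (p / 2)) ^ 2 ≤ (halfPow p 0 a - halfPow p 0 b) ^ 2 := by
        gcongr
      have h2 : (a ^ (p / 2)) ^ 2 = a ^ p := by
        rw [← Real.rpow_natCast, ← Real.rpow_mul ha]; congr 1; push_cast; ring
      have h3 : |a - b| ^ p ≤ 2 ^ p * a ^ p := by
        rw [← Real.mul_rpow (by norm_num) ha]
        refine Real.rpow_le_rpow (abs_nonneg _) ?_ hp0.le
        rw [abs_of_nonneg hab]; linarith [neg_abs_le b]
      have h4 : 2 ^ p * a ^ p ≤ 2 ^ p / c ^ 2 * (halfPow p 0 a - halfPow p 0 b) ^ 2 := by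
        rw [mul_pow, h2] at h1
        calc (2 : ℝ) ^ p * a ^ p = 2 ^ p / c ^ 2 * (c ^ 2 * a ^ p) := by field_simp
          _ ≤ _ := by gcongr
      have h5 : 0 ≤ η * (|a| ^ p + |b| ^ p) := by positivity
      linarith
  have main' : ∀ a b : ℝ, |b| ≤ |a| → |a - b| ^ p ≤
      2 ^ p / c ^ 2 * (halfPow p 0 a - halfPow p 0 b) ^ 2 + η * (|a| ^ p + |b| ^ p) := by
    intro a b hab
    rcases le_total 0 a with ha | ha
    · exact main a b ha (by rwa [abs_of_nonneg ha] at hab)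
    · have h := main (-a) (-b) (by linarith) (by rwa [abs_neg, ← abs_of_nonpos ha])
      rw [halfPow_neg, halfPow_neg, abs_neg, abs_neg] at h
      have e1 : |-a - -b| = |a - b| := by rw [← abs_neg]; congr 1; ring
      have e2 : (-halfPow p 0 a - -halfPow p 0 b) ^ 2 = (halfPow p 0 a - halfPow p 0 b) ^ 2 := by
        ring
      rwa [e1, e2] at h
  intro a b
  rcases le_total |b| |a| with h | h
  · exact main' a b h
  · have h1 := main' b a h
    rw [abs_sub_comm, add_comm (|a| ^ p)]
    have e2 : (halfPow p 0 b - halfPow p 0 a) ^ 2 = (halfPow p 0 a - halfPow p 0 b) ^ 2 := by ring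
    rwa [e2] at h1

end ScalarFunctions

section Energy

open Topology Filter

variable {n m : ℕ}

theorem dirD_comp_fst {a : (Fin n → ℝ) → ℝ} (ha : Differentiable ℝ a) (v : Pt n m) :
    dirD v (fun z : Pt n m => a z.1) = fun z => dirD v.1 a z.1 := by
  funext z
  have h := ((ha z.1).hasFDerivAt.comp z (hasFDerivAt_fst (p := z))).fderiv
  simp only [Function.comp_def] at h
  simp [dirD, h]

theorem continuous_grusin {u : Pt n m → ℝ} (hu : IsReg u) (N : ℕ) :
    Continuous (grusin n m N u) := by
  have h1 : ∀ v w : Pt n m, Continuous (dirD v (dirD w u)) := fun v w =>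
    ((hu.dirD w).dirD v).continuous
  have hs : Continuous fun z : Pt n m => sqx z.1 := contDiff_sqx.continuous
  have e : grusin n m N u = fun z =>
      -(∑ j, dirD (unitVec n m (Sum.inl j)) (dirD (unitVec n m (Sum.inl j)) u) z) -
      sqx z.1 ^ N * ∑ k, dirD (unitVec n m (Sum.inr k)) (dirD (unitVec n m (Sum.inr k)) u) z := rfl
  rw [e]
  fun_prop

theorem xBdd_sqx_pow (N : ℕ) : XBdd (fun z : Pt n m => sqx z.1 ^ N) :=
  XBdd.of_fst (a := fun x : Fin n → ℝ => sqx x ^ N) (by unfold sqx; fun_prop)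

theorem integral_mul_grusin {g u : Pt n m → ℝ} (hg : XBdd g) (hu : IsReg u) (N : ℕ) :
    Integrable (fun z => g z * grusin n m N u z) ∧
    ∫ z, g z * grusin n m N u z =
      -(∑ i, ∫ z, g z * dirD (unitVec n m (.inl i)) (dirD (unitVec n m (.inl i)) u) z) -
      ∑ l, ∫ z, g z * sqx z.1 ^ N *
        dirD (unitVec n m (.inr l)) (dirD (unitVec n m (.inr l)) u) z := by
  have e : (fun z => g z * grusin n m N u z) = fun z =>
      -(∑ i, g z * dirD (unitVec n m (.inl i)) (dirD (unitVec n m (.inl i)) u) z) -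
      ∑ l, g z * sqx z.1 ^ N * dirD (unitVec n m (.inr l)) (dirD (unitVec n m (.inr l)) u) z := by
    funext z
    rw [grusin_apply, ← Finset.mul_sum, ← Finset.mul_sum]; ring
  have i1 : ∀ i, Integrable fun z =>
      g z * dirD (unitVec n m (.inl i)) (dirD (unitVec n m (.inl i)) u) z := fun i =>
    hg.integrable_mul ((hu.dirD _).dirD _)
  have i2 : ∀ l, Integrable fun z =>
      g z * sqx z.1 ^ N * dirD (unitVec n m (.inr l)) (dirD (unitVec n m (.inr l)) u) z := fun l =>
    (hg.mul (xBdd_sqx_pow N)).integrable_mul ((hu.dirD _).dirD _)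
  have I1 := integrable_finsetSum Finset.univ fun i _ => i1 i
  have I2 := integrable_finsetSum Finset.univ fun l _ => i2 l
  rw [e]
  refine ⟨I1.neg.sub I2, ?_⟩
  rw [integral_sub (f := fun z => -(∑ i, g z * dirD (unitVec n m (.inl i))
      (dirD (unitVec n m (.inl i)) u) z)) I1.neg I2, integral_neg,
    integral_finsetSum _ fun i _ => i1 i, integral_finsetSum _ fun l _ => i2 l]

/-- The Laplacian in the `x` variables. -/
noncomputable def lapX (ρ : (Fin n → ℝ) → ℝ) (x : Fin n → ℝ) : ℝ :=
  ∑ i, dirD (Pi.single i (1 : ℝ)) (dirD (Pi.single i (1 : ℝ)) ρ) x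

/-- The squared length of the gradient in the degenerate frame. -/
noncomputable def gradSq (N : ℕ) (u : Pt n m → ℝ) (z : Pt n m) : ℝ :=
  (∑ i, dirD (unitVec n m (.inl i)) u z ^ 2) +
    sqx z.1 ^ N * ∑ l, dirD (unitVec n m (.inr l)) u z ^ 2

theorem gradSq_nonneg (N : ℕ) (u : Pt n m → ℝ) (z : Pt n m) : 0 ≤ gradSq N u z := by
  have := sqx_nonneg z.1
  unfold gradSq; positivity

theorem integral_mul_gradSq {g u : Pt n m → ℝ} (hg : XBdd g) (hu : IsReg u) (N : ℕ) :
    Integrable (fun z => g z * gradSq N u z) ∧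
    ∫ z, g z * gradSq N u z =
      (∑ i, ∫ z, g z * dirD (unitVec n m (.inl i)) u z ^ 2) +
      ∑ l, ∫ z, g z * sqx z.1 ^ N * dirD (unitVec n m (.inr l)) u z ^ 2 := by
  have e : (fun z => g z * gradSq N u z) = fun z =>
      (∑ i, g z * dirD (unitVec n m (.inl i)) u z ^ 2) +
      ∑ l, g z * sqx z.1 ^ N * dirD (unitVec n m (.inr l)) u z ^ 2 := by
    funext z
    rw [gradSq, ← Finset.mul_sum, ← Finset.mul_sum]; ring
  have i1 : ∀ i, Integrable fun z => g z * dirD (unitVec n m (.inl i)) u z ^ 2 := fun i => by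
    simpa only [sq, ← mul_assoc] using
      (hg.mul (hu.dirD (unitVec n m (.inl i))).xBdd).integrable_mul (hu.dirD (unitVec n m (.inl i)))
  have i2 : ∀ l, Integrable fun z =>
      g z * sqx z.1 ^ N * dirD (unitVec n m (.inr l)) u z ^ 2 := fun l => by
    simpa only [sq, ← mul_assoc] using
      ((hg.mul (xBdd_sqx_pow N)).mul (hu.dirD (unitVec n m (.inr l))).xBdd).integrable_mul
        (hu.dirD (unitVec n m (.inr l)))
  have I1 := integrable_finsetSum Finset.univ fun i _ => i1 i
  have I2 := integrable_finsetSum Finset.univ fun l _ => i2 l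
  rw [e]
  refine ⟨I1.add I2, ?_⟩
  rw [integral_add I1 I2, integral_finsetSum _ fun i _ => i1 i, integral_finsetSum _ fun l _ => i2 l]

/-- The energy identity for a nonlinear function of a regular function. -/
theorem energy_identity {u : Pt n m → ℝ} (hu : IsReg u) (N : ℕ) {ρ : (Fin n → ℝ) → ℝ}
    (hρ : ContDiff ℝ (⊤ : ℕ∞) ρ) {G : ℝ → ℝ} (hG : ContDiff ℝ (⊤ : ℕ∞) G) (h0 : G 0 = 0) :
    ∫ z, ρ z.1 * deriv (deriv G) (u z) * gradSq N u z =
      (∫ z, ρ z.1 * deriv G (u z) * grusin n m N u z) + ∫ z, lapX ρ z.1 * G (u z) := by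
  have hG1 : ContDiff ℝ (⊤ : ℕ∞) (deriv G) := (contDiff_infty_iff_deriv.1 hG).2
  have hG2 : ContDiff ℝ (⊤ : ℕ∞) (deriv (deriv G)) := (contDiff_infty_iff_deriv.1 hG1).2
  have dG1 : Differentiable ℝ (deriv G) := hG1.differentiable (by simp)
  have dρ : Differentiable ℝ ρ := hρ.differentiable (by simp)
  have du := hu.differentiable
  have xρ : XBdd (fun z : Pt n m => ρ z.1) := .of_fst hρ.continuous
  have xG1 := hu.xBdd_comp hG1.continuous
  have xG2 := hu.xBdd_comp hG2.continuous
  have dρ' : ∀ v : Fin n → ℝ, Differentiable ℝ (dirD v ρ) := fun v =>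
    (hρ.dirD v).differentiable (by simp)
  have dcomp : Differentiable ℝ (fun z => deriv G (u z)) := dG1.comp du
  have dfst : ∀ {a : (Fin n → ℝ) → ℝ}, Differentiable ℝ a →
      Differentiable ℝ (fun z : Pt n m => a z.1) := fun ha => ha.comp differentiable_fst
  rw [(integral_mul_gradSq (xρ.mul xG2) hu N).2, (integral_mul_grusin (xρ.mul xG1) hu N).2]
  have hx : ∀ i, ∫ z, ρ z.1 * deriv (deriv G) (u z) * dirD (unitVec n m (.inl i)) u z ^ 2 =
      -(∫ z, ρ z.1 * deriv G (u z) * dirD (unitVec n m (.inl i)) (dirD (unitVec n m (.inl i)) u) z)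
      + ∫ z, dirD (Pi.single i (1 : ℝ)) (dirD (Pi.single i (1 : ℝ)) ρ) z.1 * G (u z) := by
    intro i
    set v := unitVec n m (.inl i) with hv
    have hd : dirD v (fun z : Pt n m => ρ z.1 * deriv G (u z)) = fun z =>
        dirD (Pi.single i (1 : ℝ)) ρ z.1 * deriv G (u z) +
          ρ z.1 * (deriv (deriv G) (u z) * dirD v u z) := by
      rw [dirD_mul v (dfst dρ) dcomp, dirD_comp_fst dρ, dirD_comp_real du dG1]
      rfl
    have xρ' : XBdd (fun z : Pt n m => dirD (Pi.single i (1 : ℝ)) ρ z.1) :=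
      .of_fst (dρ' _).continuous
    have hd2 : dirD v (fun z : Pt n m => dirD (Pi.single i (1 : ℝ)) ρ z.1) = fun z =>
        dirD (Pi.single i (1 : ℝ)) (dirD (Pi.single i (1 : ℝ)) ρ) z.1 := dirD_comp_fst (dρ' _) v
    have e1 := (xρ.mul xG1).integral_mul_dirD v
      (by have h : Differentiable ℝ (fun z : Pt n m => ρ z.1) := dfst dρ
          exact h.mul dcomp)
      (by rw [hd]; exact (xρ'.mul xG1).add (xρ.mul (xG2.mul (hu.dirD v).xBdd))) (hu.dirD v)
    have e2 := xρ'.integral_mul_comp v (dfst (dρ' _))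
      (by rw [hd2]; exact .of_fst ((hρ.dirD _).dirD _).continuous) hu (hG.of_le (by simp)) h0
    rw [hd] at e1
    rw [hd2] at e2
    have i1 : Integrable fun z : Pt n m =>
        dirD (Pi.single i (1 : ℝ)) ρ z.1 * (deriv G (u z) * dirD v u z) := by
      simpa only [mul_assoc] using (xρ'.mul xG1).integrable_mul (hu.dirD v)
    have i2 : Integrable fun z : Pt n m =>
        ρ z.1 * deriv (deriv G) (u z) * dirD v u z ^ 2 := by
      simpa only [mul_assoc, sq] using
        ((xρ.mul xG2).mul (hu.dirD v).xBdd).integrable_mul (hu.dirD v)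
    have e3 : ∫ z : Pt n m, (dirD (Pi.single i (1 : ℝ)) ρ z.1 * deriv G (u z) +
          ρ z.1 * (deriv (deriv G) (u z) * dirD v u z)) * dirD v u z =
        (∫ z : Pt n m, dirD (Pi.single i (1 : ℝ)) ρ z.1 * (deriv G (u z) * dirD v u z)) +
          ∫ z : Pt n m, ρ z.1 * deriv (deriv G) (u z) * dirD v u z ^ 2 := by
      rw [← integral_add i1 i2]
      congr 1; funext z; ring
    beta_reduce at e1 e2
    linarith
  have hy : ∀ l, ∫ z, ρ z.1 * deriv (deriv G) (u z) * sqx z.1 ^ N *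
        dirD (unitVec n m (.inr l)) u z ^ 2 =
      -(∫ z, ρ z.1 * deriv G (u z) * sqx z.1 ^ N *
        dirD (unitVec n m (.inr l)) (dirD (unitVec n m (.inr l)) u) z) := by
    intro l
    set v := unitVec n m (.inr l) with hv
    let a : (Fin n → ℝ) → ℝ := fun x => ρ x * sqx x ^ N
    have ha : ContDiff ℝ (⊤ : ℕ∞) a := hρ.mul (by unfold sqx; fun_prop)
    have da : Differentiable ℝ a := ha.differentiable (by simp)
    have xa : XBdd (fun z : Pt n m => a z.1) := .of_fst ha.continuous
    have hd : dirD v (fun z : Pt n m => a z.1 * deriv G (u z)) = fun z =>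
          a z.1 * (deriv (deriv G) (u z) * dirD v u z) := by
      rw [dirD_mul v (dfst da) dcomp, dirD_comp_fst_inr a l, dirD_comp_real du dG1]
      simp
    have e1 := (xa.mul xG1).integral_mul_dirD v
      (by have h : Differentiable ℝ (fun z : Pt n m => a z.1) := dfst da
          exact h.mul dcomp)
      (by rw [hd]; exact xa.mul (xG2.mul (hu.dirD v).xBdd)) (hu.dirD v)
    rw [hd] at e1
    have e3 : ∫ z : Pt n m, ρ z.1 * deriv G (u z) * sqx z.1 ^ N * dirD v (dirD v u) z =
        ∫ z : Pt n m, a z.1 * deriv G (u z) * dirD v (dirD v u) z := by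
      congr 1; funext z; simp only [a]; ring
    rw [e3, e1, neg_neg]
    congr 1; funext z; simp only [a]; ring
  have hlap : ∫ z : Pt n m, lapX ρ z.1 * G (u z) =
      ∑ i, ∫ z : Pt n m, dirD (Pi.single i (1 : ℝ)) (dirD (Pi.single i (1 : ℝ)) ρ) z.1 * G (u z) := by
    simp only [lapX, Finset.sum_mul]
    rw [integral_finsetSum]
    intro i _
    exact XBdd.integrable_mul_comp (.of_fst ((hρ.dirD _).dirD _).continuous) hu
      (hG.differentiable (by simp)) h0
  rw [hlap, Finset.sum_congr rfl fun i _ => hx i, Finset.sum_congr rfl fun l _ => hy l,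
    Finset.sum_add_distrib, Finset.sum_neg_distrib, Finset.sum_neg_distrib]
  ring

end Energy

section EnergyBound

open Topology Filter

variable {n m : ℕ}

theorem lintegral_le_of_tendsto {α : Type*} [MeasurableSpace α] {μ : Measure α}
    {f : ℕ → α → ℝ≥0∞} {g : α → ℝ≥0∞} (hf : ∀ k, AEMeasurable (f k) μ)
    (hg : ∀ z, Tendsto (fun k => f k z) atTop (𝓝 (g z))) {B : ℕ → ℝ≥0∞} {b : ℝ≥0∞}
    (hB : ∀ k, ∫⁻ z, f k z ∂μ ≤ B k) (hb : Tendsto B atTop (𝓝 b)) : ∫⁻ z, g z ∂μ ≤ b := by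
  calc ∫⁻ z, g z ∂μ = ∫⁻ z, liminf (fun k => f k z) atTop ∂μ := by
        congr 1; funext z; exact (hg z).liminf_eq.symm
    _ ≤ liminf (fun k => ∫⁻ z, f k z ∂μ) atTop := lintegral_liminf_le' hf
    _ ≤ liminf B atTop := liminf_le_liminf (Eventually.of_forall hB)
    _ = b := hb.liminf_eq

/-- The quantity controlling the energy of the regularised powers of `u`. -/
noncomputable def regEnergy (N : ℕ) (p lam τ : ℝ) (ρ : (Fin n → ℝ) → ℝ) (u : Pt n m → ℝ) : ℝ :=
  (∫ z, ρ z.1 * |deriv (regPow p τ) (u z)| * |grusin n m N u z|) +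
    lam * ∫ z, ρ z.1 * regPow p τ (u z)

/-- The limit of `regEnergy` as the regularisation is removed. -/
noncomputable def limEnergy (N : ℕ) (p lam : ℝ) (ρ : (Fin n → ℝ) → ℝ) (u : Pt n m → ℝ) : ℝ :=
  (∫ z, ρ z.1 * (p * |u z| ^ (p - 1)) * |grusin n m N u z|) + lam * ∫ z, ρ z.1 * |u z| ^ p

theorem energy_le {u : Pt n m → ℝ} (hu : IsReg u) (N : ℕ) {p : ℝ} (hp : 1 < p)
    {ρ : (Fin n → ℝ) → ℝ} (hρ : ContDiff ℝ (⊤ : ℕ∞) ρ) (hρ0 : ∀ x, 0 ≤ ρ x) {lam : ℝ}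
    (hlap : ∀ x, lapX ρ x ≤ lam * ρ x) {τ : ℝ} (hτ : 0 < τ) :
    ∫ z, ρ z.1 * deriv (halfPow p τ) (u z) ^ 2 * gradSq N u z ≤
      p ^ 2 / (p - 1) * regEnergy N p lam τ ρ u := by
  have hΦ := contDiff_regPow p hτ
  have hΦ1 : ContDiff ℝ (⊤ : ℕ∞) (deriv (regPow p τ)) := (contDiff_infty_iff_deriv.1 hΦ).2
  have hΦ2 : Continuous (deriv (deriv (regPow p τ))) :=
    (contDiff_infty_iff_deriv.1 hΦ1).2.continuous
  have hq1 : Continuous (deriv (halfPow p τ)) :=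
    (contDiff_infty_iff_deriv.1 (contDiff_halfPow p hτ)).2.continuous
  have xρ : XBdd (fun z : Pt n m => ρ z.1) := .of_fst hρ.continuous
  have hκ : 0 ≤ p ^ 2 / (p - 1) := div_nonneg (sq_nonneg _) (by linarith)
  have h1 : ∫ z, ρ z.1 * deriv (halfPow p τ) (u z) ^ 2 * gradSq N u z ≤
      ∫ z, p ^ 2 / (p - 1) * (ρ z.1 * deriv (deriv (regPow p τ)) (u z) * gradSq N u z) := by
    refine integral_mono ?_ ?_ fun z => ?_
    · exact (integral_mul_gradSq (xρ.mul (hu.xBdd_comp (hq1.pow 2))) hu N).1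
    · exact (integral_mul_gradSq (xρ.mul (hu.xBdd_comp hΦ2)) hu N).1.const_mul _
    · have := mul_le_mul_of_nonneg_left (deriv_halfPow_sq_le hp hτ (u z)) (hρ0 z.1)
      have := mul_le_mul_of_nonneg_right this (gradSq_nonneg N u z)
      beta_reduce
      linarith
  rw [integral_const_mul] at h1
  refine h1.trans (mul_le_mul_of_nonneg_left ?_ hκ)
  rw [energy_identity hu N hρ hΦ (regPow_zero p τ), regEnergy, ← integral_const_mul]
  have iH := (integral_mul_grusin (xρ.mul (hu.xBdd_comp hΦ1.continuous)) hu N).1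
  refine add_le_add ?_ ?_
  · refine integral_mono iH ?_ fun z => ?_
    · refine iH.norm.congr (Eventually.of_forall fun z => ?_)
      simp [abs_of_nonneg (hρ0 z.1)]
    · have := le_abs_self (ρ z.1 * deriv (regPow p τ) (u z) * grusin n m N u z)
      rwa [abs_mul, abs_mul, abs_of_nonneg (hρ0 z.1)] at this
  · have dΦ := hΦ.differentiable (by simp)
    refine integral_mono ?_ ?_ fun z => ?_
    · have : Continuous (lapX ρ) := by
        refine continuous_finsetSum _ fun i _ => ((hρ.dirD _).dirD _).continuous
      exact XBdd.integrable_mul_comp (.of_fst this) hu dΦ (regPow_zero p τ)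
    · exact (xρ.integrable_mul_comp hu dΦ (regPow_zero p τ)).const_mul _
    · have := mul_le_mul_of_nonneg_right (hlap z.1) (regPow_nonneg hp hτ (u z))
      beta_reduce
      linarith

theorem tendsto_regEnergy {u : Pt n m → ℝ} (hu : IsReg u) (N : ℕ) {p : ℝ} (hp : 1 < p)
    {ρ : (Fin n → ℝ) → ℝ} (hρ : ContDiff ℝ (⊤ : ℕ∞) ρ) (lam : ℝ)
    {τ : ℕ → ℝ} (hτ0 : ∀ k, 0 < τ k) (hτ1 : ∀ k, τ k ≤ 1) (hτ : Tendsto τ atTop (𝓝 0)) :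
    Tendsto (fun k => regEnergy N p lam (τ k) ρ u) atTop (𝓝 (limEnergy N p lam ρ u)) := by
  obtain ⟨M, hM0, hM⟩ := hu.exists_bound
  have xρ : XBdd (fun z : Pt n m => ρ z.1) := .of_fst hρ.continuous
  have hΦ1 : ∀ k, Continuous (deriv (regPow p (τ k))) := fun k =>
    (contDiff_infty_iff_deriv.1 (contDiff_regPow p (hτ0 k))).2.continuous
  have cρ : Continuous fun z : Pt n m => ρ z.1 := xρ.1
  have cH := continuous_grusin hu N
  refine Tendsto.add ?_ (Tendsto.const_mul _ ?_)
  · refine tendsto_integral_of_dominated_convergence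
      (fun z => ‖ρ z.1 * grusin n m N u z‖ * (p * (M ^ 2 + 1) ^ ((p - 1) / 2)))
      (fun k => ?_) ?_ (fun k => Eventually.of_forall fun z => ?_)
      (Eventually.of_forall fun z => ?_)
    · exact ((cρ.mul ((hΦ1 k).comp hu.continuous).abs).mul cH.abs).aestronglyMeasurable
    · exact (integral_mul_grusin xρ hu N).1.norm.mul_const _
    · have := abs_deriv_regPow_le hp (hτ0 k) (hτ1 k) (hM z)
      rw [norm_mul, norm_mul, norm_mul, Real.norm_eq_abs, Real.norm_eq_abs, Real.norm_eq_abs,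
        Real.norm_eq_abs, abs_abs, abs_abs]
      calc _ = |ρ z.1| * |grusin n m N u z| * |deriv (regPow p (τ k)) (u z)| := by ring
        _ ≤ _ := by gcongr
    · exact ((tendsto_abs_deriv_regPow hp (u z) hτ0 hτ).const_mul _).mul_const _
  · refine tendsto_integral_of_dominated_convergence
      (fun z => ‖ρ z.1 * u z‖ * (p * (M ^ 2 + 1) ^ ((p - 1) / 2)))
      (fun k => ?_) ?_ (fun k => Eventually.of_forall fun z => ?_)
      (Eventually.of_forall fun z => ?_)
    · exact (cρ.mul ((contDiff_regPow p (hτ0 k)).continuous.comp hu.continuous)).aestronglyMeasurable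
    · exact (xρ.integrable_mul hu).norm.mul_const _
    · have := regPow_le hp (hτ0 k) (hτ1 k) (hM z)
      rw [norm_mul, norm_mul, Real.norm_eq_abs, Real.norm_eq_abs, Real.norm_eq_abs,
        abs_of_nonneg (regPow_nonneg hp (hτ0 k) _)]
      calc _ ≤ |ρ z.1| * (p * (M ^ 2 + 1) ^ ((p - 1) / 2) * |u z|) := by gcongr
        _ = _ := by ring
    · exact (tendsto_regPow hp (u z) hτ).const_mul _

end EnergyBound

section Increments

open Topology Filter

variable {n m : ℕ}

theorem lintegral_weighted_increment_le {V : Type*} [NormedAddCommGroup V] [NormedSpace ℝ V]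
    [FiniteDimensional ℝ V] [MeasurableSpace V] [BorelSpace V] (μ : Measure V) [μ.IsAddHaarMeasure]
    {ω v : V → ℝ} {h : V} (hω : Continuous ω) (hinv : ∀ (s : ℝ) x, ω (x + s • h) = ω x)
    (hv : ContDiff ℝ (⊤ : ℕ∞) v) :
    ∫⁻ z, ‖ω z * (v (z + h) - v z)‖ₑ ^ (2 : ℝ) ∂μ ≤ ∫⁻ z, ‖ω z * dirD h v z‖ₑ ^ (2 : ℝ) ∂μ := by
  have hc : Continuous (dirD h v) := (hv.dirD h).continuous
  have key : ∀ z, ω z * (v (z + h) - v z) =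
      avg ((volume : Measure ℝ).restrict (Set.Icc 0 1)) (fun _ => (1 : ℝ)) (fun s : ℝ => s • h)
        (fun z => ω z * dirD h v z) z := by
    intro z
    have h1 : ∫ s in (0 : ℝ)..1, dirD h v (z + s • h) = v (z + (1 : ℝ) • h) - v (z + (0 : ℝ) • h) :=
      intervalIntegral.integral_eq_sub_of_hasDerivAt
        (fun s _ => hasDerivAt_line (hv.differentiable (by simp) _))
        ((by fun_prop : Continuous fun s : ℝ => dirD h v (z + s • h)).intervalIntegrable _ _)
    rw [intervalIntegral.integral_of_le zero_le_one, ← integral_Icc_eq_integral_Ioc] at h1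
    simp only [one_smul, zero_smul, add_zero] at h1
    rw [← h1, avg, ← integral_const_mul]
    simp only [hinv, one_mul]
  simp only [key]
  refine (lintegral_avg_rpow_le μ (by norm_num) (by fun_prop) (by fun_prop)
    (hω.mul hc)).trans (le_of_eq ?_)
  simp

theorem enorm_sqrt_mul_rpow_two {a b : ℝ} (ha : 0 ≤ a) :
    ‖√a * b‖ₑ ^ (2 : ℝ) = ENNReal.ofReal (a * b ^ 2) := by
  rw [← ofReal_norm, ENNReal.ofReal_rpow_of_nonneg (norm_nonneg _) (by norm_num)]
  congr 1
  rw [Real.rpow_two, Real.norm_eq_abs, sq_abs, mul_pow, Real.sq_sqrt ha]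

theorem dirD_inr_eq_sum (k : Fin m → ℝ) (u : Pt n m → ℝ) (z : Pt n m) :
    dirD (0, k) u z = ∑ l, k l * dirD (unitVec n m (.inr l)) u z := by
  have : ((0, k) : Pt n m) = ∑ l, k l • unitVec n m (.inr l) := by
    ext i
    · simp [unitVec, Prod.fst_sum]
    · simp only [unitVec, Prod.snd_sum, Finset.sum_apply, Prod.smul_snd, Pi.smul_apply, smul_eq_mul]
      simp [Pi.single_apply]
  simp only [dirD]
  rw [this, map_sum]
  simp

theorem lintegral_halfPow_increment_le {u : Pt n m → ℝ} (hu : IsReg u) (N : ℕ) {p : ℝ} (hp : 1 < p)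
    {ρ : (Fin n → ℝ) → ℝ} (hρ : ContDiff ℝ (⊤ : ℕ∞) ρ) (hρ0 : ∀ x, 0 ≤ ρ x) {lam : ℝ}
    (hlap : ∀ x, lapX ρ x ≤ lam * ρ x) (k : Fin m → ℝ) :
    ∫⁻ z, ENNReal.ofReal (ρ z.1 * sqx z.1 ^ N *
        (halfPow p 0 (u (z + (0, k))) - halfPow p 0 (u z)) ^ 2) ≤
      ENNReal.ofReal ((∑ l, k l ^ 2) * (p ^ 2 / (p - 1) * limEnergy N p lam ρ u)) := by
  let τ : ℕ → ℝ := fun j => 1 / ((j : ℝ) + 1)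
  have hτ0 : ∀ j, 0 < τ j := fun j => by positivity
  have hτ1 : ∀ j, τ j ≤ 1 := fun j => by
    rw [div_le_one (by positivity)]; linarith [(Nat.cast_nonneg j : (0 : ℝ) ≤ j)]
  have hτ : Tendsto τ atTop (𝓝 0) := tendsto_one_div_add_atTop_nhds_zero_nat
  have hν : ∀ z : Pt n m, 0 ≤ ρ z.1 * sqx z.1 ^ N := fun z =>
    mul_nonneg (hρ0 _) (pow_nonneg (sqx_nonneg _) _)
  have cν : Continuous fun z : Pt n m => ρ z.1 * sqx z.1 ^ N := by
    have := hρ.continuous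
    unfold sqx; fun_prop
  have huc := hu.continuous
  refine lintegral_le_of_tendsto
    (f := fun j z => ENNReal.ofReal (ρ z.1 * sqx z.1 ^ N *
        (halfPow p (τ j) (u (z + (0, k))) - halfPow p (τ j) (u z)) ^ 2))
    (B := fun j => ENNReal.ofReal
      ((∑ l, k l ^ 2) * (p ^ 2 / (p - 1) * regEnergy N p lam (τ j) ρ u)))
    (fun j => ?_) (fun z => ?_) (fun j => ?_) ?_
  · have := (contDiff_halfPow p (hτ0 j)).continuous
    exact (ENNReal.continuous_ofReal.comp (by fun_prop)).aemeasurable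
  · exact ENNReal.tendsto_ofReal
      ((((tendsto_halfPow p _ hτ).sub (tendsto_halfPow p _ hτ)).pow 2).const_mul _)
  · have hq := contDiff_halfPow p (hτ0 j)
    have hq1 : Continuous (deriv (halfPow p (τ j))) := (contDiff_infty_iff_deriv.1 hq).2.continuous
    have hK : 0 ≤ ∑ l, k l ^ 2 := Finset.sum_nonneg fun l _ => sq_nonneg _
    have h1 := lintegral_weighted_increment_le (volume : Measure (Pt n m))
      (ω := fun z => √(ρ z.1 * sqx z.1 ^ N)) (h := (0, k)) (v := fun z => halfPow p (τ j) (u z))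
      cν.sqrt (fun s x => by simp) (hq.comp hu.1)
    simp only [enorm_sqrt_mul_rpow_two (hν _)] at h1
    refine h1.trans ?_
    have hi := (integral_mul_gradSq ((XBdd.of_fst hρ.continuous).mul
      (hu.xBdd_comp (hq1.pow 2))) hu N).1
    have hnn : ∀ z : Pt n m, 0 ≤ ρ z.1 * deriv (halfPow p (τ j)) (u z) ^ 2 * gradSq N u z := fun z =>
      mul_nonneg (mul_nonneg (hρ0 _) (sq_nonneg _)) (gradSq_nonneg N u z)
    calc _ ≤ ∫⁻ z, ENNReal.ofReal ((∑ l, k l ^ 2) *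
            (ρ z.1 * deriv (halfPow p (τ j)) (u z) ^ 2 * gradSq N u z)) := by
          refine lintegral_mono fun z => ENNReal.ofReal_le_ofReal ?_
          rw [dirD_comp_real hu.differentiable (hq.differentiable (by simp))]
          beta_reduce
          rw [dirD_inr_eq_sum]
          have hcs := Finset.sum_mul_sq_le_sq_mul_sq Finset.univ k
            fun l => dirD (unitVec n m (.inr l)) u z
          have hS : 0 ≤ ∑ i, dirD (unitVec n m (.inl i)) u z ^ 2 :=
            Finset.sum_nonneg fun l _ => sq_nonneg _
          calc _ = ρ z.1 * sqx z.1 ^ N * deriv (halfPow p (τ j)) (u z) ^ 2 *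
                (∑ l, k l * dirD (unitVec n m (.inr l)) u z) ^ 2 := by ring
            _ ≤ ρ z.1 * sqx z.1 ^ N * deriv (halfPow p (τ j)) (u z) ^ 2 *
                ((∑ l, k l ^ 2) * ∑ l, dirD (unitVec n m (.inr l)) u z ^ 2) :=
              mul_le_mul_of_nonneg_left hcs (mul_nonneg (hν z) (sq_nonneg _))
            _ ≤ ρ z.1 * sqx z.1 ^ N * deriv (halfPow p (τ j)) (u z) ^ 2 *
                ((∑ l, k l ^ 2) * ∑ l, dirD (unitVec n m (.inr l)) u z ^ 2) +
                (∑ l, k l ^ 2) * (ρ z.1 * deriv (halfPow p (τ j)) (u z) ^ 2 *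
                  ∑ i, dirD (unitVec n m (.inl i)) u z ^ 2) :=
              le_add_of_nonneg_right
                (mul_nonneg hK (mul_nonneg (mul_nonneg (hρ0 _) (sq_nonneg _)) hS))
            _ = _ := by rw [gradSq]; ring
      _ = ENNReal.ofReal (∫ z, (∑ l, k l ^ 2) *
            (ρ z.1 * deriv (halfPow p (τ j)) (u z) ^ 2 * gradSq N u z)) :=
          (ofReal_integral_eq_lintegral_ofReal (hi.const_mul _)
            (Eventually.of_forall fun z => mul_nonneg hK (hnn z))).symm
      _ ≤ _ := by
          rw [integral_const_mul]
          exact ENNReal.ofReal_le_ofReal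
            (mul_le_mul_of_nonneg_left (energy_le hu N hp hρ hρ0 hlap (hτ0 j)) hK)
  · exact ENNReal.tendsto_ofReal
      (((tendsto_regEnergy hu N hp hρ lam hτ0 hτ1 hτ).const_mul _).const_mul _)

end Increments

open scoped ENNReal NNReal SchwartzMap

section Poincare

open Topology Filter

variable {n m : ℕ}

/-- The inclusion of the `y` variables, with Euclidean norm on the source. -/
noncomputable def yIncl (n m : ℕ) : EuclideanSpace ℝ (Fin m) →L[ℝ] Pt n m :=
  (ContinuousLinearMap.inr ℝ (Fin n → ℝ) (Fin m → ℝ)).comp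
    (EuclideanSpace.equiv (Fin m) ℝ : EuclideanSpace ℝ (Fin m) →L[ℝ] (Fin m → ℝ))

theorem yIncl_apply (w : EuclideanSpace ℝ (Fin m)) : yIncl n m w = (0, fun l => w l) := rfl

theorem lintegral_weighted_rpow_lt_top {u : Pt n m → ℝ} (hu : IsReg u) {p : ℝ} (hp : 1 < p)
    {a : (Fin n → ℝ) → ℝ} (ha : Continuous a) :
    ∫⁻ z, ENNReal.ofReal (a z.1 * |u z| ^ p) < ⊤ := by
  obtain ⟨C, hC0, hC⟩ := hu.exists_bound
  have h1 := ((XBdd.of_fst (m := m) ha.abs).integrable_mul hu).norm.mul_const (C ^ (p - 1))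
  refine lt_of_le_of_lt (lintegral_mono fun z => ?_) h1.lintegral_lt_top
  refine ENNReal.ofReal_le_ofReal ?_
  rw [norm_mul, Real.norm_eq_abs, Real.norm_eq_abs, abs_abs, mul_assoc]
  have : |u z| ^ p = |u z| * |u z| ^ (p - 1) := by
    rw [← Real.rpow_one_add' (abs_nonneg _) (by linarith)]; ring_nf
  rw [this]
  gcongr
  · exact le_abs_self _
  · exact hC z

theorem exists_weighted_poincare (n m : ℕ) (χ : 𝓢(EuclideanSpace ℝ (Fin m), ℝ)) {p : ℝ}
    (hp : 1 < p) : ∃ C : ℝ≥0, ∀ (N : ℕ) (u : Pt n m → ℝ) (_ : IsReg u) (ρ : (Fin n → ℝ) → ℝ)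
      (_ : ContDiff ℝ (⊤ : ℕ∞) ρ) (_ : ∀ x, 0 ≤ ρ x) (lam : ℝ) (_ : ∀ x, lapX ρ x ≤ lam * ρ x)
      (R : ℝ) (_ : ∀ z, u z = ∫ w, χ w * (u z - u (z + R • yIncl n m w))),
      ∫⁻ z, ENNReal.ofReal (ρ z.1 * sqx z.1 ^ N * |u z| ^ p) ≤
        C * ENNReal.ofReal (R ^ 2 * limEnergy N p lam ρ u) := by
  have hp0 : 0 < p := by linarith
  have hκ : 0 ≤ p ^ 2 / (p - 1) := div_nonneg (sq_nonneg _) (by linarith)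
  set A : ℝ≥0∞ := ∫⁻ w, ‖χ w‖ₑ with hA
  have hAt : A ≠ ⊤ := (χ.integrable (μ := volume)).2.ne
  have hAp : A ^ (p - 1) ≠ ⊤ := ENNReal.rpow_ne_top_of_nonneg (by linarith) hAt
  set B : ℝ≥0∞ := ∫⁻ w, ‖χ w‖ₑ * ENNReal.ofReal (‖w‖ ^ 2) with hB
  have hBt : B ≠ ⊤ := by
    have := (χ.integrable_pow_mul (volume) 2).2.ne
    refine ne_of_eq_of_ne (lintegral_congr fun w => ?_) this
    rw [enorm_mul, Real.enorm_of_nonneg (r := ‖w‖ ^ 2) (by positivity), enorm_norm, mul_comm]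
  set T : ℝ := (A ^ (p - 1) * A).toReal with hT
  have hTt : A ^ (p - 1) * A ≠ ⊤ := ENNReal.mul_ne_top hAp hAt
  have hT0 : 0 ≤ T := ENNReal.toReal_nonneg
  set η : ℝ := 1 / (4 * (T + 1)) with hη
  have hη0 : 0 < η := by positivity
  obtain ⟨C, hC0, hC⟩ := exists_abs_sub_rpow_le hp hη0
  refine ⟨(2 * (A ^ (p - 1) * B * ENNReal.ofReal (C * (p ^ 2 / (p - 1))))).toNNReal,
    fun N u hu ρ hρ hρ0 lam hlap R hrep => ?_⟩
  rw [ENNReal.coe_toNNReal (ENNReal.mul_ne_top (by simp)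
    (ENNReal.mul_ne_top (ENNReal.mul_ne_top hAp hBt) (by simp)))]
  set ν : Pt n m → ℝ := fun z => ρ z.1 * sqx z.1 ^ N with hν
  have hν0 : ∀ z, 0 ≤ ν z := fun z => mul_nonneg (hρ0 _) (pow_nonneg (sqx_nonneg _) _)
  have cν' : Continuous fun x => ρ x * sqx x ^ N := by
    have := hρ.continuous
    unfold sqx; fun_prop
  have cν : Continuous ν := cν'.comp continuous_fst
  have huc := hu.continuous
  set X : ℝ≥0∞ := ∫⁻ z, ENNReal.ofReal (ν z * |u z| ^ p) with hX
  have hXt : X ≠ ⊤ := (lintegral_weighted_rpow_lt_top hu hp cν').ne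
  have cp : Continuous fun z => |u z| ^ p := huc.abs.rpow_const fun _ => Or.inr hp0.le
  have hshift : ∀ w, ∫⁻ z, ENNReal.ofReal (ν z * |u (z + R • yIncl n m w)| ^ p) = X := fun w => by
    rw [hX, ← lintegral_add_right_eq_self (fun z => ENNReal.ofReal (ν z * |u z| ^ p))
      (R • yIncl n m w)]
    refine lintegral_congr fun z => ?_
    simp [hν, yIncl_apply]
  have hinc : ∀ w, ∫⁻ z, ENNReal.ofReal (ν z * |u z - u (z + R • yIncl n m w)| ^ p) ≤
      ENNReal.ofReal (‖w‖ ^ 2) * (ENNReal.ofReal (C * (p ^ 2 / (p - 1))) *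
        ENNReal.ofReal (R ^ 2 * limEnergy N p lam ρ u)) + 2 * (ENNReal.ofReal η * X) := by
    intro w
    have hd := lintegral_halfPow_increment_le hu N hp hρ hρ0 hlap fun l => R * w l
    have hk : ((0, fun l => R * w l) : Pt n m) = R • yIncl n m w := by
      rw [yIncl_apply]; ext <;> simp
    have hs : ∑ l, (R * w l) ^ 2 = R ^ 2 * ‖w‖ ^ 2 := by
      simp only [mul_pow, ← Finset.mul_sum, EuclideanSpace.norm_sq_eq, Real.norm_eq_abs, sq_abs]
    rw [hk, hs] at hd
    calc ∫⁻ z, ENNReal.ofReal (ν z * |u z - u (z + R • yIncl n m w)| ^ p)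
        ≤ ∫⁻ z, (ENNReal.ofReal C * ENNReal.ofReal (ν z *
            (halfPow p 0 (u (z + R • yIncl n m w)) - halfPow p 0 (u z)) ^ 2) +
            ENNReal.ofReal η * (ENNReal.ofReal (ν z * |u z| ^ p) +
              ENNReal.ofReal (ν z * |u (z + R • yIncl n m w)| ^ p))) := by
          refine lintegral_mono fun z => ?_
          have h0 := hν0 z
          rw [← ENNReal.ofReal_add (by positivity) (by positivity), ← ENNReal.ofReal_mul hC0,
            ← ENNReal.ofReal_mul hη0.le, ← ENNReal.ofReal_add (by positivity) (by positivity)]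
          refine ENNReal.ofReal_le_ofReal ?_
          have := mul_le_mul_of_nonneg_left (hC (u z) (u (z + R • yIncl n m w))) h0
          nlinarith
      _ ≤ ENNReal.ofReal C * ENNReal.ofReal (R ^ 2 * ‖w‖ ^ 2 *
            (p ^ 2 / (p - 1) * limEnergy N p lam ρ u)) + ENNReal.ofReal η * (X + X) := by
          have m1 : Measurable fun z => ENNReal.ofReal (ν z * |u z| ^ p) :=
            (cν.mul cp).measurable.ennreal_ofReal
          have m2 : Measurable fun z =>
              ENNReal.ofReal (ν z * |u (z + R • yIncl n m w)| ^ p) :=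
            (cν.mul (cp.comp (by fun_prop : Continuous fun z : Pt n m => z + R • yIncl n m w))
              ).measurable.ennreal_ofReal
          have m3 : Measurable fun z => ENNReal.ofReal η * (ENNReal.ofReal (ν z * |u z| ^ p) +
              ENNReal.ofReal (ν z * |u (z + R • yIncl n m w)| ^ p)) := (m1.add m2).const_mul _
          rw [lintegral_add_right _ m3,
            lintegral_const_mul' _ _ ENNReal.ofReal_ne_top,
            lintegral_const_mul' _ _ ENNReal.ofReal_ne_top, lintegral_add_left m1, hshift]
          gcongr
      _ = _ := by
          rw [← ENNReal.ofReal_mul hC0, ← ENNReal.ofReal_mul (by positivity),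
            ← ENNReal.ofReal_mul (by positivity)]
          congr 1
          · congr 1; ring
          · ring
  have hpt : ∀ z, ENNReal.ofReal (ν z * |u z| ^ p) ≤
      A ^ (p - 1) * ∫⁻ w, ‖χ w‖ₑ * ENNReal.ofReal (ν z * |u z - u (z + R • yIncl n m w)| ^ p) := by
    intro z
    have e1 : ∀ a : ℝ, ‖a‖ₑ ^ p = ENNReal.ofReal (|a| ^ p) := fun a => by
      rw [← ofReal_norm, ENNReal.ofReal_rpow_of_nonneg (norm_nonneg _) hp0.le, Real.norm_eq_abs]
    have h1 : ‖u z‖ₑ ≤ ∫⁻ w, ‖χ w‖ₑ * ‖u z - u (z + R • yIncl n m w)‖ₑ := by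
      conv_lhs => rw [hrep z]
      refine (enorm_integral_le_lintegral_enorm _).trans (le_of_eq ?_)
      simp [enorm_mul]
    have h2 := lintegral_mul_rpow_le (ν := volume) hp.le (a := fun w => ‖χ w‖ₑ)
      (b := fun w => ‖u z - u (z + R • yIncl n m w)‖ₑ)
      χ.continuous.measurable.enorm.aemeasurable
      (by fun_prop : Continuous fun w => u z - u (z + R • yIncl n m w)).measurable.enorm.aemeasurable
    have h3 := (ENNReal.rpow_le_rpow h1 hp0.le).trans h2
    rw [ENNReal.ofReal_mul (hν0 z), ← e1]
    simp only [ENNReal.ofReal_mul (hν0 z), ← e1]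
    have e2 : ∀ w, ‖χ w‖ₑ * (ENNReal.ofReal (ν z) * ‖u z - u (z + R • yIncl n m w)‖ₑ ^ p) =
      ENNReal.ofReal (ν z) * (‖χ w‖ₑ * ‖u z - u (z + R • yIncl n m w)‖ₑ ^ p) := fun w => by ring
    simp only [e2]
    rw [lintegral_const_mul' _ _ ENNReal.ofReal_ne_top]
    calc _ ≤ ENNReal.ofReal (ν z) * _ := mul_le_mul_right h3 _
      _ = _ := by ring
  set D := ENNReal.ofReal (R ^ 2 * limEnergy N p lam ρ u) with hD
  have hmain : X ≤ A ^ (p - 1) * B * ENNReal.ofReal (C * (p ^ 2 / (p - 1))) * D +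
      A ^ (p - 1) * A * (2 * ENNReal.ofReal η) * X := by
    calc X ≤ ∫⁻ z, A ^ (p - 1) * ∫⁻ w, ‖χ w‖ₑ *
          ENNReal.ofReal (ν z * |u z - u (z + R • yIncl n m w)| ^ p) := lintegral_mono hpt
      _ = A ^ (p - 1) * ∫⁻ w, ∫⁻ z, ‖χ w‖ₑ *
          ENNReal.ofReal (ν z * |u z - u (z + R • yIncl n m w)| ^ p) := by
        rw [lintegral_const_mul' _ _ hAp, lintegral_lintegral_swap]
        have c1 : Continuous fun q : Pt n m × EuclideanSpace ℝ (Fin m) =>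
            ν q.1 * |u q.1 - u (q.1 + R • yIncl n m q.2)| ^ p :=
          (cν.comp continuous_fst).mul ((by fun_prop : Continuous fun q : Pt n m ×
            EuclideanSpace ℝ (Fin m) => |u q.1 - u (q.1 + R • yIncl n m q.2)|).rpow_const
              fun _ => Or.inr hp0.le)
        have c2 : Continuous fun q : Pt n m × EuclideanSpace ℝ (Fin m) => χ q.2 :=
          χ.continuous.comp continuous_snd
        exact (c2.measurable.enorm.mul c1.measurable.ennreal_ofReal).aemeasurable
      _ ≤ A ^ (p - 1) * ∫⁻ w, (‖χ w‖ₑ * ENNReal.ofReal (‖w‖ ^ 2) *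
            (ENNReal.ofReal (C * (p ^ 2 / (p - 1))) * D) + ‖χ w‖ₑ * (2 * (ENNReal.ofReal η * X))) := by
        refine mul_le_mul_right (lintegral_mono fun w => ?_) _
        rw [lintegral_const_mul' _ _ enorm_ne_top]
        refine (mul_le_mul_right (hinc w) _).trans (le_of_eq ?_)
        ring
      _ = _ := by
        rw [lintegral_add_right _ (χ.continuous.measurable.enorm.mul_const _),
          lintegral_mul_const' _ _ (ENNReal.mul_ne_top (by simp) (by simp [hD])),
          lintegral_mul_const' _ _ (ENNReal.mul_ne_top (by simp) (ENNReal.mul_ne_top (by simp) hXt)),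
          ← hA, ← hB]
        ring
  have hhalf : A ^ (p - 1) * A * (2 * ENNReal.ofReal η) ≤ 1 / 2 := by
    rw [← ENNReal.ofReal_toReal hTt, ← hT, show (2 : ℝ≥0∞) = ENNReal.ofReal 2 by simp,
      ← ENNReal.ofReal_mul (by norm_num), ← ENNReal.ofReal_mul hT0, ← ENNReal.ofReal_one,
      ← ENNReal.ofReal_div_of_pos (by norm_num)]
    refine ENNReal.ofReal_le_ofReal ?_
    rw [hη]
    field_simp
    linarith
  have := ENNReal.le_two_mul_of_le_add_half hXt (hmain.trans (add_le_add le_rfl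
    ((mul_le_mul_left hhalf X).trans (le_of_eq (by rw [one_div, div_eq_mul_inv, mul_comm])))))
  refine this.trans (le_of_eq ?_)
  ring

end Poincare

section Hardy

open Topology Filter

variable {n m : ℕ}

theorem hasFDerivAt_dirD_comp {V : Type*} [NormedAddCommGroup V] [NormedSpace ℝ V] {g : V → ℝ}
    {θ : ℝ → ℝ} {θ' : ℝ} {x : V} (v : V) (hg : DifferentiableAt ℝ g x)
    (hθ : HasDerivAt θ θ' (g x)) : dirD v (fun y => θ (g y)) x = θ' * dirD v g x := by
  have h := (hθ.comp_hasFDerivAt x hg.hasFDerivAt).fderiv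
  simp only [Function.comp_def] at h
  simp [dirD, h]

theorem differentiable_sqx : Differentiable ℝ (sqx : (Fin n → ℝ) → ℝ) := by
  unfold sqx; fun_prop

theorem dirD_sqx (v x : Fin n → ℝ) : dirD v sqx x = 2 * ∑ i, x i * v i := by
  have h : HasFDerivAt (fun x : Fin n → ℝ => ∑ i, x i ^ 2)
      (∑ i, (2 * x i) • ContinuousLinearMap.proj (R := ℝ) (φ := fun _ : Fin n => ℝ) i) x := by
    refine HasFDerivAt.fun_sum fun i _ => ?_
    have := (ContinuousLinearMap.proj (R := ℝ) (φ := fun _ : Fin n => ℝ) i).hasFDerivAt (x := x)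
    simpa using this.pow 2
  have e : (sqx : (Fin n → ℝ) → ℝ) = fun x : Fin n → ℝ => ∑ i, x i ^ 2 := rfl
  rw [dirD, e, h.fderiv]
  simp [Finset.mul_sum, mul_assoc]

theorem dirD_single_sqx (i : Fin n) (x : Fin n → ℝ) :
    dirD (Pi.single i (1 : ℝ)) sqx x = 2 * x i := by
  rw [dirD_sqx]; simp [Pi.single_apply]

theorem dirD_sqx_add_rpow {τ : ℝ} (hτ : 0 < τ) (s : ℝ) (v x : Fin n → ℝ) :
    dirD v (fun x => (sqx x + τ) ^ s) x = s * (sqx x + τ) ^ (s - 1) * dirD v sqx x := by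
  have h0 : 0 < sqx x + τ := by linarith [sqx_nonneg x]
  refine hasFDerivAt_dirD_comp (θ := fun t => (t + τ) ^ s) v (differentiable_sqx x) ?_
  have := ((hasDerivAt_id (sqx x)).add_const τ).rpow_const (p := s) (Or.inl h0.ne')
  simpa using this

theorem contDiff_sqx_add_rpow {τ : ℝ} (hτ : 0 < τ) (s : ℝ) :
    ContDiff ℝ (⊤ : ℕ∞) (fun x : Fin n → ℝ => (sqx x + τ) ^ s) := by
  have h : ContDiff ℝ (⊤ : ℕ∞) (fun x : Fin n → ℝ => sqx x + τ) := by unfold sqx; fun_prop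
  exact h.rpow_const_of_ne fun x => by linarith [sqx_nonneg x]

/-- A smooth unit-length substitute for the radial vector field. -/
noncomputable def radial (τ : ℝ) (i : Fin n) (x : Fin n → ℝ) : ℝ :=
  x i * (sqx x + τ) ^ (-(1 / 2) : ℝ)

theorem contDiff_radial {τ : ℝ} (hτ : 0 < τ) (i : Fin n) :
    ContDiff ℝ (⊤ : ℕ∞) (radial τ i) :=
  (by fun_prop : ContDiff ℝ (⊤ : ℕ∞) fun x : Fin n → ℝ => x i).mul (contDiff_sqx_add_rpow hτ _)

theorem sum_radial_sq_le {τ : ℝ} (hτ : 0 < τ) (x : Fin n → ℝ) : ∑ i, radial τ i x ^ 2 ≤ 1 := by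
  have h0 : 0 < sqx x + τ := by linarith [sqx_nonneg x]
  have : ((sqx x + τ) ^ (-(1 / 2) : ℝ)) ^ 2 = (sqx x + τ)⁻¹ := by
    rw [← Real.rpow_natCast, ← Real.rpow_mul h0.le, ← Real.rpow_neg_one]; norm_num
  simp only [radial, mul_pow, this]
  rw [← Finset.sum_mul, ← div_eq_mul_inv, div_le_one h0]
  change sqx x ≤ _
  linarith

theorem le_div_mul_radial (hn : 2 ≤ n) {τ : ℝ} (hτ : 0 < τ) {ρ : (Fin n → ℝ) → ℝ}
    (hρ : Differentiable ℝ ρ) (hρ0 : ∀ x, 0 ≤ ρ x)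
    (hρx : ∀ x, 0 ≤ ∑ i, x i * dirD (Pi.single i (1 : ℝ)) ρ x) (x : Fin n → ℝ) :
    ρ x * (sqx x + τ) ^ (-(1 / 2) : ℝ) ≤
      ∑ i, dirD (Pi.single i (1 : ℝ)) (fun x => ρ x * radial τ i x) x := by
  have h0 : 0 < sqx x + τ := by linarith [sqx_nonneg x]
  set g := (sqx x + τ) ^ (-(1 / 2) : ℝ) with hg
  have hg0 : 0 < g := by positivity
  have e1 : (sqx x + τ) ^ (-(1 / 2) - 1 : ℝ) = g * (sqx x + τ)⁻¹ := by
    rw [Real.rpow_sub h0, Real.rpow_one, div_eq_mul_inv]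
  have key : ∀ i, dirD (Pi.single i (1 : ℝ)) (fun x => ρ x * radial τ i x) x =
      g * (x i * dirD (Pi.single i (1 : ℝ)) ρ x) + ρ x * (g - g * (sqx x + τ)⁻¹ * x i ^ 2) := by
    intro i
    have hX : dirD (Pi.single i (1 : ℝ)) (radial τ i) x = g - g * (sqx x + τ)⁻¹ * x i ^ 2 := by
      have d1 : Differentiable ℝ (fun x : Fin n → ℝ => x i) := by fun_prop
      have e : radial τ i = fun x : Fin n → ℝ => x i * (sqx x + τ) ^ (-(1 / 2) : ℝ) := rfl
      have e2 : dirD (Pi.single i (1 : ℝ)) (fun x : Fin n → ℝ => x i) x = 1 := by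
        have := ((ContinuousLinearMap.proj (R := ℝ) (φ := fun _ : Fin n => ℝ) i).hasFDerivAt
          (x := x)).fderiv
        change fderiv ℝ (ContinuousLinearMap.proj (R := ℝ) (φ := fun _ : Fin n => ℝ) i) x _ = 1
        rw [this]; simp
      rw [e, dirD_mul _ d1 ((contDiff_sqx_add_rpow hτ _).differentiable (by simp))]
      beta_reduce
      rw [dirD_sqx_add_rpow hτ, e2, dirD_single_sqx, e1]
      ring
    rw [dirD_mul _ hρ ((contDiff_radial hτ i).differentiable (by simp))]
    beta_reduce
    rw [hX, radial, ← hg]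
    ring
  simp only [key, Finset.sum_add_distrib, ← Finset.mul_sum, Finset.sum_sub_distrib]
  simp only [Finset.sum_const, Finset.card_univ, Fintype.card_fin, nsmul_eq_mul]
  have h1 : g * (sqx x + τ)⁻¹ * ∑ i, x i ^ 2 ≤ g := by
    rw [mul_assoc]
    refine mul_le_of_le_one_right hg0.le ?_
    rw [inv_mul_le_one₀ h0]
    change sqx x ≤ _
    linarith
  have h2 : (2 : ℝ) ≤ n := by exact_mod_cast hn
  have h3 : g ≤ n * g - g * (sqx x + τ)⁻¹ * ∑ i, x i ^ 2 := by nlinarith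
  have h4 := mul_le_mul_of_nonneg_left h3 (hρ0 x)
  have h5 := mul_nonneg hg0.le (hρx x)
  linarith

theorem halfPow_sq_eq {p : ℝ} (hp : 1 < p) {τ : ℝ} (hτ : 0 < τ) (a : ℝ) :
    halfPow p τ a ^ 2 = p⁻¹ * (a * deriv (regPow p τ) a) := by
  have hb : 0 < a ^ 2 + τ := by positivity
  rw [deriv_regPow p hτ, halfPow, mul_pow,
    ← Real.rpow_natCast ((a ^ 2 + τ) ^ ((p - 2) / 4)), ← Real.rpow_mul hb.le]
  have : (p - 2) / 4 * ((2 : ℕ) : ℝ) = p / 2 - 1 := by push_cast; ring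
  rw [this]
  have : p ≠ 0 := by linarith
  beta_reduce
  field_simp

theorem regularised_hardy (hn : 2 ≤ n) {u : Pt n m → ℝ} (hu : IsReg u) (N : ℕ) {p : ℝ}
    (hp : 1 < p) {ρ : (Fin n → ℝ) → ℝ} (hρ : ContDiff ℝ (⊤ : ℕ∞) ρ) (hρ0 : ∀ x, 0 ≤ ρ x)
    (hρx : ∀ x, 0 ≤ ∑ i, x i * dirD (Pi.single i (1 : ℝ)) ρ x) {lam : ℝ}
    (hlap : ∀ x, lapX ρ x ≤ lam * ρ x) {τ : ℝ} (hτ : 0 < τ) {s : ℝ} (hs : 0 < s) :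
    ∫ z, ρ z.1 * (sqx z.1 + τ) ^ (-(1 / 2) : ℝ) * halfPow p τ (u z) ^ 2 ≤
      s * (∫ z, ρ z.1 * halfPow p τ (u z) ^ 2) +
        s⁻¹ * (p ^ 2 / (p - 1) * regEnergy N p lam τ ρ u) := by
  have hq := contDiff_halfPow p hτ
  have dq := hq.differentiable (by simp)
  have hq1 : Continuous (deriv (halfPow p τ)) := (contDiff_infty_iff_deriv.1 hq).2.continuous
  have hθ : ContDiff ℝ 1 (fun a => halfPow p τ a ^ 2) := (hq.pow 2).of_le (by simp)
  have dθ := hθ.differentiable (by simp)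
  have hθ0 : halfPow p τ 0 ^ 2 = 0 := by rw [halfPow_zero]; simp
  have hθ' : ∀ a, deriv (fun a => halfPow p τ a ^ 2) a = 2 * halfPow p τ a * deriv (halfPow p τ) a :=
    fun a => by simpa using ((dq a).hasDerivAt.fun_pow 2).deriv
  let Y : Fin n → (Fin n → ℝ) → ℝ := fun i x => ρ x * radial τ i x
  have hY : ∀ i, ContDiff ℝ (⊤ : ℕ∞) (Y i) := fun i => hρ.mul (contDiff_radial hτ i)
  have dY : ∀ i, Differentiable ℝ (fun z : Pt n m => Y i z.1) := fun i =>
    ((hY i).differentiable (by simp)).comp differentiable_fst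
  have cdY : ∀ i, Continuous (dirD (Pi.single i (1 : ℝ)) (Y i)) := fun i => ((hY i).dirD _).continuous
  have hd : ∀ i, dirD (unitVec n m (.inl i)) (fun z : Pt n m => Y i z.1) = fun z =>
      dirD (Pi.single i (1 : ℝ)) (Y i) z.1 := fun i =>
    dirD_comp_fst ((hY i).differentiable (by simp)) _
  have e1 : ∀ i, ∫ z, Y i z.1 * (deriv (fun a => halfPow p τ a ^ 2) (u z) *
        dirD (unitVec n m (.inl i)) u z) =
      -∫ z, dirD (Pi.single i (1 : ℝ)) (Y i) z.1 * halfPow p τ (u z) ^ 2 := fun i => by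
    have := (XBdd.of_fst (m := m) (hY i).continuous).integral_mul_comp (unitVec n m (.inl i)) (dY i)
      (by rw [hd]; exact .of_fst (cdY i)) hu hθ hθ0
    rw [hd] at this
    exact this
  have iA : ∀ i, Integrable fun z : Pt n m =>
      dirD (Pi.single i (1 : ℝ)) (Y i) z.1 * halfPow p τ (u z) ^ 2 := fun i =>
    (XBdd.of_fst (cdY i)).integrable_mul_comp hu dθ hθ0
  have iB : ∀ i, Integrable fun z : Pt n m => Y i z.1 *
      (deriv (fun a => halfPow p τ a ^ 2) (u z) * dirD (unitVec n m (.inl i)) u z) := fun i => by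
    simpa only [mul_assoc] using ((XBdd.of_fst (hY i).continuous).mul
      (hu.xBdd_comp hθ.continuous_deriv_one)).integrable_mul (hu.dirD (unitVec n m (.inl i)))
  have xρ : XBdd (fun z : Pt n m => ρ z.1) := .of_fst hρ.continuous
  have iq : Integrable fun z : Pt n m => ρ z.1 * halfPow p τ (u z) ^ 2 :=
    xρ.integrable_mul_comp hu dθ hθ0
  have ig : Integrable fun z : Pt n m =>
      ρ z.1 * deriv (halfPow p τ) (u z) ^ 2 * gradSq N u z := (integral_mul_gradSq (xρ.mul (hu.xBdd_comp (hq1.pow 2))) hu N).1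
  calc ∫ z, ρ z.1 * (sqx z.1 + τ) ^ (-(1 / 2) : ℝ) * halfPow p τ (u z) ^ 2
      ≤ ∫ z, ∑ i, dirD (Pi.single i (1 : ℝ)) (Y i) z.1 * halfPow p τ (u z) ^ 2 := by
        refine integral_mono ?_ (integrable_finsetSum _ fun i _ => iA i) fun z => ?_
        · exact (XBdd.of_fst (hρ.mul (contDiff_sqx_add_rpow hτ _)).continuous).integrable_mul_comp
            hu dθ hθ0
        · beta_reduce
          rw [← Finset.sum_mul]
          exact mul_le_mul_of_nonneg_right
            (le_div_mul_radial hn hτ (hρ.differentiable (by simp)) hρ0 hρx z.1) (sq_nonneg _)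
    _ = ∫ z, -∑ i, Y i z.1 * (deriv (fun a => halfPow p τ a ^ 2) (u z) *
        dirD (unitVec n m (.inl i)) u z) := by
        rw [integral_neg, integral_finsetSum _ fun i _ => iA i, integral_finsetSum _ fun i _ => iB i,
          ← Finset.sum_neg_distrib]
        exact Finset.sum_congr rfl fun i _ => by rw [e1, neg_neg]
    _ ≤ ∫ z, (s * (ρ z.1 * halfPow p τ (u z) ^ 2) +
          s⁻¹ * (ρ z.1 * deriv (halfPow p τ) (u z) ^ 2 * gradSq N u z)) := by
        refine integral_mono (integrable_finsetSum _ fun i _ => iB i).neg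
          ((iq.const_mul _).add (ig.const_mul _)) fun z => ?_
        beta_reduce
        set a := halfPow p τ (u z)
        set b := deriv (halfPow p τ) (u z)
        have hS : (∑ i, radial τ i z.1 * dirD (unitVec n m (.inl i)) u z) ^ 2 ≤ gradSq N u z := by
          refine (Finset.sum_mul_sq_le_sq_mul_sq _ _ _).trans ?_
          have h1 := sum_radial_sq_le hτ z.1
          have h2 : 0 ≤ ∑ i, dirD (unitVec n m (.inl i)) u z ^ 2 :=
            Finset.sum_nonneg fun _ _ => sq_nonneg _
          refine (mul_le_of_le_one_left h2 h1).trans ?_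
          have h3 : 0 ≤ ∑ l, dirD (unitVec n m (.inr l)) u z ^ 2 :=
            Finset.sum_nonneg fun _ _ => sq_nonneg _
          exact le_add_of_nonneg_right (mul_nonneg (pow_nonneg (sqx_nonneg _) _) h3)
        set S := ∑ i, radial τ i z.1 * dirD (unitVec n m (.inl i)) u z with hSd
        have e2 : ∑ i, Y i z.1 * (deriv (fun a => halfPow p τ a ^ 2) (u z) *
            dirD (unitVec n m (.inl i)) u z) = ρ z.1 * (2 * a * b * S) := by
          rw [hSd, Finset.mul_sum, Finset.mul_sum]
          exact Finset.sum_congr rfl fun i _ => by rw [hθ']; simp only [Y]; ring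
        rw [e2]
        have h4 : -(2 * a * b * S) ≤ s * a ^ 2 + s⁻¹ * (b ^ 2 * S ^ 2) := by
          have : 0 ≤ s⁻¹ * (s * a + b * S) ^ 2 := by positivity
          have e3 : s⁻¹ * (s * a + b * S) ^ 2 =
              s * a ^ 2 + s⁻¹ * (b ^ 2 * S ^ 2) + 2 * a * b * S := by field_simp; ring
          linarith
        have h5 : s⁻¹ * (b ^ 2 * S ^ 2) ≤ s⁻¹ * (b ^ 2 * gradSq N u z) := by gcongr
        have h6 := mul_le_mul_of_nonneg_left (h4.trans (add_le_add le_rfl h5)) (hρ0 z.1)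
        linarith
    _ ≤ _ := by
        rw [integral_add (iq.const_mul _) (ig.const_mul _), integral_const_mul, integral_const_mul]
        exact add_le_add le_rfl (mul_le_mul_of_nonneg_left (energy_le hu N hp hρ hρ0 hlap hτ)
          (by positivity))

end Hardy

open scoped ENNReal NNReal SchwartzMap

section Combine

open Topology Filter

variable {n m : ℕ}

theorem ae_fst_ne_zero (hn : 1 ≤ n) : ∀ᵐ z : Pt n m, z.1 ≠ 0 := by
  have : Nonempty (Fin n) := ⟨⟨0, hn⟩⟩
  rw [ae_iff]
  have : {z : Pt n m | ¬ z.1 ≠ 0} = ({0} : Set (Fin n → ℝ)) ×ˢ (Set.univ : Set (Fin m → ℝ)) := by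
    ext z; simp
  rw [this]
  change (volume.prod volume) _ = 0
  rw [Measure.prod_prod]
  simp

theorem sqx_pos {x : Fin n → ℝ} (hx : x ≠ 0) : 0 < sqx x := by
  have h := norm_sq_le_sqx x
  have : 0 < ‖x‖ := norm_pos_iff.2 hx
  nlinarith

theorem lintegral_le_of_ae_tendsto {α : Type*} [MeasurableSpace α] {μ : Measure α}
    {f : ℕ → α → ℝ≥0∞} {g : α → ℝ≥0∞} (hf : ∀ k, AEMeasurable (f k) μ)
    (hg : ∀ᵐ z ∂μ, Tendsto (fun k => f k z) atTop (𝓝 (g z))) {B : ℕ → ℝ≥0∞} {b : ℝ≥0∞}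
    (hB : ∀ k, ∫⁻ z, f k z ∂μ ≤ B k) (hb : Tendsto B atTop (𝓝 b)) : ∫⁻ z, g z ∂μ ≤ b := by
  calc ∫⁻ z, g z ∂μ = ∫⁻ z, liminf (fun k => f k z) atTop ∂μ :=
        lintegral_congr_ae (hg.mono fun z hz => hz.liminf_eq.symm)
    _ ≤ liminf (fun k => ∫⁻ z, f k z ∂μ) atTop := lintegral_liminf_le' hf
    _ ≤ liminf B atTop := liminf_le_liminf (Eventually.of_forall hB)
    _ = b := hb.liminf_eq

theorem integrable_weighted_rpow {u : Pt n m → ℝ} (hu : IsReg u) {p : ℝ} (hp : 1 < p)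
    {a : (Fin n → ℝ) → ℝ} (ha : Continuous a) (ha0 : ∀ x, 0 ≤ a x) :
    Integrable fun z => a z.1 * |u z| ^ p := by
  have huc := hu.continuous
  have c : Continuous fun z => a z.1 * |u z| ^ p :=
    (ha.comp continuous_fst).mul (huc.abs.rpow_const fun _ => Or.inr (by linarith))
  refine ⟨c.aestronglyMeasurable, ?_⟩
  refine lt_of_le_of_lt (le_of_eq (lintegral_congr fun z => ?_))
    (lintegral_weighted_rpow_lt_top hu hp ha)
  have := ha0 z.1
  rw [Real.enorm_of_nonneg (by positivity)]

theorem tendsto_integral_halfPow_sq {u : Pt n m → ℝ} (hu : IsReg u) {p : ℝ} (hp : 1 < p)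
    {ρ : (Fin n → ℝ) → ℝ} (hρ : Continuous ρ)
    {τ : ℕ → ℝ} (hτ0 : ∀ k, 0 < τ k) (hτ1 : ∀ k, τ k ≤ 1) (hτ : Tendsto τ atTop (𝓝 0)) :
    Tendsto (fun k => ∫ z, ρ z.1 * halfPow p (τ k) (u z) ^ 2) atTop
      (𝓝 (∫ z, ρ z.1 * |u z| ^ p)) := by
  obtain ⟨M, hM0, hM⟩ := hu.exists_bound
  have xρ : XBdd (fun z : Pt n m => ρ z.1) := .of_fst hρ
  have cρ : Continuous fun z : Pt n m => ρ z.1 := xρ.1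
  refine tendsto_integral_of_dominated_convergence
    (fun z => ‖ρ z.1 * u z‖ * (p⁻¹ * (p * (M ^ 2 + 1) ^ ((p - 1) / 2))))
    (fun k => ?_) ?_ (fun k => Eventually.of_forall fun z => ?_)
    (Eventually.of_forall fun z => ?_)
  · exact (cρ.mul (((contDiff_halfPow p (hτ0 k)).continuous.comp hu.continuous).pow 2)
      ).aestronglyMeasurable
  · exact (xρ.integrable_mul hu).norm.mul_const _
  · have := abs_deriv_regPow_le hp (hτ0 k) (hτ1 k) (hM z)
    rw [norm_mul, norm_mul, Real.norm_eq_abs, Real.norm_eq_abs, Real.norm_eq_abs,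
      halfPow_sq_eq hp (hτ0 k), abs_mul, abs_mul, abs_of_pos (by positivity : 0 < p⁻¹)]
    calc _ = |ρ z.1| * |u z| * (p⁻¹ * |deriv (regPow p (τ k)) (u z)|) := by ring
      _ ≤ _ := by gcongr
  · have := ((tendsto_halfPow p (u z) hτ).pow 2).const_mul (ρ z.1)
    rwa [halfPow_sq hp] at this

theorem weighted_hardy (hn : 2 ≤ n) {u : Pt n m → ℝ} (hu : IsReg u) (N : ℕ) {p : ℝ}
    (hp : 1 < p) {ρ : (Fin n → ℝ) → ℝ} (hρ : ContDiff ℝ (⊤ : ℕ∞) ρ) (hρ0 : ∀ x, 0 ≤ ρ x)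
    (hρx : ∀ x, 0 ≤ ∑ i, x i * dirD (Pi.single i (1 : ℝ)) ρ x) {lam : ℝ}
    (hlap : ∀ x, lapX ρ x ≤ lam * ρ x) {s : ℝ} (hs : 0 < s) :
    ∫⁻ z, ENNReal.ofReal (ρ z.1 * (√(sqx z.1))⁻¹ * |u z| ^ p) ≤
      ENNReal.ofReal (s * (∫ z, ρ z.1 * |u z| ^ p) +
        s⁻¹ * (p ^ 2 / (p - 1) * limEnergy N p lam ρ u)) := by
  let τ : ℕ → ℝ := fun j => 1 / ((j : ℝ) + 1)
  have hτ0 : ∀ j, 0 < τ j := fun j => by positivity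
  have hτ1 : ∀ j, τ j ≤ 1 := fun j => by
    rw [div_le_one (by positivity)]; linarith [(Nat.cast_nonneg j : (0 : ℝ) ≤ j)]
  have hτ : Tendsto τ atTop (𝓝 0) := tendsto_one_div_add_atTop_nhds_zero_nat
  have cw : ∀ j, Continuous fun z : Pt n m => (sqx z.1 + τ j) ^ (-(1 / 2) : ℝ) := fun j =>
    (contDiff_sqx_add_rpow (hτ0 j) _).continuous.comp continuous_fst
  refine lintegral_le_of_ae_tendsto
    (f := fun j z => ENNReal.ofReal (ρ z.1 * (sqx z.1 + τ j) ^ (-(1 / 2) : ℝ) *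
      halfPow p (τ j) (u z) ^ 2))
    (B := fun j => ENNReal.ofReal (s * (∫ z, ρ z.1 * halfPow p (τ j) (u z) ^ 2) +
        s⁻¹ * (p ^ 2 / (p - 1) * regEnergy N p lam (τ j) ρ u)))
    (fun j => ?_) ((ae_fst_ne_zero (by omega)).mono fun z hz => ?_) (fun j => ?_) ?_
  · have h1 := (contDiff_halfPow p (hτ0 j)).continuous.comp hu.continuous
    have h2 : Continuous fun z : Pt n m => ρ z.1 := hρ.continuous.comp continuous_fst
    exact (((h2.mul (cw j)).mul (h1.pow 2)).measurable.ennreal_ofReal).aemeasurable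
  · have h0 := sqx_pos hz
    have h1 : Tendsto (fun j => (sqx z.1 + τ j) ^ (-(1 / 2) : ℝ)) atTop (𝓝 (√(sqx z.1))⁻¹) := by
      have h2 : Tendsto (fun j => sqx z.1 + τ j) atTop (𝓝 (sqx z.1)) := by
        simpa using hτ.const_add (sqx z.1)
      have h3 := h2.rpow_const (p := (-(1 / 2) : ℝ)) (Or.inl h0.ne')
      rwa [Real.rpow_neg h0.le (1 / 2), ← Real.sqrt_eq_rpow] at h3
    have h4 := (tendsto_halfPow p (u z) hτ).pow 2
    rw [halfPow_sq hp] at h4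
    exact ENNReal.tendsto_ofReal ((h1.const_mul _).mul h4)
  · rw [← ofReal_integral_eq_lintegral_ofReal]
    · exact ENNReal.ofReal_le_ofReal (regularised_hardy hn hu N hp hρ hρ0 hρx hlap (hτ0 j) hs)
    · exact (XBdd.of_fst (hρ.mul (contDiff_sqx_add_rpow (hτ0 j) _)).continuous).integrable_mul_comp
            hu (θ := fun a => halfPow p (τ j) a ^ 2)
            (((contDiff_halfPow p (hτ0 j)).pow 2).differentiable (by simp))
            (by rw [halfPow_zero]; simp)
    · refine Eventually.of_forall fun z => mul_nonneg (mul_nonneg (hρ0 _) ?_) (sq_nonneg _)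
      have := sqx_nonneg z.1
      have := hτ0 j
      positivity
  · exact ENNReal.tendsto_ofReal (((tendsto_integral_halfPow_sq hu hp hρ.continuous hτ0 hτ1 hτ
      ).const_mul _).add (((tendsto_regEnergy hu N hp hρ lam hτ0 hτ1 hτ).const_mul _).const_mul _))

/-- The weight gained at scale `R` by the Hardy and Poincaré inequalities. -/
noncomputable def scaleWt (N : ℕ) (R : ℝ) (x : Fin n → ℝ) : ℝ :=
  R * (√(sqx x))⁻¹ + (R ^ (2 * N))⁻¹ * sqx x ^ N

theorem one_le_scaleWt (N : ℕ) {R : ℝ} (hR : 0 < R) {x : Fin n → ℝ} (hx : x ≠ 0) :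
    1 ≤ scaleWt N R x := by
  have h0 := sqx_pos hx
  have hs : 0 < √(sqx x) := Real.sqrt_pos.2 h0
  unfold scaleWt
  rcases le_total (√(sqx x)) R with h | h
  · have : 1 ≤ R * (√(sqx x))⁻¹ := by rwa [← div_eq_mul_inv, one_le_div hs]
    have : 0 ≤ (R ^ (2 * N))⁻¹ * sqx x ^ N := by positivity
    linarith
  · have h1 : R ^ (2 * N) ≤ sqx x ^ N := by
      rw [pow_mul, ← Real.sq_sqrt h0.le]; gcongr
    have : 1 ≤ (R ^ (2 * N))⁻¹ * sqx x ^ N := by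
      rwa [mul_comm, ← div_eq_mul_inv, one_le_div (by positivity)]
    have : 0 ≤ R * (√(sqx x))⁻¹ := by positivity
    linarith

theorem measurable_scaleWt (N : ℕ) (R : ℝ) : Measurable (scaleWt (n := n) N R) := by
  unfold scaleWt sqx; fun_prop

end Combine

open scoped ENNReal NNReal SchwartzMap

section ScaleEstimate

open Topology Filter

variable {n m : ℕ}

theorem ENNReal.le_of_le_rpow_mul_rpow {Q Y : ℝ≥0∞} {p : ℝ} (hp : 1 < p) (hQ : Q ≠ ⊤)
    (h : Q ≤ Q ^ (1 - p⁻¹) * Y ^ p⁻¹) : Q ≤ Y := by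
  have hp0 : 0 < p := by linarith
  have hpi : p⁻¹ < 1 := inv_lt_one_of_one_lt₀ hp
  by_cases h0 : Q = 0
  · simp [h0]
  have h1 : Q ^ (1 - p⁻¹) ≠ 0 := by
    simp only [ne_eq, ENNReal.rpow_eq_zero_iff, not_or, not_and_or]
    exact ⟨Or.inl h0, Or.inl hQ⟩
  have h2 : Q ^ (1 - p⁻¹) ≠ ⊤ := ENNReal.rpow_ne_top_of_nonneg (by linarith) hQ
  have h3 : Q = Q ^ (1 - p⁻¹) * Q ^ p⁻¹ := by
    rw [← ENNReal.rpow_add _ _ h0 hQ]; simp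
  have h4 : Q ^ p⁻¹ ≤ Y ^ p⁻¹ := by
    have h5 : Q ^ (1 - p⁻¹) * Q ^ p⁻¹ ≤ Q ^ (1 - p⁻¹) * Y ^ p⁻¹ := by rwa [← h3]
    exact (ENNReal.mul_le_mul_iff_right h1 h2).1 h5
  exact (ENNReal.rpow_le_rpow_iff (by positivity)).1 h4

theorem exists_scaleWt_le_integral (hn : 2 ≤ n) (m : ℕ) (χ : 𝓢(EuclideanSpace ℝ (Fin m), ℝ)) (N : ℕ)
    {p : ℝ} (hp : 1 < p) (K : ℝ) : ∃ c : ℝ, 0 ≤ c ∧ ∀ (u : Pt n m → ℝ) (_ : IsReg u)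
      (ρ : (Fin n → ℝ) → ℝ) (_ : ContDiff ℝ (⊤ : ℕ∞) ρ) (_ : ∀ x, 0 ≤ ρ x)
      (_ : ∀ x, 0 ≤ ∑ i, x i * dirD (Pi.single i (1 : ℝ)) ρ x) (lam : ℝ) (_ : 0 ≤ lam)
      (_ : ∀ x, lapX ρ x ≤ lam * ρ x) (R : ℝ) (_ : 0 < R) (_ : c * (R ^ 2 * lam) ≤ 1)
      (_ : ∀ z, u z = ∫ w, χ w * (u z - u (z + (K * R ^ (N + 1)) • yIncl n m w))),
      ∫⁻ z, ENNReal.ofReal (ρ z.1 * scaleWt N R z.1 * |u z| ^ p) ≠ ⊤ ∧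
      ∫⁻ z, ENNReal.ofReal (ρ z.1 * scaleWt N R z.1 * |u z| ^ p) ≤
        ENNReal.ofReal (c * (R ^ 2 * ∫ z, ρ z.1 * (p * |u z| ^ (p - 1)) * |grusin n m N u z|)) := by
  obtain ⟨CP, hCP⟩ := exists_weighted_poincare n m χ hp
  have hκ : 0 ≤ p ^ 2 / (p - 1) := div_nonneg (sq_nonneg _) (by linarith)
  set κ := p ^ 2 / (p - 1) with hκd
  set C1 : ℝ := 2 * κ + CP * K ^ 2 with hC1
  have hC10 : 0 ≤ C1 := by positivity
  refine ⟨4 * C1, by positivity, fun u hu ρ hρ hρ0 hρx lam hlam0 hlap R hR hc hrep => ?_⟩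
  have huc := hu.continuous
  have cp : Continuous fun z => |u z| ^ p := huc.abs.rpow_const fun _ => Or.inr (by linarith)
  have cρ : Continuous fun z : Pt n m => ρ z.1 := hρ.continuous.comp continuous_fst
  have hP := hCP N u hu ρ hρ hρ0 lam hlap (K * R ^ (N + 1)) hrep
  have hH := weighted_hardy hn hu N hp hρ hρ0 hρx hlap (s := 1 / (2 * R)) (by positivity)
  set J := ∫ z, ρ z.1 * (p * |u z| ^ (p - 1)) * |grusin n m N u z| with hJ
  set M := ∫ z, ρ z.1 * |u z| ^ p with hM
  have hJ0 : 0 ≤ J := integral_nonneg fun z => by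
    have := hρ0 z.1
    have : 0 ≤ p := by linarith
    positivity
  have hM0 : 0 ≤ M := integral_nonneg fun z => by
    have := hρ0 z.1
    positivity
  have hD : limEnergy N p lam ρ u = J + lam * M := rfl
  set D := limEnergy N p lam ρ u with hDd
  have hD0 : 0 ≤ D := by rw [hD]; positivity
  set Q := ∫⁻ z, ENNReal.ofReal (ρ z.1 * scaleWt N R z.1 * |u z| ^ p) with hQ
  have hMQ : ENNReal.ofReal M ≤ Q := by
    rw [hM, ofReal_integral_eq_lintegral_ofReal (integrable_weighted_rpow hu hp hρ.continuous hρ0)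
      (Eventually.of_forall fun z => mul_nonneg (hρ0 _) (by positivity))]
    refine lintegral_mono_ae ((ae_fst_ne_zero (by omega)).mono fun z hz => ?_)
    refine ENNReal.ofReal_le_ofReal ?_
    have := one_le_scaleWt N hR hz
    have := mul_le_mul_of_nonneg_left this (mul_nonneg (hρ0 z.1)
      (Real.rpow_nonneg (abs_nonneg (u z)) p))
    linarith
  have hsplit : Q ≤ ENNReal.ofReal (M / 2 + C1 * (R ^ 2 * D)) := by
    have e : ∀ z : Pt n m, ENNReal.ofReal (ρ z.1 * scaleWt N R z.1 * |u z| ^ p) =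
        ENNReal.ofReal R * ENNReal.ofReal (ρ z.1 * (√(sqx z.1))⁻¹ * |u z| ^ p) +
        ENNReal.ofReal ((R ^ (2 * N))⁻¹) * ENNReal.ofReal (ρ z.1 * sqx z.1 ^ N * |u z| ^ p) := by
      intro z
      have h1 := hρ0 z.1
      have h2 := sqx_nonneg z.1
      rw [← ENNReal.ofReal_mul hR.le, ← ENNReal.ofReal_mul (by positivity),
        ← ENNReal.ofReal_add (by positivity) (by positivity), scaleWt]
      congr 1; ring
    have hm : Measurable fun z : Pt n m =>
        ENNReal.ofReal ((R ^ (2 * N))⁻¹) * ENNReal.ofReal (ρ z.1 * sqx z.1 ^ N * |u z| ^ p) := by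
      have : Continuous fun z : Pt n m => sqx z.1 ^ N := (xBdd_sqx_pow N).1
      exact ((cρ.mul this).mul cp).measurable.ennreal_ofReal.const_mul _
    rw [hQ, lintegral_congr e, lintegral_add_right _ hm,
      lintegral_const_mul' _ _ ENNReal.ofReal_ne_top, lintegral_const_mul' _ _ ENNReal.ofReal_ne_top]
    refine (add_le_add (mul_le_mul_right hH _) (mul_le_mul_right hP _)).trans (le_of_eq ?_)
    rw [← ENNReal.ofReal_coe_nnreal, ← ENNReal.ofReal_mul hR.le, ← ENNReal.ofReal_mul (by simp),
      ← ENNReal.ofReal_mul (by positivity), ← ENNReal.ofReal_add (by positivity) (by positivity)]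
    congr 1
    rw [hC1]
    have : R ^ (N + 1) = R ^ N * R := pow_succ _ _
    rw [this, pow_mul']
    field_simp
    ring
  have hQt : Q ≠ ⊤ := ne_top_of_le_ne_top ENNReal.ofReal_ne_top hsplit
  refine ⟨hQt, ?_⟩
  have hMr : M ≤ Q.toReal := (ENNReal.ofReal_le_iff_le_toReal hQt).1 hMQ
  have hQr : Q.toReal ≤ M / 2 + C1 * (R ^ 2 * D) := by
    have := ENNReal.toReal_mono ENNReal.ofReal_ne_top hsplit
    rwa [ENNReal.toReal_ofReal (by positivity)] at this
  rw [← ENNReal.ofReal_toReal hQt]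
  refine ENNReal.ofReal_le_ofReal ?_
  rw [hD] at hQr
  have h1 : C1 * (R ^ 2 * (lam * M)) ≤ Q.toReal / 4 := by
    have h2 := mul_le_mul_of_nonneg_right hc hM0
    nlinarith
  nlinarith

theorem exists_scaleWt_estimate (hn : 2 ≤ n) (m : ℕ) (χ : 𝓢(EuclideanSpace ℝ (Fin m), ℝ)) (N : ℕ)
    {p : ℝ} (hp : 1 < p) (K : ℝ) : ∃ (c : ℝ) (C : ℝ≥0), 0 ≤ c ∧ ∀ (u : Pt n m → ℝ) (_ : IsReg u)
      (ρ : (Fin n → ℝ) → ℝ) (_ : ContDiff ℝ (⊤ : ℕ∞) ρ) (_ : ∀ x, 0 ≤ ρ x)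
      (_ : ∀ x, 0 ≤ ∑ i, x i * dirD (Pi.single i (1 : ℝ)) ρ x) (lam : ℝ) (_ : 0 ≤ lam)
      (_ : ∀ x, lapX ρ x ≤ lam * ρ x) (R : ℝ) (_ : 0 < R) (_ : c * (R ^ 2 * lam) ≤ 1)
      (_ : ∀ z, u z = ∫ w, χ w * (u z - u (z + (K * R ^ (N + 1)) • yIncl n m w))),
      ∫⁻ z, ENNReal.ofReal (ρ z.1 * scaleWt N R z.1 * |u z| ^ p) ≤
        C * ∫⁻ z, ENNReal.ofReal (ρ z.1 * scaleWt N R z.1 ^ (1 - p) *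
          |R ^ 2 * grusin n m N u z| ^ p) := by
  have hp0 : 0 < p := by linarith
  have hpi : p⁻¹ < 1 := inv_lt_one_of_one_lt₀ hp
  obtain ⟨c, hc0, hc⟩ := exists_scaleWt_le_integral hn m χ N hp K
  refine ⟨c, ((c * p) ^ p).toNNReal, hc0,
    fun u hu ρ hρ hρ0 hρx lam hlam0 hlap R hR hcR hrep => ?_⟩
  obtain ⟨hQt, h1⟩ := hc u hu ρ hρ hρ0 hρx lam hlam0 hlap R hR hcR hrep
  have huc := hu.continuous
  have hHc := continuous_grusin hu N
  have cρ : Continuous fun z : Pt n m => ρ z.1 := hρ.continuous.comp continuous_fst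
  have cp : Continuous fun z => |u z| ^ p := huc.abs.rpow_const fun _ => Or.inr hp0.le
  have cp' : Continuous fun z => |u z| ^ (p - 1) :=
    huc.abs.rpow_const fun _ => Or.inr (by linarith)
  have mW : Measurable fun z : Pt n m => scaleWt N R z.1 :=
    (measurable_scaleWt N R).comp measurable_fst
  set f : Pt n m → ℝ≥0∞ := fun z => ENNReal.ofReal (ρ z.1 * scaleWt N R z.1 * |u z| ^ p) with hf
  set g : Pt n m → ℝ≥0∞ := fun z => ENNReal.ofReal ((c * p) ^ p * (ρ z.1 * scaleWt N R z.1 ^ (1 - p) *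
          |R ^ 2 * grusin n m N u z| ^ p)) with hg
  have mf : Measurable f :=
    ((cρ.measurable.mul mW).mul cp.measurable).ennreal_ofReal
  have mg : Measurable g := by
    have : Measurable fun z => |R ^ 2 * grusin n m N u z| ^ p :=
      ((continuous_const.mul hHc).abs.rpow_const fun _ => Or.inr hp0.le).measurable
    exact (((cρ.measurable.mul (mW.pow_const _)).mul this).const_mul _).ennreal_ofReal
  have hgY : ∫⁻ z, g z = ((c * p) ^ p).toNNReal * ∫⁻ z, ENNReal.ofReal (ρ z.1 *
      scaleWt N R z.1 ^ (1 - p) * |R ^ 2 * grusin n m N u z| ^ p) := by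
    rw [← ENNReal.ofReal, ← lintegral_const_mul' _ _ ENNReal.ofReal_ne_top]
    refine lintegral_congr fun z => ?_
    rw [hg, ← ENNReal.ofReal_mul (by positivity)]
  rw [← hgY]
  refine ENNReal.le_of_le_rpow_mul_rpow hp hQt (h1.trans ?_)
  refine le_trans ?_ (ENNReal.lintegral_mul_norm_pow_le (p := 1 - p⁻¹) (q := p⁻¹) mf.aemeasurable
    mg.aemeasurable (by linarith) (by positivity) (by ring))
  have hi : Integrable fun z => ρ z.1 * (p * |u z| ^ (p - 1)) * |grusin n m N u z| := by
    have h2 : XBdd (fun z => ρ z.1 * (p * |u z| ^ (p - 1))) :=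
      (XBdd.of_fst hρ.continuous).mul (hu.xBdd_comp (θ := fun a => p * |a| ^ (p - 1))
        (continuous_const.mul (continuous_abs.rpow_const fun _ => Or.inr (by linarith))))
    refine (integral_mul_grusin h2 hu N).1.norm.congr (Eventually.of_forall fun z => ?_)
    have := hρ0 z.1
    beta_reduce
    rw [norm_mul, Real.norm_eq_abs, Real.norm_eq_abs, abs_of_nonneg (by positivity)]
  rw [← integral_const_mul, ← integral_const_mul, ofReal_integral_eq_lintegral_ofReal
    ((hi.const_mul _).const_mul _) (Eventually.of_forall fun z => by
      have := hρ0 z.1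
      change 0 ≤ c * (R ^ 2 * (ρ z.1 * (p * |u z| ^ (p - 1)) * |grusin n m N u z|))
      positivity)]
  refine lintegral_mono_ae ((ae_fst_ne_zero (by omega)).mono fun z hz => ?_)
  have hW := one_le_scaleWt N hR hz
  have hr := hρ0 z.1
  set W := scaleWt N R z.1 with hWd
  have hW0 : 0 < W := by linarith
  set h := grusin n m N u z with hh
  change _ ≤ f z ^ (1 - p⁻¹) * g z ^ p⁻¹
  simp only [hf, hg]
  rw [← hWd, ← hh]
  rw [ENNReal.ofReal_rpow_of_nonneg (by positivity) (by linarith),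
    ENNReal.ofReal_rpow_of_nonneg (by positivity) (by positivity),
    ← ENNReal.ofReal_mul (by positivity)]
  refine ENNReal.ofReal_le_ofReal (le_of_eq ?_)
  rw [Real.mul_rpow (by positivity) (by positivity), Real.mul_rpow (by positivity) (by positivity),
    Real.mul_rpow (by positivity) (by positivity), Real.mul_rpow (by positivity) (by positivity),
    Real.mul_rpow (by positivity) (by positivity), Real.rpow_rpow_inv (by positivity) hp0.ne',
    ← Real.rpow_mul (abs_nonneg _)]
  rw [Real.mul_rpow (mul_nonneg hr (by positivity)) (by positivity), Real.mul_rpow hr (by positivity),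
    Real.rpow_rpow_inv (by positivity) hp0.ne', ← Real.rpow_mul hW0.le]
  have e1 : ρ z.1 ^ (1 - p⁻¹) * ρ z.1 ^ p⁻¹ = ρ z.1 := by
    rw [← Real.rpow_add' hr (by simp)]; simp
  have e2 : W ^ (1 - p⁻¹) * W ^ ((1 - p) * p⁻¹) = 1 := by
    rw [← Real.rpow_add hW0]
    have : 1 - p⁻¹ + (1 - p) * p⁻¹ = 0 := by field_simp; ring
    rw [this, Real.rpow_zero]
  have e3 : p * (1 - p⁻¹) = p - 1 := by field_simp
  rw [e3, abs_mul, abs_of_pos (by positivity : 0 < R ^ 2), Real.rpow_rpow_inv (by positivity) hp0.ne']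
  calc _ = c * p * (ρ z.1) * 1 * |u z| ^ (p - 1) * (R ^ 2 * |h|) := by ring
    _ = c * p * (ρ z.1 ^ (1 - p⁻¹) * ρ z.1 ^ p⁻¹) * (W ^ (1 - p⁻¹) * W ^ ((1 - p) * p⁻¹)) *
        |u z| ^ (p - 1) * (R ^ 2 * |h|) := by rw [e1, e2]
    _ = _ := by ring

end ScaleEstimate

open scoped ENNReal NNReal SchwartzMap

section Bands

open Topology Filter

variable {n m : ℕ}

theorem isTest_grusin {f : Pt n m → ℝ} (hf : IsTest f) (N : ℕ) : IsTest (grusin n m N f) := by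
  have h1 : IsTest fun z => ∑ j, dirD (unitVec n m (Sum.inl j))
      (dirD (unitVec n m (Sum.inl j)) f) z :=
    IsTest.sum _ fun j _ => (hf.dirD _).dirD _
  have h2 : IsTest fun z => ∑ k, dirD (unitVec n m (Sum.inr k))
      (dirD (unitVec n m (Sum.inr k)) f) z :=
    IsTest.sum _ fun j _ => (hf.dirD _).dirD _
  exact h1.neg.sub (h2.mul_left (contDiff_sqx.pow N))

theorem isTest_grusin_iterate {f : Pt n m → ℝ} (hf : IsTest f) (N s : ℕ) :
    IsTest ((grusin n m N)^[s] f) := by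
  induction s with
  | zero => exact hf
  | succ s ih => rw [Function.iterate_succ_apply']; exact isTest_grusin ih N

theorem grusin_sub {f g : Pt n m → ℝ} (hf : ContDiff ℝ (⊤ : ℕ∞) f) (hg : ContDiff ℝ (⊤ : ℕ∞) g)
    (N : ℕ) : grusin n m N (fun z => f z - g z) =
      fun z => grusin n m N f z - grusin n m N g z := by
  have h : ∀ v, dirD v (dirD v fun z => f z - g z) = fun z => dirD v (dirD v f) z -
      dirD v (dirD v g) z := fun v => by
    rw [dirD_sub _ (hf.differentiable (by simp)) (hg.differentiable (by simp)),
      dirD_sub _ ((hf.dirD v).differentiable (by simp)) ((hg.dirD v).differentiable (by simp))]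
  funext z
  simp only [grusin_apply, h, Finset.sum_sub_distrib]
  ring

variable (χ : 𝓢(EuclideanSpace ℝ (Fin m), ℝ))

theorem grusin_smoothing (r : ℝ) {f : Pt n m → ℝ} (hf : IsTest f) (N : ℕ) :
    grusin n m N (smoothing χ (yIncl n m) r f) = smoothing χ (yIncl n m) r (grusin n m N f) := by
  have hA : Continuous fun w => r • yIncl n m w := by fun_prop
  have hχ : Integrable χ := χ.integrable (μ := volume)
  have h1 : ∀ j, IsTest (dirD (unitVec n m j) (dirD (unitVec n m j) f)) :=
    fun j => (hf.dirD _).dirD _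
  have h2 : IsTest fun z => ∑ k, dirD (unitVec n m (Sum.inl k))
      (dirD (unitVec n m (Sum.inl k)) f) z := IsTest.sum _ fun j _ => h1 _
  have h3 : IsTest fun z => ∑ k, dirD (unitVec n m (Sum.inr k))
      (dirD (unitVec n m (Sum.inr k)) f) z := IsTest.sum _ fun j _ => h1 _
  have h4 : grusin n m N f = fun z => (-1) * (∑ k, dirD (unitVec n m (Sum.inl k))
      (dirD (unitVec n m (Sum.inl k)) f) z) + (-1) * (sqx z.1 ^ N *
      ∑ k, dirD (unitVec n m (Sum.inr k)) (dirD (unitVec n m (Sum.inr k)) f) z) := by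
    funext z; rw [grusin_apply]; ring
  have h5 : smoothing χ (yIncl n m) r (fun z => sqx z.1 ^ N *
      ∑ k, dirD (unitVec n m (Sum.inr k)) (dirD (unitVec n m (Sum.inr k)) f) z) =
      fun z => sqx z.1 ^ N * smoothing χ (yIncl n m) r (fun z =>
      ∑ k, dirD (unitVec n m (Sum.inr k)) (dirD (unitVec n m (Sum.inr k)) f) z) z := by
    funext z
    simp only [smoothing, avg]
    rw [← integral_const_mul]
    refine integral_congr_ae (Eventually.of_forall fun w => ?_)
    simp only [yIncl_apply, Prod.smul_mk, smul_zero, Prod.fst_add, add_zero]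
    ring
  have h6 : ∀ v, dirD v (dirD v (smoothing χ (yIncl n m) r f)) =
      smoothing χ (yIncl n m) r (dirD v (dirD v f)) := fun v => by
    rw [dirD_smoothing r hf, dirD_smoothing r (hf.dirD v)]
  have h7 := h3.mul_left (contDiff_sqx.pow N)
  conv_rhs => rw [h4]
  conv_rhs => rw [smoothing]
  rw [avg_add hχ hA (h2.const_mul (-1)) (h7.const_mul (-1)), avg_const_mul, avg_const_mul,
    avg_sum hχ hA _ fun i _ => h1 _]
  rw [← smoothing, h5]
  unfold smoothing
  rw [avg_sum hχ hA _ fun i _ => h1 _]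
  funext z
  rw [grusin_apply]
  unfold smoothing at h6
  simp only [h6]
  ring

/-- The difference of two averages in the `y` variables. -/
noncomputable def band (r r' : ℝ) (f : Pt n m → ℝ) : Pt n m → ℝ :=
  fun z => smoothing χ (yIncl n m) r f z - smoothing χ (yIncl n m) r' f z

theorem grusin_band (r r' : ℝ) {f : Pt n m → ℝ} (hf : IsTest f) (N : ℕ) :
    grusin n m N (band χ r r' f) = band χ r r' (grusin n m N f) := by
  unfold band
  rw [grusin_sub (contDiff_smoothing r hf) (contDiff_smoothing r' hf), grusin_smoothing χ r hf,
    grusin_smoothing χ r' hf]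

theorem dirD_band (r r' : ℝ) {f : Pt n m → ℝ} (hf : IsTest f) (v : Pt n m) :
    dirD v (band χ r r' f) = band χ r r' (dirD v f) := by
  unfold band
  rw [dirD_sub _ ((contDiff_smoothing r hf).differentiable (by simp))
    ((contDiff_smoothing r' hf).differentiable (by simp)), dirD_smoothing r hf,
    dirD_smoothing r' hf]

theorem isReg_band (r r' : ℝ) {f : Pt n m → ℝ} (hf : IsTest f) : IsReg (band χ r r' f) :=
  (IsReg.smoothing χ (fun _ => rfl) r hf).sub (IsReg.smoothing χ (fun _ => rfl) r' hf)

theorem dirD_grusin_iterate_inr {f : Pt n m → ℝ} (hf : IsTest f) (N s : ℕ) (l : Fin m) :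
    (grusin n m N)^[s] (dirD (unitVec n m (Sum.inr l)) f) =
      dirD (unitVec n m (Sum.inr l)) ((grusin n m N)^[s] f) := by
  induction s with
  | zero => rfl
  | succ s ih =>
    rw [Function.iterate_succ_apply', Function.iterate_succ_apply', ih]
    have hg := isTest_grusin_iterate hf N s
    generalize (grusin n m N)^[s] f = g at hg
    have h2 : ∀ j, IsTest (dirD (unitVec n m j) (dirD (unitVec n m j) g)) :=
      fun j => (hg.dirD _).dirD _
    have h3 : ∀ j, dirD (unitVec n m j) (dirD (unitVec n m j) (dirD (unitVec n m (Sum.inr l)) g)) =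
        dirD (unitVec n m (Sum.inr l)) (dirD (unitVec n m j) (dirD (unitVec n m j) g)) := fun j => by
      rw [dirD_comm hg.1, dirD_comm (hg.dirD _).1]
    have h5 : IsTest fun z => ∑ k, dirD (unitVec n m (Sum.inl k))
      (dirD (unitVec n m (Sum.inl k)) g) z := IsTest.sum _ fun j _ => h2 _
    have h6 : IsTest fun z => ∑ k, dirD (unitVec n m (Sum.inr k))
      (dirD (unitVec n m (Sum.inr k)) g) z := IsTest.sum _ fun j _ => h2 _
    have h4 : grusin n m N g = fun z => -(∑ k, dirD (unitVec n m (Sum.inl k))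
      (dirD (unitVec n m (Sum.inl k)) g) z) - (sqx z.1 ^ N *
      ∑ k, dirD (unitVec n m (Sum.inr k)) (dirD (unitVec n m (Sum.inr k)) g) z) := rfl
    have h7 : Differentiable ℝ fun x : Fin n → ℝ => sqx x ^ N := differentiable_sqx.pow N
    have h8 : Differentiable ℝ fun z : Pt n m => sqx z.1 ^ N := h7.comp differentiable_fst
    conv_rhs => rw [h4]
    rw [dirD_sub _ h5.neg.differentiable (h6.mul_left (contDiff_sqx.pow N)).differentiable,
      dirD_neg, dirD_mul _ h8 h6.differentiable, dirD_comp_fst h7,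
      dirD_sum _ _ fun i _ => (h2 _).differentiable, dirD_sum _ _ fun i _ => (h2 _).differentiable]
    funext z
    rw [grusin_apply]
    simp only [h3]
    have : dirD (unitVec n m (Sum.inr l)).1 (fun x : Fin n → ℝ => sqx x ^ N) z.1 = 0 := by
      have : (unitVec n m (Sum.inr l)).1 = 0 := rfl
      simp [dirD, this]
    rw [this]
    ring

end Bands

open scoped ENNReal NNReal SchwartzMap

section BandEstimate

open Topology Filter

variable {n m : ℕ}

theorem radial_dirD_sqx_add_rpow_nonneg {τ b : ℝ} (hτ : 0 < τ) (hb : 0 ≤ b) (x : Fin n → ℝ) :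
    0 ≤ ∑ i, x i * dirD (Pi.single i (1 : ℝ)) (fun x : Fin n → ℝ => (sqx x + τ) ^ b) x := by
  refine Finset.sum_nonneg fun i _ => ?_
  rw [dirD_sqx_add_rpow hτ, dirD_single_sqx]
  have h0 : 0 < sqx x + τ := by linarith [sqx_nonneg x]
  have : x i * (b * (sqx x + τ) ^ (b - 1) * (2 * x i)) =
    2 * b * (sqx x + τ) ^ (b - 1) * x i ^ 2 := by ring
  rw [this]; positivity

theorem lapX_sqx_add_rpow_le {τ b : ℝ} (hτ : 0 < τ) (hb : 0 ≤ b) (x : Fin n → ℝ) :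
    lapX (fun x : Fin n → ℝ => (sqx x + τ) ^ b) x ≤
      (2 * n * b + 4 * b * |b - 1|) / τ * (sqx x + τ) ^ b := by
  have h0 : 0 < sqx x + τ := by linarith [sqx_nonneg x]
  have hdiff : ∀ s : ℝ, Differentiable ℝ fun x : Fin n → ℝ => (sqx x + τ) ^ s := fun s =>
    (contDiff_sqx_add_rpow hτ s).differentiable (by simp)
  have h1 : ∀ i : Fin n, dirD (Pi.single i (1 : ℝ)) (dirD (Pi.single i (1 : ℝ))
      (fun x : Fin n → ℝ => (sqx x + τ) ^ b)) x =
      2 * b * (sqx x + τ) ^ (b - 1) + 4 * b * (b - 1) * (sqx x + τ) ^ (b - 2) * x i ^ 2 := by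
    intro i
    have e : dirD (Pi.single i (1 : ℝ)) (fun x : Fin n → ℝ => (sqx x + τ) ^ b) =
        fun x => (sqx x + τ) ^ (b - 1) * (2 * b * x i) := by
      funext x
      rw [dirD_sqx_add_rpow hτ, dirD_single_sqx]; ring
    have hx : Differentiable ℝ fun x : Fin n → ℝ => 2 * b * x i := by fun_prop
    have hxi : dirD (Pi.single i (1 : ℝ)) (fun x : Fin n → ℝ => 2 * b * x i) x = 2 * b := by
      have : HasFDerivAt (fun x : Fin n → ℝ => 2 * b * x i)
          ((2 * b) • ContinuousLinearMap.proj (R := ℝ) (φ := fun _ : Fin n => ℝ) i) x :=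
        (ContinuousLinearMap.proj (R := ℝ) (φ := fun _ : Fin n => ℝ) i).hasFDerivAt.const_mul _
      simp [dirD, this.fderiv]
    rw [e, dirD_mul _ (hdiff _) hx]
    beta_reduce
    rw [hxi, dirD_sqx_add_rpow hτ, dirD_single_sqx]
    have : b - 1 - 1 = b - 2 := by ring
    rw [this]; ring
  have h2 : lapX (fun x : Fin n → ℝ => (sqx x + τ) ^ b) x = 2 * n * b * (sqx x + τ) ^ (b - 1) +
      4 * b * (b - 1) * (sqx x + τ) ^ (b - 2) * sqx x := by
    simp only [lapX, h1, Finset.sum_add_distrib, ← Finset.mul_sum, Finset.sum_const,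
      Finset.card_univ, Fintype.card_fin, nsmul_eq_mul]
    rw [← sqx]; ring
  have e1 : (sqx x + τ) ^ (b - 1) = (sqx x + τ) ^ b / (sqx x + τ) := Real.rpow_sub_one h0.ne' b
  have e2 : (sqx x + τ) ^ (b - 2) = (sqx x + τ) ^ b / (sqx x + τ) ^ 2 := by
    rw [Real.rpow_sub h0]; norm_num
  have hP : 0 < (sqx x + τ) ^ b := by positivity
  rw [h2, e1, e2]
  have hs := sqx_nonneg x
  have i1 : (sqx x + τ) ^ b / (sqx x + τ) ≤ (sqx x + τ) ^ b / τ := by gcongr; linarith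
  have i2 : (sqx x + τ) ^ b / (sqx x + τ) ^ 2 * sqx x ≤ (sqx x + τ) ^ b / τ := by
    rw [div_mul_eq_mul_div, div_le_div_iff₀ (by positivity) hτ]
    have : sqx x * τ ≤ (sqx x + τ) ^ 2 := by nlinarith [mul_nonneg hs hτ.le]
    nlinarith
  have i3 : 4 * b * (b - 1) * ((sqx x + τ) ^ b / (sqx x + τ) ^ 2 * sqx x) ≤
      4 * b * |b - 1| * ((sqx x + τ) ^ b / τ) := by
    refine mul_le_mul (mul_le_mul_of_nonneg_left (le_abs_self _) (by positivity)) i2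
      (by positivity) (by positivity)
  have i4 : 2 * n * b * ((sqx x + τ) ^ b / (sqx x + τ)) ≤ 2 * n * b * ((sqx x + τ) ^ b / τ) :=
    mul_le_mul_of_nonneg_left i1 (by positivity)
  calc _ = 2 * n * b * ((sqx x + τ) ^ b / (sqx x + τ)) +
      4 * b * (b - 1) * ((sqx x + τ) ^ b / (sqx x + τ) ^ 2 * sqx x) := by ring
    _ ≤ _ := add_le_add i4 i3
    _ = _ := by ring

theorem exists_band_estimate (hn : 2 ≤ n) (m N : ℕ) {p : ℝ} (hp : 1 < p) {b : ℝ} (hb : 0 ≤ b)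
    {χ : 𝓢(EuclideanSpace ℝ (Fin m), ℝ)} (h1 : ∫ w, χ w = 1)
    (hχ : ∀ ε : ℝ, 0 ≤ ε → ε ≤ 1 / 2 → ∀ v, ∫ w, χ (v - ε • w) * χ w = χ v) :
    ∃ κ : ℝ, 1 ≤ κ ∧ ∃ C : ℝ≥0, ∀ (s : ℕ) {f : Pt n m → ℝ} (_ : IsTest f) (R : ℝ) (_ : 0 < R),
      ∫⁻ z, ENNReal.ofReal ((sqx z.1 + κ * R ^ 2) ^ b * scaleWt N R z.1 *
        |band χ (R ^ (N + 1)) ((2 * R) ^ (N + 1)) f z| ^ p) ≤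
      (C * ENNReal.ofReal ((R ^ 2) ^ p)) ^ (s + 1) *
        ∫⁻ z, ENNReal.ofReal ((sqx z.1 + κ * R ^ 2) ^ b * scaleWt N R z.1 ^ (1 - p) *
        |band χ (R ^ (N + 1)) ((2 * R) ^ (N + 1)) ((grusin n m N)^[s + 1] f) z| ^ p) := by
  obtain ⟨c, C, hc0, hc⟩ := exists_scaleWt_estimate hn m χ N hp (2 * 2 ^ (N + 1))
  set A := 2 * n * b + 4 * b * |b - 1| with hA
  have hA0 : 0 ≤ A := by positivity
  refine ⟨1 + c * A, by nlinarith [mul_nonneg hc0 hA0], C, fun s f hf R hR => ?_⟩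
  set κ := 1 + c * A with hκ
  have hκ0 : 0 < κ := by positivity
  have hτ : 0 < κ * R ^ 2 := by positivity
  have key : ∀ {f : Pt n m → ℝ}, IsTest f →
      ∫⁻ z, ENNReal.ofReal ((sqx z.1 + κ * R ^ 2) ^ b * scaleWt N R z.1 *
        |band χ (R ^ (N + 1)) ((2 * R) ^ (N + 1)) f z| ^ p) ≤
      (C * ENNReal.ofReal ((R ^ 2) ^ p)) *
        ∫⁻ z, ENNReal.ofReal ((sqx z.1 + κ * R ^ 2) ^ b * scaleWt N R z.1 ^ (1 - p) *
        |band χ (R ^ (N + 1)) ((2 * R) ^ (N + 1)) (grusin n m N f) z| ^ p) := by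
    intro f hf
    refine (hc (band χ (R ^ (N + 1)) ((2 * R) ^ (N + 1)) f) (isReg_band χ _ _ hf)
      (fun x => (sqx x + κ * R ^ 2) ^ b) (contDiff_sqx_add_rpow hτ b)
      (fun x => Real.rpow_nonneg (by linarith [sqx_nonneg x]) _)
      (radial_dirD_sqx_add_rpow_nonneg hτ hb) (A / (κ * R ^ 2)) (by positivity)
      (fun x => lapX_sqx_add_rpow_le hτ hb x) R hR ?_ fun z => ?_).trans ?_
    · have : c * (R ^ 2 * (A / (κ * R ^ 2))) = c * A / κ := by field_simp
      rw [this, div_le_one hκ0, hκ]; linarith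
    · have e : (2 * 2 ^ (N + 1) * R ^ (N + 1) : ℝ) = 2 * (2 * R) ^ (N + 1) := by
        rw [mul_pow]; ring
      rw [e]
      refine sub_smoothing_eq_integral h1 hχ (r := R ^ (N + 1)) (r' := (2 * R) ^ (N + 1))
        (by positivity) (by positivity) (by positivity) ?_ le_rfl hf rfl z
      have : R ^ (N + 1) ≤ (2 * R) ^ (N + 1) := pow_le_pow_left₀ hR.le (by linarith) _
      linarith
    · rw [grusin_band χ _ _ hf, mul_assoc, ← lintegral_const_mul' _ _ ENNReal.ofReal_ne_top]
      refine mul_le_mul_right (lintegral_mono fun z => ?_) _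
      beta_reduce
      rw [← ENNReal.ofReal_mul (by positivity), abs_mul, Real.mul_rpow (abs_nonneg _)
        (abs_nonneg _), abs_of_nonneg (by positivity : (0:ℝ) ≤ R ^ 2)]
      exact ENNReal.ofReal_le_ofReal (le_of_eq (by ring))
  induction s generalizing f with
  | zero => simpa using key hf
  | succ s ih =>
    refine (key hf).trans ?_
    rw [pow_succ' _ (s + 1), mul_assoc (C * ENNReal.ofReal ((R ^ 2) ^ p)), Function.iterate_succ_apply]
    refine mul_le_mul_right (le_trans (lintegral_mono_ae
      ((ae_fst_ne_zero (by omega)).mono fun z hz => ?_)) (ih _ (isTest_grusin hf N))) _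
    have hW := one_le_scaleWt N hR hz
    have : scaleWt N R z.1 ^ (1 - p) ≤ scaleWt N R z.1 :=
      (Real.rpow_le_one_of_one_le_of_nonpos hW (by linarith)).trans hW
    have h2 : 0 ≤ sqx z.1 + κ * R ^ 2 := by linarith [sqx_nonneg z.1]
    refine ENNReal.ofReal_le_ofReal ?_
    gcongr

end BandEstimate

open scoped ENNReal NNReal SchwartzMap

section Hump

open Topology Filter

variable {n m : ℕ}

/-- A profile on the half line that decays like `t ^ δ` at `0` and like `t ^ (-δ)` at infinity. -/
noncomputable def hump (δ t : ℝ) : ℝ := t ^ δ / (1 + t ^ δ) ^ 2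

theorem hump_pos {δ t : ℝ} (ht : 0 < t) : 0 < hump δ t := by
  unfold hump; positivity

theorem hump_nonneg {δ t : ℝ} (ht : 0 ≤ t) : 0 ≤ hump δ t := by
  unfold hump; positivity

theorem rpow_le_four_mul_hump {δ t : ℝ} (hδ : 0 ≤ δ) (ht : 0 < t) (h1 : t ≤ 1) :
    t ^ δ ≤ 4 * hump δ t := by
  have h2 : t ^ δ ≤ 1 := Real.rpow_le_one ht.le h1 hδ
  have h0 : 0 < t ^ δ := by positivity
  rw [hump, mul_div_assoc', le_div_iff₀ (by positivity), mul_comm]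
  refine mul_le_mul_of_nonneg_right ?_ h0.le
  nlinarith

theorem hump_neg (δ : ℝ) {t : ℝ} (ht : 0 < t) : hump (-δ) t = hump δ t := by
  have h0 : 0 < t ^ δ := by positivity
  rw [hump, hump, Real.rpow_neg ht.le]
  field_simp
  ring

theorem hump_inv (δ : ℝ) {t : ℝ} (ht : 0 < t) : hump δ t⁻¹ = hump δ t := by
  rw [← hump_neg δ ht, hump, hump, Real.inv_rpow ht.le, Real.rpow_neg ht.le]

theorem rpow_neg_le_four_mul_hump {δ t : ℝ} (hδ : 0 ≤ δ) (h1 : 1 ≤ t) :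
    t ^ (-δ) ≤ 4 * hump δ t := by
  have ht : 0 < t := by linarith
  rw [← hump_inv δ ht, Real.rpow_neg ht.le, ← Real.inv_rpow ht.le]
  exact rpow_le_four_mul_hump hδ (by positivity) (inv_le_one_of_one_le₀ h1)

theorem hump_le_rpow {δ t : ℝ} (ht : 0 < t) : hump δ t ≤ t ^ δ := by
  have h0 : 0 < t ^ δ := by positivity
  rw [hump]
  exact div_le_self h0.le (by nlinarith)

theorem hump_rpow_le {δ q t : ℝ} (hδ : 0 ≤ δ) (hq : 0 ≤ q) (ht : 0 < t) :
    hump δ t ^ q ≤ 4 * hump (δ * q) t := by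
  have key : ∀ {t : ℝ}, 0 < t → t ≤ 1 → hump δ t ^ q ≤ 4 * hump (δ * q) t := fun {t} ht h1 => by
    refine (Real.rpow_le_rpow (hump_nonneg ht.le) (hump_le_rpow ht) hq).trans ?_
    rw [← Real.rpow_mul ht.le]
    exact rpow_le_four_mul_hump (by positivity) ht h1
  rcases le_total t 1 with h | h
  · exact key ht h
  · have := key (inv_pos.2 ht) (inv_le_one_of_one_le₀ h)
    rwa [hump_inv _ ht, hump_inv _ ht] at this

theorem continuous_hump {δ : ℝ} (hδ : 0 < δ) {X : Type*} [TopologicalSpace X] {f : X → ℝ}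
    (hf : Continuous f) (h0 : ∀ x, 0 ≤ f x) : Continuous fun x => hump δ (f x) := by
  have h1 : Continuous fun x => f x ^ δ := hf.rpow_const fun _ => Or.inr hδ.le
  unfold hump
  refine h1.div (by fun_prop) fun x => ?_
  have := Real.rpow_nonneg (h0 x) δ
  positivity

theorem sum_hump_rpow_le {δ q : ℝ} (hδ : 0 < δ) (hq : 0 < q) {t : ℝ} (ht : 0 < t) (M : ℕ) :
    ∑ i ∈ Finset.range M, hump δ (t / 2 ^ i) ^ q ≤
      4 * (2 ^ (δ * q) / (2 ^ (δ * q) - 1)) := by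
  set a := δ * q with ha
  have ha0 : 0 < a := by positivity
  have h2a : 1 < (2 : ℝ) ^ a := Real.one_lt_rpow (by norm_num) ha0
  have hc : 0 < (2 : ℝ) ^ a / (2 ^ a - 1) := div_pos (by positivity) (by linarith)
  set F : ℝ → ℝ := fun t => t ^ a / (1 + t ^ a) with hF
  have step : ∀ {t : ℝ}, 0 < t → hump a t ≤ 2 ^ a / (2 ^ a - 1) * (F (2 * t) - F t) := by
    intro t ht
    have h0 : 0 < t ^ a := by positivity
    simp only [hF, hump]
    rw [Real.mul_rpow (by norm_num) ht.le]
    set c := (2 : ℝ) ^ a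
    set y := t ^ a
    have e : c / (c - 1) * (c * y / (1 + c * y) - y / (1 + y)) =
        c * y / ((1 + c * y) * (1 + y)) := by
      have : c - 1 ≠ 0 := by linarith
      field_simp
      ring
    rw [e, div_le_div_iff₀ (by positivity) (by positivity)]
    have h3 : 0 ≤ y * (1 + y) * (c - 1) := by
      have : 0 ≤ c - 1 := by linarith
      positivity
    nlinarith
  have hF1 : ∀ {t : ℝ}, 0 < t → 0 ≤ F t ∧ F t ≤ 1 := fun {t} ht => by
    have h0 : 0 < t ^ a := by positivity
    exact ⟨by positivity, (div_le_one (by positivity)).2 (by linarith)⟩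
  have hsum : ∑ i ∈ Finset.range M, (F (2 * (t / 2 ^ i)) - F (t / 2 ^ i)) =
      F (2 * (t / 2 ^ 0)) - F (2 * (t / 2 ^ M)) := by
    rw [← Finset.sum_range_sub' (fun i => F (2 * (t / 2 ^ i))) M]
    refine Finset.sum_congr rfl fun i _ => ?_
    congr 2
    rw [pow_succ]; field_simp
  calc _ ≤ ∑ i ∈ Finset.range M, 4 * (2 ^ a / (2 ^ a - 1) *
        (F (2 * (t / 2 ^ i)) - F (t / 2 ^ i))) := Finset.sum_le_sum fun i _ =>
          (hump_rpow_le hδ.le hq.le (by positivity)).trans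
            (mul_le_mul_of_nonneg_left (step (by positivity)) (by norm_num))
    _ = 4 * (2 ^ a / (2 ^ a - 1)) * (F (2 * (t / 2 ^ 0)) - F (2 * (t / 2 ^ M))) := by
      rw [← Finset.mul_sum, ← Finset.mul_sum, hsum]; ring
    _ ≤ 4 * (2 ^ a / (2 ^ a - 1)) * 1 := by
      refine mul_le_mul_of_nonneg_left ?_ (by positivity)
      have h3 := hF1 (t := 2 * (t / 2 ^ 0)) (by positivity)
      have h4 := hF1 (t := 2 * (t / 2 ^ M)) (by positivity)
      linarith [h3.2, h4.1]
    _ = _ := mul_one _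

theorem rpow_le_hump_mul_weight {p δ b κ t : ℝ} {N d : ℕ} (hp : 1 < p) (hδ : 0 < δ)
    (hδp : δ * p ≤ 1) (hb : b = N * (p - 1) - p * δ / 2) (hb0 : 0 ≤ b) (hκ : 1 ≤ κ)
    (hd : d + 1 ≤ N) (ht : 0 < t) :
    (t ^ d) ^ p ≤ 4 ^ p * (hump δ t ^ p * ((t ^ 2 + κ) ^ b * (t⁻¹ + t ^ (2 * N)))) := by
  have hp0 : 0 < p := by linarith
  have hh := hump_pos (δ := δ) ht
  rw [← mul_assoc, ← Real.mul_rpow (by norm_num) (hump_nonneg ht.le)]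
  rcases le_total t 1 with h | h
  · have h1 := Real.rpow_le_rpow (by positivity) (rpow_le_four_mul_hump hδ.le ht h) hp0.le
    have h2 : 1 ≤ (t ^ 2 + κ) ^ b := Real.one_le_rpow (by nlinarith) hb0
    have h3 : t⁻¹ ≤ t⁻¹ + t ^ (2 * N) := by
      have : 0 ≤ t ^ (2 * N) := by positivity
      linarith
    have h4 : (t ^ d) ^ p ≤ 1 := Real.rpow_le_one (by positivity) (pow_le_one₀ ht.le h) hp0.le
    refine h4.trans ?_
    calc (1:ℝ) ≤ t ^ (δ * p - 1) :=
          Real.one_le_rpow_of_pos_of_le_one_of_nonpos ht h (by linarith)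
      _ = (t ^ δ) ^ p * (1 * t⁻¹) := by
        rw [← Real.rpow_mul ht.le, Real.rpow_sub_one ht.ne']; ring
      _ ≤ _ := by gcongr
  · have h1 := Real.rpow_le_rpow (by positivity) (rpow_neg_le_four_mul_hump hδ.le h) hp0.le
    have h2 : (t ^ 2) ^ b ≤ (t ^ 2 + κ) ^ b := Real.rpow_le_rpow (by positivity) (by linarith) hb0
    have h3 : t ^ (2 * N) ≤ t⁻¹ + t ^ (2 * N) := by
      have : 0 ≤ t⁻¹ := by positivity
      linarith
    have hdN : (d : ℝ) + 1 ≤ N := by exact_mod_cast hd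
    calc (t ^ d) ^ p = t ^ (d * p) := by rw [← Real.rpow_natCast, ← Real.rpow_mul ht.le]
      _ ≤ t ^ (-δ * p + 2 * b + (2 * N : ℕ)) := by
        refine Real.rpow_le_rpow_of_exponent_le h ?_
        rw [hb]; push_cast
        have h5 : (d + 1) * p ≤ N * p := mul_le_mul_of_nonneg_right hdN hp0.le
        have h6 : 1 * p ≤ N * p :=
          mul_le_mul_of_nonneg_right (by linarith [(Nat.cast_nonneg d : (0:ℝ) ≤ d)]) hp0.le
        nlinarith
      _ = (t ^ (-δ)) ^ p * ((t ^ 2) ^ b * t ^ (2 * N)) := by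
        rw [Real.rpow_add ht, Real.rpow_add ht, Real.rpow_natCast, ← Real.rpow_mul ht.le,
          ← Real.rpow_natCast t 2, ← Real.rpow_mul ht.le]
        push_cast; ring
      _ ≤ _ := by gcongr

theorem weight_mul_rpow_le_hump {p δ b κ t : ℝ} {N : ℕ} (hp : 1 < p) (hδ : 0 < δ)
    (hδp : δ * p ≤ p - 1) (hb : b = N * (p - 1) - p * δ / 2) (hb0 : 0 ≤ b) (hκ : 1 ≤ κ)
    (ht : 0 < t) :
    (t ^ 2 + κ) ^ b * (t⁻¹ + t ^ (2 * N)) ^ (1 - p) ≤ (1 + κ) ^ b * 4 ^ p * hump δ t ^ p := by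
  have hp0 : 0 < p := by linarith
  rw [mul_assoc, ← Real.mul_rpow (by norm_num) (hump_nonneg ht.le)]
  have e : ∀ {a : ℝ}, 0 < a → a ≤ t⁻¹ + t ^ (2 * N) →
      (t⁻¹ + t ^ (2 * N)) ^ (1 - p) ≤ a ^ (1 - p) := fun ha h =>
    Real.rpow_le_rpow_of_nonpos ha h (by linarith)
  rcases le_total t 1 with h | h
  · have h1 := Real.rpow_le_rpow (by positivity) (rpow_le_four_mul_hump hδ.le ht h) hp0.le
    have h2 : (t ^ 2 + κ) ^ b ≤ (1 + κ) ^ b :=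
      Real.rpow_le_rpow (by positivity) (by nlinarith) hb0
    have h3 := e (a := t⁻¹) (by positivity) (by
      have : 0 ≤ t ^ (2 * N) := by positivity
      linarith)
    refine (mul_le_mul h2 h3 (by positivity) (by positivity)).trans
      (mul_le_mul_of_nonneg_left (le_trans ?_ h1) (by positivity))
    rw [Real.inv_rpow ht.le, ← Real.rpow_neg ht.le, ← Real.rpow_mul ht.le]
    exact Real.rpow_le_rpow_of_exponent_ge ht h (by linarith)
  · have h1 := Real.rpow_le_rpow (by positivity) (rpow_neg_le_four_mul_hump hδ.le h) hp0.le
    have h2 : (t ^ 2 + κ) ^ b ≤ (1 + κ) ^ b * (t ^ 2) ^ b := by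
      rw [← Real.mul_rpow (by positivity) (by positivity)]
      refine Real.rpow_le_rpow (by positivity) ?_ hb0
      have : 1 ≤ t ^ 2 := one_le_pow₀ h
      nlinarith
    have h3 := e (a := t ^ (2 * N)) (by positivity) (by
      have : 0 ≤ t⁻¹ := by positivity
      linarith)
    refine (mul_le_mul h2 h3 (by positivity) (by positivity)).trans ?_
    rw [mul_assoc]
    refine mul_le_mul_of_nonneg_left (le_trans (le_of_eq ?_) h1) (by positivity)
    rw [← Real.rpow_natCast t 2, ← Real.rpow_natCast t (2 * N), ← Real.rpow_mul ht.le,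
      ← Real.rpow_mul ht.le, ← Real.rpow_mul ht.le, ← Real.rpow_add ht, hb]
    congr 1
    push_cast; ring

end Hump

open scoped ENNReal NNReal SchwartzMap

section SingleScale

open Topology Filter

variable {n m : ℕ}

theorem scaleWt_eq (N : ℕ) (R : ℝ) (x : Fin n → ℝ) :
    scaleWt N R x = (√(sqx x) / R)⁻¹ + (√(sqx x) / R) ^ (2 * N) := by
  have h : sqx x ^ N = √(sqx x) ^ (2 * N) := by
    rw [pow_mul, Real.sq_sqrt (sqx_nonneg x)]
  rw [scaleWt, h, div_pow, inv_div]
  ring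

theorem sqx_add_rpow_eq (κ b : ℝ) (hκ : 0 ≤ κ) {R : ℝ} (hR : 0 < R) (x : Fin n → ℝ) :
    (sqx x + κ * R ^ 2) ^ b = (R ^ 2) ^ b * ((√(sqx x) / R) ^ 2 + κ) ^ b := by
  rw [← Real.mul_rpow (by positivity) (by positivity)]
  congr 1
  rw [div_pow, Real.sq_sqrt (sqx_nonneg x)]
  field_simp

theorem yIncl_single (l : Fin m) :
    yIncl n m (EuclideanSpace.single l 1) = unitVec n m (Sum.inr l) := by
  rw [yIncl_apply]
  ext i
  · rfl
  · simp [unitVec, Pi.single_apply]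

theorem exists_band_dirD_estimate (hn : 2 ≤ n) (m N : ℕ) {p : ℝ} (hp : 1 < p) {δ : ℝ}
    (hδ : 0 < δ) (hδ1 : δ * p ≤ 1) (hδ2 : δ * p ≤ p - 1)
    {χ : 𝓢(EuclideanSpace ℝ (Fin m), ℝ)} (h1 : ∫ w, χ w = 1)
    (hχ : ∀ ε : ℝ, 0 ≤ ε → ε ≤ 1 / 2 → ∀ v, ∫ w, χ (v - ε • w) * χ w = χ v)
    {s d : ℕ} (hsd : d + 2 * (s + 1) = N + 1) (l : Fin m) :
    ∃ C : ℝ≥0, ∀ (φ : Pt n m → ℝ) (_ : IsTest φ) (R : ℝ) (_ : 0 < R),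
      ∫⁻ z, ENNReal.ofReal ((hump δ (√(sqx z.1) / R))⁻¹ ^ p * |√(sqx z.1) ^ d *
        band χ (R ^ (N + 1)) ((2 * R) ^ (N + 1)) (dirD (unitVec n m (Sum.inr l)) φ) z| ^ p) ≤
      C * ∫⁻ z, ‖hump δ (√(sqx z.1) / R) * (grusin n m N)^[s + 1] φ z‖ₑ ^ p := by
  have hp0 : 0 < p := by linarith
  obtain ⟨b, hb⟩ : ∃ b, b = N * (p - 1) - p * δ / 2 := ⟨_, rfl⟩
  have hN1 : (1:ℝ) ≤ N := by
    have : 1 ≤ N := by omega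
    exact_mod_cast this
  have hb0 : 0 ≤ b := by rw [hb]; nlinarith
  obtain ⟨κ, hκ, C, hC⟩ := exists_band_estimate hn m N hp hb0 h1 hχ
  obtain ⟨A, hA⟩ : ∃ A : ℝ≥0, (A : ℝ≥0∞) =
      (∫⁻ w, ‖fderiv ℝ χ w (EuclideanSpace.single l 1)‖ₑ) ^ p := by
    have : Integrable fun w => fderiv ℝ χ w (EuclideanSpace.single l 1) :=
      (LineDeriv.lineDerivOp (EuclideanSpace.single l (1:ℝ)) χ).integrable (μ := volume)
    exact ⟨_, ENNReal.coe_toNNReal (ENNReal.rpow_ne_top_of_nonneg hp0.le this.2.ne)⟩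
  set c0 : ℝ := 4 ^ p * ((1 + κ) ^ b * 4 ^ p) with hc0
  have hc00 : 0 ≤ c0 := by positivity
  obtain ⟨B, hB⟩ : ∃ B : ℝ≥0, (B : ℝ≥0∞) = 2 ^ (p - 1) :=
    ⟨_, ENNReal.coe_toNNReal (ENNReal.rpow_ne_top_of_nonneg (by linarith) (by simp))⟩
  refine ⟨C ^ (s + 1) * c0.toNNReal * B * (2 * A), fun φ hφ R hR => ?_⟩
  have hω : Continuous fun z : Pt n m => hump δ (√(sqx z.1) / R) := by
    refine continuous_hump hδ ?_ fun z => by positivity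
    have : Continuous fun z : Pt n m => sqx z.1 := contDiff_sqx.continuous
    exact this.sqrt.div_const R
  set ω : Pt n m → ℝ := fun z => hump δ (√(sqx z.1) / R) with hωd
  set g := (grusin n m N)^[s + 1] φ with hg
  have hgT : IsTest g := isTest_grusin_iterate hφ N (s + 1)
  set Y := ∫⁻ z, ‖ω z * g z‖ₑ ^ p with hY
  set e := unitVec n m (Sum.inr l) with he
  -- the two smoothed derivatives
  have hS : ∀ r : ℝ, R ^ (N + 1) ≤ r → ∫⁻ z, ‖ω z * dirD e (smoothing χ (yIncl n m) r g) z‖ₑ ^ p ≤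
      ENNReal.ofReal (R ^ (N + 1))⁻¹ ^ p * A * Y := by
    intro r hr
    have hr0 : 0 < r := lt_of_lt_of_le (by positivity) hr
    have := lintegral_weighted_dirD_smoothing_le (L := yIncl n m) volume hp.le hr0 χ
      (EuclideanSpace.single l 1) hgT hω (fun x w => by simp [hωd, yIncl_apply])
    rw [yIncl_single, ← hA] at this
    refine this.trans ?_
    gcongr
  have hband : ∫⁻ z, ‖ω z * band χ (R ^ (N + 1)) ((2 * R) ^ (N + 1)) (dirD e g) z‖ₑ ^ p ≤
      B * (2 * (ENNReal.ofReal (R ^ (N + 1))⁻¹ ^ p * A * Y)) := by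
    rw [← dirD_band χ _ _ hgT]
    have e1 : ∀ z, ω z * dirD e (band χ (R ^ (N + 1)) ((2 * R) ^ (N + 1)) g) z =
        ω z * dirD e (smoothing χ (yIncl n m) (R ^ (N + 1)) g) z +
        -(ω z * dirD e (smoothing χ (yIncl n m) ((2 * R) ^ (N + 1)) g) z) := fun z => by
      have : dirD e (band χ (R ^ (N + 1)) ((2 * R) ^ (N + 1)) g) = fun z =>
          dirD e (smoothing χ (yIncl n m) (R ^ (N + 1)) g) z -
          dirD e (smoothing χ (yIncl n m) ((2 * R) ^ (N + 1)) g) z :=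
        dirD_sub _ ((contDiff_smoothing _ hgT).differentiable (by simp))
          ((contDiff_smoothing _ hgT).differentiable (by simp))
      rw [this]; ring
    simp only [e1]
    refine (lintegral_add_rpow_le hp.le
      (hω.mul ((contDiff_smoothing _ hgT).dirD e).continuous).aemeasurable).trans ?_
    rw [hB]
    refine mul_le_mul_right ?_ _
    simp only [enorm_neg]
    rw [two_mul (ENNReal.ofReal _ ^ p * _ * _)]
    exact add_le_add (hS _ le_rfl) (hS _ (pow_le_pow_left₀ hR.le (by linarith) _))
  have hpt1 : ∀ z : Pt n m, z.1 ≠ 0 → ∀ a : ℝ,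
      ENNReal.ofReal ((hump δ (√(sqx z.1) / R))⁻¹ ^ p * |√(sqx z.1) ^ d * a| ^ p) ≤
      ENNReal.ofReal (4 ^ p * (R ^ d) ^ p / (R ^ 2) ^ b) * ENNReal.ofReal
        ((sqx z.1 + κ * R ^ 2) ^ b * scaleWt N R z.1 * |a| ^ p) := by
    intro z hz a
    have hX : 0 < √(sqx z.1) := Real.sqrt_pos.2 (sqx_pos hz)
    rw [← ENNReal.ofReal_mul (by positivity)]
    refine ENNReal.ofReal_le_ofReal ?_
    rw [scaleWt_eq, sqx_add_rpow_eq κ b (by linarith) hR]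
    obtain ⟨t, ht⟩ : ∃ t, t = √(sqx z.1) / R := ⟨_, rfl⟩
    have hXt : √(sqx z.1) = R * t := by rw [ht]; field_simp
    have ht0 : 0 < t := by rw [ht]; positivity
    rw [← ht, hXt]
    have hh := hump_pos (δ := δ) ht0
    have key := rpow_le_hump_mul_weight (d := d) hp hδ hδ1 hb hb0 hκ (by omega) ht0
    have hh' : 0 < hump δ t ^ p := by positivity
    rw [abs_mul, abs_of_pos (by positivity : 0 < (R * t) ^ d), Real.mul_rpow (by positivity)
      (abs_nonneg _), mul_pow, Real.mul_rpow (by positivity) (by positivity),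
      Real.inv_rpow hh.le]
    have hRb : 0 < (R ^ 2) ^ b := by positivity
    calc _ = (hump δ t ^ p)⁻¹ * ((R ^ d) ^ p * |a| ^ p) * (t ^ d) ^ p := by ring
      _ ≤ (hump δ t ^ p)⁻¹ * ((R ^ d) ^ p * |a| ^ p) *
          (4 ^ p * (hump δ t ^ p * ((t ^ 2 + κ) ^ b * (t⁻¹ + t ^ (2 * N))))) := by gcongr
      _ = _ := by field_simp
  have hpt2 : ∀ z : Pt n m, z.1 ≠ 0 → ∀ a : ℝ,
      ENNReal.ofReal ((sqx z.1 + κ * R ^ 2) ^ b * scaleWt N R z.1 ^ (1 - p) * |a| ^ p) ≤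
      ENNReal.ofReal ((1 + κ) ^ b * 4 ^ p * (R ^ 2) ^ b) * ‖ω z * a‖ₑ ^ p := by
    intro z hz a
    have hX : 0 < √(sqx z.1) := Real.sqrt_pos.2 (sqx_pos hz)
    rw [Real.enorm_eq_ofReal_abs, ENNReal.ofReal_rpow_of_nonneg (abs_nonneg _) hp0.le,
      ← ENNReal.ofReal_mul (by positivity)]
    refine ENNReal.ofReal_le_ofReal ?_
    rw [scaleWt_eq, sqx_add_rpow_eq κ b (by linarith) hR]
    simp only [hωd]
    obtain ⟨t, ht⟩ : ∃ t, t = √(sqx z.1) / R := ⟨_, rfl⟩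
    have ht0 : 0 < t := by rw [ht]; positivity
    rw [← ht]
    have hh := hump_pos (δ := δ) ht0
    have key := weight_mul_rpow_le_hump hp hδ hδ2 hb hb0 hκ ht0
    rw [abs_mul, abs_of_pos hh, Real.mul_rpow hh.le (abs_nonneg _)]
    calc _ = (R ^ 2) ^ b * |a| ^ p *
          ((t ^ 2 + κ) ^ b * (t⁻¹ + t ^ (2 * N)) ^ (1 - p)) := by ring
      _ ≤ (R ^ 2) ^ b * |a| ^ p * ((1 + κ) ^ b * 4 ^ p * hump δ t ^ p) := by gcongr
      _ = _ := by ring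
  have hconst : ENNReal.ofReal (4 ^ p * (R ^ d) ^ p / (R ^ 2) ^ b) *
      ENNReal.ofReal ((R ^ 2) ^ p) ^ (s + 1) * ENNReal.ofReal ((1 + κ) ^ b * 4 ^ p * (R ^ 2) ^ b) *
      ENNReal.ofReal (R ^ (N + 1))⁻¹ ^ p = ENNReal.ofReal c0 := by
    rw [← ENNReal.ofReal_pow (by positivity), ENNReal.ofReal_rpow_of_nonneg (by positivity) hp0.le,
      ← ENNReal.ofReal_mul (by positivity), ← ENNReal.ofReal_mul (by positivity),
      ← ENNReal.ofReal_mul (by positivity)]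
    congr 1
    have e1 : ((R ^ 2) ^ p) ^ (s + 1) = ((R ^ 2) ^ (s + 1)) ^ p := by
      rw [← Real.rpow_natCast, ← Real.rpow_mul (by positivity), mul_comm, Real.rpow_mul
        (by positivity), Real.rpow_natCast]
    have e2 : (R ^ d) ^ p * ((R ^ 2) ^ (s + 1)) ^ p * ((R ^ (N + 1))⁻¹) ^ p = 1 := by
      rw [← Real.mul_rpow (by positivity) (by positivity),
        ← Real.mul_rpow (by positivity) (by positivity), ← hsd, ← pow_mul, ← pow_add,
        mul_inv_cancel₀ (by positivity), Real.one_rpow]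
    have hRb : (R ^ 2) ^ b ≠ 0 := by positivity
    rw [e1, hc0]
    calc _ = 4 ^ p * ((1 + κ) ^ b * 4 ^ p) * ((R ^ 2) ^ b / (R ^ 2) ^ b) *
          ((R ^ d) ^ p * ((R ^ 2) ^ (s + 1)) ^ p * ((R ^ (N + 1))⁻¹) ^ p) := by ring
      _ = _ := by rw [e2, div_self hRb]; ring
  have hae := ae_fst_ne_zero (n := n) (m := m) (by omega)
  refine (lintegral_mono_ae (hae.mono fun z hz => hpt1 z hz _)).trans ?_
  rw [lintegral_const_mul' _ _ ENNReal.ofReal_ne_top]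
  refine (mul_le_mul_right (hC s (hφ.dirD e) R hR) _).trans ?_
  rw [dirD_grusin_iterate_inr hφ, ← hg]
  refine (mul_le_mul_right (mul_le_mul_right
    (lintegral_mono_ae (hae.mono fun z hz => hpt2 z hz _)) _) _).trans ?_
  rw [lintegral_const_mul' _ _ ENNReal.ofReal_ne_top]
  refine (mul_le_mul_right (mul_le_mul_right (mul_le_mul_right hband _) _) _).trans (le_of_eq ?_)
  rw [mul_pow]
  push_cast
  rw [← ENNReal.ofReal, ← hconst]
  ring

end SingleScale

open scoped ENNReal NNReal SchwartzMap

section SumOverScales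

open Topology Filter

variable {n m : ℕ}

theorem abs_sum_rpow_le {ι : Type*} (S : Finset ι) {a w : ι → ℝ} (hw : ∀ i ∈ S, 0 < w i) {p q : ℝ}
    (hpq : p.HolderConjugate q) : |∑ i ∈ S, a i| ^ p ≤
      (∑ i ∈ S, w i ^ q) ^ (p / q) * ∑ i ∈ S, (w i)⁻¹ ^ p * |a i| ^ p := by
  have hp0 := hpq.pos
  have h := Real.inner_le_Lp_mul_Lq S (fun i => |a i| * (w i)⁻¹) w hpq
  have e1 : ∑ i ∈ S, |a i| * (w i)⁻¹ * w i = ∑ i ∈ S, |a i| := Finset.sum_congr rfl fun i hi => by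
    have := (hw i hi).ne'
    field_simp
  have e2 : ∑ i ∈ S, |(|a i| * (w i)⁻¹)| ^ p = ∑ i ∈ S, (w i)⁻¹ ^ p * |a i| ^ p :=
    Finset.sum_congr rfl fun i hi => by
      have := hw i hi
      rw [abs_of_nonneg (by positivity), Real.mul_rpow (abs_nonneg _) (by positivity), mul_comm]
  have e3 : ∑ i ∈ S, |w i| ^ q = ∑ i ∈ S, w i ^ q := Finset.sum_congr rfl fun i hi => by
    rw [abs_of_pos (hw i hi)]
  rw [e1, e2, e3] at h
  have h0 : 0 ≤ ∑ i ∈ S, (w i)⁻¹ ^ p * |a i| ^ p := Finset.sum_nonneg fun i hi => by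
    have := hw i hi
    positivity
  have h0' : 0 ≤ ∑ i ∈ S, w i ^ q := Finset.sum_nonneg fun i hi => by
    have := hw i hi
    positivity
  have h1 := Real.rpow_le_rpow (abs_nonneg _) ((Finset.abs_sum_le_sum_abs a S).trans h) hp0.le
  refine h1.trans (le_of_eq ?_)
  rw [Real.mul_rpow (by positivity) (by positivity), ← Real.rpow_mul h0, ← Real.rpow_mul h0',
    one_div_mul_cancel hp0.ne', Real.rpow_one, mul_comm]
  congr 2
  ring

theorem exists_sum_band_estimate (hn : 2 ≤ n) (m N : ℕ) {p : ℝ} (hp : 1 < p)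
    {χ : 𝓢(EuclideanSpace ℝ (Fin m), ℝ)} (h1 : ∫ w, χ w = 1)
    (hχ : ∀ ε : ℝ, 0 ≤ ε → ε ≤ 1 / 2 → ∀ v, ∫ w, χ (v - ε • w) * χ w = χ v)
    {s d : ℕ} (hsd : d + 2 * (s + 1) = N + 1) (l : Fin m) :
    ∃ C : ℝ≥0, ∀ (φ : Pt n m → ℝ) (_ : IsTest φ) (R : ℝ) (_ : 0 < R) (M : ℕ),
      ∫⁻ z, ‖√(sqx z.1) ^ d * band χ (R ^ (N + 1)) ((R * 2 ^ M) ^ (N + 1))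
        (dirD (unitVec n m (Sum.inr l)) φ) z‖ₑ ^ p ≤
      C * ∫⁻ z, ‖(grusin n m N)^[s + 1] φ z‖ₑ ^ p := by
  have hp0 : 0 < p := by linarith
  obtain ⟨q, hpq⟩ : ∃ q, p.HolderConjugate q := ⟨_, Real.HolderConjugate.conjExponent hp⟩
  set δ := min 1 (p - 1) / p with hδd
  have hδ : 0 < δ := div_pos (lt_min one_pos (by linarith)) hp0
  have hδp : δ * p = min 1 (p - 1) := div_mul_cancel₀ _ hp0.ne'
  obtain ⟨C, hC⟩ := exists_band_dirD_estimate hn m N hp hδ (hδp ▸ min_le_left _ _)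
    (hδp ▸ min_le_right _ _) h1 hχ hsd l
  set Kq := 4 * ((2:ℝ) ^ (δ * q) / (2 ^ (δ * q) - 1)) with hKq
  set Kp := 4 * ((2:ℝ) ^ (δ * p) / (2 ^ (δ * p) - 1)) with hKp
  refine ⟨(Kq ^ (p / q)).toNNReal * C * Kp.toNNReal, fun φ hφ R hR M => ?_⟩
  set ψ := dirD (unitVec n m (Sum.inr l)) φ with hψ
  have hψT : IsTest ψ := hφ.dirD _
  set g := (grusin n m N)^[s + 1] φ with hg
  have hgT : IsTest g := isTest_grusin_iterate hφ N _
  set r : ℕ → ℝ := fun i => R * 2 ^ i with hr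
  have hr0 : ∀ i, 0 < r i := fun i => by positivity
  have htel : ∀ z, band χ (R ^ (N + 1)) ((R * 2 ^ M) ^ (N + 1)) ψ z =
      ∑ i ∈ Finset.range M, band χ (r i ^ (N + 1)) ((2 * r i) ^ (N + 1)) ψ z := fun z => by
    have := Finset.sum_range_sub' (fun i => smoothing χ (yIncl n m) (r i ^ (N + 1)) ψ z) M
    have e : ∀ i, 2 * r i = r (i + 1) := fun i => by simp only [hr, pow_succ]; ring
    simp only [band, e]
    rw [this]
    simp [hr]
  have hX : ∀ {z : Pt n m}, z.1 ≠ 0 → 0 < √(sqx z.1) := fun hz => Real.sqrt_pos.2 (sqx_pos hz)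
  have hwt : ∀ (z : Pt n m) i, √(sqx z.1) / r i = √(sqx z.1) / R / 2 ^ i := fun z i => by
    rw [hr, div_div]
  have hae := ae_fst_ne_zero (n := n) (m := m) (by omega)
  have hcX : Continuous fun z : Pt n m => √(sqx z.1) := by
    have : Continuous fun z : Pt n m => sqx z.1 := contDiff_sqx.continuous
    exact this.sqrt
  have hcω : ∀ i, Continuous fun z : Pt n m => hump δ (√(sqx z.1) / r i) := fun i =>
    continuous_hump hδ (hcX.div_const _) fun z => div_nonneg (Real.sqrt_nonneg _) (hr0 i).le
  have hcB : ∀ i, Continuous (band χ (r i ^ (N + 1)) ((2 * r i) ^ (N + 1)) ψ) := fun i =>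
    (isReg_band χ _ _ hψT).continuous
  calc ∫⁻ z, ‖√(sqx z.1) ^ d * band χ (R ^ (N + 1)) ((R * 2 ^ M) ^ (N + 1)) ψ z‖ₑ ^ p
      ≤ ∫⁻ z, ENNReal.ofReal (Kq ^ (p / q)) * ∑ i ∈ Finset.range M,
        ENNReal.ofReal ((hump δ (√(sqx z.1) / r i))⁻¹ ^ p * |√(sqx z.1) ^ d *
        band χ (r i ^ (N + 1)) ((2 * r i) ^ (N + 1)) ψ z| ^ p) := by
        refine lintegral_mono_ae (hae.mono fun z hz => ?_)
        have hz' := hX hz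
        rw [htel, Finset.mul_sum, Real.enorm_eq_ofReal_abs,
          ENNReal.ofReal_rpow_of_nonneg (abs_nonneg _) hp0.le, ← ENNReal.ofReal_sum_of_nonneg
          (fun i _ => mul_nonneg (Real.rpow_nonneg (inv_nonneg.2 (hump_nonneg (div_nonneg hz'.le
            (hr0 i).le))) _) (Real.rpow_nonneg (abs_nonneg _) _)),
          ← ENNReal.ofReal_mul' (Finset.sum_nonneg
          (fun i _ => mul_nonneg (Real.rpow_nonneg (inv_nonneg.2 (hump_nonneg (div_nonneg hz'.le
            (hr0 i).le))) _) (Real.rpow_nonneg (abs_nonneg _) _)))]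
        refine ENNReal.ofReal_le_ofReal ((abs_sum_rpow_le _
          (fun i _ => hump_pos (δ := δ) (div_pos hz' (hr0 i))) hpq).trans ?_)
        refine mul_le_mul_of_nonneg_right ?_ (Finset.sum_nonneg
          (fun i _ => mul_nonneg (Real.rpow_nonneg (inv_nonneg.2 (hump_nonneg (div_nonneg hz'.le
            (hr0 i).le))) _) (Real.rpow_nonneg (abs_nonneg _) _)))
        refine Real.rpow_le_rpow (Finset.sum_nonneg fun i _ => Real.rpow_nonneg
          (hump_nonneg (div_nonneg hz'.le (hr0 i).le)) _) ?_ (div_nonneg hp0.le hpq.symm.nonneg)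
        simp only [hwt]
        exact sum_hump_rpow_le hδ hpq.symm.pos (by positivity) M
    _ = ENNReal.ofReal (Kq ^ (p / q)) * ∑ i ∈ Finset.range M, ∫⁻ z,
        ENNReal.ofReal ((hump δ (√(sqx z.1) / r i))⁻¹ ^ p * |√(sqx z.1) ^ d *
        band χ (r i ^ (N + 1)) ((2 * r i) ^ (N + 1)) ψ z| ^ p) := by
        rw [lintegral_const_mul' _ _ ENNReal.ofReal_ne_top, lintegral_finsetSum]
        intro i _
        exact (((hcω i).measurable.inv.pow_const p).mul
          (((hcX.pow d).mul (hcB i)).measurable.abs.pow_const p)).ennreal_ofReal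
    _ ≤ ENNReal.ofReal (Kq ^ (p / q)) * ∑ i ∈ Finset.range M,
        C * ∫⁻ z, ‖hump δ (√(sqx z.1) / r i) * g z‖ₑ ^ p :=
        mul_le_mul_right (Finset.sum_le_sum fun i _ => hC φ hφ (r i) (hr0 i)) _
    _ = ENNReal.ofReal (Kq ^ (p / q)) * (C *
        ∫⁻ z, ∑ i ∈ Finset.range M, ‖hump δ (√(sqx z.1) / r i) * g z‖ₑ ^ p) := by
        rw [← Finset.mul_sum, lintegral_finsetSum]
        intro i _
        exact ((hcω i).mul hgT.continuous).measurable.enorm.pow_const p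
    _ ≤ ENNReal.ofReal (Kq ^ (p / q)) * (C * ∫⁻ z, ENNReal.ofReal Kp * ‖g z‖ₑ ^ p) := by
        refine mul_le_mul_right (mul_le_mul_right (lintegral_mono_ae (hae.mono fun z hz => ?_)) _) _
        have hz' := hX hz
        have : ∀ i ∈ Finset.range M, ‖hump δ (√(sqx z.1) / r i) * g z‖ₑ ^ p =
            ENNReal.ofReal (hump δ (√(sqx z.1) / R / 2 ^ i) ^ p) * ‖g z‖ₑ ^ p := fun i _ => by
          have h0 : 0 ≤ hump δ (√(sqx z.1) / R / 2 ^ i) := hump_nonneg (by positivity)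
          rw [hwt, enorm_mul, ENNReal.mul_rpow_of_nonneg _ _ hp0.le, Real.enorm_of_nonneg h0,
            ENNReal.ofReal_rpow_of_nonneg h0 hp0.le]
        rw [Finset.sum_congr rfl this, ← Finset.sum_mul, ← ENNReal.ofReal_sum_of_nonneg fun i _ =>
          Real.rpow_nonneg (hump_nonneg (by positivity)) _]
        exact mul_le_mul_left (ENNReal.ofReal_le_ofReal
          (sum_hump_rpow_le hδ hp0 (by positivity) M)) _
    _ = _ := by
        rw [lintegral_const_mul' _ _ ENNReal.ofReal_ne_top]
        push_cast
        rw [ENNReal.ofReal, ENNReal.ofReal]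
        ring

theorem exists_weighted_dirD_inr_estimate (hn : 2 ≤ n) (m N : ℕ) {p : ℝ} (hp : 1 < p)
    {s d : ℕ} (hs : 1 ≤ s) (hsd : d + 2 * s = N + 1) :
    ∃ C : ℝ≥0, ∀ (φ : Pt n m → ℝ) (_ : IsTest φ) (l : Fin m),
      ∫⁻ z, ‖‖z.1‖ ^ d * dirD (unitVec n m (Sum.inr l)) φ z‖ₑ ^ p ≤
      C * ∫⁻ z, ‖(grusin n m N)^[s] φ z‖ₑ ^ p := by
  have hp0 : 0 < p := by linarith
  obtain ⟨s, rfl⟩ : ∃ k, s = k + 1 := ⟨s - 1, by omega⟩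
  obtain ⟨χ, h1, hχ⟩ := exists_reproducing_kernel (EuclideanSpace ℝ (Fin m))
  choose C hC using fun l => exists_sum_band_estimate hn m N hp h1 hχ hsd l
  refine ⟨∑ l, C l, fun φ hφ l => ?_⟩
  have : Nonempty (Fin m) := ⟨l⟩
  have hψ := hφ.dirD (unitVec n m (Sum.inr l))
  have hinj : Function.Injective (yIncl n m) := fun a b h => by
    rw [yIncl_apply, yIncl_apply] at h
    ext i
    exact congrFun (congrArg Prod.snd h) i
  calc _ ≤ ∫⁻ z, ‖√(sqx z.1) ^ d * dirD (unitVec n m (Sum.inr l)) φ z‖ₑ ^ p := by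
        refine lintegral_mono fun z => ENNReal.rpow_le_rpow ?_ hp0.le
        rw [enorm_mul, enorm_mul]
        refine mul_le_mul_left ?_ _
        rw [Real.enorm_of_nonneg (by positivity), Real.enorm_of_nonneg (by positivity)]
        refine ENNReal.ofReal_le_ofReal (pow_le_pow_left₀ (norm_nonneg _) ?_ _)
        exact Real.le_sqrt_of_sq_le (norm_sq_le_sqx _)
    _ ≤ C l * ∫⁻ z, ‖(grusin n m N)^[s + 1] φ z‖ₑ ^ p := by
        refine lintegral_le_of_ae_tendsto (f := fun (k : ℕ) z => ‖√(sqx z.1) ^ d *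
          band χ (((2:ℝ) ^ k)⁻¹ ^ (N + 1)) ((((2:ℝ) ^ k)⁻¹ * 2 ^ (2 * k)) ^ (N + 1))
          (dirD (unitVec n m (Sum.inr l)) φ) z‖ₑ ^ p) (fun k => ?_) (Eventually.of_forall fun z => ?_)
          (fun k => hC l φ hφ ((2:ℝ) ^ k)⁻¹ (by positivity) (2 * k)) tendsto_const_nhds
        · have hcX : Continuous fun z : Pt n m => √(sqx z.1) := by
            have : Continuous fun z : Pt n m => sqx z.1 := contDiff_sqx.continuous
            exact this.sqrt
          exact ((hcX.pow d).mul (isReg_band χ _ _ hψ).continuous).measurable.enorm.pow_const p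
            |>.aemeasurable
        · have e : ∀ k : ℕ, ((2:ℝ) ^ k)⁻¹ * 2 ^ (2 * k) = 2 ^ k := fun k => by
            rw [two_mul, pow_add]; field_simp
          simp only [e]
          have t2 : Tendsto (fun k : ℕ => ((2:ℝ) ^ k)) atTop atTop :=
            tendsto_pow_atTop_atTop_of_one_lt (by norm_num)
          have t3 : Tendsto (fun k : ℕ => ((2:ℝ) ^ k) ^ (N + 1)) atTop atTop :=
            (tendsto_pow_atTop (by omega)).comp t2
          have t4 : Tendsto (fun k : ℕ => ((2:ℝ) ^ k)⁻¹ ^ (N + 1)) atTop (𝓝 0) := by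
            simpa using (tendsto_inv_atTop_zero.comp t2).pow (N + 1)
          have t5 := (tendsto_smoothing_zero (L := yIncl n m) h1 hψ t4 z).sub
            (tendsto_smoothing_atTop (χ := χ) hinj hψ t3 z)
          rw [sub_zero] at t5
          exact ((t5.const_mul (√(sqx z.1) ^ d)).enorm).ennrpow_const p
    _ ≤ _ := by
        push_cast
        exact mul_le_mul_left (Finset.single_le_sum (f := fun l => (C l : ℝ≥0∞))
          (fun _ _ => zero_le) (Finset.mem_univ l)) _

end SumOverScales

section Homogeneous

open Topology Filter

variable {n m : ℕ}

/-- Smooth functions off the origin that are positively homogeneous of integer degree. -/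
def HomSmooth (k : ℤ) (c : (Fin n → ℝ) → ℝ) : Prop :=
  ContDiffOn ℝ (⊤ : ℕ∞) c {0}ᶜ ∧ ∀ t : ℝ, 0 < t → ∀ x, x ≠ 0 → c (t • x) = t ^ k * c x

theorem HomSmooth.differentiableAt {k : ℤ} {c : (Fin n → ℝ) → ℝ} (hc : HomSmooth k c)
    {x : Fin n → ℝ} (hx : x ≠ 0) : DifferentiableAt ℝ c x :=
  (hc.1.contDiffAt (isOpen_compl_singleton.mem_nhds hx)).differentiableAt (by simp)

theorem HomSmooth.exists_bound {k : ℤ} {c : (Fin n → ℝ) → ℝ} (hc : HomSmooth k c) :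
    ∃ C : ℝ, 0 ≤ C ∧ ∀ x, x ≠ 0 → |c x| ≤ C * ‖x‖ ^ k := by
  obtain ⟨C, hC⟩ := (isCompact_sphere (0 : Fin n → ℝ) 1).exists_bound_of_continuousOn
    (hc.1.continuousOn.mono fun x hx => by
      rintro rfl
      simp at hx)
  refine ⟨max C 0, le_max_right _ _, fun x hx => ?_⟩
  have h0 : 0 < ‖x‖ := norm_pos_iff.2 hx
  have h1 := hC (‖x‖⁻¹ • x) (by simp [norm_smul, h0.ne'])
  have h2 := hc.2 ‖x‖ h0 (‖x‖⁻¹ • x) (smul_ne_zero (inv_ne_zero h0.ne') hx)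
  rw [smul_inv_smul₀ h0.ne'] at h2
  rw [h2, abs_mul, abs_of_pos (zpow_pos h0 k), mul_comm]
  exact mul_le_mul_of_nonneg_right (h1.trans (le_max_left _ _)) (zpow_pos h0 k).le

theorem HomSmooth.mul {k l : ℤ} {c d : (Fin n → ℝ) → ℝ} (hc : HomSmooth k c)
    (hd : HomSmooth l d) : HomSmooth (k + l) fun x => c x * d x :=
  ⟨hc.1.mul hd.1, fun t ht x hx => by
    beta_reduce
    rw [hc.2 t ht x hx, hd.2 t ht x hx, zpow_add₀ ht.ne']; ring⟩

theorem HomSmooth.dirD {k : ℤ} {c : (Fin n → ℝ) → ℝ} (hc : HomSmooth k c) (v : Fin n → ℝ) :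
    HomSmooth (k - 1) (dirD v c) := by
  refine ⟨?_, fun t ht x hx => ?_⟩
  · have := (contDiffOn_infty_iff_fderiv_of_isOpen (isOpen_compl_singleton)).1 hc.1
    exact this.2.clm_apply contDiffOn_const
  · have h1 : HasFDerivAt (fun y : Fin n → ℝ => c (t • y)) (t • fderiv ℝ c (t • x)) x := by
      have h2 := (hc.differentiableAt (smul_ne_zero ht.ne' hx)).hasFDerivAt
      have h3 : HasFDerivAt (fun y : Fin n → ℝ => t • y)
          (t • ContinuousLinearMap.id ℝ (Fin n → ℝ)) x := (hasFDerivAt_id x).const_smul t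
      refine (h2.comp x h3).congr_fderiv ?_
      ext; simp
    have h4 : HasFDerivAt (fun y : Fin n → ℝ => c (t • y)) (t ^ k • fderiv ℝ c x) x := by
      refine ((hc.differentiableAt hx).hasFDerivAt.const_mul (t ^ k)).congr_of_eventuallyEq ?_
      filter_upwards [isOpen_compl_singleton.mem_nhds hx] with y hy
      exact hc.2 t ht y hy
    have h5 := congrArg (fun L => L v) (h1.unique h4)
    simp only [smul_apply, smul_eq_mul] at h5
    rw [_root_.dirD, _root_.dirD, zpow_sub_one₀ ht.ne']
    field_simp
    rw [mul_comm]
    exact h5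

theorem sqx_smul (t : ℝ) (x : Fin n → ℝ) : sqx (t • x) = t ^ 2 * sqx x := by
  simp [sqx, Finset.mul_sum, mul_pow]

theorem contDiff_sqx_fst : ContDiff ℝ (⊤ : ℕ∞) (sqx : (Fin n → ℝ) → ℝ) := by
  unfold sqx; fun_prop

theorem HomSmooth.sqx_pow (N : ℕ) : HomSmooth (n := n) (2 * N) fun x => sqx x ^ N :=
  ⟨(contDiff_sqx_fst.pow N).contDiffOn, fun t _ x _ => by
    beta_reduce
    rw [sqx_smul, mul_pow, zpow_mul, zpow_natCast]; norm_cast⟩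

theorem HomSmooth.sqrt_sqx_pow (N : ℕ) : HomSmooth (n := n) N fun x => √(sqx x) ^ N :=
  ⟨(contDiff_sqx_fst.contDiffOn.sqrt fun _ hx => (sqx_pos hx).ne').pow N, fun t ht x _ => by
    beta_reduce
    rw [sqx_smul, Real.sqrt_mul (by positivity), Real.sqrt_sq ht.le, mul_pow, zpow_natCast]⟩

end Homogeneous

section MixedDerivatives

open Topology Filter

variable {n m : ℕ}

/-- Iterated derivatives in the `x` directions. -/
noncomputable def derX (xs : List (Fin n)) (f : Pt n m → ℝ) : Pt n m → ℝ :=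
  xs.foldr (fun i g => dirD (unitVec n m (Sum.inl i)) g) f

/-- Iterated derivatives in the `y` directions. -/
noncomputable def derY (ys : List (Fin m)) (f : Pt n m → ℝ) : Pt n m → ℝ :=
  ys.foldr (fun l g => dirD (unitVec n m (Sum.inr l)) g) f

theorem derX_cons (i : Fin n) (xs : List (Fin n)) (f : Pt n m → ℝ) :
    derX (i :: xs) f = dirD (unitVec n m (Sum.inl i)) (derX xs f) := rfl

theorem derY_cons (l : Fin m) (ys : List (Fin m)) (f : Pt n m → ℝ) :
    derY (l :: ys) f = dirD (unitVec n m (Sum.inr l)) (derY ys f) := rfl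

theorem IsTest.derX {f : Pt n m → ℝ} (hf : IsTest f) (xs : List (Fin n)) :
    IsTest (derX xs f) := by
  induction xs with
  | nil => exact hf
  | cons i xs ih => exact ih.dirD _

theorem IsTest.derY {f : Pt n m → ℝ} (hf : IsTest f) (ys : List (Fin m)) :
    IsTest (derY ys f) := by
  induction ys with
  | nil => exact hf
  | cons i ys ih => exact ih.dirD _

theorem dirD_derX {f : Pt n m → ℝ} (hf : IsTest f) (v : Pt n m) (xs : List (Fin n)) :
    dirD v (derX xs f) = derX xs (dirD v f) := by
  induction xs with
  | nil => rfl
  | cons i xs ih => rw [derX_cons, derX_cons, dirD_comm (hf.derX xs).1, ih]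

theorem derY_grusin {f : Pt n m → ℝ} (hf : IsTest f) (N : ℕ) (ys : List (Fin m)) :
    derY ys (grusin n m N f) = grusin n m N (derY ys f) := by
  induction ys with
  | nil => rfl
  | cons l ys ih =>
    rw [derY_cons, derY_cons, ih]
    exact (dirD_grusin_iterate_inr (hf.derY ys) N 1 l).symm

variable {N : ℕ}

/-- Linear differential operators, on test functions and off `{x = 0}`, that are finite sums of
terms `c(x) ∂_x^β ∂_y^γ` with `c` homogeneous of degree `e + (N + 1) |γ| + |β|` and with
`(|β|, |γ|)` subject to `S`. -/
inductive MixedSum (N : ℕ) (e : ℤ) (S : ℕ → ℕ → Prop) :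
    ((Pt n m → ℝ) → Pt n m → ℝ) → Prop
  | zero {T : (Pt n m → ℝ) → Pt n m → ℝ} (h : ∀ φ, IsTest φ → ∀ z, z.1 ≠ 0 → T φ z = 0) :
    MixedSum N e S T
  | add_term {T T' : (Pt n m → ℝ) → Pt n m → ℝ} {k : ℤ} {c : (Fin n → ℝ) → ℝ}
    {xs : List (Fin n)} {ys : List (Fin m)} (hc : HomSmooth k c) (hS : S xs.length ys.length)
    (hk : k = e + (N + 1) * ys.length + xs.length) (hT : MixedSum N e S T)
    (h : ∀ φ, IsTest φ → ∀ z, z.1 ≠ 0 → T' φ z = T φ z + c z.1 * derX xs (derY ys φ) z) :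
    MixedSum N e S T'

namespace MixedSum

variable {e : ℤ} {S S' : ℕ → ℕ → Prop} {T T' : (Pt n m → ℝ) → Pt n m → ℝ}

theorem congr (hT : MixedSum N e S T)
    (h : ∀ φ, IsTest φ → ∀ z, z.1 ≠ 0 → T' φ z = T φ z) : MixedSum N e S T' := by
  cases hT with
  | zero h' => exact .zero fun φ hφ z hz => (h φ hφ z hz).trans (h' φ hφ z hz)
  | add_term hc hS hk hT h' =>
    exact .add_term hc hS hk hT fun φ hφ z hz => (h φ hφ z hz).trans (h' φ hφ z hz)

theorem mono (hT : MixedSum N e S T) (h : ∀ a b, S a b → S' a b) : MixedSum N e S' T := by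
  induction hT with
  | zero h' => exact .zero h'
  | add_term hc hS hk _ h' ih => exact .add_term hc (h _ _ hS) hk ih h'

theorem single {k : ℤ} {c : (Fin n → ℝ) → ℝ} (xs : List (Fin n)) (ys : List (Fin m))
    (hc : HomSmooth k c) (hS : S xs.length ys.length)
    (hk : k = e + (N + 1) * ys.length + xs.length) :
    MixedSum N e S fun φ z => c z.1 * derX xs (derY ys φ) z :=
  .add_term hc hS hk (.zero (T := fun _ _ => 0) fun _ _ _ _ => rfl) fun _ _ _ _ => by simp

theorem add (hT : MixedSum N e S T) (hT' : MixedSum N e S T') :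
    MixedSum N e S fun φ z => T φ z + T' φ z := by
  induction hT' with
  | zero h => exact hT.congr fun φ hφ z hz => by simp [h φ hφ z hz]
  | add_term hc hS hk _ h ih =>
    exact .add_term hc hS hk ih fun φ hφ z hz => by rw [h φ hφ z hz, add_assoc]

theorem sum {ι : Type*} (s : Finset ι) {T : ι → (Pt n m → ℝ) → Pt n m → ℝ}
    (hT : ∀ i ∈ s, MixedSum N e S (T i)) : MixedSum N e S fun φ z => ∑ i ∈ s, T i φ z := by
  classical
  induction s using Finset.induction_on with
  | empty => exact .zero fun _ _ _ _ => by simp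
  | insert i s hi ih =>
    refine ((hT i (by simp)).add (ih fun j hj => hT j (by simp [hj]))).congr fun φ _ z _ => ?_
    exact Finset.sum_insert hi

theorem mul {k : ℤ} {c : (Fin n → ℝ) → ℝ} (hT : MixedSum N e S T) (hc : HomSmooth k c) :
    MixedSum N (e + k) S fun φ z => c z.1 * T φ z := by
  induction hT with
  | zero h => exact .zero fun φ hφ z hz => by simp [h φ hφ z hz]
  | add_term hd hS hk _ h ih =>
    exact .add_term (hc.mul hd) hS (by rw [hk]; ring) ih fun φ hφ z hz => by
      rw [h φ hφ z hz]; ring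

theorem hasFDerivAt_term {k : ℤ} {c : (Fin n → ℝ) → ℝ} (hc : HomSmooth k c) {f : Pt n m → ℝ}
    (hf : IsTest f) {z : Pt n m} (hz : z.1 ≠ 0) :
    HasFDerivAt (fun z : Pt n m => c z.1 * f z) (c z.1 • fderiv ℝ f z +
      f z • (fderiv ℝ c z.1).comp (ContinuousLinearMap.fst ℝ (Fin n → ℝ) (Fin m → ℝ))) z :=
  ((hc.differentiableAt hz).hasFDerivAt.comp z hasFDerivAt_fst).mul
    (hf.differentiable z).hasFDerivAt

theorem eventually_fst_ne_zero {z : Pt n m} (hz : z.1 ≠ 0) : ∀ᶠ w : Pt n m in 𝓝 z, w.1 ≠ 0 :=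
  continuous_fst.continuousAt.eventually_ne hz

theorem differentiableAt (hT : MixedSum N e S T) {φ : Pt n m → ℝ} (hφ : IsTest φ) {z : Pt n m}
    (hz : z.1 ≠ 0) : DifferentiableAt ℝ (T φ) z := by
  induction hT with
  | zero h =>
    refine (differentiableAt_const (0 : ℝ)).congr_of_eventuallyEq ?_
    filter_upwards [eventually_fst_ne_zero hz] with w hw using h φ hφ w hw
  | @add_term _ _ _ _ xs ys hc hS hk _ h ih =>
    refine (ih.add (hasFDerivAt_term hc ((hφ.derY ys).derX xs) hz).differentiableAt)
      |>.congr_of_eventuallyEq ?_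
    filter_upwards [eventually_fst_ne_zero hz] with w hw using h φ hφ w hw

theorem dirD_zero_of (h : ∀ φ, IsTest φ → ∀ z, z.1 ≠ 0 → T φ z = 0) (v : Pt n m)
    {φ : Pt n m → ℝ} (hφ : IsTest φ) {z : Pt n m} (hz : z.1 ≠ 0) : dirD v (T φ) z = 0 := by
  have : T φ =ᶠ[𝓝 z] fun _ => 0 := by
    filter_upwards [eventually_fst_ne_zero hz] with w hw using h φ hφ w hw
  rw [dirD, this.fderiv_eq]
  simp

theorem dirD_add_term {k : ℤ} {c : (Fin n → ℝ) → ℝ} {xs : List (Fin n)} {ys : List (Fin m)}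
    (hc : HomSmooth k c) (hT : MixedSum N e S T)
    (h : ∀ φ, IsTest φ → ∀ z, z.1 ≠ 0 → T' φ z = T φ z + c z.1 * derX xs (derY ys φ) z)
    (v : Pt n m) {φ : Pt n m → ℝ} (hφ : IsTest φ) {z : Pt n m} (hz : z.1 ≠ 0) :
    dirD v (T' φ) z = dirD v (T φ) z + dirD v.1 c z.1 * derX xs (derY ys φ) z +
      c z.1 * dirD v (derX xs (derY ys φ)) z := by
  have h1 : T' φ =ᶠ[𝓝 z] fun w => T φ w + c w.1 * derX xs (derY ys φ) w := by
    filter_upwards [eventually_fst_ne_zero hz] with w hw using h φ hφ w hw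
  have h2 := ((hT.differentiableAt hφ hz).hasFDerivAt.fun_add
    (hasFDerivAt_term hc ((hφ.derY ys).derX xs) hz)).congr_of_eventuallyEq h1
  simp only [dirD, h2.fderiv]
  simp
  ring

theorem dirD_inl (hT : MixedSum N e S T) (i : Fin n) (h0 : ∀ a b, S a b → S' a b)
    (h1 : ∀ a b, S a b → S' (a + 1) b) :
    MixedSum N (e - 1) S' fun φ => dirD (unitVec n m (Sum.inl i)) (T φ) := by
  induction hT with
  | zero h => exact .zero fun φ hφ z hz => dirD_zero_of h _ hφ hz
  | @add_term T T' k c xs ys hc hS hk hT h ih =>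
    refine .add_term (xs := i :: xs) (ys := ys) hc (h1 _ _ hS) 
      (by rw [hk]; push_cast [List.length_cons]; ring)
      (.add_term (xs := xs) (ys := ys) (hc.dirD (unitVec n m (Sum.inl i)).1) (h0 _ _ hS) (by rw [hk]; ring) ih
        fun φ hφ z hz => rfl) fun φ hφ z hz => ?_
    exact dirD_add_term hc hT h _ hφ hz

theorem dirD_inr (hT : MixedSum N e S T) (l : Fin m) (h1 : ∀ a b, S a b → S' a (b + 1)) :
    MixedSum N (e - (N + 1)) S' fun φ => dirD (unitVec n m (Sum.inr l)) (T φ) := by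
  induction hT with
  | zero h => exact .zero fun φ hφ z hz => dirD_zero_of h _ hφ hz
  | @add_term T T' k c xs ys hc hS hk hT h ih =>
    refine .add_term (xs := xs) (ys := l :: ys) hc (h1 _ _ hS)
      (by rw [hk]; push_cast [List.length_cons]; ring) ih fun φ hφ z hz => ?_
    rw [dirD_add_term hc hT h _ hφ hz, dirD_derX (hφ.derY ys), derY_cons]
    simp [dirD, unitVec]

end MixedSum

end MixedDerivatives

section Domination

open Topology Filter

variable {n m : ℕ}

/-- The `L_p` norm of `A φ` is at most a constant times that of `B φ`, for test functions `φ`. -/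
def LpDominated (p : ℝ) (A B : (Pt n m → ℝ) → Pt n m → ℝ) : Prop :=
  ∃ C : ℝ≥0, ∀ φ, IsTest φ → ∫⁻ z, ‖A φ z‖ₑ ^ p ≤ C * ∫⁻ z, ‖B φ z‖ₑ ^ p

namespace LpDominated

variable {p : ℝ} {A A' B B' : (Pt n m → ℝ) → Pt n m → ℝ}

theorem refl (A : (Pt n m → ℝ) → Pt n m → ℝ) : LpDominated p A A := ⟨1, fun φ _ => by simp⟩

theorem comp (h : LpDominated p A B) {Q : (Pt n m → ℝ) → Pt n m → ℝ}
    (hQ : ∀ φ, IsTest φ → IsTest (Q φ)) :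
    LpDominated p (fun φ => A (Q φ)) fun φ => B (Q φ) := by
  obtain ⟨C, hC⟩ := h
  exact ⟨C, fun φ hφ => hC _ (hQ φ hφ)⟩

theorem of_ae_le (hp : 0 ≤ p) (h : LpDominated p A B) {c : ℝ} (hc : 0 ≤ c)
    (hA : ∀ φ, IsTest φ → ∀ᵐ z, |A' φ z| ≤ c * |A φ z|) : LpDominated p A' B := by
  obtain ⟨C, hC⟩ := h
  refine ⟨(c ^ p).toNNReal * C, fun φ hφ => ?_⟩
  calc ∫⁻ z, ‖A' φ z‖ₑ ^ p ≤ ∫⁻ z, ENNReal.ofReal (c ^ p) * ‖A φ z‖ₑ ^ p := by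
        refine lintegral_mono_ae ?_
        filter_upwards [hA φ hφ] with z hz
        rw [← ENNReal.ofReal_rpow_of_nonneg hc hp, ← ENNReal.mul_rpow_of_nonneg _ _ hp]
        refine ENNReal.rpow_le_rpow ?_ hp
        rw [Real.enorm_eq_ofReal_abs, Real.enorm_eq_ofReal_abs, ← ENNReal.ofReal_mul hc]
        exact ENNReal.ofReal_le_ofReal hz
    _ ≤ _ := by
        rw [lintegral_const_mul' _ _ ENNReal.ofReal_ne_top, ENNReal.coe_mul, mul_assoc,
          ← ENNReal.ofReal]
        exact mul_le_mul_right (hC φ hφ) _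

theorem congr_ae (hp : 0 ≤ p) (h : LpDominated p A B)
    (hA : ∀ φ, IsTest φ → ∀ᵐ z, A' φ z = A φ z) : LpDominated p A' B :=
  h.of_ae_le hp zero_le_one fun φ hφ => by
    filter_upwards [hA φ hφ] with z hz
    rw [hz, one_mul]

theorem add (hp : 1 ≤ p) (h : LpDominated p A B) (h' : LpDominated p A' B)
    (hA : ∀ φ, IsTest φ → AEMeasurable (A φ)) :
    LpDominated p (fun φ z => A φ z + A' φ z) B := by
  obtain ⟨C, hC⟩ := h
  obtain ⟨C', hC'⟩ := h'
  refine ⟨(2 : ℝ≥0) ^ (p - 1) * (C + C'), fun φ hφ => ?_⟩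
  refine (lintegral_add_rpow_le hp (hA φ hφ)).trans ?_
  rw [ENNReal.coe_mul, ENNReal.coe_rpow_of_nonneg _ (by linarith), ENNReal.coe_add, mul_assoc,
    add_mul]
  exact mul_le_mul_right (add_le_add (hC φ hφ) (hC' φ hφ)) _

theorem zero (hp : 0 < p) : LpDominated p (fun _ _ => 0) B :=
  ⟨0, fun φ _ => by simp [ENNReal.zero_rpow_of_pos hp]⟩

end LpDominated

theorem MixedSum.lpDominated (hn : 1 ≤ n) {p : ℝ} (hp : 1 ≤ p) {N : ℕ} {e : ℤ}
    {S : ℕ → ℕ → Prop} {T B : (Pt n m → ℝ) → Pt n m → ℝ} (hT : MixedSum N e S T) (k : ℕ)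
    (hS : ∀ (xs : List (Fin n)) (ys : List (Fin m)), S xs.length ys.length →
      ∃ d : ℕ, d = e + k + (N + 1) * ys.length + xs.length ∧
        LpDominated p (fun φ z => ‖z.1‖ ^ d * derX xs (derY ys φ) z) B) :
    LpDominated p (fun φ z => ‖z.1‖ ^ k * T φ z) B := by
  have hp0 : 0 < p := by linarith
  induction hT with
  | zero h =>
    refine (LpDominated.zero hp0).congr_ae hp0.le fun φ hφ => ?_
    filter_upwards [ae_fst_ne_zero hn] with z hz
    rw [h φ hφ z hz, mul_zero]
  | @add_term T T' j c xs ys hc hS' hj hT h ih =>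
    obtain ⟨d, hd, hD⟩ := hS xs ys hS'
    obtain ⟨C, hC0, hC⟩ := hc.exists_bound
    have hU : LpDominated p (fun φ z => C * (‖z.1‖ ^ d * derX xs (derY ys φ) z)) B :=
      hD.of_ae_le hp0.le hC0 fun φ _ => .of_forall fun z => by
        rw [abs_mul, abs_of_nonneg hC0]
    have hV : LpDominated p (fun φ z => |C * (‖z.1‖ ^ d * derX xs (derY ys φ) z)| +
        |‖z.1‖ ^ k * T φ z|) B := by
      refine LpDominated.add hp (hU.of_ae_le hp0.le zero_le_one fun φ _ => .of_forall fun z => ?_)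
        (ih.of_ae_le hp0.le zero_le_one fun φ _ => .of_forall fun z => ?_) fun φ hφ => ?_
      · rw [abs_abs, one_mul]
      · rw [abs_abs, one_mul]
      · have := ((hφ.derY ys).derX xs).continuous
        exact (by fun_prop : Continuous _).aemeasurable
    refine hV.of_ae_le hp0.le zero_le_one fun φ hφ => ?_
    filter_upwards [ae_fst_ne_zero hn] with z hz
    have h0 : 0 < ‖z.1‖ := norm_pos_iff.2 hz
    have h1 : ‖z.1‖ ^ k * |c z.1| ≤ C * ‖z.1‖ ^ d := by
      refine (mul_le_mul_of_nonneg_left (hC _ hz) (by positivity)).trans_eq ?_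
      rw [mul_left_comm]
      congr 1
      rw [← zpow_natCast, ← zpow_natCast, ← zpow_add₀ h0.ne', hd, hj]
      congr 1
      ring
    rw [h φ hφ z hz, one_mul, mul_add]
    refine (abs_add_le _ _).trans ?_
    rw [add_comm (|‖z.1‖ ^ k * T φ z|)]
    refine (add_le_add ?_ le_rfl).trans (le_abs_self _)
    rw [← mul_assoc, ← mul_assoc, abs_mul, abs_mul _ (derX xs (derY ys φ) z),
      abs_mul, abs_of_nonneg (by positivity : 0 ≤ ‖z.1‖ ^ k),
      abs_of_nonneg (by positivity : 0 ≤ C * ‖z.1‖ ^ d)]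
    exact mul_le_mul_of_nonneg_right h1 (abs_nonneg _)

end Domination

section Commutators

open Topology Filter

variable {n m : ℕ}

theorem derX_sub {f g : Pt n m → ℝ} (hf : IsTest f) (hg : IsTest g) (xs : List (Fin n)) :
    derX xs (fun z => f z - g z) = fun z => derX xs f z - derX xs g z := by
  induction xs with
  | nil => rfl
  | cons i xs ih =>
    rw [derX_cons, ih, dirD_sub _ (hf.derX xs).differentiable (hg.derX xs).differentiable]; rfl

theorem derX_neg (f : Pt n m → ℝ) (xs : List (Fin n)) :
    derX xs (fun z => -f z) = fun z => -derX xs f z := by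
  induction xs with
  | nil => rfl
  | cons i xs ih => rw [derX_cons, ih, dirD_neg]; rfl

theorem derX_sum {ι : Type*} (s : Finset ι) {f : ι → Pt n m → ℝ} (hf : ∀ i ∈ s, IsTest (f i))
    (xs : List (Fin n)) :
    derX xs (fun z => ∑ i ∈ s, f i z) = fun z => ∑ i ∈ s, derX xs (f i) z := by
  induction xs with
  | nil => rfl
  | cons i xs ih =>
    rw [derX_cons, ih, dirD_sum _ _ fun j hj => ((hf j hj).derX xs).differentiable]; rfl

theorem IsTest.sqx_pow_mul {f : Pt n m → ℝ} (hf : IsTest f) (N : ℕ) :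
    IsTest fun z => sqx z.1 ^ N * f z := hf.mul_left (contDiff_sqx.pow N)

theorem derX_grusin {g : Pt n m → ℝ} (hg : IsTest g) (N : ℕ) (xs : List (Fin n)) (z : Pt n m) :
    derX xs (grusin n m N g) z =
      -(∑ j, dirD (unitVec n m (Sum.inl j)) (dirD (unitVec n m (Sum.inl j)) (derX xs g)) z) -
      ∑ k : Fin m, derX xs (fun z => sqx z.1 ^ N *
        dirD (unitVec n m (Sum.inr k)) (dirD (unitVec n m (Sum.inr k)) g) z) z := by
  have h1 : ∀ j : Fin n, IsTest (dirD (unitVec n m (Sum.inl j))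
    (dirD (unitVec n m (Sum.inl j)) g)) := fun j => (hg.dirD _).dirD _
  have h2 : ∀ k : Fin m, IsTest fun z => sqx z.1 ^ N *
      dirD (unitVec n m (Sum.inr k)) (dirD (unitVec n m (Sum.inr k)) g) z :=
    fun k => ((hg.dirD _).dirD _).sqx_pow_mul N
  have h : grusin n m N g = fun z =>
      -(∑ j, dirD (unitVec n m (Sum.inl j)) (dirD (unitVec n m (Sum.inl j)) g) z) -
      ∑ k : Fin m, sqx z.1 ^ N *
        dirD (unitVec n m (Sum.inr k)) (dirD (unitVec n m (Sum.inr k)) g) z := by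
    funext z
    rw [grusin_apply, Finset.mul_sum]
  rw [h, derX_sub (IsTest.sum _ fun j _ => h1 j).neg (IsTest.sum _ fun k _ => h2 k), derX_neg,
    derX_sum _ fun j _ => h1 j, derX_sum _ fun k _ => h2 k]
  simp only [dirD_derX hg, dirD_derX (hg.dirD _)]

theorem grusin_derX {g : Pt n m → ℝ} (hg : IsTest g) (N : ℕ) (xs : List (Fin n)) (z : Pt n m) :
    grusin n m N (derX xs g) z = derX xs (grusin n m N g) z + ∑ k : Fin m,
      (derX xs (fun z => sqx z.1 ^ N *
        dirD (unitVec n m (Sum.inr k)) (dirD (unitVec n m (Sum.inr k)) g) z) z -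
      sqx z.1 ^ N * derX xs
        (dirD (unitVec n m (Sum.inr k)) (dirD (unitVec n m (Sum.inr k)) g)) z) := by
  rw [derX_grusin hg, grusin_apply, Finset.sum_sub_distrib, ← Finset.mul_sum]
  simp only [dirD_derX hg, dirD_derX (hg.dirD _)]
  ring

theorem mixedSum_commutator (N : ℕ) (xs : List (Fin n)) (ys : List (Fin m)) :
    MixedSum N (2 * N - (N + 1) * ys.length - xs.length)
      (fun a b => a + 1 ≤ xs.length ∧ b = ys.length)
      fun φ z => derX xs (fun z => sqx z.1 ^ N * derY ys φ z) z -
        sqx z.1 ^ N * derX xs (derY ys φ) z := by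
  induction xs with
  | nil => exact .zero fun φ hφ z hz => by simp [derX]
  | cons i xs ih =>
    have hq := HomSmooth.sqx_pow (n := n) N
    have h1 : MixedSum N (2 * N - (N + 1) * ys.length - (i :: xs).length)
        (fun a b => a + 1 ≤ (i :: xs).length ∧ b = ys.length) fun φ z =>
          dirD (unitVec n m (Sum.inl i)).1 (fun x => sqx x ^ N) z.1 * derX xs (derY ys φ) z :=
      .single xs ys (hq.dirD _) ⟨by simp, rfl⟩ (by push_cast [List.length_cons]; ring)
    have h2 := ih.dirD_inl (S' := fun a b => a + 1 ≤ (i :: xs).length ∧ b = ys.length) i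
      (fun a b h => ⟨by rw [List.length_cons]; omega, h.2⟩)
      (fun a b h => ⟨by rw [List.length_cons]; omega, h.2⟩)
    rw [show (2 * N - (N + 1) * ys.length - xs.length - 1 : ℤ) =
      2 * N - (N + 1) * ys.length - (i :: xs).length by push_cast [List.length_cons]; ring] at h2
    refine (h2.add h1).congr fun φ hφ z hz => ?_
    have ht := (hφ.derY ys).derX xs
    have hqd : Differentiable ℝ fun x : Fin n → ℝ => sqx x ^ N := (differentiable_sqx).pow N
    rw [dirD_sub _ (((hφ.derY ys).sqx_pow_mul N).derX xs).differentiable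
      (ht.sqx_pow_mul N).differentiable,
      dirD_mul (f := fun z : Pt n m => sqx z.1 ^ N) _ (hqd.comp differentiable_fst)
      ht.differentiable, dirD_comp_fst hqd]
    simp only [derX_cons]
    ring

/-- Weighted estimates for all mixed derivatives of order at most `2 s` with a `y` derivative. -/
def MixedBound (n m N : ℕ) (p : ℝ) (s : ℕ) : Prop :=
  ∀ (xs : List (Fin n)) (ys : List (Fin m)) (d : ℕ), ys ≠ [] → xs.length + ys.length ≤ 2 * s →
    d + 2 * s = (N + 1) * ys.length + xs.length →
    LpDominated p (fun φ z => ‖z.1‖ ^ d * derX xs (derY ys φ) z) (grusin n m N)^[s]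

theorem LpDominated.grusin_iterate_succ {p : ℝ} {N s : ℕ} {A : (Pt n m → ℝ) → Pt n m → ℝ}
    (h : LpDominated p A (grusin n m N)^[s]) :
    LpDominated p (fun φ => A (grusin n m N φ)) (grusin n m N)^[s + 1] :=
  h.comp fun _ hφ => isTest_grusin hφ N

/-- The derivative of `H φ` written as a divergence plus a lower order remainder. -/
theorem MixedBound.exists_divergence_form {N s : ℕ} {p : ℝ} (hp : 1 < p)
    (hT : MixedBound n m N p s) (xs : List (Fin n)) (ys : List (Fin m)) (hys : ys ≠ [])
    (hL : xs.length + ys.length + 1 ≤ 2 * (s + 1)) {a : ℕ}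
    (ha : a + 2 * (s + 1) = (N + 1) * ys.length + xs.length) (hn : 1 ≤ n) :
    ∃ (k : Fin n ⊕ Fin m) (F : (Pt n m → ℝ) → Pt n m → ℝ), (∀ φ, IsTest φ → IsTest (F φ)) ∧
      dirWeight N k ≤ a + 1 ∧
      LpDominated p (fun φ z => ‖z.1‖ ^ (a + 1 - dirWeight N k) * F φ z)
        (grusin n m N)^[s + 1] ∧
      LpDominated p (fun φ z => ‖z.1‖ ^ (a + 2) *
        (derX xs (derY ys (grusin n m N φ)) z - dirD (unitVec n m k) (F φ) z))
        (grusin n m N)^[s + 1] := by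
  have hp0 : 0 < p := by linarith
  have hz : ∀ (b : ℕ) (A : (Pt n m → ℝ) → Pt n m → ℝ), LpDominated p
      (fun φ z => ‖z.1‖ ^ b * (A φ z - A φ z)) (grusin n m N)^[s + 1] := fun b A =>
    (LpDominated.zero hp0).congr_ae hp0.le fun φ _ => .of_forall fun z => by simp
  by_cases h : xs.length + ys.length ≤ 2 * s
  · refine ⟨Sum.inl ⟨0, hn⟩, fun _ _ => 0, fun _ _ => IsTest.zero, by simp [dirWeight], ?_, ?_⟩
    · exact (LpDominated.zero hp0).congr_ae hp0.le fun φ _ => .of_forall fun z => by simp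
    · refine (hT xs ys (a + 2) hys h (by omega)).grusin_iterate_succ.congr_ae hp0.le
        fun φ _ => .of_forall fun z => ?_
      rw [dirD_const, sub_zero]
  · rcases xs with _ | ⟨i, xs⟩
    · rcases ys with _ | ⟨l, ys⟩
      · exact absurd rfl hys
      simp only [List.length_nil, List.length_cons, zero_add, add_zero] at hL h ha
      have hlen : ys.length = 2 * s := by omega
      rw [hlen] at ha
      have ha' : a + 1 = N + 2 * s * N := by
        have : (N + 1) * (2 * s + 1) = 2 * s * N + N + 2 * s + 1 := by ring
        omega
      refine ⟨Sum.inr l, fun φ => derY ys (grusin n m N φ),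
        fun φ hφ => (isTest_grusin hφ N).derY ys, by simp only [dirWeight]; omega, ?_,
        hz _ fun φ => derY (l :: ys) (grusin n m N φ)⟩
      have hw : a + 1 - dirWeight N (Sum.inr l : Fin n ⊕ Fin m) = 2 * s * N := by
        simp only [dirWeight]; omega
      rw [hw]
      rcases Nat.eq_zero_or_pos s with rfl | hs
      · obtain rfl : ys = [] := List.length_eq_zero_iff.1 (by omega)
        refine (LpDominated.refl _).congr_ae hp0.le fun φ _ => .of_forall fun z => ?_
        simp [derY]
      · refine (hT [] ys (2 * s * N) (fun h => ?_) (by simp [hlen]) ?_).grusin_iterate_succ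
        · rw [h] at hlen; simp at hlen; omega
        · rw [hlen, List.length_nil]; ring
    · simp only [List.length_cons] at hL h ha
      refine ⟨Sum.inl i, fun φ => derX xs (derY ys (grusin n m N φ)),
        fun φ hφ => ((isTest_grusin hφ N).derY ys).derX xs, by simp [dirWeight], ?_,
        hz _ fun φ => derX (i :: xs) (derY ys (grusin n m N φ))⟩
      exact (hT xs ys (a + 1) hys (by omega) (by omega)).grusin_iterate_succ

end Commutators

section MixedBounds

open Topology Filter

variable {n m : ℕ}

theorem exists_mixed_step (hn : 1 ≤ n) {N s : ℕ} {p : ℝ} (hp : 1 < p)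
    (hs : 2 * (s + 1) ≤ N + 1) (hT : MixedBound n m N p s) (xs : List (Fin n)) (ys : List (Fin m)) (hys : ys ≠ [])
    (hL : xs.length + ys.length + 1 ≤ 2 * (s + 1)) {a : ℕ}
    (ha : a + 2 * (s + 1) = (N + 1) * ys.length + xs.length)
    (h0 : LpDominated p (fun φ z => ‖z.1‖ ^ a * derX xs (derY ys φ) z) (grusin n m N)^[s + 1])
    (h1 : ∀ (xs' : List (Fin n)) (ys' : List (Fin m)) (d : ℕ), xs'.length + 1 ≤ xs.length →
      ys'.length = ys.length + 2 → d + 2 * (s + 1) = (N + 1) * ys'.length + xs'.length →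
      LpDominated p (fun φ z => ‖z.1‖ ^ d * derX xs' (derY ys' φ) z) (grusin n m N)^[s + 1])
    (j : Fin n ⊕ Fin m) :
    LpDominated p (fun φ z => ‖z.1‖ ^ (a + 1 + dirWeight N j) *
      dirD (unitVec n m j) (derX xs (derY ys φ)) z) (grusin n m N)^[s + 1] := by
  obtain ⟨k, F, hF, hk, hF1, hF2⟩ := hT.exists_divergence_form hp xs ys hys hL ha hn
  have hp0 : 0 < p := by linarith
  have hsum : MixedSum N (2 * N - (N + 1) * (ys.length + 2 : ℕ) - xs.length)
      (fun a b => a + 1 ≤ xs.length ∧ b = ys.length + 2) fun φ z => ∑ k : Fin m,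
        (derX xs (fun z => sqx z.1 ^ N * derY (k :: k :: ys) φ z) z -
        sqx z.1 ^ N * derX xs (derY (k :: k :: ys) φ) z) :=
    MixedSum.sum (Finset.univ : Finset (Fin m)) fun k _ => mixedSum_commutator N xs (k :: k :: ys)
  have hcomm := hsum.lpDominated (B := (grusin n m N)^[s + 1]) hn hp.le (a + 2)
    fun xs' ys' ⟨h2, h3⟩ => by
      have h4 : 2 * (s + 1) ≤ (N + 1) * ys'.length + xs'.length := by
        rw [h3]
        exact hs.trans ((Nat.le_mul_of_pos_right _ (by omega)).trans (Nat.le_add_right _ _))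
      refine ⟨(N + 1) * ys'.length + xs'.length - 2 * (s + 1), ?_,
        h1 xs' ys' _ h2 h3 (Nat.sub_add_cancel h4)⟩
      rw [Nat.cast_sub h4, h3]
      have := congrArg (Nat.cast (R := ℤ)) ha
      push_cast at this ⊢
      linarith
  set G : (Pt n m → ℝ) → Pt n m → ℝ := fun φ z =>
    grusin n m N (derX xs (derY ys φ)) z - dirD (unitVec n m k) (F φ) z with hG
  have hGt : ∀ φ, IsTest φ → IsTest (G φ) := fun φ hφ =>
    (isTest_grusin ((hφ.derY ys).derX xs) N).sub ((hF φ hφ).dirD _)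
  have hG1 : LpDominated p (fun φ z => ‖z.1‖ ^ (a + 2) * G φ z) (grusin n m N)^[s + 1] := by
    refine (hF2.add hp.le hcomm fun φ hφ => ?_).congr_ae hp0.le fun φ hφ => .of_forall fun z => ?_
    · have h5 := (((isTest_grusin hφ N).derY ys).derX xs).continuous
      have h6 := ((hF φ hφ).dirD (unitVec n m k)).continuous
      exact (by fun_prop : Continuous _).aemeasurable
    · rw [hG, ← mul_add]
      beta_reduce
      rw [grusin_derX (hφ.derY ys), derY_grusin hφ]
      simp only [derY_cons]
      ring
  obtain ⟨C, hC⟩ := exists_base_estimate hn m N a hp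
  obtain ⟨C0, hC0⟩ := h0
  obtain ⟨C1, hC1⟩ := hF1
  obtain ⟨C2, hC2⟩ := hG1
  refine ⟨C * (C1 + C2 + C0), fun φ hφ => ?_⟩
  refine (hC k ((hφ.derY ys).derX xs) (hF φ hφ) (hGt φ hφ) (fun z => ?_) hk j).trans ?_
  · rw [hG]; ring
  · rw [ENNReal.coe_mul, ENNReal.coe_add, ENNReal.coe_add, mul_assoc, add_mul, add_mul]
    exact mul_le_mul_right (add_le_add (add_le_add (hC1 φ hφ) (hC2 φ hφ)) (hC0 φ hφ)) _

theorem mixedBound_succ (hn : 2 ≤ n) {N s : ℕ} {p : ℝ} (hp : 1 < p) (hs : 2 * (s + 1) ≤ N + 1)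
    (hT : MixedBound n m N p s) : MixedBound n m N p (s + 1) := by
  intro xs ys
  induction hM : 2 * xs.length + ys.length using Nat.strong_induction_on generalizing xs ys with
  | _ M ih =>
  intro d hys hL hd
  have hrec : ∀ (xs' : List (Fin n)) (ys' : List (Fin m)), ys' ≠ [] →
      xs'.length + ys'.length + 1 = xs.length + ys.length →
      2 * xs'.length + ys'.length < M → ∀ j : Fin n ⊕ Fin m,
      (N + 1) * ys'.length + xs'.length + 1 + dirWeight N j =
        (N + 1) * ys.length + xs.length →
      LpDominated p (fun φ z => ‖z.1‖ ^ d * dirD (unitVec n m j) (derX xs' (derY ys' φ)) z)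
        (grusin n m N)^[s + 1] := by
    intro xs' ys' hys' hlen hlt j hj
    have h2 : N + 1 ≤ (N + 1) * ys'.length :=
      Nat.le_mul_of_pos_right _ (List.length_pos_iff.2 hys')
    obtain ⟨a, ha⟩ : ∃ a, a + 2 * (s + 1) = (N + 1) * ys'.length + xs'.length :=
      ⟨(N + 1) * ys'.length + xs'.length - 2 * (s + 1), by omega⟩
    obtain rfl : d = a + 1 + dirWeight N j := by omega
    refine exists_mixed_step (by omega) hp hs hT xs' ys' hys' (by omega) ha
      (ih _ hlt xs' ys' rfl a hys' (by omega) ha) (fun xs'' ys'' d' h3 h4 h5 => ?_) j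
    exact ih _ (by omega) xs'' ys'' rfl d' (List.length_pos_iff.1 (by omega)) (by omega) h5
  rcases xs with _ | ⟨i, xs⟩
  · rcases ys with _ | ⟨l, ys⟩
    · exact absurd rfl hys
    rcases eq_or_ne ys [] with rfl | hys'
    · obtain ⟨C, hC⟩ := exists_weighted_dirD_inr_estimate hn m N hp (s := s + 1) (d := d)
        (by omega) (by simpa using hd)
      exact ⟨C, fun φ hφ => hC φ hφ l⟩
    · have := hrec [] ys hys' (by simp) (by simp [← hM]) (Sum.inr l)
        (by simp [dirWeight]; ring)
      obtain ⟨C, hC⟩ := this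
      exact ⟨C, fun φ hφ => hC φ hφ⟩
  · obtain ⟨C, hC⟩ := hrec xs ys hys (by simp; omega) (by simp [← hM]) (Sum.inl i)
      (by simp [dirWeight]; ring)
    exact ⟨C, fun φ hφ => hC φ hφ⟩

theorem mixedBound (hn : 2 ≤ n) {N : ℕ} {p : ℝ} (hp : 1 < p) (s : ℕ) (hs : 2 * s ≤ N + 1) :
    MixedBound n m N p s := by
  induction s with
  | zero =>
    intro xs ys d hys hL
    have := List.length_pos_iff.2 hys
    omega
  | succ s ih => exact mixedBound_succ hn hp hs (ih (by omega))

end MixedBounds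

section Words

open Topology Filter

variable {n m : ℕ}

theorem lpDominated_derX (hn : 2 ≤ n) {N : ℕ} {p : ℝ} (hp : 1 < p) (s : ℕ)
    (hs : 2 * s ≤ N + 1) (xs : List (Fin n)) (hxs : xs.length = 2 * s) :
    LpDominated (m := m) p (derX xs) (grusin n m N)^[s] := by
  have hp0 : 0 < p := by linarith
  induction s generalizing xs with
  | zero =>
    obtain rfl : xs = [] := List.length_eq_zero_iff.1 (by omega)
    exact .refl _
  | succ s ih =>
    obtain ⟨i, j, xs, rfl⟩ : ∃ i j xs', xs = i :: j :: xs' := by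
      match xs, hxs with
      | [], h => simp at h
      | [_], h => simp at h; omega
      | i :: j :: xs, _ => exact ⟨i, j, xs, rfl⟩
    simp only [List.length_cons] at hxs
    have hmix (k : Fin m) : MixedSum N (-(2 * (s + 1)))
        (fun a b => a ≤ xs.length ∧ b = 2) fun φ z =>
        derX xs (fun z => sqx z.1 ^ N * derY [k, k] φ z) z := by
      have h1 := (mixedSum_commutator N xs [k, k]).mono (S' := fun a b => a ≤ xs.length ∧ b = 2)
        fun a b h => ⟨by omega, h.2⟩
      have he : (2 * N - (N + 1) * [k, k].length - xs.length : ℤ) = -(2 * (s + 1)) := by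
        have := congrArg (Nat.cast (R := ℤ)) hxs
        push_cast [List.length_cons, List.length_nil] at this ⊢
        linarith
      rw [he] at h1
      refine (h1.add (.single xs [k, k] (HomSmooth.sqx_pow N) ⟨le_rfl, rfl⟩ ?_)).congr
        fun φ hφ z hz => ?_
      · rw [← he]; ring
      · ring
    have h2 := (MixedSum.sum Finset.univ fun k _ => hmix k).lpDominated
      (B := (grusin n m N)^[s + 1]) (by omega) hp.le 0 fun xs' ys' ⟨h3, h4⟩ => by
        have h5 : 2 * (s + 1) ≤ (N + 1) * ys'.length + xs'.length := by
          rw [h4]; omega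
        refine ⟨(N + 1) * ys'.length + xs'.length - 2 * (s + 1), ?_,
          mixedBound hn hp (s + 1) hs xs' ys' _ (List.length_pos_iff.1 (by omega)) (by omega)
            (Nat.sub_add_cancel h5)⟩
        rw [Nat.cast_sub h5]
        push_cast
        ring
    have h3 := ih (by omega) xs (by omega) |>.grusin_iterate_succ
    have h4 : LpDominated p (fun φ z => ∑ k, dirD (unitVec n m (Sum.inl k))
        (dirD (unitVec n m (Sum.inl k)) (derX xs φ)) z) (grusin n m N)^[s + 1] := by
      refine (h3.add hp.le h2 fun φ hφ =>
        ((isTest_grusin hφ N).derX xs).continuous.aemeasurable).of_ae_le hp0.le zero_le_one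
        fun φ hφ => .of_forall fun z => le_of_eq ?_
      rw [derX_grusin hφ, one_mul, ← abs_neg]
      simp only [derY, List.foldr, pow_zero, one_mul]
      congr 1
      ring
    obtain ⟨C, hC⟩ := exists_lintegral_dirD_rpow_le (ι := Fin n) (volume : Measure (Pt n m)) hp
    obtain ⟨D, hD⟩ := h4
    refine ⟨C * D, fun φ hφ => ?_⟩
    have hW := hφ.derX xs
    have hLap : IsTest fun z => ∑ k, dirD (unitVec n m (Sum.inl k))
        (dirD (unitVec n m (Sum.inl k)) (derX xs φ)) z := IsTest.sum _ fun k _ => (hW.dirD _).dirD _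
    refine (hC (fun k => unitVec n m (Sum.inl k)) (W := derX (j :: xs) φ)
      (F := fun k => if k = j then fun z => ∑ k, dirD (unitVec n m (Sum.inl k))
        (dirD (unitVec n m (Sum.inl k)) (derX xs φ)) z else fun _ => 0) (hW.dirD _)
      (fun k => ?_) ?_ i).trans ?_
    · split_ifs
      exacts [hLap, IsTest.zero]
    · funext z
      rw [Finset.sum_eq_single j]
      · rw [if_pos rfl, dirD_sum _ _ fun k _ => ((hW.dirD _).dirD _).differentiable]
        refine Finset.sum_congr rfl fun k _ => ?_
        rw [derX_cons, dirD_comm hW.1, dirD_comm (hW.dirD _).1]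
      · intro k _ hk
        rw [if_neg hk, dirD_const]
      · simp
    · rw [Finset.sum_eq_single j, if_pos rfl, ENNReal.coe_mul, mul_assoc]
      · exact mul_le_mul_right (hD φ hφ) _
      · intro k _ hk
        simp [if_neg hk, ENNReal.zero_rpow_of_pos hp0]
      · simp

theorem yWord_cases (N : ℕ) (l : List (Fin n ⊕ Fin m)) :
    (∃ xs : List (Fin n), xs.length = l.length ∧ compOps (l.map (Yop n m N)) = derX xs) ∨
      MixedSum N (-l.length) (fun a b => 1 ≤ b ∧ a + b ≤ l.length)
        (compOps (l.map (Yop n m N))) := by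
  induction l with
  | nil => exact .inl ⟨[], rfl, rfl⟩
  | cons i l ih =>
    have hlen : (-(i :: l).length : ℤ) = -l.length - 1 := by push_cast [List.length_cons]; ring
    rcases i with i | k
    · rcases ih with ⟨xs, hx, h⟩ | h
      · refine .inl ⟨i :: xs, by simp [hx], ?_⟩
        funext f
        exact congrArg (dirD (unitVec n m (Sum.inl i))) (congrFun h f)
      · right
        rw [hlen]
        exact h.dirD_inl i (fun a b h => ⟨h.1, by rw [List.length_cons]; omega⟩)
          (fun a b h => ⟨h.1, by rw [List.length_cons]; omega⟩)
    · right
      rcases ih with ⟨xs, hx, h⟩ | h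
      · refine (MixedSum.single xs [k] (HomSmooth.sqrt_sqx_pow N) (by simp [hx]) ?_).congr
          fun φ hφ z hz => ?_
        · rw [hlen, ← hx]; simp
        · rw [derY_cons, ← dirD_derX (f := derY [] φ) hφ]
          change _ * dirD (unitVec n m (Sum.inr k)) (compOps (l.map (Yop n m N)) φ) z = _
          rw [h]
          rfl
      · have h1 := (h.dirD_inr (S' := fun a b => 1 ≤ b ∧ a + b ≤ (Sum.inr k :: l).length) k
          fun a b h => ⟨by omega, by rw [List.length_cons]; omega⟩).mul
          (HomSmooth.sqrt_sqx_pow N)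
        rw [hlen]
        refine (show (-l.length - 1 : ℤ) = -l.length - (N + 1) + N by ring) ▸ h1

theorem lpDominated_Yw (hn : 2 ≤ n) {N : ℕ} {p : ℝ} (hp : 1 < p) (s : ℕ)
    (hs : 2 * s ≤ N + 1) (α : Fin (2 * s) → Fin n ⊕ Fin m) :
    LpDominated p (Yw (N := N) α) (grusin n m N)^[s] := by
  have hY : Yw (N := N) α = compOps ((List.ofFn α).map (Yop n m N)) := by
    rw [List.map_ofFn]; rfl
  rw [hY]
  rcases yWord_cases N (List.ofFn α) with ⟨xs, hx, h⟩ | h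
  · rw [h]
    exact lpDominated_derX hn hp s hs xs (by simpa using hx)
  · have h2 := h.lpDominated (B := (grusin n m N)^[s]) (by omega) hp.le 0
      fun xs ys ⟨h3, h4⟩ => by
        rw [List.length_ofFn] at h4
        have h5 : 2 * s ≤ (N + 1) * ys.length + xs.length :=
          hs.trans ((Nat.le_mul_of_pos_right _ h3).trans (Nat.le_add_right _ _))
        refine ⟨(N + 1) * ys.length + xs.length - 2 * s, ?_,
          mixedBound hn hp s hs xs ys _ (List.length_pos_iff.1 h3) h4 (Nat.sub_add_cancel h5)⟩
        rw [Nat.cast_sub h5, List.length_ofFn]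
        push_cast
        ring
    simpa only [pow_zero, one_mul] using h2

theorem LpDominated.eLpNorm_le {p : ℝ} (hp : 0 < p) {A B : (Pt n m → ℝ) → Pt n m → ℝ}
    (h : LpDominated p A B) : ∃ C : ℝ, 0 ≤ C ∧ ∀ φ, IsTest φ →
      eLpNorm (A φ) (ENNReal.ofReal p) volume ≤
        ENNReal.ofReal C * eLpNorm (B φ) (ENNReal.ofReal p) volume := by
  obtain ⟨C, hC⟩ := h
  refine ⟨(C : ℝ) ^ (1 / p), by positivity, fun φ hφ => ?_⟩
  have h0 : ENNReal.ofReal p ≠ 0 := by simpa using hp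
  rw [eLpNorm_eq_lintegral_rpow_enorm_toReal h0 ENNReal.ofReal_ne_top,
    eLpNorm_eq_lintegral_rpow_enorm_toReal h0 ENNReal.ofReal_ne_top, ENNReal.toReal_ofReal hp.le,
    ← ENNReal.ofReal_rpow_of_nonneg C.coe_nonneg (by positivity), ENNReal.ofReal_coe_nnreal,
    ← ENNReal.mul_rpow_of_nonneg _ _ (by positivity)]
  exact ENNReal.rpow_le_rpow (hC φ hφ) (by positivity)

end Words

/-- (Even-order case of Theorem 3.2.)  For `n ≥ 2`, `m, N ≥ 1`,
`p ∈ (1,∞)` and `s ≥ 1` with `2s ≤ N+1`, there is `c > 0` such that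
`‖Y^α φ‖_p ≤ c ‖H_N^s φ‖_p` for all `φ ∈ C_c^∞(ℝ^(n+m))` and all words
`α ∈ {1,…,n+m}^(2s)`. -/
theorem Y_riesz_even_order_up_to_N_plus_one
    (n m N : ℕ) (hn : 2 ≤ n) (hm : 1 ≤ m) (hN : 1 ≤ N)
    (p : ℝ) (hp : 1 < p) (s : ℕ) (hs : 1 ≤ s) (hsN : 2 * s ≤ N + 1) :
    ∃ c > (0 : ℝ), ∀ φ : Pt n m → ℝ, ContDiff ℝ (⊤ : ℕ∞) φ → HasCompactSupport φ →
      ∀ α : Fin (2 * s) → (Fin n ⊕ Fin m),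
        eLpNorm (Yw (N := N) α φ) (ENNReal.ofReal p) volume ≤
          ENNReal.ofReal c * eLpNorm ((grusin n m N)^[s] φ) (ENNReal.ofReal p) volume := by
  have hp0 : 0 < p := by linarith
  have h (α : Fin (2 * s) → Fin n ⊕ Fin m) :=
    (lpDominated_Yw (N := N) hn hp s hsN α).eLpNorm_le hp0
  choose C hC0 hC using h
  refine ⟨1 + ∑ α, C α, add_pos_of_pos_of_nonneg one_pos (Finset.sum_nonneg fun α _ => hC0 α),
    fun φ h1 h2 α => (hC α φ ⟨h1, h2⟩).trans (mul_le_mul_left (ENNReal.ofReal_le_ofReal ?_) _)⟩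
  have := Finset.single_le_sum (fun β _ => hC0 β) (Finset.mem_univ α)
  linarith
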